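/- Let n ≥ 2 and 2 < p < ∞. Then there exists a constant C ∈ (0,∞) such that for every continuous compactly supported function f : ℝⁿ → ℂ one has ‖ sup_{1 ≤ t ≤ 2} |A_t f(·)| ‖_{L^p(ℝⁿ)} ≤ C ‖f‖_{L^p(ℝⁿ)}. -/

import Mathlib

open MeasureTheory Filter Metric
open scoped ENNReal Topology

/-- The (unnormalized) rotation-invariant surface measure on the unit sphere `S^{n-1} ⊂ ℝⁿ`,
obtained from Lebesgue measure by the polar decomposition. -/
noncomputable def surfMeasure (n : ℕ) : Measure (Metric.sphere (0 : EuclideanSpace ℝ (Fin n)) 1) :=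
  (volume : Measure (EuclideanSpace ℝ (Fin n))).toSphere

/-- The normalized (total mass one) rotation-invariant surface measure on `S^{n-1}`. -/
noncomputable def surfMeasureNorm (n : ℕ) :
    Measure (Metric.sphere (0 : EuclideanSpace ℝ (Fin n)) 1) :=
  (surfMeasure n Set.univ)⁻¹ • surfMeasure n

/-- The spherical mean `A_t f(x) = ∫_{S^{n-1}} f(x + tω) dσ(ω)` with respect to the normalized
surface measure `σ`. -/
noncomputable def sphAvg (n : ℕ) (t : ℝ) (f : EuclideanSpace ℝ (Fin n) → ℂ)
    (x : EuclideanSpace ℝ (Fin n)) : ℂ :=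
  ∫ ω, f (x + t • (ω : EuclideanSpace ℝ (Fin n))) ∂(surfMeasureNorm n)

/-- Smooth functions on the line supported in `[-1,1]`. -/
def IsCutoff (g : ℝ → ℝ) : Prop := ContDiff ℝ (⊤ : ℕ∞) g ∧ ∀ w, 1 < |w| → g w = 0

theorem IsCutoff.hasCompactSupport {g : ℝ → ℝ} (hg : IsCutoff g) : HasCompactSupport g := by
  refine HasCompactSupport.intro (K := Set.Icc (-1) 1) isCompact_Icc fun x hx => hg.2 x ?_
  by_contra h
  exact hx (abs_le.1 (not_lt.1 h))

theorem IsCutoff.integrable_pow_mul {g : ℝ → ℝ} (hg : IsCutoff g) (j : ℕ) :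
    Integrable fun w => w ^ j * g w := by
  refine Continuous.integrable_of_hasCompactSupport ?_ ?_
  · exact (continuous_id.pow j).mul hg.1.continuous
  · exact hg.hasCompactSupport.mul_left

theorem IsCutoff.integral_eq {g : ℝ → ℝ} (hg : IsCutoff g) :
    ∫ w, g w = ∫ w in (-1 : ℝ)..1, g w := by
  rw [intervalIntegral.integral_of_le (by norm_num), ← integral_Icc_eq_integral_Ioc]
  symm
  apply setIntegral_eq_integral_of_forall_compl_eq_zero
  intro x hx
  refine hg.2 x ?_
  by_contra h
  exact hx (abs_le.1 (not_lt.1 h))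

theorem IsCutoff.zero_at_one {g : ℝ → ℝ} (hg : IsCutoff g) : g 1 = 0 ∧ g (-1) = 0 := by
  constructor
  · have h1 : Tendsto g (𝓝[>] 1) (𝓝 (g 1)) := hg.1.continuous.continuousWithinAt
    have h2 : Tendsto g (𝓝[>] 1) (𝓝 0) := by
      refine tendsto_const_nhds.congr' ?_
      filter_upwards [self_mem_nhdsWithin] with x hx
      exact (hg.2 x (lt_of_lt_of_le hx (le_abs_self x))).symm
    exact tendsto_nhds_unique h1 h2
  · have h1 : Tendsto g (𝓝[<] (-1)) (𝓝 (g (-1))) := hg.1.continuous.continuousWithinAt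
    have h2 : Tendsto g (𝓝[<] (-1)) (𝓝 0) := by
      refine tendsto_const_nhds.congr' ?_
      filter_upwards [self_mem_nhdsWithin] with x hx
      have hx' : x < -1 := hx
      exact (hg.2 x (lt_of_lt_of_le (by linarith) (neg_le_abs x))).symm
    exact tendsto_nhds_unique h1 h2

/-- The primitive of a cutoff with vanishing integral is a cutoff. -/
theorem IsCutoff.exists_primitive {g : ℝ → ℝ} (hg : IsCutoff g) (h0 : ∫ w, g w = 0) :
    ∃ G, IsCutoff G ∧ deriv G = g := by
  have hd : ∀ x, HasDerivAt (fun x => ∫ w in (-1 : ℝ)..x, g w) (g x) x := fun x =>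
    intervalIntegral.integral_hasDerivAt_right (hg.1.continuous.intervalIntegrable _ _)
      (hg.1.continuous.stronglyMeasurableAtFilter _ _) hg.1.continuous.continuousAt
  have hde : deriv (fun x => ∫ w in (-1 : ℝ)..x, g w) = g := funext fun x => (hd x).deriv
  refine ⟨fun x => ∫ w in (-1 : ℝ)..x, g w, ⟨?_, ?_⟩, hde⟩
  · rw [contDiff_infty_iff_deriv]
    refine ⟨fun x => (hd x).differentiableAt, ?_⟩
    rw [hde]; exact hg.1
  · intro w hw
    rcases lt_abs.1 hw with h | h
    · have : ∫ x in (1 : ℝ)..w, g x = 0 := by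
        rw [intervalIntegral.integral_congr (g := fun _ => 0)]
        · simp
        · intro x hx
          rw [Set.uIcc_of_le h.le] at hx
          rcases hx.1.eq_or_lt with h1 | h1
          · rw [← h1]; exact hg.zero_at_one.1
          · exact hg.2 x (lt_of_lt_of_le h1 (le_abs_self x))
      change ∫ x in (-1 : ℝ)..w, g x = 0
      rw [← intervalIntegral.integral_add_adjacent_intervals (b := 1)
        (hg.1.continuous.intervalIntegrable _ _) (hg.1.continuous.intervalIntegrable _ _),
        this, ← hg.integral_eq, h0, zero_add]
    · change ∫ x in (-1 : ℝ)..w, g x = 0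
      rw [intervalIntegral.integral_congr (g := fun _ => 0)]
      · simp
      · intro x hx
        rw [Set.uIcc_of_ge (by linarith)] at hx
        rcases hx.2.eq_or_lt with h1 | h1
        · rw [h1]; exact hg.zero_at_one.2
        · exact hg.2 x (lt_of_lt_of_le (by linarith) (neg_le_abs x))

theorem IsCutoff.deriv {g : ℝ → ℝ} (hg : IsCutoff g) : IsCutoff (deriv g) := by
  refine ⟨(contDiff_infty_iff_deriv.1 hg.1).2, fun w hw => ?_⟩
  have : g =ᶠ[𝓝 w] fun _ => 0 := by
    have : ∀ᶠ x in 𝓝 w, 1 < |x| := (isOpen_lt continuous_const continuous_abs).mem_nhds hw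
    filter_upwards [this] with x hx using hg.2 x hx
  rw [this.deriv_eq]; simp

theorem IsCutoff.iteratedDeriv {g : ℝ → ℝ} (hg : IsCutoff g) (m : ℕ) :
    IsCutoff (iteratedDeriv m g) := by
  induction m with
  | zero => simpa using hg
  | succ m ih => rw [iteratedDeriv_succ]; exact ih.deriv

theorem IsCutoff.bounded {g : ℝ → ℝ} (hg : IsCutoff g) : ∃ C, 0 < C ∧ ∀ w, |g w| ≤ C := by
  obtain ⟨C, hC⟩ := hg.hasCompactSupport.exists_bound_of_continuous hg.1.continuous
  exact ⟨max C 1, by positivity, fun w => (hC w).trans (le_max_left _ _)⟩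

theorem IsCutoff.integral_moment {g : ℝ → ℝ} (hg : IsCutoff g) (j : ℕ) :
    ∫ w, w ^ j * _root_.deriv g w = -(j * ∫ w, w ^ (j - 1) * g w) := by
  have h := integral_mul_deriv_eq_deriv_mul_of_integrable (u := fun w : ℝ => w ^ j) (v := g)
    (u' := fun w => j * w ^ (j - 1)) (v' := _root_.deriv g)
    (fun x _ => by simpa using hasDerivAt_pow j x)
    (fun x _ => (hg.1.differentiable (by simp) x).hasDerivAt)
    (hg.deriv.integrable_pow_mul j)
    (by
      have := (hg.integrable_pow_mul (j - 1)).const_mul (j : ℝ)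
      refine this.congr (Eventually.of_forall fun x => ?_)
      simp [mul_assoc])
    (hg.integrable_pow_mul j)
  rw [h, ← integral_const_mul]
  congr 2; ext x; ring

theorem IsCutoff.exists_iterated_primitive (m : ℕ) : ∀ {g : ℝ → ℝ}, IsCutoff g →
    (∀ j < m, ∫ w, w ^ j * g w = 0) → ∃ G, IsCutoff G ∧ _root_.iteratedDeriv m G = g := by
  induction m with
  | zero => intro g hg _; exact ⟨g, hg, by simp⟩
  | succ m ih =>
    intro g hg h
    obtain ⟨G, hG, hGg⟩ := hg.exists_primitive (by simpa using h 0 (by omega))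
    obtain ⟨H, hH, hHG⟩ := ih hG (by
      intro j hj
      have h1 := hG.integral_moment (j + 1)
      rw [hGg, h (j + 1) (by omega)] at h1
      have h2 : ((j + 1 : ℕ) : ℝ) ≠ 0 := by positivity
      have h3 : ((j + 1 : ℕ) : ℝ) * ∫ w, w ^ j * G w = 0 := by
        simpa using h1
      exact (mul_eq_zero.1 h3).resolve_left h2)
    exact ⟨H, hH, by rw [iteratedDeriv_succ, hHG, hGg]⟩

theorem IsCutoff.comp_mul {g : ℝ → ℝ} (hg : IsCutoff g) {a : ℝ} (ha : 1 ≤ a) :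
    IsCutoff fun w => a * g (a * w) := by
  refine ⟨contDiff_const.mul (hg.1.comp (contDiff_const.mul contDiff_id)), fun w hw => ?_⟩
  change a * g (a * w) = 0
  rw [hg.2, mul_zero]
  rw [abs_mul, abs_of_nonneg (by linarith)]
  nlinarith

theorem integral_moment_comp_mul (g : ℝ → ℝ) {a : ℝ} (ha : 1 ≤ a) (j : ℕ) :
    ∫ w, w ^ j * (a * g (a * w)) = (a⁻¹) ^ j * ∫ w, w ^ j * g w := by
  have ha0 : a ≠ 0 := by linarith
  have : ∀ w, w ^ j * (a * g (a * w)) =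
      (fun u => (a⁻¹) ^ j * a * (u ^ j * g u)) (a * w) := by
    intro w
    simp only [mul_pow, inv_pow]
    field_simp
  rw [integral_congr_ae (Eventually.of_forall this)]
  rw [Measure.integral_comp_mul_left (fun u => (a⁻¹) ^ j * a * (u ^ j * g u)) a,
      integral_const_mul, abs_of_pos (by positivity), smul_eq_mul]
  field_simp

theorem exists_cutoff_moments (m : ℕ) : ∃ Θ : ℝ → ℝ, IsCutoff Θ ∧ ∫ w, Θ w = 1 ∧
    ∀ j, 1 ≤ j → j < m + 1 → ∫ w, w ^ j * Θ w = 0 := by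
  induction m with
  | zero =>
    let b : ContDiffBump (0 : ℝ) := ⟨1 / 2, 1, by norm_num, by norm_num⟩
    refine ⟨b.normed volume, ⟨b.contDiff_normed, fun w hw => ?_⟩, b.integral_normed, ?_⟩
    · by_contra h
      have : w ∈ Function.support (b.normed volume) := h
      rw [b.support_normed_eq] at this
      simp [b] at this
      linarith
    · intro j h1 h2; omega
  | succ m ih =>
    obtain ⟨Θ, h, h1, hj⟩ := ih
    set c : ℝ := -1 / (2 ^ (m + 1) - 1) with hc
    have h2 : (0 : ℝ) < 2 ^ (m + 1) - 1 := by
      have : (1 : ℝ) < 2 ^ (m + 1) := one_lt_pow₀ (by norm_num) (by omega)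
      linarith
    have hcut : IsCutoff fun w => 2 * Θ (2 * w) := h.comp_mul (by norm_num)
    have mom : ∀ j, ∫ w, w ^ j * (c * Θ w + (1 - c) * (2 * Θ (2 * w))) =
        (c + (1 - c) * (2⁻¹) ^ j) * ∫ w, w ^ j * Θ w := by
      intro j
      have e : ∀ w, w ^ j * (c * Θ w + (1 - c) * (2 * Θ (2 * w))) =
        c * (w ^ j * Θ w) + (1 - c) * (w ^ j * (2 * Θ (2 * w))) := fun w => by ring
      simp_rw [e]
      rw [integral_add ((h.integrable_pow_mul j).const_mul c)
        ((hcut.integrable_pow_mul j).const_mul _), integral_const_mul, integral_const_mul,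
        integral_moment_comp_mul Θ (by norm_num)]
      ring
    refine ⟨fun w => c * Θ w + (1 - c) * (2 * Θ (2 * w)), ⟨?_, ?_⟩, ?_, ?_⟩
    · exact (contDiff_const.mul h.1).add (contDiff_const.mul hcut.1)
    · intro w hw
      have h3 : 2 * Θ (2 * w) = 0 := hcut.2 w hw
      simp only [h.2 w hw, h3]; ring
    · have := mom 0
      simp only [pow_zero, one_mul, h1] at this
      rw [this]; ring
    · intro j hj1 hj2
      rw [mom j]
      rcases Nat.lt_or_ge j (m + 1) with h3 | h3
      · rw [hj j hj1 h3, mul_zero]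
      · obtain rfl : j = m + 1 := by omega
        have : c + (1 - c) * (2⁻¹) ^ (m + 1) = 0 := by
          rw [hc, inv_pow]; field_simp; ring
        rw [this, zero_mul]

/-- A normalized cutoff `Θ` all of whose rescaled differences are `m`-th derivatives of a
cutoff. -/
theorem exists_cutoff_telescope (m : ℕ) (a : ℝ) (ha : 1 ≤ a) :
    ∃ Θ η : ℝ → ℝ, IsCutoff Θ ∧ IsCutoff η ∧ ∫ w, Θ w = 1 ∧
      ∀ w, a * Θ (a * w) - Θ w = iteratedDeriv m η w := by
  obtain ⟨Θ, h, h1, hj⟩ := exists_cutoff_moments m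
  have hc := h.comp_mul ha
  have hd : IsCutoff fun w => a * Θ (a * w) - Θ w :=
    ⟨hc.1.sub h.1, fun w hw => by
      have h3 : a * Θ (a * w) = 0 := hc.2 w hw
      simp only [h.2 w hw, h3, sub_zero]⟩
  obtain ⟨η, hη, he⟩ := IsCutoff.exists_iterated_primitive m hd (by
    intro j hjm
    have e : ∀ w, w ^ j * (a * Θ (a * w) - Θ w) = w ^ j * (a * Θ (a * w)) - w ^ j * Θ w :=
      fun w => by ring
    simp_rw [e]
    rw [integral_sub (hc.integrable_pow_mul j) (h.integrable_pow_mul j),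
      integral_moment_comp_mul Θ ha]
    rcases Nat.eq_zero_or_pos j with h0 | h0
    · subst h0; simp
    · rw [hj j h0 (by omega)]; simp)
  exact ⟨Θ, η, h, hη, h1, fun w => by rw [he]⟩

/-- Smooth functions whose derivatives up to order `n` grow at most like `B * D ^ i`. -/
def DerivBound (n : ℕ) (D B : ℝ) (g : ℝ → ℝ) : Prop :=
  ContDiff ℝ (⊤ : ℕ∞) g ∧ ∀ i ≤ n, ∀ x, |iteratedDeriv i g x| ≤ B * D ^ i

theorem DerivBound.mono_order {m n : ℕ} {D B : ℝ} {g : ℝ → ℝ} (h : DerivBound n D B g)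
    (hm : m ≤ n) : DerivBound m D B g :=
  ⟨h.1, fun i hi x => h.2 i (hi.trans hm) x⟩

theorem DerivBound.nonneg {n : ℕ} {D B : ℝ} {g : ℝ → ℝ} (h : DerivBound n D B g) : 0 ≤ B := by
  have := (abs_nonneg _).trans (h.2 0 (Nat.zero_le _) 0)
  simpa using this

theorem DerivBound.abs_le {n : ℕ} {D B : ℝ} {g : ℝ → ℝ} (h : DerivBound n D B g) (x : ℝ) :
    |g x| ≤ B := by
  simpa using h.2 0 (Nat.zero_le _) x

theorem DerivBound.deriv {n : ℕ} {D B : ℝ} {g : ℝ → ℝ} (h : DerivBound (n + 1) D B g) :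
    DerivBound n D (B * D) (deriv g) := by
  refine ⟨(contDiff_infty_iff_deriv.1 h.1).2, fun i hi x => ?_⟩
  rw [← iteratedDeriv_succ']
  refine (h.2 (i + 1) (by omega) x).trans (le_of_eq ?_)
  rw [pow_succ]; ring

theorem DerivBound.mul {n : ℕ} {D B₁ B₂ : ℝ} {f g : ℝ → ℝ} (hD : 0 ≤ D)
    (hf : DerivBound n D B₁ f) (hg : DerivBound n D B₂ g) :
    DerivBound n D (2 ^ n * (B₁ * B₂)) (fun x => f x * g x) := by
  have hB₁ := hf.nonneg
  have hB₂ := hg.nonneg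
  refine ⟨hf.1.mul hg.1, fun i hi x => ?_⟩
  have h := norm_iteratedFDeriv_mul_le hf.1 hg.1 x (n := i) (by exact_mod_cast le_top)
  simp only [norm_iteratedFDeriv_eq_norm_iteratedDeriv, Real.norm_eq_abs] at h
  refine h.trans ?_
  calc ∑ j ∈ Finset.range (i + 1), (i.choose j : ℝ) * |iteratedDeriv j f x| *
        |iteratedDeriv (i - j) g x|
      ≤ ∑ j ∈ Finset.range (i + 1), (i.choose j : ℝ) * (B₁ * B₂ * D ^ i) := by
        refine Finset.sum_le_sum fun j hj => ?_
        have hj' : j ≤ i := by simpa [Nat.lt_succ_iff] using hj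
        rw [mul_assoc]
        refine mul_le_mul_of_nonneg_left ?_ (by positivity)
        calc _ ≤ (B₁ * D ^ j) * (B₂ * D ^ (i - j)) :=
              mul_le_mul (hf.2 j (hj'.trans hi) x) (hg.2 (i - j) (by omega) x)
                (abs_nonneg _) (by positivity)
          _ = B₁ * B₂ * (D ^ j * D ^ (i - j)) := by ring
          _ = _ := by rw [← pow_add, Nat.add_sub_cancel' hj']
    _ = 2 ^ i * (B₁ * B₂ * D ^ i) := by
        rw [← Finset.sum_mul]
        congr 1
        exact_mod_cast Nat.sum_range_choose i
    _ ≤ 2 ^ n * (B₁ * B₂ * D ^ i) := by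
        gcongr
        norm_num
    _ = _ := by ring

theorem DerivBound.const_mul {n : ℕ} {D B : ℝ} {g : ℝ → ℝ} (c : ℝ) (h : DerivBound n D B g) :
    DerivBound n D (|c| * B) (fun x => c * g x) := by
  refine ⟨contDiff_const.mul h.1, fun i hi x => ?_⟩
  rw [iteratedDeriv_const_mul_field, abs_mul, mul_assoc]
  exact mul_le_mul_of_nonneg_left (h.2 i hi x) (abs_nonneg _)

theorem DerivBound.comp {n : ℕ} {D C : ℝ} {β u : ℝ → ℝ} (hβ : DerivBound n 1 C β)
    (hu : ContDiff ℝ (⊤ : ℕ∞) u) (hD : 0 ≤ D)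
    (hb : ∀ i, 1 ≤ i → i ≤ n → ∀ x, |iteratedDeriv i u x| ≤ D ^ i) :
    DerivBound n D (n.factorial * C) (fun x => β (u x)) := by
  have hC := hβ.nonneg
  refine ⟨hβ.1.comp hu, fun i hi x => ?_⟩
  have h := norm_iteratedFDeriv_comp_le (𝕜 := ℝ) (g := β) (f := u) (n := i) (C := C) (D := D)
    hβ.1 hu (by exact_mod_cast le_top) x
    (fun j hj => by
      rw [norm_iteratedFDeriv_eq_norm_iteratedDeriv, Real.norm_eq_abs]
      simpa using hβ.2 j (hj.trans hi) (u x))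
    (fun j h1 hj => by
      rw [norm_iteratedFDeriv_eq_norm_iteratedDeriv, Real.norm_eq_abs]
      exact hb j h1 (hj.trans hi) x)
  rw [norm_iteratedFDeriv_eq_norm_iteratedDeriv, Real.norm_eq_abs] at h
  refine (le_of_eq_of_le rfl h).trans ?_
  gcongr

/-- Trigonometric polynomials of degree one. -/
noncomputable def trig (c a b θ : ℝ) : ℝ := c + a * Real.cos θ + b * Real.sin θ

theorem hasDerivAt_trig (c a b θ : ℝ) : HasDerivAt (trig c a b) (trig 0 b (-a) θ) θ := by
  have h := (((Real.hasDerivAt_cos θ).const_mul a).const_add c).add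
    ((Real.hasDerivAt_sin θ).const_mul b)
  refine h.congr_deriv ?_
  simp only [trig]; ring

theorem contDiff_trig (c a b : ℝ) : ContDiff ℝ (⊤ : ℕ∞) (trig c a b) :=
  (contDiff_const.add (contDiff_const.mul Real.contDiff_cos)).add
    (contDiff_const.mul Real.contDiff_sin)

theorem deriv_trig (c a b : ℝ) : deriv (trig c a b) = trig 0 b (-a) :=
  funext fun θ => (hasDerivAt_trig c a b θ).deriv

theorem abs_trig_zero_le (a b θ : ℝ) : |trig 0 a b θ| ≤ |a| + |b| := by
  unfold trig
  rw [zero_add]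
  refine (abs_add_le _ _).trans ?_
  rw [abs_mul, abs_mul]
  have := Real.abs_cos_le_one θ
  have := Real.abs_sin_le_one θ
  have := abs_nonneg a
  have := abs_nonneg b
  gcongr <;> nlinarith

theorem abs_iteratedDeriv_trig_zero_le (i : ℕ) : ∀ a b θ : ℝ,
    |iteratedDeriv i (trig 0 a b) θ| ≤ |a| + |b| := by
  induction i with
  | zero => intro a b θ; simpa using abs_trig_zero_le a b θ
  | succ i ih =>
    intro a b θ
    rw [iteratedDeriv_succ', deriv_trig]
    refine (ih b (-a) θ).trans ?_
    rw [abs_neg, add_comm]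

theorem abs_iteratedDeriv_trig_le {i : ℕ} (hi : 1 ≤ i) (c a b θ : ℝ) :
    |iteratedDeriv i (trig c a b) θ| ≤ |a| + |b| := by
  obtain ⟨j, rfl⟩ := Nat.exists_eq_add_of_le' hi
  rw [iteratedDeriv_succ', deriv_trig]
  refine (abs_iteratedDeriv_trig_zero_le j b (-a) θ).trans ?_
  rw [abs_neg, add_comm]

theorem trig_periodic (c a b : ℝ) : Function.Periodic (trig c a b) (2 * Real.pi) := by
  intro θ; simp [trig]

theorem DerivBound.comp_trig {n : ℕ} {D C c a b : ℝ} {β : ℝ → ℝ} (hβ : DerivBound n 1 C β)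
    (hD : 1 ≤ D) (hab : |a| + |b| ≤ D) :
    DerivBound n D (n.factorial * C) (fun θ => β (trig c a b θ)) := by
  refine hβ.comp (contDiff_trig c a b) (by linarith) fun i h1 _ x => ?_
  refine (abs_iteratedDeriv_trig_le h1 c a b x).trans (hab.trans ?_)
  exact le_self_pow₀ hD (by omega)

/-- Cutoffs have bounded derivatives of all orders. -/
theorem IsCutoff.derivBound {g : ℝ → ℝ} (hg : IsCutoff g) (n : ℕ) :
    ∃ C, 0 < C ∧ DerivBound n 1 C g := by
  choose C hC hb using fun i => (hg.iteratedDeriv i).bounded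
  refine ⟨∑ i ∈ Finset.range (n + 1), C i, Finset.sum_pos (fun i _ => hC i) (by simp), hg.1,
    fun i hi x => (hb i x).trans ?_⟩
  simp only [one_pow, mul_one]
  exact Finset.single_le_sum (f := C) (fun j _ => (hC j).le) (by simp; omega)

/-- A standard even cutoff, equal to one on `[-1/2,1/2]`. -/
theorem exists_plateau : ∃ β : ℝ → ℝ, IsCutoff β ∧ (∀ v, |v| ≤ 1 / 2 → β v = 1) ∧
    ∀ v, 0 ≤ β v ∧ β v ≤ 1 := by
  let b : ContDiffBump (0 : ℝ) := ⟨1 / 2, 1, by norm_num, by norm_num⟩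
  refine ⟨b, ⟨b.contDiff, fun w hw => ?_⟩, fun v hv => ?_, fun v => ⟨b.nonneg, b.le_one⟩⟩
  · by_contra h
    have : w ∈ Function.support b := h
    rw [b.support_eq] at this
    simp [b] at this
    linarith
  · exact b.one_of_mem_closedBall (by simpa [b] using hv)

/-- A smooth function with bounded derivatives agreeing with `v⁻¹` for `1 ≤ |v|`. -/
theorem exists_smooth_inv (n : ℕ) : ∃ K : ℝ → ℝ, ∃ C, 0 < C ∧ DerivBound n 1 C K ∧
    ∀ v, 1 ≤ |v| → K v = v⁻¹ := by
  obtain ⟨β, hβ, hβ1, -⟩ := exists_plateau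
  set K : ℝ → ℝ := fun v => (1 - β v) * v⁻¹ with hK
  have hsm : ContDiff ℝ (⊤ : ℕ∞) K := by
    rw [contDiff_iff_contDiffAt]
    intro x
    by_cases hx : x = 0
    · have : K =ᶠ[𝓝 x] fun _ => 0 := by
        have : ∀ᶠ v in 𝓝 x, |v| < 1 / 2 :=
          (isOpen_lt continuous_abs continuous_const).mem_nhds (by simp [hx])
        filter_upwards [this] with v hv
        simp [hK, hβ1 v hv.le]
      exact contDiffAt_const.congr_of_eventuallyEq this
    · exact ((contDiff_const.sub hβ.1).contDiffAt).mul (contDiffAt_id.inv hx)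
  have hval : ∀ v, 1 ≤ |v| → K v = v⁻¹ := by
    intro v hv
    have : β v = 0 := by
      rcases hv.eq_or_lt with h | h
      · rcases abs_cases v with ⟨h1, -⟩ | ⟨h1, -⟩
        · rw [show v = 1 by linarith]; exact hβ.zero_at_one.1
        · rw [show v = -1 by linarith]; exact hβ.zero_at_one.2
      · exact hβ.2 v h
    simp [hK, this]
  have hloc : ∀ i, ∃ C, 0 < C ∧ ∀ x, |iteratedDeriv i K x| ≤ C := by
    intro i
    have hc : Continuous (iteratedDeriv i K) := hsm.continuous_iteratedDeriv i (by
      exact_mod_cast le_top)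
    obtain ⟨C, hC⟩ := (isCompact_Icc (a := (-2 : ℝ)) (b := 2)).exists_bound_of_continuousOn
      hc.continuousOn
    refine ⟨max C (i.factorial), lt_max_of_lt_right (by positivity), fun x => ?_⟩
    by_cases hx : |x| ≤ 2
    · exact (hC x (abs_le.1 hx)).trans (le_max_left _ _)
    · push Not at hx
      have he : K =ᶠ[𝓝 x] Inv.inv := by
        have : ∀ᶠ v in 𝓝 x, 2 < |v| := (isOpen_lt continuous_const continuous_abs).mem_nhds hx
        filter_upwards [this] with v hv using hval v (by linarith)
      rw [he.iteratedDeriv_eq, iteratedDeriv_eq_iterate, iter_deriv_inv, abs_mul, abs_mul]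
      refine le_trans ?_ (le_max_right _ _)
      have h1 : |(-1 : ℝ) ^ i| = 1 := by simp
      have h2 : |x ^ (-1 - i : ℤ)| ≤ 1 := by
        rw [abs_zpow]
        exact zpow_le_one_of_nonpos₀ (by linarith) (by omega)
      rw [h1, one_mul, abs_of_nonneg (by positivity : (0 : ℝ) ≤ (i.factorial : ℝ))]
      exact mul_le_of_le_one_right (by positivity) h2
  choose C hC hb using hloc
  refine ⟨K, ∑ i ∈ Finset.range (n + 1), C i, Finset.sum_pos (fun i _ => hC i) (by simp),
    ⟨hsm, fun i hi x => (hb i x).trans ?_⟩, hval⟩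
  simp only [one_pow, mul_one]
  exact Finset.single_le_sum (f := C) (fun j _ => (hC j).le) (by simp; omega)

/-- Nonstationary phase: repeated integration by parts against a trigonometric phase. -/
theorem exists_nonstationary_bound {η : ℝ → ℝ} (hη : IsCutoff η) (m : ℕ) : ∃ C, 0 < C ∧
    ∀ (g : ℝ → ℝ) (D B α δ c a b : ℝ), DerivBound m D B g → Function.Periodic g (2 * Real.pi) →
      1 ≤ D → 0 < α → 0 < δ → |a| + |b| ≤ α * D →
      (∀ θ, |trig 0 b (-a) θ| < α → g θ = 0) →
      |∫ θ in (-Real.pi)..Real.pi, g θ * iteratedDeriv m η (trig c a b θ / δ)| ≤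
        C * B * (δ * D / α) ^ m := by
  obtain ⟨K, CK, hCK, hK, hKv⟩ := exists_smooth_inv m
  suffices H : ∀ l ≤ m, ∃ C, 0 < C ∧
    ∀ (g : ℝ → ℝ) (D B α δ c a b : ℝ), DerivBound l D B g → Function.Periodic g (2 * Real.pi) →
      1 ≤ D → 0 < α → 0 < δ → |a| + |b| ≤ α * D →
      (∀ θ, |trig 0 b (-a) θ| < α → g θ = 0) →
      |∫ θ in (-Real.pi)..Real.pi, g θ * iteratedDeriv l η (trig c a b θ / δ)| ≤
        C * B * (δ * D / α) ^ l from H m le_rfl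
  intro l
  induction l with
  | zero =>
    intro _
    obtain ⟨C, hC, hb⟩ := hη.bounded
    refine ⟨C * (2 * Real.pi), by positivity, fun g D B α δ c a b hg _ _ _ _ _ _ => ?_⟩
    have := intervalIntegral.norm_integral_le_of_norm_le_const (a := -Real.pi) (b := Real.pi)
      (C := B * C) (f := fun θ => g θ * iteratedDeriv 0 η (trig c a b θ / δ)) (fun θ _ => by
        rw [norm_mul]
        exact mul_le_mul (hg.abs_le θ) (by simpa using hb _) (norm_nonneg _) hg.nonneg)
    rw [Real.norm_eq_abs] at this
    refine this.trans (le_of_eq ?_)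
    rw [abs_of_pos (by linarith [Real.pi_pos])]
    ring
  | succ l ih =>
    intro hl
    obtain ⟨C, hC, hI⟩ := ih (by omega)
    refine ⟨C * (2 ^ (l + 1) * ((l + 1).factorial * CK)), by positivity,
      fun g D B α δ c a b hg hper hD hα hδ hab hz => ?_⟩
    have hDpos : 0 < D := by linarith
    have hB := hg.nonneg
    set W : ℝ → ℝ := fun θ => α⁻¹ * K (trig 0 (b / α) (-a / α) θ) with hW
    have htr : ∀ θ, trig 0 (b / α) (-a / α) θ = trig 0 b (-a) θ / α := by
      intro θ; simp only [trig]; ring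
    have hWb : DerivBound (l + 1) D (|α⁻¹| * ((l + 1).factorial * CK)) W := by
      refine DerivBound.const_mul _ (DerivBound.comp_trig (hK.mono_order hl) hD ?_)
      rw [abs_div, abs_div, abs_neg, abs_of_pos hα, ← add_div, div_le_iff₀ hα]
      linarith
    have hgW := DerivBound.mul hDpos.le hg hWb
    set G : ℝ → ℝ := fun θ => g θ * W θ with hG
    have hGper : Function.Periodic G (2 * Real.pi) := by
      intro θ
      simp only [hG, hW, hper θ, (trig_periodic _ _ _ : Function.Periodic _ _) θ]
    have hGd := hgW.deriv
    have hdper : Function.Periodic (deriv G) (2 * Real.pi) := by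
      intro θ
      rw [← deriv_comp_add_const]
      congr 1
      exact funext hGper
    have hdz : ∀ θ, |trig 0 b (-a) θ| < α → deriv G θ = 0 := by
      intro θ hθ
      have : G =ᶠ[𝓝 θ] fun _ => 0 := by
        have : ∀ᶠ x in 𝓝 θ, |trig 0 b (-a) x| < α :=
          (isOpen_lt (contDiff_trig _ _ _).continuous.abs continuous_const).mem_nhds hθ
        filter_upwards [this] with x hx
        simp [hG, hz x hx]
      rw [this.deriv_eq]; simp
    set v : ℝ → ℝ := fun θ => iteratedDeriv l η (trig c a b θ / δ) with hv
    set v' : ℝ → ℝ := fun θ => iteratedDeriv (l + 1) η (trig c a b θ / δ) *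
      (trig 0 b (-a) θ / δ) with hv'
    have hvd : ∀ θ, HasDerivAt v (v' θ) θ := by
      intro θ
      have h1 : HasDerivAt (iteratedDeriv l η) (iteratedDeriv (l + 1) η (trig c a b θ / δ))
          (trig c a b θ / δ) := by
        rw [iteratedDeriv_succ]
        exact ((hη.iteratedDeriv l).1.differentiable (by simp) _).hasDerivAt
      exact h1.comp θ ((hasDerivAt_trig c a b θ).div_const δ)
    have hcont : Continuous v' :=
      ((hη.iteratedDeriv (l + 1)).1.continuous.comp
        ((contDiff_trig c a b).continuous.div_const δ)).mul
          ((contDiff_trig 0 b (-a)).continuous.div_const δ)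
    have hpt : ∀ θ, g θ * iteratedDeriv (l + 1) η (trig c a b θ / δ) = δ * (G θ * v' θ) := by
      intro θ
      by_cases hθ : |trig 0 b (-a) θ| < α
      · simp [hG, hz θ hθ]
      · push Not at hθ
        have h0 : trig 0 b (-a) θ ≠ 0 := by
          intro h; rw [h] at hθ; simp at hθ; linarith
        have hKθ : K (trig 0 (b / α) (-a / α) θ) = α / trig 0 b (-a) θ := by
          rw [htr, hKv, inv_div]
          rw [abs_div, abs_of_pos hα, le_div_iff₀ hα]; linarith
        simp only [hG, hW, hv', hKθ]
        field_simp
    have hparts := intervalIntegral.integral_mul_deriv_eq_deriv_mul (a := -Real.pi)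
      (b := Real.pi) (u := G) (v := v) (u' := deriv G) (v' := v')
      (fun x _ => (hgW.1.differentiable (by simp) x).hasDerivAt) (fun x _ => hvd x)
      (hGd.1.continuous.intervalIntegrable _ _) (hcont.intervalIntegrable _ _)
    have hbd : G Real.pi * v Real.pi - G (-Real.pi) * v (-Real.pi) = 0 := by
      have h1 : G Real.pi = G (-Real.pi) := by
        rw [← hGper (-Real.pi)]; congr 1; ring
      have h2 : v Real.pi = v (-Real.pi) := by
        simp only [hv]
        rw [← (trig_periodic c a b) (-Real.pi)]; congr 3; ring
      rw [h1, h2, sub_self]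
    rw [hbd, zero_sub] at hparts
    simp_rw [hpt]
    rw [intervalIntegral.integral_const_mul, hparts, abs_mul, abs_neg, abs_of_pos hδ]
    have hmain := hI (deriv G) D _ α δ c a b hGd hdper hD hα hδ hab hdz
    calc _ ≤ δ * _ := mul_le_mul_of_nonneg_left hmain hδ.le
      _ = _ := by
        rw [abs_of_pos (inv_pos.2 hα), pow_succ (δ * D / α)]
        field_simp

theorem volume_le_of_dist_le {S : Set ℝ} {L : ℝ}
    (h : ∀ u ∈ S, ∀ v ∈ S, |u - v| ≤ L) : volume S ≤ ENNReal.ofReal L := by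
  refine (Real.volume_le_diam S).trans (Metric.ediam_le fun u hu v hv => ?_)
  rw [edist_dist, Real.dist_eq]
  exact ENNReal.ofReal_le_ofReal (h u hu v hv)

/-- Size of a thin sublevel set of `c - r²` on the half line. -/
theorem volume_sq_sublevel {c l δ : ℝ} (hl : 0 < l) :
    volume {r : ℝ | l ≤ r ∧ |r ^ 2 - c| ≤ δ} ≤ ENNReal.ofReal (δ / l) := by
  refine volume_le_of_dist_le fun u hu v hv => ?_
  obtain ⟨hu1, hu2⟩ := hu
  obtain ⟨hv1, hv2⟩ := hv
  rw [abs_le] at hu2 hv2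
  rw [le_div_iff₀ hl, abs_sub_comm]
  rcases abs_cases (v - u) with ⟨h1, h2⟩ | ⟨h1, h2⟩ <;> rw [h1] <;> nlinarith

theorem cos_sub_cos_ge {u v : ℝ} (hu : 0 ≤ u) (huv : u ≤ v) (hv : v ≤ Real.pi) :
    2 * ((v - u) / Real.pi) ^ 2 ≤ Real.cos u - Real.cos v := by
  have hpi := Real.pi_pos
  rw [Real.cos_sub_cos]
  have e : -2 * Real.sin ((u + v) / 2) * Real.sin ((u - v) / 2) =
      2 * Real.sin ((u + v) / 2) * Real.sin ((v - u) / 2) := by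
    rw [show (u - v) / 2 = -((v - u) / 2) by ring, Real.sin_neg]; ring
  rw [e]
  have h1 : (v - u) / Real.pi ≤ Real.sin ((v - u) / 2) := by
    refine le_trans (le_of_eq ?_) (Real.mul_le_sin (by linarith) (by linarith))
    field_simp
  have h2 : (v - u) / Real.pi ≤ Real.sin ((u + v) / 2) := by
    rcases le_total ((u + v) / 2) (Real.pi / 2) with h | h
    · refine le_trans ?_ (Real.mul_le_sin (by linarith) h)
      rw [div_mul_eq_mul_div, div_le_div_iff_of_pos_right hpi]
      linarith
    · rw [← Real.sin_pi_sub]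
      refine le_trans ?_ (Real.mul_le_sin (by linarith) (by linarith))
      rw [div_mul_eq_mul_div, div_le_div_iff_of_pos_right hpi]
      linarith
  have h0 : 0 ≤ (v - u) / Real.pi := div_nonneg (by linarith) hpi.le
  nlinarith [mul_le_mul h2 h1 h0 (h0.trans h2)]

theorem cos_diff_abs_le {k : ℤ} {A c δ u v : ℝ} (hA : 0 < A)
    (hu : k * Real.pi ≤ u ∧ u ≤ (k + 1) * Real.pi) (hv : k * Real.pi ≤ v ∧ v ≤ (k + 1) * Real.pi)
    (hu' : |c + A * Real.cos u| ≤ δ) (hv' : |c + A * Real.cos v| ≤ δ) :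
    |u - v| ≤ Real.pi * √(δ / A) := by
  wlog huv : u ≤ v generalizing u v
  · rw [abs_sub_comm]; exact this hv hu hv' hu' (le_of_not_ge huv)
  have hpi := Real.pi_pos
  have h := cos_sub_cos_ge (u := u - k * Real.pi) (v := v - k * Real.pi) (by linarith) (by linarith)
    (by linarith)
  rw [Real.cos_sub_int_mul_pi, Real.cos_sub_int_mul_pi] at h
  have h1 : |((-1 : ℝ) ^ k * Real.cos u - (-1) ^ k * Real.cos v)| = |Real.cos u - Real.cos v| := by
    rw [← mul_sub, abs_mul, abs_zpow]; simp
  have h2 : A * |Real.cos u - Real.cos v| ≤ 2 * δ := by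
    have e : A * |Real.cos u - Real.cos v| = |A * (Real.cos u - Real.cos v)| := by
      rw [abs_mul, abs_of_pos hA]
    rw [e]
    rw [abs_le] at *
    constructor <;> nlinarith
  have h3 : 2 * ((v - u) / Real.pi) ^ 2 ≤ |Real.cos u - Real.cos v| := by
    rw [← h1]; refine le_trans (le_of_eq ?_) (h.trans (le_abs_self _)); congr 3; ring
  have h4 : ((v - u) / Real.pi) ^ 2 ≤ δ / A := by
    rw [le_div_iff₀ hA]; nlinarith
  rw [abs_sub_comm, abs_of_nonneg (by linarith)]
  have h5 := Real.le_sqrt_of_sq_le h4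
  rw [div_le_iff₀ hpi] at h5
  linarith

theorem volume_trig_sublevel {a b c δ A : ℝ} (hA : 0 < A) (hab : A ^ 2 ≤ a ^ 2 + b ^ 2)
    (hδ : 0 ≤ δ) :
    volume {θ : ℝ | (-Real.pi ≤ θ ∧ θ ≤ Real.pi) ∧ |trig c a b θ| ≤ δ} ≤
      ENNReal.ofReal (4 * Real.pi * √(δ / A)) := by
  have hpi := Real.pi_pos
  set ζ : ℂ := ⟨a, b⟩ with hζ
  set B : ℝ := ‖ζ‖ with hB
  have hBs : B ^ 2 = a ^ 2 + b ^ 2 := by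
    rw [hB, Complex.sq_norm, Complex.normSq_apply]; simp [hζ]; ring
  have hAB : A ≤ B := by
    have : 0 ≤ B := norm_nonneg _
    nlinarith
  have hBpos : 0 < B := lt_of_lt_of_le hA hAB
  set t := Complex.arg ζ with ht
  have ha : a = B * Real.cos t := by
    exact (Complex.norm_mul_cos_arg ζ).symm
  have hb : b = B * Real.sin t := by
    exact (Complex.norm_mul_sin_arg ζ).symm
  have ht1 := Complex.neg_pi_lt_arg ζ
  have ht2 := Complex.arg_le_pi ζ
  have hD : ∀ θ, trig c a b θ = c + B * Real.cos (θ - t) := by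
    intro θ; rw [trig, Real.cos_sub, ha, hb]; ring
  let S : ℤ → Set ℝ := fun k => {θ | (k * Real.pi ≤ θ - t ∧ θ - t ≤ (k + 1) * Real.pi) ∧
    |c + B * Real.cos (θ - t)| ≤ δ}
  have hS : ∀ k, volume (S k) ≤ ENNReal.ofReal (Real.pi * √(δ / A)) := by
    intro k
    refine volume_le_of_dist_le fun u hu v hv => ?_
    have := cos_diff_abs_le hBpos hu.1 hv.1 hu.2 hv.2
    rw [show u - t - (v - t) = u - v by ring] at this
    refine this.trans ?_
    gcongr
  have hsub : {θ : ℝ | (-Real.pi ≤ θ ∧ θ ≤ Real.pi) ∧ |trig c a b θ| ≤ δ} ⊆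
      (S (-2) ∪ S (-1)) ∪ (S 0 ∪ S 1) := by
    rintro θ ⟨⟨h1, h2⟩, h3⟩
    rw [hD] at h3
    rcases le_total (θ - t) 0 with h | h
    · left
      rcases le_total (θ - t) (-Real.pi) with h' | h'
      · left; refine ⟨⟨?_, ?_⟩, h3⟩ <;> push_cast <;> linarith
      · right; refine ⟨⟨?_, ?_⟩, h3⟩ <;> push_cast <;> linarith
    · right
      rcases le_total (θ - t) Real.pi with h' | h'
      · left; refine ⟨⟨?_, ?_⟩, h3⟩ <;> push_cast <;> linarith
      · right; refine ⟨⟨?_, ?_⟩, h3⟩ <;> push_cast <;> linarith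
  refine (measure_mono hsub).trans ?_
  refine (measure_union_le _ _).trans ((add_le_add (measure_union_le _ _)
    (measure_union_le _ _)).trans ?_)
  refine (add_le_add (add_le_add (hS _) (hS _)) (add_le_add (hS _) (hS _))).trans ?_
  rw [← ENNReal.ofReal_add, ← ENNReal.ofReal_add] <;> try positivity
  apply ENNReal.ofReal_le_ofReal
  linarith

/-- The defining function of the circle of centre `x` and radius `t`. -/
noncomputable def rho (x : ℝ × ℝ) (t : ℝ) (z : ℝ × ℝ) : ℝ :=
  (z.1 - x.1) ^ 2 + (z.2 - x.2) ^ 2 - t ^ 2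

theorem continuous_rho : Continuous fun q : ((ℝ × ℝ) × ℝ) × (ℝ × ℝ) => rho q.1.1 q.1.2 q.2 := by
  unfold rho; fun_prop

theorem continuous_rho_right (x : ℝ × ℝ) (t : ℝ) : Continuous (rho x t) := by
  unfold rho; fun_prop

theorem volume_sq_shift_sublevel {x c δ : ℝ} (hδ : 0 ≤ δ) :
    volume {v : ℝ | 1 / 2 ≤ |v - x| ∧ |(v - x) ^ 2 - c| ≤ δ} ≤ ENNReal.ofReal (4 * δ) := by
  have h1 : volume {v : ℝ | 1 / 2 ≤ v - x ∧ |(v - x) ^ 2 - c| ≤ δ} ≤ ENNReal.ofReal (2 * δ) := by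
    refine volume_le_of_dist_le fun u hu v hv => ?_
    obtain ⟨hu1, hu2⟩ := hu
    obtain ⟨hv1, hv2⟩ := hv
    rw [abs_le] at *
    constructor <;> nlinarith
  have h2 : volume {v : ℝ | 1 / 2 ≤ x - v ∧ |(v - x) ^ 2 - c| ≤ δ} ≤ ENNReal.ofReal (2 * δ) := by
    refine volume_le_of_dist_le fun u hu v hv => ?_
    obtain ⟨hu1, hu2⟩ := hu
    obtain ⟨hv1, hv2⟩ := hv
    rw [abs_le] at *
    constructor <;> nlinarith
  refine (measure_mono (t := {v : ℝ | 1 / 2 ≤ v - x ∧ |(v - x) ^ 2 - c| ≤ δ} ∪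
    {v : ℝ | 1 / 2 ≤ x - v ∧ |(v - x) ^ 2 - c| ≤ δ}) ?_).trans ?_
  · rintro v ⟨h, h'⟩
    rcases le_abs.1 h with h | h
    · exact Or.inl ⟨h, h'⟩
    · exact Or.inr ⟨by linarith, h'⟩
  · refine (measure_union_le _ _).trans ((add_le_add h1 h2).trans ?_)
    rw [← ENNReal.ofReal_add (by positivity) (by positivity)]
    apply ENNReal.ofReal_le_ofReal; linarith

/-- Area of the part of a thin annulus inside a box. -/
theorem volume_annulus_box_le {x z₀ : ℝ × ℝ} {t δ κ : ℝ} (ht : 1 ≤ t) (hδ : 0 ≤ δ)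
    (hδ' : δ ≤ 1 / 2) (hκ : 0 ≤ κ) :
    volume {z : ℝ × ℝ | z ∈ closedBall z₀ κ ∧ |rho x t z| ≤ δ} ≤
      ENNReal.ofReal (16 * δ * κ) := by
  set S₁ : Set (ℝ × ℝ) := {z | |z.1 - z₀.1| ≤ κ ∧ (1 / 2 ≤ |z.2 - x.2| ∧ |rho x t z| ≤ δ)} with hS₁
  set S₂ : Set (ℝ × ℝ) := {z | |z.2 - z₀.2| ≤ κ ∧ (1 / 2 ≤ |z.1 - x.1| ∧ |rho x t z| ≤ δ)} with hS₂
  have hr := continuous_rho_right x t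
  have c₃ : IsClosed {z : ℝ × ℝ | |rho x t z| ≤ δ} := isClosed_le hr.abs continuous_const
  have m₁ : MeasurableSet S₁ := by
    have c₁ : IsClosed {z : ℝ × ℝ | |z.1 - z₀.1| ≤ κ} := isClosed_le (by fun_prop) continuous_const
    have c₂ : IsClosed {z : ℝ × ℝ | 1 / 2 ≤ |z.2 - x.2|} :=
      isClosed_le continuous_const (by fun_prop)
    exact (c₁.inter (c₂.inter c₃)).measurableSet
  have m₂ : MeasurableSet S₂ := by
    have c₁ : IsClosed {z : ℝ × ℝ | |z.2 - z₀.2| ≤ κ} := isClosed_le (by fun_prop) continuous_const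
    have c₂ : IsClosed {z : ℝ × ℝ | 1 / 2 ≤ |z.1 - x.1|} :=
      isClosed_le continuous_const (by fun_prop)
    exact (c₁.inter (c₂.inter c₃)).measurableSet
  have b : ∀ a : ℝ, volume {v : ℝ | |v - a| ≤ κ} = ENNReal.ofReal (2 * κ) := by
    intro a
    have : {v : ℝ | |v - a| ≤ κ} = closedBall a κ := by
      ext v; simp [Real.dist_eq]
    rw [this, Real.volume_closedBall]
  have v₁ : volume S₁ ≤ ENNReal.ofReal (8 * δ * κ) := by
    rw [Measure.volume_eq_prod, Measure.prod_apply m₁]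
    calc _ ≤ ∫⁻ u, Set.indicator {u : ℝ | |u - z₀.1| ≤ κ} (fun _ => ENNReal.ofReal (4 * δ)) u := by
          refine lintegral_mono fun u => ?_
          by_cases hu : |u - z₀.1| ≤ κ
          · rw [Set.indicator_of_mem (by exact hu)]
            refine le_trans (measure_mono ?_) (volume_sq_shift_sublevel (x := x.2)
              (c := t ^ 2 - (u - x.1) ^ 2) hδ)
            rintro v ⟨_, h2, h3⟩
            refine ⟨h2, ?_⟩
            simp only [rho] at h3
            convert h3 using 2; ring
          · rw [Set.indicator_of_notMem (by exact hu)]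
            have : Prod.mk u ⁻¹' S₁ = ∅ := by
              ext v; simp [hS₁]; intro h; exact absurd h hu
            rw [this]; simp
      _ = _ := by
          rw [lintegral_indicator_const, b, ← ENNReal.ofReal_mul (by positivity)]
          · congr 1; ring
          · exact (isClosed_le (by fun_prop) continuous_const).measurableSet
  have v₂ : volume S₂ ≤ ENNReal.ofReal (8 * δ * κ) := by
    rw [Measure.volume_eq_prod, Measure.prod_apply_symm m₂]
    calc _ ≤ ∫⁻ u, Set.indicator {u : ℝ | |u - z₀.2| ≤ κ} (fun _ => ENNReal.ofReal (4 * δ)) u := by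
          refine lintegral_mono fun u => ?_
          by_cases hu : |u - z₀.2| ≤ κ
          · rw [Set.indicator_of_mem (by exact hu)]
            refine le_trans (measure_mono ?_) (volume_sq_shift_sublevel (x := x.1)
              (c := t ^ 2 - (u - x.2) ^ 2) hδ)
            rintro v ⟨_, h2, h3⟩
            refine ⟨h2, ?_⟩
            simp only [rho] at h3
            convert h3 using 2; ring
          · rw [Set.indicator_of_notMem (by exact hu)]
            have : (fun v => (v, u)) ⁻¹' S₂ = ∅ := by
              ext v; simp [hS₂]; intro h; exact absurd h hu
            rw [this]; simp
      _ = _ := by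
          rw [lintegral_indicator_const, b, ← ENNReal.ofReal_mul (by positivity)]
          · congr 1; ring
          · exact (isClosed_le (by fun_prop) continuous_const).measurableSet
  refine (measure_mono (t := S₁ ∪ S₂) ?_).trans ((measure_union_le _ _).trans
    ((add_le_add v₁ v₂).trans ?_))
  · rintro z ⟨hz, h⟩
    rw [mem_closedBall, Prod.dist_eq, max_le_iff, Real.dist_eq, Real.dist_eq] at hz
    by_cases h2 : 1 / 2 ≤ |z.2 - x.2|
    · exact Or.inl ⟨hz.1, h2, h⟩
    · refine Or.inr ⟨hz.2, ?_, h⟩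
      by_contra h1
      push Not at h1 h2
      have e1 := sq_lt_sq' (neg_lt_of_abs_lt h1) (lt_of_abs_lt h1)
      have e2 := sq_lt_sq' (neg_lt_of_abs_lt h2) (lt_of_abs_lt h2)
      rw [abs_le] at h
      simp only [rho] at h
      nlinarith
  · rw [← ENNReal.ofReal_add (by positivity) (by positivity)]
    apply ENNReal.ofReal_le_ofReal; linarith

theorem mem_ball_of_rho_le {x : ℝ × ℝ} {t δ : ℝ} {z : ℝ × ℝ} (ht : 1 ≤ t ∧ t ≤ 2)
    (hδ' : δ ≤ 1 / 2) (h : |rho x t z| ≤ δ) : |z.1 - x.1| ≤ 9 / 4 ∧ |z.2 - x.2| ≤ 9 / 4 := by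
  rw [abs_le] at h
  simp only [rho] at h
  constructor <;> apply abs_le_of_sq_le_sq <;> nlinarith [sq_nonneg (z.1 - x.1), sq_nonneg (z.2 -
      x.2)]

theorem volume_annulus_le {x : ℝ × ℝ} {t δ : ℝ} (ht : 1 ≤ t ∧ t ≤ 2) (hδ : 0 ≤ δ)
    (hδ' : δ ≤ 1 / 2) :
    volume {z : ℝ × ℝ | |rho x t z| ≤ δ} ≤ ENNReal.ofReal (36 * δ) := by
  refine le_trans (measure_mono ?_) ((volume_annulus_box_le (x := x) (z₀ := x) (κ := 9 / 4)
    ht.1 hδ hδ' (by norm_num)).trans (ENNReal.ofReal_le_ofReal (by linarith)))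
  intro z hz
  have := mem_ball_of_rho_le ht hδ' hz
  refine ⟨?_, hz⟩
  rw [mem_closedBall, Prod.dist_eq, max_le_iff, Real.dist_eq, Real.dist_eq]
  exact this

/-- The square of the Euclidean norm on the plane. -/
noncomputable def nsq (v : ℝ × ℝ) : ℝ := v.1 ^ 2 + v.2 ^ 2

/-- The planar cross product. -/
noncomputable def cross (d v : ℝ × ℝ) : ℝ := d.1 * v.2 - d.2 * v.1

/-- The overlap kernel of two thin annuli. -/
noncomputable def kern (φ : ℝ → ℝ) (w : ℝ × ℝ → ℝ) (δ : ℝ) (x : ℝ × ℝ) (t : ℝ) (y : ℝ × ℝ)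
    (s : ℝ) : ℝ :=
  ∫ z, w z * (φ (rho x t z / δ) * φ (rho y s z / δ))

/-- The point at polar coordinates `(r, θ)` about `y`. -/
noncomputable def circ (y : ℝ × ℝ) (r θ : ℝ) : ℝ × ℝ :=
  (y.1 + r * Real.cos θ, y.2 + r * Real.sin θ)

theorem rho_circ_self (y : ℝ × ℝ) (s r θ : ℝ) : rho y s (circ y r θ) = r ^ 2 - s ^ 2 := by
  simp only [rho, circ]
  linear_combination r ^ 2 * Real.sin_sq_add_cos_sq θ

theorem rho_circ (x y : ℝ × ℝ) (t r θ : ℝ) : rho x t (circ y r θ) =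
    trig (r ^ 2 + nsq (x - y) - t ^ 2) (-2 * r * (x - y).1) (-2 * r * (x - y).2) θ := by
  simp only [rho, circ, trig, nsq, Prod.fst_sub, Prod.snd_sub]
  linear_combination r ^ 2 * Real.sin_sq_add_cos_sq θ

theorem nsq_circ_sub (y z₀ : ℝ × ℝ) (κ r θ : ℝ) : nsq (circ y r θ - z₀) / κ ^ 2 =
    trig ((r ^ 2 + nsq (y - z₀)) / κ ^ 2) (2 * r * (y - z₀).1 / κ ^ 2)
      (2 * r * (y - z₀).2 / κ ^ 2) θ := by
  simp only [circ, trig, nsq, Prod.fst_sub, Prod.snd_sub]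
  linear_combination (r ^ 2 / κ ^ 2) * Real.sin_sq_add_cos_sq θ

theorem IsCutoff.zero_of_lt {φ : ℝ → ℝ} (hφ : IsCutoff φ) {v δ : ℝ} (hδ : 0 < δ) (h : δ < |v|) :
    φ (v / δ) = 0 := by
  refine hφ.2 _ ?_
  rw [abs_div, abs_of_pos hδ, lt_div_iff₀ hδ]
  linarith

theorem continuous_circ (y : ℝ × ℝ) : Continuous fun p : ℝ × ℝ => circ y p.1 p.2 := by
  unfold circ; fun_prop

theorem kern_polar {φ : ℝ → ℝ} (hφ : IsCutoff φ) {w : ℝ × ℝ → ℝ}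
    (hw : Continuous w) {δ : ℝ} (hδ : 0 < δ) (hδ' : δ ≤ 1 / 2) {x y : ℝ × ℝ} {t s : ℝ}
    (hs : 1 ≤ s ∧ s ≤ 2) :
    kern φ w δ x t y s = ∫ r in Set.Ioi (0 : ℝ), r * φ ((r ^ 2 - s ^ 2) / δ) *
      ∫ θ in (-Real.pi)..Real.pi, w (circ y r θ) * φ (rho x t (circ y r θ) / δ) := by
  have hrx := continuous_rho_right x t
  have hry := continuous_rho_right y s
  set f : ℝ × ℝ → ℝ := fun z => w z * (φ (rho x t z / δ) * φ (rho y s z / δ)) with hf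
  have hfc : Continuous f :=
    hw.mul ((hφ.1.continuous.comp (hrx.div_const δ)).mul (hφ.1.continuous.comp (hry.div_const δ)))
  have e1 : kern φ w δ x t y s = ∫ p in polarCoord.target, p.1 * f (circ y p.1 p.2) := by
    have h := integral_comp_polarCoord_symm (fun v => f (y + v))
    rw [integral_add_left_eq_self] at h
    rw [kern, ← h]
    rfl
  have hg : Continuous fun p : ℝ × ℝ => p.1 * f (circ y p.1 p.2) :=
    continuous_fst.mul (hfc.comp (continuous_circ y))
  have hIntg : IntegrableOn (fun p : ℝ × ℝ => p.1 * f (circ y p.1 p.2))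
      (Set.Ioi (0 : ℝ) ×ˢ Set.Ioo (-Real.pi) Real.pi) (volume.prod volume) := by
    have h1 : IntegrableOn (fun p : ℝ × ℝ => p.1 * f (circ y p.1 p.2))
      (Set.Icc (0 : ℝ) 3 ×ˢ Set.Icc (-Real.pi) Real.pi) (volume.prod volume) :=
      hg.continuousOn.integrableOn_compact (isCompact_Icc.prod isCompact_Icc)
    refine h1.of_forall_sdiff_eq_zero (measurableSet_Ioi.prod measurableSet_Ioo) ?_
    rintro ⟨r, θ⟩ ⟨⟨h2, h3⟩, h4⟩
    have hr : 3 < r := by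
      by_contra h
      exact h4 ⟨⟨le_of_lt h2, not_lt.1 h⟩, ⟨h3.1.le, h3.2.le⟩⟩
    simp only [hf, rho_circ_self]
    rw [hφ.zero_of_lt (v := r ^ 2 - s ^ 2) hδ]
    · ring
    · rw [lt_abs]; left; nlinarith
  rw [e1]
  change ∫ p in Set.Ioi (0 : ℝ) ×ˢ Set.Ioo (-Real.pi) Real.pi, p.1 * f (circ y p.1 p.2) = _
  rw [Measure.volume_eq_prod, setIntegral_prod _ hIntg]
  refine setIntegral_congr_fun measurableSet_Ioi fun r _ => ?_
  change ∫ θ in Set.Ioo (-Real.pi) Real.pi, r * f (circ y r θ) = _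
  rw [← integral_Ioc_eq_integral_Ioo, ← intervalIntegral.integral_of_le (by
    linarith [Real.pi_pos]), ← intervalIntegral.integral_const_mul]
  refine intervalIntegral.integral_congr fun θ _ => ?_
  simp only [hf, rho_circ_self]
  ring

theorem abs_kern_le_of_circle {φ : ℝ → ℝ} (hφ : IsCutoff φ) {C : ℝ} (hC : ∀ v, |φ v| ≤ C)
    {w : ℝ × ℝ → ℝ} (hw : Continuous w) {δ : ℝ} (hδ : 0 < δ) (hδ' : δ ≤ 1 / 2) {x y : ℝ × ℝ}
    {t s : ℝ} (hs : 1 ≤ s ∧ s ≤ 2) {A : ℝ}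
    (hA : ∀ r, 0 < r → r ≤ 3 → |r ^ 2 - s ^ 2| ≤ δ →
      |∫ θ in (-Real.pi)..Real.pi, w (circ y r θ) * φ (rho x t (circ y r θ) / δ)| ≤ A) :
    |kern φ w δ x t y s| ≤ 6 * C * A * δ := by
  rw [kern_polar hφ hw hδ hδ' hs]
  have hC0 : 0 ≤ C := (abs_nonneg _).trans (hC 0)
  have hA0 : 0 ≤ A := (abs_nonneg _).trans (hA s (by linarith) (by linarith) (by simp [hδ.le]))
  set S : Set ℝ := {r | 1 / 2 ≤ r ∧ |r ^ 2 - s ^ 2| ≤ δ} with hS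
  have hSm : MeasurableSet S := by
    have c1 : IsClosed {r : ℝ | 1 / 2 ≤ r} := isClosed_le continuous_const continuous_id
    have c2 : IsClosed {r : ℝ | |r ^ 2 - s ^ 2| ≤ δ} := isClosed_le (by fun_prop) continuous_const
    exact (c1.inter c2).measurableSet
  have hSv : volume S ≤ ENNReal.ofReal (δ / (1 / 2)) := volume_sq_sublevel (by norm_num)
  rw [setIntegral_eq_of_subset_of_forall_sdiff_eq_zero (s := S) measurableSet_Ioi
    (fun r hr => lt_of_lt_of_le (by norm_num) hr.1)]
  · have h := norm_setIntegral_le_of_norm_le_const (μ := volume) (s := S) (C := 3 * C * A)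
      (f := fun r => r * φ ((r ^ 2 - s ^ 2) / δ) *
        ∫ θ in (-Real.pi)..Real.pi, w (circ y r θ) * φ (rho x t (circ y r θ) / δ))
      (hSv.trans_lt ENNReal.ofReal_lt_top) (by
        rintro r ⟨h1, h2⟩
        have h3 : r ≤ 3 := by rw [abs_le] at h2; nlinarith
        rw [norm_mul, norm_mul, Real.norm_eq_abs, Real.norm_eq_abs, Real.norm_eq_abs,
          abs_of_pos (by linarith : (0 : ℝ) < r)]
        have := hA r (by linarith) h3 h2
        have := hC ((r ^ 2 - s ^ 2) / δ)
        gcongr)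
    refine h.trans ?_
    have h2 : volume.real S ≤ δ / (1 / 2) :=
      ENNReal.toReal_le_of_le_ofReal (by positivity) hSv
    calc _ ≤ 3 * C * A * (δ / (1 / 2)) := by gcongr
      _ = _ := by ring
  · rintro r ⟨h1, h2⟩
    have : φ ((r ^ 2 - s ^ 2) / δ) = 0 := by
      apply hφ.zero_of_lt hδ
      by_contra h
      push Not at h
      refine h2 ⟨?_, h⟩
      have h1 : 0 < r := h1
      rw [abs_le] at h
      nlinarith
    rw [this]; ring

theorem trig_deriv_cross (y d : ℝ × ℝ) (r θ : ℝ) :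
    trig 0 (-2 * r * d.2) (-(-2 * r * d.1)) θ = 2 * cross d (circ y r θ - y) := by
  simp only [trig, cross, circ, Prod.fst_sub, Prod.snd_sub]; ring

/-- If the two annuli nowhere meet almost tangentially, the kernel is very small. -/
theorem exists_kern_transverse {η β : ℝ → ℝ} (hη : IsCutoff η) (hβ : IsCutoff β) (m : ℕ) :
    ∃ C, 0 < C ∧ ∀ (δ α κ D : ℝ) (z₀ x y : ℝ × ℝ) (t s : ℝ), 0 < δ → δ ≤ 1 / 2 → 0 < α → 0 < κ →
      1 ≤ D → 1 ≤ s ∧ s ≤ 2 →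
      6 * (|(x - y).1| + |(x - y).2|) ≤ α * D →
      6 * (|(y - z₀).1| + |(y - z₀).2|) ≤ κ ^ 2 * D →
      (∀ z, β (nsq (z - z₀) / κ ^ 2) ≠ 0 → |rho x t z| ≤ δ → |rho y s z| ≤ δ →
        α ≤ |cross (x - y) (z - y)|) →
      |kern (iteratedDeriv m η) (fun z => β (nsq (z - z₀) / κ ^ 2)) δ x t y s| ≤
        C * δ * (δ * D / α) ^ m := by
  obtain ⟨β₀, hβ₀, hβ1, -⟩ := exists_plateau
  obtain ⟨Cβ, hCβ, hβd⟩ := hβ.derivBound m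
  obtain ⟨C₀, hC₀, hβ₀d⟩ := hβ₀.derivBound m
  obtain ⟨CI, hCI, hI⟩ := exists_nonstationary_bound hη m
  obtain ⟨Cφ, hCφ, hφb⟩ := (hη.iteratedDeriv m).bounded
  have hφ := hη.iteratedDeriv m
  -- the cutoff `1 - β₀ (v / 2)` vanishes for `|v| ≤ 1` and equals one for `2 ≤ |v|`
  have hζd : ∃ C, 0 < C ∧ DerivBound m 1 C fun v => 1 - β₀ (v / 2) := by
    have hsm : ContDiff ℝ (⊤ : ℕ∞) fun v : ℝ => 1 - β₀ (v / 2) :=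
      contDiff_const.sub (hβ₀.1.comp (contDiff_id.div_const 2))
    have h2 : ∀ i, ∃ C, 0 < C ∧ ∀ x, |iteratedDeriv i (fun v : ℝ => 1 - β₀ (v / 2)) x| ≤ C := by
      intro i
      have hc : Continuous (iteratedDeriv i (fun v : ℝ => 1 - β₀ (v / 2))) :=
        hsm.continuous_iteratedDeriv i (by exact_mod_cast le_top)
      obtain ⟨C, hC⟩ := (isCompact_Icc (a := (-3 : ℝ)) (b := 3)).exists_bound_of_continuousOn
        hc.continuousOn
      refine ⟨max C 1, by positivity, fun x => ?_⟩
      by_cases hx : |x| ≤ 3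
      · exact (hC x (abs_le.1 hx)).trans (le_max_left _ _)
      · push Not at hx
        have he : (fun v : ℝ => 1 - β₀ (v / 2)) =ᶠ[𝓝 x] fun _ => 1 := by
          have : ∀ᶠ v in 𝓝 x, 3 < |v| :=
            (isOpen_lt continuous_const continuous_abs).mem_nhds hx
          filter_upwards [this] with v hv
          rw [hβ₀.2, sub_zero]
          rw [abs_div, abs_two]; linarith
        rw [he.iteratedDeriv_eq]
        refine le_trans ?_ (le_max_right _ _)
        rcases Nat.eq_zero_or_pos i with rfl | hi
        · simp
        · rw [iteratedDeriv_const]; simp [hi.ne']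
    choose C hC hb using h2
    refine ⟨∑ i ∈ Finset.range (m + 1), C i, Finset.sum_pos (fun i _ => hC i) (by simp),
      ⟨hsm, fun i hi x => (hb i x).trans ?_⟩⟩
    simp only [one_pow, mul_one]
    exact Finset.single_le_sum (f := C) (fun j _ => (hC j).le) (by simp; omega)
  obtain ⟨Cζ, hCζ, hζd⟩ := hζd
  set Bg : ℝ := 2 ^ m * ((m.factorial * Cβ) * (m.factorial * Cζ)) with hBg
  refine ⟨6 * Cφ * (CI * Bg), by positivity, ?_⟩
  intro δ α κ D z₀ x y t s hδ hδ' hα hκ hD hs hxy hyz H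
  have hwc : Continuous fun z : ℝ × ℝ => β (nsq (z - z₀) / κ ^ 2) := by
    refine hβ.1.continuous.comp ?_
    unfold nsq; fun_prop
  have key := abs_kern_le_of_circle hφ hφb hwc hδ hδ' (x := x) (y := y) (t := t) hs
    (A := CI * Bg * (δ * D / α) ^ m) ?_
  · refine key.trans (le_of_eq ?_); ring
  intro r hr0 hr3 hrs
  set d := x - y with hd
  set a := -2 * r * d.1 with ha
  set b := -2 * r * d.2 with hb
  set c := r ^ 2 + nsq d - t ^ 2 with hc
  have habs : ∀ v : ℝ, |-2 * r * v| = 2 * r * |v| := by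
    intro v; rw [abs_mul, abs_mul, abs_of_pos hr0]; norm_num
  have hab : |a| + |b| ≤ α * D := by
    rw [ha, hb, habs, habs]
    have h1 := abs_nonneg d.1
    have h2 := abs_nonneg d.2
    nlinarith
  set g : ℝ → ℝ := fun θ => β (trig ((r ^ 2 + nsq (y - z₀)) / κ ^ 2) (2 * r * (y - z₀).1 / κ ^ 2)
      (2 * r * (y - z₀).2 / κ ^ 2) θ) * (1 - β₀ (trig 0 (b / α) (-a / α) θ / 2)) with hg
  have hgd : DerivBound m D Bg g := by
    refine DerivBound.mul (by linarith) (hβd.comp_trig hD ?_) (hζd.comp_trig hD ?_)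
    · have habs' : ∀ v : ℝ, |2 * r * v / κ ^ 2| = 2 * r * |v| / κ ^ 2 := by
        intro v; rw [abs_div, abs_mul, abs_mul, abs_of_pos hr0, abs_of_pos (by positivity : 0 < κ
            ^ 2)]
        norm_num
      rw [habs', habs', ← add_div, div_le_iff₀ (by positivity)]
      have h1 := abs_nonneg (y - z₀).1
      have h2 := abs_nonneg (y - z₀).2
      nlinarith
    · rw [abs_div, abs_div, abs_neg, abs_of_pos hα, ← add_div, div_le_iff₀ hα]
      linarith
  have htr : ∀ θ, trig 0 (b / α) (-a / α) θ = trig 0 b (-a) θ / α := by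
    intro θ; simp only [trig]; ring
  have hgper : Function.Periodic g (2 * Real.pi) := by
    intro θ
    simp only [hg, (trig_periodic _ _ _ : Function.Periodic _ _) θ]
  have hgz : ∀ θ, |trig 0 b (-a) θ| < α → g θ = 0 := by
    intro θ hθ
    have : β₀ (trig 0 (b / α) (-a / α) θ / 2) = 1 := by
      apply hβ1
      rw [htr, abs_div, abs_div, abs_two, abs_of_pos hα]
      have : |trig 0 b (-a) θ| / α ≤ 1 := by rw [div_le_one hα]; exact hθ.le
      linarith
    simp [hg, this]
  have main := hI g D Bg α δ c a b hgd hgper hD hα hδ hab hgz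
  refine le_trans (le_of_eq ?_) main
  congr 1
  refine intervalIntegral.integral_congr fun θ _ => ?_
  rw [rho_circ, ← hd, ← ha, ← hb, ← hc]
  by_cases h1 : iteratedDeriv m η (trig c a b θ / δ) = 0
  · rw [h1]; ring
  by_cases h2 : β (nsq (circ y r θ - z₀) / κ ^ 2) = 0
  · have h2' := h2
    rw [nsq_circ_sub] at h2'
    simp only [hg, h2', h2]; ring
  have h3 : |rho x t (circ y r θ)| ≤ δ := by
    by_contra h
    push Not at h
    apply h1
    have := hφ.zero_of_lt hδ h
    rwa [rho_circ, ← hd, ← ha, ← hb, ← hc] at this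
  have h4 := H _ h2 h3 (by rw [rho_circ_self]; exact hrs)
  have h5 : β₀ (trig 0 (b / α) (-a / α) θ / 2) = 0 := by
    rw [htr, trig_deriv_cross y]
    have h6 : 1 ≤ |2 * cross d (circ y r θ - y) / α / 2| := by
      rw [abs_div, abs_div, abs_mul, abs_two, abs_of_pos hα, le_div_iff₀ (by norm_num),
        le_div_iff₀ hα]
      linarith
    rcases h6.eq_or_lt with h | h
    · rcases abs_cases (2 * cross d (circ y r θ - y) / α / 2) with ⟨h1, -⟩ | ⟨h1, -⟩
      · rw [← h1, ← h]; exact hβ₀.zero_at_one.1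
      · rw [show 2 * cross d (circ y r θ - y) / α / 2 = -1 by linarith]; exact hβ₀.zero_at_one.2
    · exact hβ₀.2 _ h
  simp only [hg, h5]
  rw [nsq_circ_sub]; ring

theorem abs_kern_le_sqrt {φ : ℝ → ℝ} (hφ : IsCutoff φ) {C : ℝ} (hC : ∀ v, |φ v| ≤ C)
    {w : ℝ × ℝ → ℝ} (hw : Continuous w) (hw1 : ∀ z, |w z| ≤ 1) {δ : ℝ} (hδ : 0 < δ)
    (hδ' : δ ≤ 1 / 2) {x y : ℝ × ℝ} {t s : ℝ} (hs : 1 ≤ s ∧ s ≤ 2) {A : ℝ} (hA : 0 < A)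
    (hxy : A ^ 2 ≤ nsq (x - y)) :
    |kern φ w δ x t y s| ≤ 96 * C ^ 2 * δ * √(δ / A) := by
  have hC0 : 0 ≤ C := (abs_nonneg _).trans (hC 0)
  have hpi := Real.pi_pos
  refine (abs_kern_le_of_circle hφ hC hw hδ hδ' (x := x) (t := t) hs
    (A := C * (4 * Real.pi * √(δ / A))) ?_).trans ?_
  · intro r hr0 hr3 hrs
    have hr : 1 / 2 ≤ r := by rw [abs_le] at hrs; nlinarith
    set a := -2 * r * (x - y).1 with ha
    set b := -2 * r * (x - y).2 with hb
    set c := r ^ 2 + nsq (x - y) - t ^ 2 with hc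
    have hvol := volume_trig_sublevel (a := a) (b := b) (c := c) (δ := δ) hA (by
      have : a ^ 2 + b ^ 2 = 4 * r ^ 2 * nsq (x - y) := by rw [ha, hb, nsq]; ring
      rw [this]
      have h0 : 0 ≤ nsq (x - y) := (by positivity : 0 ≤ A ^ 2).trans hxy
      have h1 : 1 ≤ 4 * r ^ 2 := by nlinarith
      nlinarith) hδ.le
    set S : Set ℝ := {θ : ℝ | (-Real.pi ≤ θ ∧ θ ≤ Real.pi) ∧ |trig c a b θ| ≤ δ} with hS
    have hSm : MeasurableSet S := by
      have c1 : IsClosed {θ : ℝ | -Real.pi ≤ θ} := isClosed_le continuous_const continuous_id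
      have c2 : IsClosed {θ : ℝ | θ ≤ Real.pi} := isClosed_le continuous_id continuous_const
      have c3 : IsClosed {θ : ℝ | |trig c a b θ| ≤ δ} :=
        isClosed_le (contDiff_trig c a b).continuous.abs continuous_const
      exact ((c1.inter c2).inter c3).measurableSet
    rw [intervalIntegral.integral_of_le (by linarith), ← integral_Icc_eq_integral_Ioc,
      setIntegral_eq_of_subset_of_forall_sdiff_eq_zero (s := S) measurableSet_Icc
        (fun θ hθ => hθ.1)]
    · rw [← Real.norm_eq_abs]
      refine (norm_setIntegral_le_of_norm_le_const (C := C)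
        (hvol.trans_lt ENNReal.ofReal_lt_top) ?_).trans ?_
      · intro θ _
        rw [norm_mul, Real.norm_eq_abs, Real.norm_eq_abs]
        calc _ ≤ 1 * C := mul_le_mul (hw1 _) (hC _) (abs_nonneg _) zero_le_one
          _ = C := one_mul C
      · refine mul_le_mul_of_nonneg_left ?_ hC0
        exact ENNReal.toReal_le_of_le_ofReal (by positivity) hvol
    · rintro θ ⟨h1, h2⟩
      rw [hφ.zero_of_lt hδ, mul_zero]
      rw [rho_circ]
      by_contra h
      exact h2 ⟨h1, not_lt.1 h⟩
  · have h4 : Real.pi ≤ 4 := Real.pi_le_four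
    have h5 : 0 ≤ C ^ 2 * δ * √(δ / A) := by positivity
    calc _ = 24 * Real.pi * (C ^ 2 * δ * √(δ / A)) := by ring
      _ ≤ 24 * 4 * (C ^ 2 * δ * √(δ / A)) := by gcongr
      _ = _ := by ring

theorem abs_kern_le {φ : ℝ → ℝ} (hφ : IsCutoff φ) {C : ℝ} (hC : ∀ v, |φ v| ≤ C)
    {w : ℝ × ℝ → ℝ} (hw1 : ∀ z, |w z| ≤ 1) {δ : ℝ} (hδ : 0 < δ)
    (hδ' : δ ≤ 1 / 2) {x y : ℝ × ℝ} {t s : ℝ} (hs : 1 ≤ s ∧ s ≤ 2) :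
    |kern φ w δ x t y s| ≤ 36 * C ^ 2 * δ := by
  have hC0 : 0 ≤ C := (abs_nonneg _).trans (hC 0)
  have hvol := volume_annulus_le (x := y) hs hδ.le hδ'
  set S := {z : ℝ × ℝ | |rho y s z| ≤ δ} with hS
  have hSm : MeasurableSet S :=
    (isClosed_le (continuous_rho_right y s).abs continuous_const).measurableSet
  rw [kern, ← setIntegral_eq_integral_of_forall_compl_eq_zero (s := S)]
  · rw [← Real.norm_eq_abs]
    refine (norm_setIntegral_le_of_norm_le_const (C := C ^ 2)
      (hvol.trans_lt ENNReal.ofReal_lt_top) ?_).trans ?_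
    · intro z _
      rw [norm_mul, norm_mul, Real.norm_eq_abs, Real.norm_eq_abs, Real.norm_eq_abs]
      calc _ ≤ 1 * (C * C) := by
            gcongr
            · exact hw1 _
            · exact hC _
            · exact hC _
        _ = C ^ 2 := by ring
    · calc _ ≤ C ^ 2 * (36 * δ) := by
            gcongr
            exact ENNReal.toReal_le_of_le_ofReal (by positivity) hvol
        _ = _ := by ring
  · intro z hz
    rw [hφ.zero_of_lt (v := rho y s z) hδ, mul_zero, mul_zero]
    by_contra h
    exact hz (not_lt.1 h)

theorem continuous_kern_integrand {φ : ℝ → ℝ} (hφ : IsCutoff φ) {w : ℝ × ℝ → ℝ}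
    (hw : Continuous w) (δ : ℝ) :
    Continuous fun q : (((ℝ × ℝ) × ℝ) × ((ℝ × ℝ) × ℝ)) × (ℝ × ℝ) =>
      w q.2 * (φ (rho q.1.1.1 q.1.1.2 q.2 / δ) * φ (rho q.1.2.1 q.1.2.2 q.2 / δ)) := by
  have h := hφ.1.continuous
  refine (hw.comp continuous_snd).mul ((h.comp ?_).mul (h.comp ?_)) <;> unfold rho <;> fun_prop

theorem measurable_kern {φ : ℝ → ℝ} (hφ : IsCutoff φ) {w : ℝ × ℝ → ℝ}
    (hw : Continuous w) (δ : ℝ) :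
    Measurable fun q : ((ℝ × ℝ) × ℝ) × ((ℝ × ℝ) × ℝ) =>
      kern φ w δ q.1.1 q.1.2 q.2.1 q.2.2 := by
  have h := (continuous_kern_integrand hφ hw δ).stronglyMeasurable
  exact (StronglyMeasurable.integral_prod_right (ν := (volume : Measure (ℝ × ℝ)))
    (f := fun (q : ((ℝ × ℝ) × ℝ) × ((ℝ × ℝ) × ℝ)) z =>
      w z * (φ (rho q.1.1 q.1.2 z / δ) * φ (rho q.2.1 q.2.2 z / δ))) h).measurable

section Dual

variable {X Z : Type*} [MeasurableSpace X] [MeasurableSpace Z]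

/-- The quadratic kernel of an integral operator with weight `w`. -/
noncomputable def quadKer (ν : Measure Z) (a : X → Z → ℝ) (w : Z → ℝ) (P Q : X) : ℝ :=
  ∫ z, w z * (a P z * a Q z) ∂ν

theorem measurable_quadKer (ν : Measure Z) [SFinite ν] {a : X → Z → ℝ} {w : Z → ℝ}
    (ha : Measurable fun p : X × Z => a p.1 p.2) (hw : Measurable w) :
    Measurable fun p : X × X => quadKer ν a w p.1 p.2 := by
  have h : Measurable fun q : (X × X) × Z => w q.2 * (a q.1.1 q.2 * a q.1.2 q.2) := by
    have h1 : Measurable fun q : (X × X) × Z => a q.1.1 q.2 :=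
      ha.comp ((measurable_fst.comp measurable_fst).prodMk measurable_snd)
    have h2 : Measurable fun q : (X × X) × Z => a q.1.2 q.2 :=
      ha.comp ((measurable_snd.comp measurable_fst).prodMk measurable_snd)
    exact (hw.comp measurable_snd).mul (h1.mul h2)
  exact (StronglyMeasurable.integral_prod_right (ν := ν)
    (f := fun (q : X × X) z => w z * (a q.1 z * a q.2 z)) h.stronglyMeasurable).measurable

/-- Duality (`T T*`) bound for integral operators. -/
theorem sq_integral_le_quadKer {μ : Measure X} {ν : Measure Z} [IsFiniteMeasure μ] [SFinite ν]
    {a : X → Z → ℝ} {h : X → ℝ} {f w : Z → ℝ} {Ca Ch Cf : ℝ}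
    (ha : Measurable fun p : X × Z => a p.1 p.2) (hh : Measurable h) (hf : Integrable f ν)
    (hfm : Measurable f) (hw : Integrable w ν) (hCa : ∀ P z, |a P z| ≤ Ca)
    (hCh : ∀ P, |h P| ≤ Ch)
    (hCf : ∀ z, |f z| ≤ Cf) (hw0 : ∀ z, 0 ≤ w z) (hwf : ∀ z, f z ≠ 0 → 1 ≤ w z) :
    (∫ P, h P * ∫ z, f z * a P z ∂ν ∂μ) ^ 2 ≤
      (∫ z, f z ^ 2 ∂ν) * ∫ P, |h P| * ∫ Q, |h Q| * |quadKer ν a w P Q| ∂μ ∂μ := by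
  have hh' : Integrable h μ := Integrable.of_bound hh.aestronglyMeasurable Ch
    (Eventually.of_forall hCh)
  have hsw : Measurable fun p : Z × X => a p.2 p.1 := ha.comp measurable_swap
  set H : Z → ℝ := fun z => ∫ P, h P * a P z ∂μ with hH
  have hHm : Measurable H := by
    have : Measurable fun q : Z × X => h q.2 * a q.2 q.1 := (hh.comp measurable_snd).mul hsw
    exact (StronglyMeasurable.integral_prod_right (ν := μ)
      (f := fun (z : Z) P => h P * a P z) this.stronglyMeasurable).measurable
  have hHb : ∀ z, |H z| ≤ Ch * Ca * μ.real Set.univ := by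
    intro z
    rw [← Real.norm_eq_abs]
    refine norm_integral_le_of_norm_le_const (Eventually.of_forall fun P => ?_)
    rw [norm_mul]
    exact mul_le_mul (hCh P) (hCa P z) (norm_nonneg _) ((abs_nonneg _).trans (hCh P))
  -- first Fubini
  have e1 : ∫ P, h P * ∫ z, f z * a P z ∂ν ∂μ = ∫ z, f z * H z ∂ν := by
    have hIntg : Integrable (fun p : X × Z => (h p.1 * f p.2) * a p.1 p.2) (μ.prod ν) :=
      (hh'.mul_prod hf).mul_bdd (c := Ca) ha.aestronglyMeasurable
        (Eventually.of_forall fun p => hCa p.1 p.2)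
    have := integral_integral_swap (f := fun P z => (h P * f z) * a P z) hIntg
    have l : ∫ P, h P * ∫ z, f z * a P z ∂ν ∂μ = ∫ P, ∫ z, (h P * f z) * a P z ∂ν ∂μ := by
      congr 1; ext P; rw [← integral_const_mul]; congr 1; ext z; ring
    rw [l, this]
    congr 1; ext z; simp only [hH]; rw [← integral_const_mul]; congr 1; ext P; ring
  -- second Fubini
  have hI3 : Integrable (fun q : (X × X) × Z => ((h q.1.1 * h q.1.2) * w q.2) *
      (a q.1.1 q.2 * a q.1.2 q.2)) ((μ.prod μ).prod ν) := by
    refine ((hh'.mul_prod hh').mul_prod hw).mul_bdd (c := Ca * Ca) ?_ (Eventually.of_forall fun q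
        => ?_)
    · have h1 : Measurable fun q : (X × X) × Z => a q.1.1 q.2 :=
        ha.comp ((measurable_fst.comp measurable_fst).prodMk measurable_snd)
      have h2 : Measurable fun q : (X × X) × Z => a q.1.2 q.2 :=
        ha.comp ((measurable_snd.comp measurable_fst).prodMk measurable_snd)
      exact (h1.mul h2).aestronglyMeasurable
    · rw [norm_mul]
      exact mul_le_mul (hCa _ _) (hCa _ _) (norm_nonneg _)
        ((abs_nonneg _).trans (hCa q.1.1 q.2))
  have e2 : ∫ z, w z * H z ^ 2 ∂ν = ∫ p, (h p.1 * h p.2) * quadKer ν a w p.1 p.2 ∂(μ.prod μ) := by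
    have := integral_integral_swap (f := fun (p : X × X) z => ((h p.1 * h p.2) * w z) *
      (a p.1 z * a p.2 z)) hI3
    have l : ∀ p : X × X, (h p.1 * h p.2) * quadKer ν a w p.1 p.2 =
        ∫ z, ((h p.1 * h p.2) * w z) * (a p.1 z * a p.2 z) ∂ν := by
      intro p; rw [quadKer, ← integral_const_mul]; congr 1; ext z; ring
    simp_rw [l]
    rw [this]
    congr 1; ext z
    have : ∀ p : X × X, ((h p.1 * h p.2) * w z) * (a p.1 z * a p.2 z) =
      w z * ((h p.1 * a p.1 z) * (h p.2 * a p.2 z)) := fun p => by ring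
    simp_rw [this]
    rw [integral_const_mul, integral_prod_mul (fun P => h P * a P z) (fun P => h P * a P z), sq]
  have hJ : Integrable (fun p : X × X => (h p.1 * h p.2) * quadKer ν a w p.1 p.2) (μ.prod μ) := by
    have := hI3.integral_prod_left
    refine this.congr (Eventually.of_forall fun p => ?_)
    simp only [quadKer]; rw [← integral_const_mul]; congr 1; ext z; ring
  have e3 : ∫ p, (h p.1 * h p.2) * quadKer ν a w p.1 p.2 ∂(μ.prod μ) ≤
      ∫ P, |h P| * ∫ Q, |h Q| * |quadKer ν a w P Q| ∂μ ∂μ := by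
    refine (integral_mono hJ hJ.norm fun p => le_abs_self _).trans (le_of_eq ?_)
    rw [integral_prod _ hJ.norm]
    congr 1; ext P; rw [← integral_const_mul]; congr 1; ext Q
    simp only [norm_mul, Real.norm_eq_abs]; ring
  -- Cauchy–Schwarz
  have i1 : Integrable (fun z => f z ^ 2) ν := by
    have := hf.mul_bdd (c := Cf) hfm.aestronglyMeasurable (Eventually.of_forall hCf)
    refine this.congr (Eventually.of_forall fun z => ?_)
    ring
  have i2 : Integrable (fun z => f z * H z) ν :=
    hf.mul_bdd hHm.aestronglyMeasurable (Eventually.of_forall hHb)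
  have i3 : Integrable (fun z => w z * H z ^ 2) ν := by
    have := (hw.mul_bdd hHm.aestronglyMeasurable (Eventually.of_forall hHb)).mul_bdd
      hHm.aestronglyMeasurable (Eventually.of_forall hHb)
    refine this.congr (Eventually.of_forall fun z => ?_)
    ring
  have hq : ∀ x : ℝ, 0 ≤ (∫ z, f z ^ 2 ∂ν) * (x * x) + (-2 * ∫ z, f z * H z ∂ν) * x +
      ∫ z, w z * H z ^ 2 ∂ν := by
    intro x
    have : 0 ≤ ∫ z, ((x * x) * f z ^ 2 + (-2 * x) * (f z * H z) + w z * H z ^ 2) ∂ν := by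
      refine integral_nonneg fun z => ?_
      by_cases hz : f z = 0
      · simp only [hz]
        have := mul_nonneg (hw0 z) (sq_nonneg (H z))
        simp only [Pi.zero_apply]; nlinarith
      · have := hwf z hz
        simp only [Pi.zero_apply]
        nlinarith [sq_nonneg (x * f z - H z), sq_nonneg (H z)]
    have i12 : Integrable (fun z => (x * x) * f z ^ 2 + (-2 * x) * (f z * H z)) ν :=
      (i1.const_mul _).add (i2.const_mul _)
    rw [integral_add i12 i3, integral_add (i1.const_mul _) (i2.const_mul _),
      integral_const_mul, integral_const_mul] at this
    linarith
  have hd := discrim_le_zero hq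
  rw [discrim] at hd
  rw [e1]
  have hf2 : 0 ≤ ∫ z, f z ^ 2 ∂ν := integral_nonneg fun z => sq_nonneg _
  calc _ ≤ (∫ z, f z ^ 2 ∂ν) * ∫ z, w z * H z ^ 2 ∂ν := by nlinarith
    _ ≤ _ := by
      rw [e2]
      exact mul_le_mul_of_nonneg_left e3 hf2

/-- The Schur test for the quadratic kernel bounds the operator in `L²`. -/
theorem integral_sq_le_of_schur {μ : Measure X} {ν : Measure Z} [IsFiniteMeasure μ] [SFinite ν]
    {a : X → Z → ℝ} {f w : Z → ℝ} {Ca Cf A : ℝ}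
    (ha : Measurable fun p : X × Z => a p.1 p.2) (hf : Integrable f ν)
    (hfm : Measurable f) (hw : Integrable w ν) (hwm : Measurable w) (hCa : ∀ P z, |a P z| ≤ Ca)
    (hCf : ∀ z, |f z| ≤ Cf) (hw0 : ∀ z, 0 ≤ w z) (hwf : ∀ z, f z ≠ 0 → 1 ≤ w z) (hA0 : 0 ≤ A)
    (hA : ∀ᵐ P ∂μ, ∫ Q, |quadKer ν a w P Q| ∂μ ≤ A) :
    ∫ P, (∫ z, f z * a P z ∂ν) ^ 2 ∂μ ≤ A * ∫ z, f z ^ 2 ∂ν := by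
  set F : X → ℝ := fun P => ∫ z, f z * a P z ∂ν with hF
  have hFm : Measurable F := by
    have : Measurable fun q : X × Z => f q.2 * a q.1 q.2 := (hfm.comp measurable_snd).mul ha
    exact (StronglyMeasurable.integral_prod_right (ν := ν)
      (f := fun (P : X) z => f z * a P z) this.stronglyMeasurable).measurable
  have hFb : ∀ P, |F P| ≤ ∫ z, |f z| * Ca ∂ν := by
    intro P
    rw [← Real.norm_eq_abs]
    refine norm_integral_le_of_norm_le (hf.abs.mul_const Ca) (Eventually.of_forall fun z => ?_)
    rw [norm_mul]
    exact mul_le_mul_of_nonneg_left (hCa P z) (norm_nonneg _)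
  set CF := ∫ z, |f z| * Ca ∂ν
  have hkb : ∀ P Q, |quadKer ν a w P Q| ≤ ∫ z, w z * (Ca * Ca) ∂ν := by
    intro P Q
    rw [← Real.norm_eq_abs, quadKer]
    refine norm_integral_le_of_norm_le (hw.mul_const _) (Eventually.of_forall fun z => ?_)
    rw [norm_mul, norm_mul, Real.norm_eq_abs, Real.norm_eq_abs, Real.norm_eq_abs,
      abs_of_nonneg (hw0 z)]
    refine mul_le_mul_of_nonneg_left ?_ (hw0 z)
    exact mul_le_mul (hCa _ _) (hCa _ _) (abs_nonneg _) ((abs_nonneg _).trans (hCa P z))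
  have main := sq_integral_le_quadKer (μ := μ) (ν := ν) ha hFm hf hfm hw hCa hFb hCf hw0 hwf
  have hkm := (measurable_quadKer ν ha hwm).abs
  -- Schur
  have hkint : Integrable (fun p : X × X => |quadKer ν a w p.1 p.2|) (μ.prod μ) :=
    Integrable.of_bound hkm.aestronglyMeasurable _ (Eventually.of_forall fun p => by
      rw [Real.norm_eq_abs, abs_abs]; exact hkb p.1 p.2)
  have hJ : Integrable (fun p : X × X => |F p.1| * (|F p.2| * |quadKer ν a w p.1 p.2|))
      (μ.prod μ) := by
    refine Integrable.of_bound (C := CF * (CF * ∫ z, w z * (Ca * Ca) ∂ν)) ?_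
      (Eventually.of_forall fun p => ?_)
    · exact ((hFm.comp measurable_fst).abs.mul ((hFm.comp measurable_snd).abs.mul
        hkm)).aestronglyMeasurable
    · simp only [norm_mul, Real.norm_eq_abs, abs_abs]
      have h1 := hFb p.1
      have h2 := hFb p.2
      have h3 := hkb p.1 p.2
      have h4 : 0 ≤ CF := (abs_nonneg _).trans h1
      gcongr
  have hJ2 : Integrable (fun p : X × X => F p.1 ^ 2 * |quadKer ν a w p.1 p.2|) (μ.prod μ) := by
    refine hkint.bdd_mul (c := CF ^ 2) ((hFm.comp measurable_fst).pow_const 2).aestronglyMeasurable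
      (Eventually.of_forall fun p => ?_)
    rw [norm_pow, Real.norm_eq_abs]
    exact pow_le_pow_left₀ (abs_nonneg _) (hFb p.1) 2
  have hsymm : ∀ P Q, quadKer ν a w P Q = quadKer ν a w Q P := by
    intro P Q; unfold quadKer; congr 1; ext z; ring
  have hJ3 : Integrable (fun p : X × X => F p.2 ^ 2 * |quadKer ν a w p.1 p.2|) (μ.prod μ) := by
    have := hJ2.swap
    refine this.congr (Eventually.of_forall fun p => ?_)
    simp only [Function.comp, Prod.fst_swap, Prod.snd_swap]
    rw [hsymm]
  have eqs : ∫ p, F p.2 ^ 2 * |quadKer ν a w p.1 p.2| ∂(μ.prod μ) =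
      ∫ p, F p.1 ^ 2 * |quadKer ν a w p.1 p.2| ∂(μ.prod μ) := by
    rw [← integral_prod_swap]
    congr 1; ext p; simp only [Prod.fst_swap, Prod.snd_swap]; rw [hsymm]
  have hS : ∫ P, |F P| * ∫ Q, |F Q| * |quadKer ν a w P Q| ∂μ ∂μ ≤ A * ∫ P, F P ^ 2 ∂μ := by
    calc ∫ P, |F P| * ∫ Q, |F Q| * |quadKer ν a w P Q| ∂μ ∂μ
        = ∫ p, |F p.1| * (|F p.2| * |quadKer ν a w p.1 p.2|) ∂(μ.prod μ) := by
          rw [integral_prod _ hJ]; congr 1; ext P; rw [← integral_const_mul]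
      _ ≤ ∫ p, (1 / 2 * (F p.1 ^ 2 * |quadKer ν a w p.1 p.2|) +
            1 / 2 * (F p.2 ^ 2 * |quadKer ν a w p.1 p.2|)) ∂(μ.prod μ) := by
          refine integral_mono hJ ((hJ2.const_mul _).add (hJ3.const_mul _)) fun p => ?_
          have h1 : |F p.1| * |F p.2| ≤ 1 / 2 * F p.1 ^ 2 + 1 / 2 * F p.2 ^ 2 := by
            rw [← sq_abs (F p.1), ← sq_abs (F p.2)]
            nlinarith [sq_nonneg (|F p.1| - |F p.2|)]
          nlinarith [abs_nonneg (quadKer ν a w p.1 p.2)]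
      _ = ∫ p, F p.1 ^ 2 * |quadKer ν a w p.1 p.2| ∂(μ.prod μ) := by
          rw [integral_add (hJ2.const_mul _) (hJ3.const_mul _), integral_const_mul,
            integral_const_mul, eqs]; ring
      _ = ∫ P, F P ^ 2 * ∫ Q, |quadKer ν a w P Q| ∂μ ∂μ := by
          rw [integral_prod _ hJ2]; congr 1; ext P; rw [← integral_const_mul]
      _ ≤ ∫ P, F P ^ 2 * A ∂μ := by
          refine integral_mono_ae ?_ ?_ ?_
          · have := hJ2.integral_prod_left
            refine this.congr (Eventually.of_forall fun P => ?_)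
            exact integral_const_mul (F P ^ 2) _
          · refine Integrable.mul_const ?_ A
            refine Integrable.of_bound (hFm.pow_const 2).aestronglyMeasurable (CF ^ 2)
              (Eventually.of_forall fun p => ?_)
            rw [norm_pow, Real.norm_eq_abs]
            exact pow_le_pow_left₀ (abs_nonneg _) (hFb p) 2
          · filter_upwards [hA] with P hP
            exact mul_le_mul_of_nonneg_left hP (sq_nonneg _)
      _ = A * ∫ P, F P ^ 2 ∂μ := by rw [integral_mul_const]; ring
  have e : ∫ P, F P * ∫ z, f z * a P z ∂ν ∂μ = ∫ P, F P ^ 2 ∂μ := by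
    congr 1; ext P; simp only [hF]; ring
  rw [e] at main
  have hf2 : 0 ≤ ∫ z, f z ^ 2 ∂ν := integral_nonneg fun z => sq_nonneg _
  have hF2 : 0 ≤ ∫ P, F P ^ 2 ∂μ := integral_nonneg fun z => sq_nonneg _
  change ∫ P, F P ^ 2 ∂μ ≤ _
  rcases hF2.eq_or_lt with h0 | h0
  · rw [← h0]; positivity
  · have : (∫ P, F P ^ 2 ∂μ) ^ 2 ≤ (A * ∫ z, f z ^ 2 ∂ν) * ∫ P, F P ^ 2 ∂μ := by
      refine main.trans ?_
      calc _ ≤ (∫ z, f z ^ 2 ∂ν) * (A * ∫ P, F P ^ 2 ∂μ) := mul_le_mul_of_nonneg_left hS hf2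
        _ = _ := by ring
    rw [sq] at this
    exact le_of_mul_le_mul_right this h0

end Dual

/-- Bounded measurable functions supported in the ball of radius three. -/
structure LocData (f : ℝ × ℝ → ℝ) : Prop where
  meas : Measurable f
  bdd : ∃ C, ∀ z, |f z| ≤ C
  supp : ∀ z, 3 < ‖z‖ → f z = 0

theorem LocData.integrable {f : ℝ × ℝ → ℝ} (hf : LocData f) : Integrable f := by
  obtain ⟨C, hC⟩ := hf.bdd
  have h : IntegrableOn f (closedBall 0 3) := by
    refine Measure.integrableOn_of_bounded (M := C) ?_ hf.meas.aestronglyMeasurable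
      (Eventually.of_forall hC)
    exact (isCompact_closedBall _ _).measure_lt_top.ne
  refine (integrableOn_iff_integrable_of_support_subset ?_).1 h
  intro z hz
  rw [mem_closedBall_zero_iff]
  by_contra h3
  exact hz (hf.supp z (not_le.1 h3))

theorem LocData.of_abs_le {f g : ℝ × ℝ → ℝ} (hf : LocData f) (hg : Measurable g)
    (h : ∀ z, |g z| ≤ |f z|) : LocData g := by
  obtain ⟨C, hC⟩ := hf.bdd
  refine ⟨hg, ⟨C, fun z => (h z).trans (hC z)⟩, fun z hz => ?_⟩
  have := h z
  rw [hf.supp z hz, abs_zero] at this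
  exact abs_nonpos_iff.1 this

theorem LocData.sq {f : ℝ × ℝ → ℝ} (hf : LocData f) : LocData fun z => f z ^ 2 := by
  obtain ⟨C, hC⟩ := hf.bdd
  refine ⟨hf.meas.pow_const 2, ⟨C ^ 2, fun z => ?_⟩, fun z hz => ?_⟩
  · rw [abs_pow]; exact pow_le_pow_left₀ (abs_nonneg _) (hC z) 2
  · rw [hf.supp z hz]; norm_num

/-- The thickened circular mean. -/
noncomputable def thick (φ : ℝ → ℝ) (δ : ℝ) (f : ℝ × ℝ → ℝ) (x : ℝ × ℝ) (t : ℝ) : ℝ :=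
  δ⁻¹ * ∫ z, f z * φ (rho x t z / δ)

theorem continuous_annulus_fun {φ : ℝ → ℝ} (hφ : IsCutoff φ) (δ : ℝ) :
    Continuous fun q : ((ℝ × ℝ) × ℝ) × (ℝ × ℝ) => φ (rho q.1.1 q.1.2 q.2 / δ) :=
  hφ.1.continuous.comp (continuous_rho.div_const δ)

theorem measurable_annulus_fun {φ : ℝ → ℝ} (hφ : IsCutoff φ) (δ : ℝ) (x : ℝ × ℝ) (s : ℝ) :
    Measurable fun z => φ (rho x s z / δ) :=
  (hφ.1.continuous.comp ((continuous_rho_right x s).div_const δ)).measurable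

theorem continuous_thick {φ : ℝ → ℝ} (hφ : IsCutoff φ) (δ : ℝ) {f : ℝ × ℝ → ℝ} (hf : LocData f) :
    Continuous fun P : (ℝ × ℝ) × ℝ => thick φ δ f P.1 P.2 := by
  obtain ⟨C, _, hC⟩ := hφ.bounded
  refine continuous_const.mul (continuous_of_dominated (bound := fun z => |f z| * C) ?_ ?_ ?_ ?_)
  · intro P
    exact (hf.meas.mul ((continuous_annulus_fun hφ δ).measurable.comp
      measurable_prodMk_left)).aestronglyMeasurable
  · intro P
    refine Eventually.of_forall fun z => ?_
    rw [norm_mul]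
    exact mul_le_mul_of_nonneg_left (hC _) (norm_nonneg _)
  · exact hf.integrable.abs.mul_const C
  · refine Eventually.of_forall fun z => continuous_const.mul ?_
    exact (continuous_annulus_fun hφ δ).comp (continuous_id.prodMk continuous_const)

theorem hasDerivAt_thick {φ : ℝ → ℝ} (hφ : IsCutoff φ) {δ : ℝ} (hδ : 0 < δ) {f : ℝ × ℝ → ℝ}
    (hf : LocData f) (x : ℝ × ℝ) (t : ℝ) :
    HasDerivAt (thick φ δ f x) (-(2 * t) / δ * thick (deriv φ) δ f x t) t := by
  obtain ⟨C, hC0, hC⟩ := hφ.bounded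
  obtain ⟨C', hC'0, hC'⟩ := hφ.deriv.bounded
  have key := hasDerivAt_integral_of_dominated_loc_of_deriv_le (μ := (volume : Measure (ℝ × ℝ)))
    (F := fun s z => f z * φ (rho x s z / δ))
    (F' := fun s z => f z * (deriv φ (rho x s z / δ) * (-(2 * s) / δ)))
    (x₀ := t) (s := ball t 1) (bound := fun z => |f z| * (C' * (2 * (|t| + 1) / δ)))
    (ball_mem_nhds t one_pos) ?_ ?_ ?_ ?_ ?_ ?_
  · have h2 := key.2.const_mul δ⁻¹
    have e : δ⁻¹ * ∫ z, f z * (deriv φ (rho x t z / δ) * (-(2 * t) / δ)) =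
        -(2 * t) / δ * thick (deriv φ) δ f x t := by
      unfold thick
      have : ∀ z, f z * (deriv φ (rho x t z / δ) * (-(2 * t) / δ)) =
        (-(2 * t) / δ) * (f z * deriv φ (rho x t z / δ)) := fun z => by ring
      simp_rw [this]
      rw [integral_const_mul]; ring
    rw [e] at h2
    exact h2
  · exact Eventually.of_forall fun s => (hf.meas.mul (measurable_annulus_fun hφ δ x
        s)).aestronglyMeasurable
  · refine hf.integrable.mul_bdd (c := C) (measurable_annulus_fun hφ δ x t).aestronglyMeasurable
      (Eventually.of_forall fun z => hC _)
  · exact (hf.meas.mul ((measurable_annulus_fun hφ.deriv δ x t).mul_const _)).aestronglyMeasurable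
  · refine Eventually.of_forall fun z s hs => ?_
    rw [norm_mul, norm_mul, Real.norm_eq_abs, Real.norm_eq_abs, Real.norm_eq_abs]
    refine mul_le_mul_of_nonneg_left (mul_le_mul (hC' _) ?_ (abs_nonneg _) hC'0.le) (abs_nonneg _)
    rw [abs_div, abs_neg, abs_mul, abs_two, abs_of_pos hδ]
    have : |s| ≤ |t| + 1 := by
      rw [mem_ball, Real.dist_eq] at hs
      have := abs_sub_abs_le_abs_sub s t
      linarith
    gcongr
  · exact hf.integrable.abs.mul_const _
  · refine Eventually.of_forall fun z s hs => ?_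
    have h1 : HasDerivAt (fun s => rho x s z / δ) (-(2 * s) / δ) s := by
      have := ((hasDerivAt_pow 2 s).const_sub ((z.1 - x.1) ^ 2 + (z.2 - x.2) ^ 2)).div_const δ
      exact this.congr_deriv (by norm_num)
    have h2 : HasDerivAt φ (deriv φ (rho x s z / δ)) (rho x s z / δ) :=
      (hφ.1.differentiable (by simp) _).hasDerivAt
    exact (h2.comp s h1).const_mul (f z)

theorem abs_thick_le {φ : ℝ → ℝ} (hφ : IsCutoff φ) {C : ℝ} (hC : ∀ v, |φ v| ≤ C)
    {δ : ℝ} (hδ : 0 < δ) (hδ' : δ ≤ 1 / 2) {f : ℝ × ℝ → ℝ} {b : ℝ} (hb : ∀ z, |f z| ≤ b)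
    {x : ℝ × ℝ} {t : ℝ} (ht : 1 ≤ t ∧ t ≤ 2) : |thick φ δ f x t| ≤ 36 * C * b := by
  have hC0 : 0 ≤ C := (abs_nonneg _).trans (hC 0)
  have hb0 : 0 ≤ b := (abs_nonneg _).trans (hb 0)
  have hvol := volume_annulus_le (x := x) ht hδ.le hδ'
  set S := {z : ℝ × ℝ | |rho x t z| ≤ δ} with hS
  have h1 : |∫ z, f z * φ (rho x t z / δ)| ≤ (b * C) * (36 * δ) := by
    rw [← setIntegral_eq_integral_of_forall_compl_eq_zero (s := S)]
    · rw [← Real.norm_eq_abs]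
      refine (norm_setIntegral_le_of_norm_le_const (C := b * C)
        (hvol.trans_lt ENNReal.ofReal_lt_top) ?_).trans ?_
      · intro z _
        rw [norm_mul, Real.norm_eq_abs, Real.norm_eq_abs]
        exact mul_le_mul (hb z) (hC _) (abs_nonneg _) hb0
      · gcongr
        exact ENNReal.toReal_le_of_le_ofReal (by positivity) hvol
    · intro z hz
      rw [hφ.zero_of_lt (v := rho x t z) hδ, mul_zero]
      by_contra h
      exact hz (not_lt.1 h)
  rw [thick, abs_mul, abs_inv, abs_of_pos hδ]
  calc _ ≤ δ⁻¹ * ((b * C) * (36 * δ)) := by gcongr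
    _ = _ := by field_simp

theorem abs_thick_sub_le {φ : ℝ → ℝ} (hφ : IsCutoff φ) {C : ℝ} (hC : ∀ v, |deriv φ v| ≤ C)
    {δ : ℝ} (hδ : 0 < δ) (hδ' : δ ≤ 1 / 2) {f : ℝ × ℝ → ℝ} (hf : LocData f) {b : ℝ}
    (hb : ∀ z, |f z| ≤ b) {x : ℝ × ℝ} {t s : ℝ} (ht : t ∈ Set.Icc (1 : ℝ) 2)
    (hs : s ∈ Set.Icc (1 : ℝ) 2) :
    |thick φ δ f x t - thick φ δ f x s| ≤ 144 * C * b / δ * |t - s| := by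
  have := Convex.norm_image_sub_le_of_norm_hasDerivWithin_le (𝕜 := ℝ) (f := thick φ δ f x)
    (f' := fun t => -(2 * t) / δ * thick (deriv φ) δ f x t) (C := 144 * C * b / δ)
    (s := Set.Icc (1 : ℝ) 2) (fun r _ => (hasDerivAt_thick hφ hδ hf x r).hasDerivWithinAt) ?_
    (convex_Icc _ _) hs ht
  · exact this
  · intro r hr
    have h1 := abs_thick_le hφ.deriv hC hδ hδ' hb (x := x) hr
    rw [norm_mul, Real.norm_eq_abs, Real.norm_eq_abs, abs_div, abs_neg, abs_mul, abs_two,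
      abs_of_pos hδ, abs_of_nonneg (zero_le_one.trans hr.1)]
    have hr2 := hr.2
    have := (abs_nonneg _).trans h1
    calc 2 * r / δ * |thick (deriv φ) δ f x r| ≤ 2 * 2 / δ * (36 * C * b) := by gcongr
      _ = _ := by ring

theorem abs_fst_add_abs_snd_sq_le (v : ℝ × ℝ) : (|v.1| + |v.2|) ^ 2 ≤ 2 * nsq v := by
  unfold nsq
  nlinarith [sq_nonneg (|v.1| - |v.2|), sq_abs v.1, sq_abs v.2]

theorem norm_sq_le_nsq (v : ℝ × ℝ) : ‖v‖ ^ 2 ≤ nsq v := by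
  unfold nsq
  rw [Prod.norm_def]
  rcases max_choice ‖v.1‖ ‖v.2‖ with h | h <;> rw [h, Real.norm_eq_abs, sq_abs] <;>
    nlinarith [sq_nonneg v.1, sq_nonneg v.2]

theorem nsq_le_norm_sq (v : ℝ × ℝ) : nsq v ≤ 2 * ‖v‖ ^ 2 := by
  unfold nsq
  have h1 := norm_fst_le v
  have h2 := norm_snd_le v
  rw [Real.norm_eq_abs] at h1 h2
  have h3 := sq_le_sq' (by linarith [abs_nonneg v.1]) h1
  have h4 := sq_le_sq' (by linarith [abs_nonneg v.2]) h2
  rw [sq_abs] at h3 h4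
  linarith

/-- Two circles of the same radius are transverse. -/
theorem cross_ge_of_same_radius {x y z : ℝ × ℝ} {t δ R : ℝ} (ht : 1 ≤ t) (hR : 0 < R)
    (hd : nsq (x - y) = R ^ 2) (hR2 : R ≤ 2 / 5) (hδ : 4 * δ ≤ R)
    (h1 : |rho x t z| ≤ δ) (h2 : |rho y t z| ≤ δ) : R / 2 ≤ |cross (x - y) (z - y)| := by
  set u := z - y with hu
  set d := x - y with hd'
  have e1 : rho y t z = nsq u - t ^ 2 := by simp [rho, nsq, hu]
  have e2 : rho x t z = nsq u - 2 * (d.1 * u.1 + d.2 * u.2) + nsq d - t ^ 2 := by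
    simp only [rho, nsq, hu, hd', Prod.fst_sub, Prod.snd_sub]; ring
  rw [e1] at h2
  rw [e2, hd] at h1
  rw [abs_le] at h1 h2
  set X := d.1 * u.1 + d.2 * u.2 with hX
  have hc : cross d u ^ 2 + X ^ 2 = R ^ 2 * nsq u := by
    rw [← hd]; simp only [cross, nsq, hX]; ring
  have hX1 : |X| ≤ R * (9 / 20) := by
    rw [abs_le]; constructor <;> nlinarith
  have hX2 : X ^ 2 ≤ (R * (9 / 20)) ^ 2 := by
    rw [← sq_abs X]; exact pow_le_pow_left₀ (abs_nonneg _) hX1 2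
  have hu1 : 9 / 10 ≤ nsq u := by nlinarith
  refine abs_le_of_sq_le_sq' ?_ (abs_nonneg _) |>.2
  rw [sq_abs]
  nlinarith [mul_le_mul_of_nonneg_left hu1 (sq_nonneg R)]

/-- The localizing weight attached to a plateau function. -/
noncomputable def wgt (β : ℝ → ℝ) (z₀ : ℝ × ℝ) (κ : ℝ) (z : ℝ × ℝ) : ℝ :=
  β (nsq (z - z₀) / κ ^ 2)

theorem continuous_wgt {β : ℝ → ℝ} (hβ : IsCutoff β) (z₀ : ℝ × ℝ) (κ : ℝ) :
    Continuous (wgt β z₀ κ) := by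
  refine hβ.1.continuous.comp ?_
  unfold nsq; fun_prop

theorem wgt_eq_zero {β : ℝ → ℝ} (hβ : IsCutoff β) {z₀ z : ℝ × ℝ} {κ : ℝ} (hκ : 0 < κ)
    (h : κ ^ 2 < nsq (z - z₀)) : wgt β z₀ κ z = 0 := by
  refine hβ.2 _ ?_
  rw [lt_abs]; left
  rw [lt_div_iff₀ (by positivity)]; linarith

theorem integrable_wgt {β : ℝ → ℝ} (hβ : IsCutoff β) (z₀ : ℝ × ℝ) {κ : ℝ} (hκ : 0 < κ) :
    Integrable (wgt β z₀ κ) := by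
  refine (continuous_wgt hβ z₀ κ).integrable_of_hasCompactSupport ?_
  refine HasCompactSupport.intro (isCompact_closedBall z₀ κ) fun z hz => wgt_eq_zero hβ hκ ?_
  rw [mem_closedBall, not_le, dist_eq_norm] at hz
  exact (pow_lt_pow_left₀ hz hκ.le (by norm_num)).trans_le (norm_sq_le_nsq _)

theorem wgt_eq_one {β : ℝ → ℝ} (hβ1 : ∀ v, |v| ≤ 1 / 2 → β v = 1) {z₀ z : ℝ × ℝ} {κ : ℝ}
    (hκ : 0 < κ) (h : 2 * nsq (z - z₀) ≤ κ ^ 2) : wgt β z₀ κ z = 1 := by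
  refine hβ1 _ ?_
  have : 0 ≤ nsq (z - z₀) := by unfold nsq; positivity
  rw [abs_of_nonneg (by positivity), div_le_iff₀ (by positivity)]; linarith

theorem abs_wgt_le {β : ℝ → ℝ} (hβ01 : ∀ v, 0 ≤ β v ∧ β v ≤ 1) (z₀ : ℝ × ℝ) (κ : ℝ) (z : ℝ × ℝ) :
    |wgt β z₀ κ z| ≤ 1 := by
  rw [wgt, abs_of_nonneg (hβ01 _).1]; exact (hβ01 _).2

theorem exists_kern_same_radius {η β : ℝ → ℝ} (hη : IsCutoff η) (hβ : IsCutoff β)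
    (hβ01 : ∀ v, 0 ≤ β v ∧ β v ≤ 1) {m : ℕ} (hm : 3 ≤ m) :
    ∃ C, 0 < C ∧ ∀ (δ : ℝ) (x y : ℝ × ℝ) (t : ℝ), 0 < δ → δ ≤ 1 / 2 →
      x ∈ closedBall (0 : ℝ × ℝ) (1 / 8) → y ∈ closedBall (0 : ℝ × ℝ) (1 / 8) → 1 ≤ t ∧ t ≤ 2 →
      |kern (iteratedDeriv m η) (wgt β 0 6) δ x t y t| ≤
        C * δ * (1 + ‖δ⁻¹ • (x - y)‖) ^ (-3 : ℝ) := by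
  obtain ⟨C₁, hC₁, h₁⟩ := exists_kern_transverse hη hβ m
  obtain ⟨C₂, hC₂, h₂⟩ := (hη.iteratedDeriv m).bounded
  refine ⟨49 ^ 3 * (C₁ + 36 * C₂ ^ 2), by positivity, fun δ x y t hδ hδ' hx hy ht => ?_⟩
  have hw1 := abs_wgt_le hβ01 0 6
  rw [norm_smul, norm_inv, Real.norm_of_nonneg hδ.le]
  set r := δ⁻¹ * ‖x - y‖ with hr
  have hr0 : 0 ≤ r := by positivity
  have e : (1 + r) ^ (-3 : ℝ) = ((1 + r) ^ 3)⁻¹ := by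
    rw [Real.rpow_neg (by positivity)]; norm_cast
  rw [e]
  rcases le_or_gt r 48 with hr48 | hr48
  · have h3 : 1 ≤ 49 ^ 3 * ((1 + r) ^ 3)⁻¹ := by
      rw [← div_eq_mul_inv, one_le_div (by positivity)]
      exact pow_le_pow_left₀ (by positivity) (by linarith) 3
    calc _ ≤ 36 * C₂ ^ 2 * δ := abs_kern_le (hη.iteratedDeriv m) h₂ hw1 hδ hδ' ht
      _ ≤ (C₁ + 36 * C₂ ^ 2) * δ := by gcongr; linarith
      _ ≤ (C₁ + 36 * C₂ ^ 2) * δ * (49 ^ 3 * ((1 + r) ^ 3)⁻¹) := le_mul_of_one_le_right (by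
          positivity) h3
      _ = _ := by ring
  · have hn : 48 * δ < ‖x - y‖ := by
      rw [hr, inv_mul_eq_div, lt_div_iff₀ hδ] at hr48; exact hr48
    rw [mem_closedBall_zero_iff] at hx hy
    have hn2 : ‖x - y‖ ≤ 1 / 4 := (norm_sub_le _ _).trans (by linarith)
    set R := √(nsq (x - y)) with hR
    have hnn : 0 ≤ nsq (x - y) := by unfold nsq; positivity
    have hR2 : R ^ 2 = nsq (x - y) := Real.sq_sqrt hnn
    have hnR : ‖x - y‖ ≤ R := Real.le_sqrt_of_sq_le (norm_sq_le_nsq _)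
    have hR0 : 0 < R := by linarith
    have hRle : R ≤ 2 / 5 := by
      refine abs_le_of_sq_le_sq' ?_ (by norm_num) |>.2
      have := nsq_le_norm_sq (x - y)
      nlinarith [norm_nonneg (x - y)]
    have hl1 : |(x - y).1| + |(x - y).2| ≤ 2 * R := by
      refine abs_le_of_sq_le_sq' ?_ (by positivity) |>.2
      have := abs_fst_add_abs_snd_sq_le (x - y)
      nlinarith
    have hy1 := norm_fst_le y
    have hy2 := norm_snd_le y
    rw [Real.norm_eq_abs] at hy1 hy2
    have := h₁ δ (R / 2) 6 24 0 x y t t hδ hδ' (by positivity) (by norm_num) (by norm_num) ht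
      (by nlinarith) (by rw [sub_zero]; nlinarith)
      (fun z _ hz1 hz2 => cross_ge_of_same_radius ht.1 hR0 hR2.symm hRle (by linarith) hz1 hz2)
    refine this.trans ?_
    have hrR : r ≤ R / δ := by
      rw [hr, inv_mul_eq_div]; gcongr
    have hb : δ * 24 / (R / 2) ≤ 48 / r := by
      rw [div_le_div_iff₀ (by positivity) (by linarith)]
      rw [le_div_iff₀ hδ] at hrR
      nlinarith
    have hb1 : (δ * 24 / (R / 2)) ≤ 1 := hb.trans (by rw [div_le_one (by linarith)]; linarith)
    have hb2 : δ * 24 / (R / 2) ≤ 49 / (1 + r) := by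
      refine hb.trans ?_
      rw [div_le_div_iff₀ (by linarith) (by linarith)]; linarith
    calc C₁ * δ * (δ * 24 / (R / 2)) ^ m ≤ C₁ * δ * (δ * 24 / (R / 2)) ^ 3 := by
          refine mul_le_mul_of_nonneg_left ?_ (by positivity)
          exact pow_le_pow_of_le_one (by positivity) hb1 hm
      _ ≤ C₁ * δ * (49 / (1 + r)) ^ 3 := by gcongr
      _ = 49 ^ 3 * C₁ * δ * ((1 + r) ^ 3)⁻¹ := by rw [div_pow]; ring
      _ ≤ _ := by gcongr; nlinarith [sq_nonneg C₂]

theorem integral_decay_eq {δ : ℝ} (hδ : 0 < δ) (x : ℝ × ℝ) :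
    ∫ y : ℝ × ℝ, (1 + ‖δ⁻¹ • (x - y)‖) ^ (-3 : ℝ) =
      δ ^ 2 * ∫ v : ℝ × ℝ, (1 + ‖v‖) ^ (-3 : ℝ) := by
  rw [integral_sub_left_eq_self (fun v : ℝ × ℝ => (1 + ‖δ⁻¹ • v‖) ^ (-3 : ℝ)) volume x,
    Measure.integral_comp_smul volume (fun v : ℝ × ℝ => (1 + ‖v‖) ^ (-3 : ℝ)) δ⁻¹]
  have : Module.finrank ℝ (ℝ × ℝ) = 2 := by simp
  rw [this, smul_eq_mul, abs_of_nonneg (by positivity), inv_pow, inv_inv]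

theorem integrable_decay : Integrable fun v : ℝ × ℝ => (1 + ‖v‖) ^ (-3 : ℝ) := by
  refine integrable_one_add_norm ?_
  have : Module.finrank ℝ (ℝ × ℝ) = 2 := by simp
  rw [this]; norm_num

theorem integrable_decay_comp {δ : ℝ} (hδ : 0 < δ) (x : ℝ × ℝ) :
    Integrable fun y : ℝ × ℝ => (1 + ‖δ⁻¹ • (x - y)‖) ^ (-3 : ℝ) := by
  have h := (integrable_comp_smul_iff volume (fun v : ℝ × ℝ => (1 + ‖v‖) ^ (-3 : ℝ))
    (inv_ne_zero hδ.ne')).2 integrable_decay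
  exact h.comp_sub_left x

theorem exists_thick_sq_fixed {η : ℝ → ℝ} (hη : IsCutoff η) {m : ℕ} (hm : 3 ≤ m) :
    ∃ C, 0 < C ∧ ∀ (δ : ℝ) (f : ℝ × ℝ → ℝ) (t : ℝ), 0 < δ → δ ≤ 1 / 2 → LocData f →
      1 ≤ t ∧ t ≤ 2 → ∫ x in closedBall (0 : ℝ × ℝ) (1 / 8),
        thick (iteratedDeriv m η) δ f x t ^ 2 ≤ C * δ * ∫ z, f z ^ 2 := by
  obtain ⟨β, hβ, hβ1, hβ01⟩ := exists_plateau
  obtain ⟨C, hC, h⟩ := exists_kern_same_radius hη hβ hβ01 hm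
  obtain ⟨C₂, hC₂, h₂⟩ := (hη.iteratedDeriv m).bounded
  set I := ∫ v : ℝ × ℝ, (1 + ‖v‖) ^ (-3 : ℝ) with hI
  have hI0 : 0 ≤ I := integral_nonneg fun v => by positivity
  refine ⟨C * I + 1, by positivity, fun δ f t hδ hδ' hf ht => ?_⟩
  set φ := iteratedDeriv m η with hφ
  set B := closedBall (0 : ℝ × ℝ) (1 / 8) with hB
  have : IsFiniteMeasure ((volume : Measure (ℝ × ℝ)).restrict B) :=
    ⟨by rw [Measure.restrict_apply_univ]; exact (isCompact_closedBall _ _).measure_lt_top⟩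
  obtain ⟨Cf, hCf⟩ := hf.bdd
  have ha : Measurable fun p : (ℝ × ℝ) × (ℝ × ℝ) => φ (rho p.1 t p.2 / δ) := by
    refine ((hη.iteratedDeriv m).1.continuous.comp ?_).measurable
    unfold rho; fun_prop
  have hS := integral_sq_le_of_schur (μ := (volume : Measure (ℝ × ℝ)).restrict B)
    (ν := (volume : Measure (ℝ × ℝ))) (a := fun x z => φ (rho x t z / δ)) (f := f)
    (w := wgt β 0 6) (Ca := C₂) (Cf := Cf) (A := C * I * δ ^ 3) ha hf.integrable hf.meas
    (integrable_wgt hβ 0 (by norm_num)) (continuous_wgt hβ 0 6).measurable (fun x z => h₂ _) hCf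
    (fun z => (hβ01 _).1) ?_ (by positivity) ?_
  · have e : ∀ x, thick φ δ f x t ^ 2 = (δ ^ 2)⁻¹ * (∫ z, f z * φ (rho x t z / δ)) ^ 2 := by
      intro x; rw [thick, mul_pow, inv_pow]
    simp_rw [e]
    rw [integral_const_mul]
    have h0 : 0 ≤ ∫ z, f z ^ 2 := integral_nonneg fun z => sq_nonneg _
    calc _ ≤ (δ ^ 2)⁻¹ * (C * I * δ ^ 3 * ∫ z, f z ^ 2) := by gcongr
      _ = C * I * δ * ∫ z, f z ^ 2 := by field_simp
      _ ≤ _ := by gcongr; linarith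
  · intro z hz
    refine (wgt_eq_one hβ1 (by norm_num) ?_).ge
    have : ‖z‖ ≤ 3 := by
      by_contra h3
      exact hz (hf.supp z (not_le.1 h3))
    rw [sub_zero]
    have := nsq_le_norm_sq z
    nlinarith [norm_nonneg z]
  · refine (ae_restrict_iff' measurableSet_closedBall).2 (Eventually.of_forall fun x hx => ?_)
    calc ∫ y in B, |quadKer volume (fun x z => φ (rho x t z / δ)) (wgt β 0 6) x y|
        ≤ ∫ y in B, C * δ * (1 + ‖δ⁻¹ • (x - y)‖) ^ (-3 : ℝ) := by
          refine integral_mono_of_nonneg (Eventually.of_forall fun y => abs_nonneg _)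
            (((integrable_decay_comp hδ x).const_mul _).integrableOn) ?_
          refine (ae_restrict_iff' measurableSet_closedBall).2 (Eventually.of_forall fun y hy => ?_)
          exact h δ x y t hδ hδ' hx hy ht
      _ ≤ ∫ y, C * δ * (1 + ‖δ⁻¹ • (x - y)‖) ^ (-3 : ℝ) :=
          setIntegral_le_integral ((integrable_decay_comp hδ x).const_mul _)
            (Eventually.of_forall fun y => by positivity)
      _ = C * I * δ ^ 3 := by rw [integral_const_mul, integral_decay_eq hδ]; ring

theorem le_integral_add_deriv {G G' : ℝ → ℝ} (hG : ∀ t, HasDerivAt G (G' t) t)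
    (hG' : Continuous G') {t : ℝ} (ht : t ∈ Set.Icc (1 : ℝ) 2) :
    G t ≤ (∫ s in (1 : ℝ)..2, G s) + ∫ s in (1 : ℝ)..2, |G' s| := by
  have hGc : Continuous G := continuous_iff_continuousAt.2 fun t => (hG t).continuousAt
  have h1 : ∀ s ∈ Set.Icc (1 : ℝ) 2, G t - (∫ s in (1 : ℝ)..2, |G' s|) ≤ G s := by
    intro s hs
    have e : ∫ r in s..t, G' r = G t - G s :=
      intervalIntegral.integral_eq_sub_of_hasDerivAt (fun r _ => hG r)
        (hG'.intervalIntegrable _ _)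
    have h2 : |∫ r in s..t, G' r| ≤ ∫ r in (1 : ℝ)..2, |G' r| := by
      rw [← Real.norm_eq_abs]
      refine (intervalIntegral.norm_integral_le_integral_norm_uIoc).trans ?_
      rw [intervalIntegral.integral_of_le (by norm_num)]
      refine setIntegral_mono_set ?_ (Eventually.of_forall fun r => abs_nonneg _) ?_
      · exact (hG'.abs.intervalIntegrable 1 2).1
      · refine (Set.Ioc_subset_Ioc ?_ ?_).eventuallyLE
        · exact le_min hs.1 ht.1
        · exact max_le hs.2 ht.2
    have := le_abs_self (∫ r in s..t, G' r)
    linarith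
  have := intervalIntegral.integral_mono_on (μ := volume) (by norm_num : (1 : ℝ) ≤ 2)
    intervalIntegrable_const (hGc.intervalIntegrable 1 2) h1
  rw [intervalIntegral.integral_const, smul_eq_mul] at this
  linarith

theorem sq_le_setIntegral_sq {u v : ℝ → ℝ} {δ : ℝ} (hδ : 0 < δ) (hδ' : δ ≤ 1 / 2)
    (hu : ∀ s, HasDerivAt u (-(2 * s) / δ * v s) s) (d2 : Continuous v) {t : ℝ}
    (ht : t ∈ Set.Icc (1 : ℝ) 2) :
    u t ^ 2 ≤ ∫ s in Set.Icc (1 : ℝ) 2, 5 / δ * (u s ^ 2 + v s ^ 2) := by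
  have d1 : Continuous u := continuous_iff_continuousAt.2 fun t => (hu t).continuousAt
  have hder : ∀ s, HasDerivAt (fun s => u s ^ 2) (2 * u s * (-(2 * s) / δ * v s)) s := by
    intro s
    exact ((hu s).pow 2).congr_deriv (by norm_num)
  have := le_integral_add_deriv hder (by fun_prop) ht
  refine this.trans ?_
  rw [integral_Icc_eq_integral_Ioc, ← intervalIntegral.integral_of_le (by norm_num),
    ← intervalIntegral.integral_add (Continuous.intervalIntegrable (by fun_prop) _ _)
      (Continuous.intervalIntegrable (by fun_prop) _ _)]
  refine intervalIntegral.integral_mono_on (by norm_num)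
    (Continuous.intervalIntegrable (by fun_prop) _ _)
    (Continuous.intervalIntegrable (by fun_prop) _ _) fun s hs => ?_
  generalize u s = u
  generalize v s = v
  rw [abs_mul, abs_mul, abs_mul, abs_div, abs_neg, abs_mul, abs_two, abs_of_pos hδ,
    abs_of_nonneg (zero_le_one.trans hs.1)]
  have h1 : u ^ 2 ≤ 1 / δ * u ^ 2 := le_mul_of_one_le_left (sq_nonneg _) (by
    rw [one_le_div hδ]; linarith)
  have h2 : 2 * |u| * (2 * s / δ * |v|) ≤ 4 / δ * (u ^ 2 + v ^ 2) := by
    have h3 : 2 * |u| * |v| ≤ u ^ 2 + v ^ 2 := by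
      rw [← sq_abs u, ← sq_abs v]; nlinarith [sq_nonneg (|u| - |v|)]
    calc 2 * |u| * (2 * s / δ * |v|) = (2 * s / δ) * (2 * |u| * |v|) := by ring
      _ ≤ (2 * 2 / δ) * (u ^ 2 + v ^ 2) := by
        have := hs.2
        gcongr
      _ = _ := by ring
  have h4 : 0 ≤ 1 / δ * v ^ 2 := by positivity
  calc _ ≤ 1 / δ * u ^ 2 + 4 / δ * (u ^ 2 + v ^ 2) + 1 / δ * v ^ 2 := by linarith
    _ = _ := by ring

theorem exists_thick_majorant {η : ℝ → ℝ} (hη : IsCutoff η) {m : ℕ} (hm : 3 ≤ m) :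
    ∃ C, 0 < C ∧ ∀ (δ : ℝ) (f : ℝ × ℝ → ℝ), 0 < δ → δ ≤ 1 / 2 → LocData f →
      ∃ J : ℝ × ℝ → ℝ, IntegrableOn J (closedBall 0 (1 / 8)) ∧ (∀ x, 0 ≤ J x) ∧
        (∀ x, ∀ t ∈ Set.Icc (1 : ℝ) 2, thick (iteratedDeriv m η) δ f x t ^ 2 ≤ J x) ∧
        ∫ x in closedBall 0 (1 / 8), J x ≤ C * ∫ z, f z ^ 2 := by
  obtain ⟨C₁, hC₁, h₁⟩ := exists_thick_sq_fixed hη hm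
  obtain ⟨C₂, hC₂, h₂⟩ := exists_thick_sq_fixed hη (m := m + 1) (by omega)
  refine ⟨5 * (C₁ + C₂), by positivity, fun δ f hδ hδ' hf => ?_⟩
  have hφ := hη.iteratedDeriv m
  have hφ' := hη.iteratedDeriv (m + 1)
  set φ := iteratedDeriv m η with hφd
  have hd : deriv φ = iteratedDeriv (m + 1) η := iteratedDeriv_succ.symm
  set φ' := iteratedDeriv (m + 1) η with hφ'd
  have c1 := continuous_thick hφ δ hf
  have c2 := continuous_thick hφ' δ hf
  have hf2 : 0 ≤ ∫ z, f z ^ 2 := integral_nonneg fun z => sq_nonneg _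
  set G : ℝ × ℝ → ℝ → ℝ := fun x t => 5 / δ * (thick φ δ f x t ^ 2 + thick φ' δ f x t ^ 2) with hG
  have cG : Continuous fun P : (ℝ × ℝ) × ℝ => G P.1 P.2 :=
    continuous_const.mul ((c1.pow 2).add (c2.pow 2))
  have hG0 : ∀ x t, 0 ≤ G x t := fun x t => by positivity
  have hIntg : Integrable (Function.uncurry G)
      ((volume.restrict (closedBall (0 : ℝ × ℝ) (1 / 8))).prod
        (volume.restrict (Set.Icc (1 : ℝ) 2))) := by
    rw [Measure.prod_restrict]
    exact cG.continuousOn.integrableOn_compact ((isCompact_closedBall _ _).prod isCompact_Icc)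
  refine ⟨fun x => ∫ t in Set.Icc (1 : ℝ) 2, G x t, hIntg.integral_prod_left,
    fun x => integral_nonneg fun t => hG0 x t, fun x t ht => ?_, ?_⟩
  · have cx : Continuous fun s : ℝ => (x, s) := by fun_prop
    refine sq_le_setIntegral_sq hδ hδ' (fun s => ?_) (c2.comp cx) ht
    have := hasDerivAt_thick hφ hδ hf x s
    rwa [hd] at this
  · rw [integral_integral_swap hIntg]
    have hb : ∀ t ∈ Set.Icc (1 : ℝ) 2, ∫ x in closedBall (0 : ℝ × ℝ) (1 / 8), G x t ≤
        5 * (C₁ + C₂) * ∫ z, f z ^ 2 := by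
      intro t ht
      have i1 : IntegrableOn (fun x => thick φ δ f x t ^ 2) (closedBall (0 : ℝ × ℝ) (1 / 8)) :=
        ((c1.comp (by fun_prop : Continuous fun x : ℝ × ℝ => (x, t))).pow
            2).continuousOn.integrableOn_compact
          (isCompact_closedBall _ _)
      have i2 : IntegrableOn (fun x => thick φ' δ f x t ^ 2) (closedBall (0 : ℝ × ℝ) (1 / 8)) :=
        ((c2.comp (by fun_prop : Continuous fun x : ℝ × ℝ => (x, t))).pow
            2).continuousOn.integrableOn_compact
          (isCompact_closedBall _ _)
      simp only [hG]
      rw [integral_const_mul, integral_add i1 i2]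
      have a1 := h₁ δ f t hδ hδ' hf ht
      have a2 := h₂ δ f t hδ hδ' hf ht
      calc _ ≤ 5 / δ * (C₁ * δ * (∫ z, f z ^ 2) + C₂ * δ * ∫ z, f z ^ 2) := by gcongr
        _ = _ := by field_simp
    calc ∫ t in Set.Icc (1 : ℝ) 2, ∫ x in closedBall (0 : ℝ × ℝ) (1 / 8), G x t
        ≤ ∫ t in Set.Icc (1 : ℝ) 2, 5 * (C₁ + C₂) * ∫ z, f z ^ 2 := by
          refine setIntegral_mono_on hIntg.integral_prod_right ?_ measurableSet_Icc hb
          exact integrableOn_const (by simp)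
      _ = _ := by simp; norm_num

/-- Weak-type `L²` bound for the maximal thickened mean. -/
theorem exists_thick_weak_two {η : ℝ → ℝ} (hη : IsCutoff η) {m : ℕ} (hm : 3 ≤ m) :
    ∃ C, 0 < C ∧ ∀ (δ : ℝ) (f : ℝ × ℝ → ℝ) (l : ℝ), 0 < δ → δ ≤ 1 / 2 → LocData f → 0 < l →
      volume {x | x ∈ closedBall (0 : ℝ × ℝ) (1 / 8) ∧ ∃ t ∈ Set.Icc (1 : ℝ) 2,
        l < |thick (iteratedDeriv m η) δ f x t|} ≤ ENNReal.ofReal (C / l ^ 2 * ∫ z, f z ^ 2) := by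
  obtain ⟨C, hC, h⟩ := exists_thick_majorant hη hm
  refine ⟨C, hC, fun δ f l hδ hδ' hf hl => ?_⟩
  obtain ⟨J, hJ, hJ0, hJ1, hJ2⟩ := h δ f hδ hδ' hf
  have hm := mul_meas_ge_le_integral_of_nonneg (Eventually.of_forall hJ0) hJ (l ^ 2)
  have hsub : {x | x ∈ closedBall (0 : ℝ × ℝ) (1 / 8) ∧ ∃ t ∈ Set.Icc (1 : ℝ) 2,
        l < |thick (iteratedDeriv m η) δ f x t|} ⊆ {x | l ^ 2 ≤ J x} ∩ closedBall 0 (1 / 8) := by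
    rintro x ⟨hx, t, ht, hlt⟩
    refine ⟨?_, hx⟩
    refine le_trans ?_ (hJ1 x t ht)
    rw [← sq_abs (thick _ _ _ _ _)]
    exact pow_le_pow_left₀ hl.le hlt.le 2
  refine (measure_mono hsub).trans ?_
  have hfin : (volume.restrict (closedBall (0 : ℝ × ℝ) (1 / 8))) {x | l ^ 2 ≤ J x} ≠ ⊤ :=
    (lt_of_le_of_lt (measure_mono (Set.subset_univ _)) (by
      rw [Measure.restrict_apply_univ]; exact (isCompact_closedBall _ _).measure_lt_top)).ne
  rw [← Measure.restrict_apply' measurableSet_closedBall]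
  refine ENNReal.le_ofReal_iff_toReal_le hfin (by
    have : 0 ≤ ∫ z, f z ^ 2 := integral_nonneg fun z => sq_nonneg _
    positivity) |>.2 ?_
  rw [div_mul_eq_mul_div, le_div_iff₀ (by positivity), mul_comm]
  exact hm.trans hJ2

theorem abs_inner_le_of_nsq {a b : ℝ × ℝ} {A B : ℝ} (hA : 0 ≤ A) (hB : 0 ≤ B)
    (ha : nsq a ≤ A ^ 2) (hb : nsq b ≤ B ^ 2) : |a.1 * b.1 + a.2 * b.2| ≤ A * B := by
  refine abs_le_of_sq_le_sq' ?_ (by positivity) |>.2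
  rw [sq_abs]
  have h : (a.1 * b.1 + a.2 * b.2) ^ 2 ≤ nsq a * nsq b := by
    unfold nsq; nlinarith [sq_nonneg (a.1 * b.2 - a.2 * b.1)]
  have h0 : 0 ≤ nsq b := by unfold nsq; positivity
  calc _ ≤ nsq a * nsq b := h
    _ ≤ A ^ 2 * B ^ 2 := mul_le_mul ha hb h0 (by positivity)
    _ = _ := by ring

theorem rho_eq_nsq (y : ℝ × ℝ) (s : ℝ) (z : ℝ × ℝ) : rho y s z = nsq (z - y) - s ^ 2 := by
  simp [rho, nsq]

/-- The scalar computation behind the light cone estimate. -/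
theorem abs_lightcone_scalar {s τ n X c R δ δ₁ : ℝ} (ht1 : 1 ≤ s + τ)
    (hs1 : 1 ≤ s) (hs2 : s ≤ 2) (hδ : 0 < δ) (hδ' : δ ≤ 1 / 100) (hδR : δ ≤ R) (hR : R ≤ 9 / 25)
    (hδ₁ : δ ≤ δ₁) (h1 : |n - 2 * X + R ^ 2 - (s + τ) ^ 2| ≤ δ) (h2 : |n - s ^ 2| ≤ δ)
    (hcX : c ^ 2 + X ^ 2 = R ^ 2 * n) (hc : c ^ 2 ≤ δ₁ * R) :
    |R ^ 2 - τ ^ 2| ≤ 25 * δ₁ * R := by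
  have hR0 : 0 < R := hδ.trans_le hδR
  have hE : 0 ≤ δ₁ * R := mul_nonneg (hδ.le.trans hδ₁) hR0.le
  have a3 : δ * R ≤ δ₁ * R := by gcongr
  have hss : s ≤ s ^ 2 := by nlinarith only [hs1]
  have hRR : R ^ 2 ≤ 9 / 25 * R := by nlinarith only [hR, hR0]
  rw [abs_le] at h1 h2
  have hn : n ≤ (101 / 100 * s) ^ 2 := by nlinarith only [h2, hss, hs1, hδ']
  have hXs : |X| ≤ R * (101 / 100 * s) := by
    refine abs_le_of_sq_le_sq' ?_ (by positivity) |>.2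
    rw [sq_abs, mul_pow]
    linarith [sq_nonneg c, mul_le_mul_of_nonneg_left hn (sq_nonneg R)]
  have hRs : R * s ≤ 2 * R := by nlinarith only [hR0, hs2]
  have hRs' : R * s ≤ 9 / 25 * s := by nlinarith only [hR, hs1]
  have hX1 : |X| ≤ 3 * R := by linarith
  have hX2 : |X| ≤ 37 / 100 * s := by linarith
  have hexp : (s + τ) ^ 2 = s ^ 2 + τ * (2 * s + τ) := by ring
  have hpos : 0 ≤ 2 * s + τ := by linarith
  have k1 : |τ| ≤ 7 / 2 * R := by
    have h3 : |τ| * 2 ≤ |τ| * (2 * s + τ) :=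
      mul_le_mul_of_nonneg_left (by linarith) (abs_nonneg _)
    have hτ3 : |τ * (2 * s + τ)| ≤ 7 * R := by
      have hX3 : |X| ≤ 203 / 100 * R := by linarith
      have := abs_le.1 hX3
      rw [abs_le]; constructor <;> linarith [sq_nonneg R]
    rw [abs_mul, abs_of_nonneg hpos] at hτ3
    linarith
  have k2 : |τ| ≤ 6 / 10 := by
    have : |τ * (2 * s + τ)| ≤ 6 / 10 * (1 + s) := by
      have := abs_le.1 hX2
      rw [abs_le]; constructor <;> linarith [sq_nonneg R]
    rw [abs_mul, abs_of_nonneg hpos] at this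
    have h3 : |τ| * (1 + s) ≤ |τ| * (2 * s + τ) :=
      mul_le_mul_of_nonneg_left (by linarith) (abs_nonneg _)
    exact le_of_mul_le_mul_right (h3.trans this) (by linarith)
  have t0 : |s * τ| = s * |τ| := by rw [abs_mul, abs_of_pos (by linarith : 0 < s)]
  have k3 : |X - s * τ| ≤ 98 / 100 * s := by
    have h4 : s * |τ| ≤ s * (6 / 10) := mul_le_mul_of_nonneg_left k2 (by linarith)
    exact (abs_sub _ _).trans (by rw [t0]; linarith)
  have k4 : |X - s * τ| ≤ 10 * R := by
    have h4 : s * |τ| ≤ 2 * (7 / 2 * R) := mul_le_mul hs2 k1 (abs_nonneg _) (by norm_num)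
    exact (abs_sub _ _).trans (by rw [t0]; linarith)
  have he' : |X + s * τ - (R ^ 2 - τ ^ 2) / 2| ≤ δ := by
    rw [abs_le]; constructor <;> linarith
  have key : (R ^ 2 - τ ^ 2) * (s ^ 2 - (X - s * τ) / 2) =
      (X + s * τ - (R ^ 2 - τ ^ 2) / 2) * (X - s * τ) - R ^ 2 * (n - s ^ 2) + c ^ 2 := by
    linear_combination -hcX
  have k5 : 1 / 2 ≤ s ^ 2 - (X - s * τ) / 2 := by
    have := abs_le.1 k3
    linarith
  have k6 : |(X + s * τ - (R ^ 2 - τ ^ 2) / 2) * (X - s * τ) - R ^ 2 * (n - s ^ 2) + c ^ 2| ≤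
      12 * δ₁ * R := by
    have a1 : |(X + s * τ - (R ^ 2 - τ ^ 2) / 2) * (X - s * τ)| ≤ δ * (10 * R) := by
      rw [abs_mul]; exact mul_le_mul he' k4 (abs_nonneg _) hδ.le
    have a2 : |R ^ 2 * (n - s ^ 2)| ≤ R * δ := by
      rw [abs_mul, abs_of_nonneg (sq_nonneg R)]
      exact mul_le_mul (by linarith) (abs_le.2 h2) (abs_nonneg _) hR0.le
    have a1' := abs_le.1 a1
    have a2' := abs_le.1 a2
    rw [abs_le]; constructor <;> linarith [sq_nonneg c]
  have k7 : |R ^ 2 - τ ^ 2| * (1 / 2) ≤ 12 * δ₁ * R := by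
    rw [← key, abs_mul, abs_of_nonneg (by linarith : (0 : ℝ) ≤ s ^ 2 - (X - s * τ) / 2)] at k6
    exact (mul_le_mul_of_nonneg_left k5 (abs_nonneg _)).trans k6
  linarith

/-- Approximately tangent circles lie near a light cone. -/
theorem abs_lightcone_le {x y z : ℝ × ℝ} {t s δ δ₁ R : ℝ} (ht : 1 ≤ t ∧ t ≤ 2)
    (hs : 1 ≤ s ∧ s ≤ 2) (hd : nsq (x - y) = R ^ 2) (hδ : 0 < δ) (hδ' : δ ≤ 1 / 100)
    (hδR : δ ≤ R) (hR : R ≤ 9 / 25) (hδ₁ : δ ≤ δ₁) (h1 : |rho x t z| ≤ δ)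
    (h2 : |rho y s z| ≤ δ) (hc : cross (x - y) (z - y) ^ 2 ≤ δ₁ * R) :
    |R ^ 2 - (t - s) ^ 2| ≤ 25 * δ₁ * R := by
  rw [rho_eq_nsq] at h2
  have e2 : rho x t z = nsq (z - y) - 2 * ((x - y).1 * (z - y).1 + (x - y).2 * (z - y).2) +
      R ^ 2 - (s + (t - s)) ^ 2 := by
    rw [← hd]
    simp only [rho, nsq, Prod.fst_sub, Prod.snd_sub]; ring
  rw [e2] at h1
  refine abs_lightcone_scalar (by linarith [ht.1]) hs.1 hs.2 hδ hδ' hδR hR hδ₁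
    h1 h2 ?_ hc
  rw [← hd]; simp only [cross, nsq]; ring

theorem abs_sub_le_of_lightcone {R τ A : ℝ} (hR : 0 < R) (h : |R ^ 2 - τ ^ 2| ≤ A * R) :
    |(R - |τ|)| ≤ A := by
  have : |R ^ 2 - τ ^ 2| = |(R - |τ|)| * (R + |τ|) := by
    have h0 : 0 ≤ R + |τ| := by positivity
    rw [← sq_abs τ, (by ring : R ^ 2 - |τ| ^ 2 = (R - |τ|) * (R + |τ|)), abs_mul, abs_of_nonneg h0]
  rw [this] at h
  have h2 : |(R - |τ|)| * R ≤ A * R :=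
    (mul_le_mul_of_nonneg_left (by linarith [abs_nonneg τ]) (abs_nonneg _)).trans h
  exact le_of_mul_le_mul_right h2 hR

set_option maxHeartbeats 1000000 in
/-- The displacement of approximately tangent circles is nearly radial. -/
theorem nsq_radial_le {x y z : ℝ × ℝ} {t s δ δ₁ R : ℝ} (ht : 1 ≤ t ∧ t ≤ 2)
    (hs : 1 ≤ s ∧ s ≤ 2) (hd : nsq (x - y) = R ^ 2) (hδ : 0 < δ) (hδ' : δ ≤ 1 / 100)
    (hδR : δ ≤ R) (hR : R ≤ 9 / 25) (hδ₁ : δ ≤ δ₁) (hδ₁' : δ₁ ≤ 1) (h1 : |rho x t z| ≤ δ)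
    (h2 : |rho y s z| ≤ δ) (hc : cross (x - y) (z - y) ^ 2 ≤ δ₁ * R) :
    nsq (t • (x - y) + (t - s) • (z - x)) ≤ 40 ^ 2 * (δ₁ * R) := by
  have hq := abs_lightcone_le ht hs hd hδ hδ' hδR hR hδ₁ h1 h2 hc
  have hR0 : 0 < R := hδ.trans_le hδR
  have e2 : rho y s z = nsq (z - x) + 2 * ((x - y).1 * (z - x).1 + (x - y).2 * (z - x).2) +
      nsq (x - y) - s ^ 2 := by
    simp only [rho, nsq, Prod.fst_sub, Prod.snd_sub]; ring
  have ec : cross (x - y) (z - y) = cross (x - y) (z - x) := by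
    simp only [cross, Prod.fst_sub, Prod.snd_sub]; ring
  rw [e2, hd] at h2
  rw [rho_eq_nsq] at h1
  rw [ec] at hc
  set u := z - x
  set d := x - y
  set Y := d.1 * u.1 + d.2 * u.2 with hY
  set n := nsq u with hn
  set q := R ^ 2 - (t - s) ^ 2 with hqd
  set τ := t - s with hτ
  have key : nsq (t • d + τ • u) * n = (t * Y + τ * n) ^ 2 + t ^ 2 * cross d u ^ 2 := by
    simp only [hn, hY, nsq, cross, Prod.fst_add, Prod.snd_add, Prod.smul_fst, Prod.smul_snd,
      smul_eq_mul]; ring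
  rw [abs_le] at h1 h2 hq
  obtain ⟨ht1, ht2⟩ := ht
  obtain ⟨hs1, hs2⟩ := hs
  have hn1 : 99 / 100 ≤ n := by nlinarith only [h1, ht1, hδ']
  have hδδ : δ * δ ≤ δ₁ * R := mul_le_mul hδ₁ hδR hδ.le (hδ.le.trans hδ₁)
  have hE0 : 0 ≤ δ₁ * R := (mul_nonneg hδ.le hδ.le).trans hδδ
  have hE1 : δ₁ * R ≤ 9 / 25 := (mul_le_of_le_one_left hR0.le hδ₁').trans hR
  have hsτ : s = t - τ := by rw [hτ]; ring
  have hexp : t * Y + τ * n = t * ((n + 2 * Y + R ^ 2 - s ^ 2) - (n - t ^ 2) - q) / 2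
      + τ * (n - t ^ 2) := by
    rw [hqd, hsτ]; ring
  have hτ1 : |τ| ≤ 1 := by rw [abs_le]; constructor <;> linarith
  rw [abs_le] at hτ1
  have hb : |t * Y + τ * n| ≤ 25 * (δ₁ * R) + 3 * δ := by
    rw [hexp]
    have a1 : |τ * (n - t ^ 2)| ≤ 1 * δ := by
      rw [abs_mul]; exact mul_le_mul (abs_le.2 hτ1) (abs_le.2 h1) (abs_nonneg _) zero_le_one
    have a2 : |t * ((n + 2 * Y + R ^ 2 - s ^ 2) - (n - t ^ 2) - q)| ≤
        2 * (2 * δ + 25 * δ₁ * R) := by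
      rw [abs_mul, abs_of_pos (by linarith : 0 < t)]
      refine mul_le_mul ht2 ?_ (abs_nonneg _) (by norm_num)
      rw [abs_le]; constructor <;> linarith [sq_nonneg R]
    rw [abs_le] at a1 a2 ⊢
    constructor <;> linarith
  have hb2 : (t * Y + τ * n) ^ 2 ≤ (25 * (δ₁ * R) + 3 * δ) ^ 2 := by
    rw [← sq_abs (t * Y + τ * n)]; exact pow_le_pow_left₀ (abs_nonneg _) hb 2
  have hb3 : (25 * (δ₁ * R) + 3 * δ) ^ 2 ≤ 2 * (25 ^ 2 * (δ₁ * R)) + 18 * (δ₁ * R) := by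
    set E := δ₁ * R
    have h6 : E ^ 2 ≤ E := by nlinarith only [hE0, hE1]
    linarith [sq_nonneg (25 * E - 3 * δ),
      (by ring : (25 * E + 3 * δ) ^ 2 + (25 * E - 3 * δ) ^ 2 = 2 * (25 ^ 2 * E ^ 2) + 18 * (δ * δ))]
  have hb4 : t ^ 2 * cross d u ^ 2 ≤ 4 * (δ₁ * R) := by
    refine mul_le_mul (by nlinarith only [ht1, ht2]) hc (sq_nonneg _) (by norm_num)
  have h0 : 0 ≤ nsq (t • d + τ • u) := by unfold nsq; positivity
  have h7 : nsq (t • d + τ • u) * (99 / 100) ≤ nsq (t • d + τ • u) * n :=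
    mul_le_mul_of_nonneg_left hn1 h0
  linarith

set_option maxHeartbeats 1000000 in
/-- Increment estimate along the set of circles tangent to a fixed one. -/
theorem abs_tangent_increment_le {d a u : ℝ × ℝ} {t τ b δ₁ R R' W : ℝ} (ht : 1 ≤ t ∧ t ≤ 2)
    (hR : 0 < R) (hδ₁ : 0 < δ₁) (hδR : 50 * δ₁ ≤ R) (hd : nsq d = R ^ 2)
    (hd' : nsq (d + a) = R' ^ 2)
    (hq : |R ^ 2 - τ ^ 2| ≤ 25 * δ₁ * R) (hq' : |R' ^ 2 - (τ + b) ^ 2| ≤ 25 * δ₁ * R')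
    (hrad : nsq (t • d + τ • u) ≤ 40 ^ 2 * (δ₁ * R)) (ha : ‖a‖ ≤ W) (hb : |b| ≤ W) :
    |a.1 * u.1 + a.2 * u.2 + t * b| ≤ 50 * δ₁ * (1 + R' / R) +
      (120 * √(δ₁ / R) + 6 * W / R) * W := by
  have hW : 0 ≤ W := (norm_nonneg _).trans ha
  set g := t • d + τ • u with hg
  have hna : nsq a ≤ 2 * W ^ 2 := (nsq_le_norm_sq a).trans (by gcongr)
  have hga : |g.1 * a.1 + g.2 * a.2| ≤ (40 * √(δ₁ * R)) * (3 / 2 * W) := by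
    refine abs_inner_le_of_nsq (by positivity) (by positivity) ?_ ?_
    · rw [mul_pow, Real.sq_sqrt (by positivity)]; exact hrad
    · nlinarith only [hna, sq_nonneg W]
  have hτ := abs_sub_le_of_lightcone hR hq
  have hτ2 : R / 2 ≤ |τ| := by
    have := (abs_le.1 hτ).2; linarith
  set S := a.1 * u.1 + a.2 * u.2 + t * b with hS
  have key : 2 * τ * S = 2 * (g.1 * a.1 + g.2 * a.2) + t * (nsq a - b ^ 2) -
      t * ((R' ^ 2 - (τ + b) ^ 2) - (R ^ 2 - τ ^ 2)) := by
    rw [← hd, ← hd', hS, hg]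
    simp only [nsq, Prod.fst_add, Prod.snd_add, Prod.smul_fst, Prod.smul_snd, smul_eq_mul]; ring
  have hna0 : 0 ≤ nsq a := by unfold nsq; positivity
  have hb2 : b ^ 2 ≤ W ^ 2 := by rw [← sq_abs b]; exact pow_le_pow_left₀ (abs_nonneg _) hb 2
  have k1 : |t * (nsq a - b ^ 2)| ≤ 2 * (2 * W ^ 2) := by
    rw [abs_mul, abs_of_pos (by linarith [ht.1] : 0 < t)]
    refine mul_le_mul ht.2 ?_ (abs_nonneg _) (by norm_num)
    rw [abs_le]; constructor <;> linarith [sq_nonneg b, sq_nonneg W]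
  have k2 : |t * ((R' ^ 2 - (τ + b) ^ 2) - (R ^ 2 - τ ^ 2))| ≤ 2 * (25 * δ₁ * R' + 25 * δ₁ * R) :=
      by
    rw [abs_mul, abs_of_pos (by linarith [ht.1] : 0 < t)]
    refine mul_le_mul ht.2 ?_ (abs_nonneg _) (by norm_num)
    exact (abs_sub _ _).trans (by linarith)
  have k3 : |2 * τ * S| ≤ 2 * ((40 * √(δ₁ * R)) * (3 / 2 * W)) + 2 * (2 * W ^ 2) +
      2 * (25 * δ₁ * R' + 25 * δ₁ * R) := by
    rw [key]
    rw [abs_le] at hga k1 k2 ⊢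
    constructor <;> linarith
  have k4 : R * |S| ≤ |2 * τ * S| := by
    rw [abs_mul, abs_mul, abs_two]
    exact mul_le_mul_of_nonneg_right (by linarith) (abs_nonneg _)
  have e1 : √(δ₁ * R) = √(δ₁ / R) * R := by
    have : δ₁ * R = (δ₁ / R) * R ^ 2 := by field_simp
    rw [this, Real.sqrt_mul (by positivity), Real.sqrt_sq hR.le]
  rw [e1] at k3
  have e2 : R * (50 * δ₁ * (1 + R' / R) + (120 * √(δ₁ / R) + 6 * W / R) * W) =
      50 * δ₁ * (R + R') + 120 * (√(δ₁ / R) * R) * W + 6 * W ^ 2 := by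
    field_simp; ring
  refine le_of_mul_le_mul_left ?_ hR
  rw [e2]
  linarith [sq_nonneg W]

set_option maxHeartbeats 1000000 in
/-- Three separated points on a circle determine an affine function stably. -/
theorem norm_le_of_three_points {u : Fin 3 → ℝ × ℝ} {a : ℝ × ℝ} {t b δ κ m : ℝ}
    (ht : 1 ≤ t ∧ t ≤ 2) (hκ : 0 < κ) (hκ1 : κ ≤ 1) (hδ : 0 ≤ δ) (hδκ : 100 * δ ≤ κ ^ 3)
    (hu : ∀ i, |nsq (u i) - t ^ 2| ≤ δ) (hsep : ∀ i j, i ≠ j → κ ^ 2 ≤ nsq (u i - u j))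
    (hm : ∀ i, |a.1 * (u i).1 + a.2 * (u i).2 + t * b| ≤ m) :
    ‖a‖ ≤ 1000 / κ ^ 3 * m ∧ |b| ≤ 10000 / κ ^ 3 * m := by
  obtain ⟨ht1, ht2⟩ := ht
  have hκ3 : κ ^ 3 ≤ 1 := pow_le_one₀ hκ.le hκ1
  have hκ30 : 0 < κ ^ 3 := by positivity
  have hδ1 : δ ≤ 1 / 100 := by linarith
  have hm0 : 0 ≤ m := (abs_nonneg _).trans (hm 0)
  have hub : ∀ i, |(u i).1| ≤ 5 / 2 ∧ |(u i).2| ≤ 5 / 2 := by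
    intro i
    have h := (abs_le.1 (hu i)).2
    unfold nsq at h
    constructor <;> refine abs_le_of_sq_le_sq' ?_ (by norm_num) |>.2 <;> rw [sq_abs] <;>
      nlinarith only [sq_nonneg (u i).1, sq_nonneg (u i).2, h, hδ1, ht1, ht2]
  set e := u 0 - u 1 with he
  set f := u 0 - u 2 with hf
  set c := cross e f with hc
  have hfe : nsq (e - f) = nsq (u 2 - u 1) := by
    congr 1; rw [he, hf]; abel
  have n1 : κ ^ 2 ≤ nsq e := hsep 0 1 (by decide)
  have n2 : κ ^ 2 ≤ nsq f := hsep 0 2 (by decide)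
  have n3 : κ ^ 2 ≤ nsq (e - f) := hfe ▸ hsep 2 1 (by decide)
  have bnd : ∀ i j : Fin 3, |(u i - u j).1| ≤ 5 ∧ |(u i - u j).2| ≤ 5 := by
    intro i j
    have hi := hub i
    have hj := hub j
    exact ⟨(abs_sub _ _).trans (by linarith), (abs_sub _ _).trans (by linarith)⟩
  have be := bnd 0 1
  have bf := bnd 0 2
  rw [← he] at be
  rw [← hf] at bf
  -- the defects
  set p := nsq (u 0) - nsq (u 1) with hp
  set r := nsq (u 0) - nsq (u 2) with hr
  have hp' : |p| ≤ 2 * δ := by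
    have h0 := abs_le.1 (hu 0); have h1 := abs_le.1 (hu 1)
    rw [hp, abs_le]; constructor <;> linarith
  have hr' : |r| ≤ 2 * δ := by
    have h0 := abs_le.1 (hu 0); have h1 := abs_le.1 (hu 2)
    rw [hr, abs_le]; constructor <;> linarith
  set Pv : ℝ × ℝ := nsq e • f - nsq f • e with hPv
  set Ev : ℝ × ℝ := p • f - r • e with hEv
  have id1 : nsq (Pv + Ev) = 4 * c ^ 2 * nsq (u 0) := by
    simp only [hPv, hEv, hp, hr, hc, he, hf, nsq, cross, Prod.fst_add, Prod.snd_add, Prod.fst_sub,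
      Prod.snd_sub, Prod.smul_fst, Prod.smul_snd, smul_eq_mul]; ring
  have id2 : nsq Pv = nsq e * nsq f * nsq (e - f) := by
    simp only [hPv, nsq, Prod.fst_sub,
      Prod.snd_sub, Prod.smul_fst, Prod.smul_snd, smul_eq_mul]; ring
  have low : κ ^ 6 ≤ nsq Pv := by
    rw [id2]
    calc κ ^ 6 = κ ^ 2 * κ ^ 2 * κ ^ 2 := by ring
      _ ≤ _ := mul_le_mul (mul_le_mul n1 n2 (by positivity) ((by positivity : (0:ℝ) ≤ κ ^ 2).trans
          n1))
        n3 (by positivity) (mul_nonneg ((by positivity : (0:ℝ) ≤ κ ^ 2).trans n1)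
          ((by positivity : (0:ℝ) ≤ κ ^ 2).trans n2))
  have ev1 : ∀ {k l : ℝ}, |k| ≤ 5 → |l| ≤ 5 → |p * k - r * l| ≤ 20 * δ := by
    intro k l hk hl
    have a1 : |p * k| ≤ 2 * δ * 5 := by
      rw [abs_mul]; exact mul_le_mul hp' hk (abs_nonneg _) (by positivity)
    have a2 : |r * l| ≤ 2 * δ * 5 := by
      rw [abs_mul]; exact mul_le_mul hr' hl (abs_nonneg _) (by positivity)
    exact (abs_sub _ _).trans (by linarith)
  have hEvb : nsq Ev ≤ 800 * δ ^ 2 := by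
    have a1 := ev1 bf.1 be.1
    have a2 := ev1 bf.2 be.2
    have b1 : (p * f.1 - r * e.1) ^ 2 ≤ (20 * δ) ^ 2 := by
      rw [← sq_abs (p * f.1 - r * e.1)]; exact pow_le_pow_left₀ (abs_nonneg _) a1 2
    have b2 : (p * f.2 - r * e.2) ^ 2 ≤ (20 * δ) ^ 2 := by
      rw [← sq_abs (p * f.2 - r * e.2)]; exact pow_le_pow_left₀ (abs_nonneg _) a2 2
    have : nsq Ev = (p * f.1 - r * e.1) ^ 2 + (p * f.2 - r * e.2) ^ 2 := by
      simp only [hEv, nsq, Prod.fst_sub, Prod.snd_sub, Prod.smul_fst, Prod.smul_snd, smul_eq_mul]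
    rw [this]; nlinarith only [b1, b2]
  have comb : nsq Pv / 2 - nsq Ev ≤ nsq (Pv + Ev) := by
    have sc : ∀ k l : ℝ, k ^ 2 / 2 - l ^ 2 ≤ (k + l) ^ 2 := fun k l => by
      linarith [sq_nonneg (k + 2 * l), (by ring : (k + l) ^ 2 - (k ^ 2 / 2 - l ^ 2) = (k + 2 * l)
          ^ 2 / 2)]
    have s1 := sc Pv.1 Ev.1
    have s2 := sc Pv.2 Ev.2
    simp only [nsq, Prod.fst_add, Prod.snd_add]
    linarith
  have hδ2 : 10000 * δ ^ 2 ≤ κ ^ 6 := by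
    calc 10000 * δ ^ 2 = (100 * δ) ^ 2 := by ring
      _ ≤ (κ ^ 3) ^ 2 := by gcongr
      _ = κ ^ 6 := by ring
  have hu0 : nsq (u 0) ≤ 5 := by
    have := (abs_le.1 (hu 0)).2
    have : t ^ 2 ≤ 2 ^ 2 := by gcongr
    linarith
  have hc2 : (κ ^ 3 / 10) ^ 2 ≤ c ^ 2 := by
    have h5 : 4 * c ^ 2 * nsq (u 0) ≤ 4 * c ^ 2 * 5 := by gcongr
    have : (κ ^ 3 / 10) ^ 2 = κ ^ 6 / 100 := by ring
    rw [this]; rw [← id1] at h5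
    have h6 : 0 < κ ^ 6 := by positivity
    linarith only [h5, comb, low, hEvb, hδ2, h6]
  have hcl : κ ^ 3 / 10 ≤ |c| := by
    refine abs_le_of_sq_le_sq' ?_ (abs_nonneg _) |>.2
    rwa [sq_abs]
  -- Cramer
  set A := a.1 * e.1 + a.2 * e.2 with hA
  set B := a.1 * f.1 + a.2 * f.2 with hB
  have hA' : |A| ≤ 2 * m := by
    have h0 := abs_le.1 (hm 0); have h1 := abs_le.1 (hm 1)
    have : A = (a.1 * (u 0).1 + a.2 * (u 0).2 + t * b) - (a.1 * (u 1).1 + a.2 * (u 1).2 + t * b)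
        := by
      rw [hA, he]; simp only [Prod.fst_sub, Prod.snd_sub]; ring
    rw [this, abs_le]; constructor <;> linarith
  have hB' : |B| ≤ 2 * m := by
    have h0 := abs_le.1 (hm 0); have h1 := abs_le.1 (hm 2)
    have : B = (a.1 * (u 0).1 + a.2 * (u 0).2 + t * b) - (a.1 * (u 2).1 + a.2 * (u 2).2 + t * b)
        := by
      rw [hB, hf]; simp only [Prod.fst_sub, Prod.snd_sub]; ring
    rw [this, abs_le]; constructor <;> linarith
  have c1 : a.1 * c = A * f.2 - B * e.2 := by rw [hA, hB, hc, cross]; ring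
  have c2 : a.2 * c = B * e.1 - A * f.1 := by rw [hA, hB, hc, cross]; ring
  have lin : ∀ {k l : ℝ}, |k| ≤ 5 → |l| ≤ 5 → |A * k - B * l| ≤ 20 * m := by
    intro k l hk hl
    have a1 : |A * k| ≤ 2 * m * 5 := by
      rw [abs_mul]; exact mul_le_mul hA' hk (abs_nonneg _) (by positivity)
    have a2 : |B * l| ≤ 2 * m * 5 := by
      rw [abs_mul]; exact mul_le_mul hB' hl (abs_nonneg _) (by positivity)
    exact (abs_sub _ _).trans (by linarith)
  have fin : ∀ {k : ℝ}, |k * c| ≤ 20 * m → |k| ≤ 200 / κ ^ 3 * m := by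
    intro k hk
    rw [abs_mul] at hk
    have : |k| * (κ ^ 3 / 10) ≤ 20 * m := (mul_le_mul_of_nonneg_left hcl (abs_nonneg _)).trans hk
    rw [div_mul_eq_mul_div, le_div_iff₀ hκ30]; linarith
  have a1 : |a.1| ≤ 200 / κ ^ 3 * m := fin (by rw [c1]; exact lin bf.2 be.2)
  have a2 : |a.2| ≤ 200 / κ ^ 3 * m := fin (by
    rw [c2, abs_sub_comm]; exact lin bf.1 be.1)
  have hge : m ≤ 1 / κ ^ 3 * m := le_mul_of_one_le_left hm0 (by rw [one_le_div hκ30]; exact hκ3)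
  have hq0 : 0 ≤ 1 / κ ^ 3 * m := by positivity
  have e200 : 200 / κ ^ 3 * m = 200 * (1 / κ ^ 3 * m) := by ring
  have e1000 : 1000 / κ ^ 3 * m = 1000 * (1 / κ ^ 3 * m) := by ring
  have e10000 : 10000 / κ ^ 3 * m = 10000 * (1 / κ ^ 3 * m) := by ring
  rw [e200] at a1 a2
  rw [e1000, e10000]
  set q := 1 / κ ^ 3 * m
  constructor
  · rw [Prod.norm_def]
    exact max_le (by rw [Real.norm_eq_abs]; linarith) (by rw [Real.norm_eq_abs]; linarith)
  · have h0 := hm 0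
    have x1 : |a.1 * (u 0).1| ≤ 200 * q * (5 / 2) := by
      rw [abs_mul]; exact mul_le_mul a1 (hub 0).1 (abs_nonneg _) (by positivity)
    have x2 : |a.2 * (u 0).2| ≤ 200 * q * (5 / 2) := by
      rw [abs_mul]; exact mul_le_mul a2 (hub 0).2 (abs_nonneg _) (by positivity)
    have x3 : |t * b| ≤ 1002 * q := by
      rw [abs_le] at h0 x1 x2 ⊢
      constructor <;> linarith
    rw [abs_mul, abs_of_pos (by linarith : 0 < t)] at x3
    have : |b| ≤ t * |b| := le_mul_of_one_le_left (abs_nonneg _) ht1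
    linarith

/-- The Euclidean length on the plane. -/
noncomputable def elen (v : ℝ × ℝ) : ℝ := √(nsq v)

theorem nsq_nonneg (v : ℝ × ℝ) : 0 ≤ nsq v := by unfold nsq; positivity

theorem elen_nonneg (v : ℝ × ℝ) : 0 ≤ elen v := Real.sqrt_nonneg _

theorem elen_sq (v : ℝ × ℝ) : elen v ^ 2 = nsq v := Real.sq_sqrt (nsq_nonneg v)

theorem nsq_eq_elen (v : ℝ × ℝ) : nsq v = elen v ^ 2 := (elen_sq v).symm

theorem norm_le_elen (v : ℝ × ℝ) : ‖v‖ ≤ elen v :=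
  Real.le_sqrt_of_sq_le (norm_sq_le_nsq v)

theorem continuous_nsq : Continuous nsq := by unfold nsq; fun_prop

theorem continuous_elen : Continuous elen := Real.continuous_sqrt.comp continuous_nsq

theorem elen_add_le (v w : ℝ × ℝ) : elen (v + w) ≤ elen v + elen w := by
  refine Real.sqrt_le_iff.2 ⟨add_nonneg (elen_nonneg _) (elen_nonneg _), ?_⟩
  have h := abs_inner_le_of_nsq (elen_nonneg v) (elen_nonneg w) (elen_sq v).ge (elen_sq w).ge
  have e : nsq (v + w) = nsq v + 2 * (v.1 * w.1 + v.2 * w.2) + nsq w := by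
    simp only [nsq, Prod.fst_add, Prod.snd_add]; ring
  rw [e, nsq_eq_elen v, nsq_eq_elen w]
  nlinarith [(abs_le.1 h).2]

theorem elen_neg (v : ℝ × ℝ) : elen (-v) = elen v := by simp [elen, nsq]

theorem elen_sub_comm (v w : ℝ × ℝ) : elen (v - w) = elen (w - v) := by
  rw [← elen_neg, neg_sub]

/-- The circles `P` and `Q` are approximately tangent near `z₀`. -/
def Tang (δ κ δ₁ : ℝ) (z₀ : ℝ × ℝ) (P Q : (ℝ × ℝ) × ℝ) : Prop :=
  ∃ z, nsq (z - z₀) ≤ κ ^ 2 ∧ |rho P.1 P.2 z| ≤ δ ∧ |rho Q.1 Q.2 z| ≤ δ ∧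
    cross (P.1 - Q.1) (z - Q.1) ^ 2 ≤ δ₁ * elen (P.1 - Q.1)

theorem Tang.abs_lightcone_le {δ κ δ₁ : ℝ} {z₀ : ℝ × ℝ} {P Q : (ℝ × ℝ) × ℝ}
    (h : Tang δ κ δ₁ z₀ P Q) (hP : 1 ≤ P.2 ∧ P.2 ≤ 2) (hQ : 1 ≤ Q.2 ∧ Q.2 ≤ 2) (hδ : 0 < δ)
    (hδ' : δ ≤ 1 / 100) (hδR : δ ≤ elen (P.1 - Q.1)) (hR : elen (P.1 - Q.1) ≤ 9 / 25)
    (hδ₁ : δ ≤ δ₁) :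
    |elen (P.1 - Q.1) ^ 2 - (P.2 - Q.2) ^ 2| ≤ 25 * δ₁ * elen (P.1 - Q.1) := by
  obtain ⟨z, -, h1, h2, h3⟩ := h
  exact _root_.abs_lightcone_le hP hQ (elen_sq _).symm hδ hδ' hδR hR hδ₁ h1 h2 h3

theorem volume_abs_sub_abs_le (R t : ℝ) {A : ℝ} (hA : 0 ≤ A) :
    volume {s : ℝ | |(R - |t - s|)| ≤ A} ≤ ENNReal.ofReal (4 * A) := by
  have hsub : {s : ℝ | |(R - |t - s|)| ≤ A} ⊆
      Set.Icc (t - R - A) (t - R + A) ∪ Set.Icc (t + R - A) (t + R + A) := by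
    intro s hs
    have hs0 : |(R - |t - s|)| ≤ A := hs
    have hs' := abs_le.1 hs0
    rcases le_total 0 (t - s) with h | h
    · rw [abs_of_nonneg h] at hs'
      exact Or.inl ⟨by linarith, by linarith⟩
    · rw [abs_of_nonpos h] at hs'
      exact Or.inr ⟨by linarith, by linarith⟩
  refine (measure_mono hsub).trans ((measure_union_le _ _).trans ?_)
  rw [Real.volume_Icc, Real.volume_Icc, ← ENNReal.ofReal_add (by linarith) (by linarith)]
  exact ENNReal.ofReal_le_ofReal (by linarith)

/-- Circles tangent at three separated places to three given circles are close to each other. -/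
theorem norm_sub_le_of_three_tang {P P' : (ℝ × ℝ) × ℝ} {Q : Fin 3 → (ℝ × ℝ) × ℝ}
    {c : Fin 3 → ℝ × ℝ} {δ κ δ₁ ρ H ε : ℝ} (hP : 1 ≤ P.2 ∧ P.2 ≤ 2) (hP' : 1 ≤ P'.2 ∧ P'.2 ≤ 2)
    (hQ : ∀ i, 1 ≤ (Q i).2 ∧ (Q i).2 ≤ 2) (hκ : 0 < κ) (hκ1 : κ ≤ 1) (hδ : 0 < δ)
    (hδ' : δ ≤ 1 / 100) (hδκ : 100 * δ ≤ κ ^ 3) (hδ₁ : δ ≤ δ₁) (hδ₁' : δ₁ ≤ 1)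
    (hρ : 50 * δ₁ ≤ ρ)
    (hc : ∀ i j, i ≠ j → 3 * κ ≤ elen (c i - c j))
    (hR : ∀ i, ρ ≤ elen (P.1 - (Q i).1) ∧ elen (P.1 - (Q i).1) ≤ 9 / 25)
    (hR' : ∀ i, δ ≤ elen (P'.1 - (Q i).1) ∧ elen (P'.1 - (Q i).1) ≤ 9 / 25)
    (hRR : ∀ i, elen (P'.1 - (Q i).1) ≤ H * elen (P.1 - (Q i).1))
    (hT : ∀ i, Tang δ κ δ₁ (c i) P (Q i)) (hT' : ∀ i, Tang δ κ δ₁ (c i) P' (Q i))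
    (hε : ‖P' - P‖ ≤ ε)
    (hsmall : 10000 / κ ^ 3 * (120 * √(δ₁ / ρ) + 6 * ε / ρ) ≤ 1 / 2) :
    ‖P' - P‖ ≤ 1000000 / κ ^ 3 * (δ₁ * (1 + H)) := by
  have hδ₁0 : 0 < δ₁ := hδ.trans_le hδ₁
  have hρ0 : 0 < ρ := by linarith
  choose z hz1 hz2 hz3 hz4 using hT
  set W := ‖P' - P‖ with hW
  have hW0 : 0 ≤ W := norm_nonneg _
  have ha : ‖P'.1 - P.1‖ ≤ W := norm_fst_le (P' - P)
  have hb : |P'.2 - P.2| ≤ W := norm_snd_le (P' - P)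
  set m := 50 * δ₁ * (1 + H) + (120 * √(δ₁ / ρ) + 6 * ε / ρ) * W with hm
  have hinc : ∀ i, |(P'.1 - P.1).1 * (z i - P.1).1 + (P'.1 - P.1).2 * (z i - P.1).2 +
      P.2 * (P'.2 - P.2)| ≤ m := by
    intro i
    have hR0 : 0 < elen (P.1 - (Q i).1) := hρ0.trans_le (hR i).1
    have hδR : δ ≤ elen (P.1 - (Q i).1) := by linarith [(hR i).1]
    have hq' := (hT' i).abs_lightcone_le hP' (hQ i) hδ hδ' (hR' i).1 (hR' i).2 hδ₁
    have hq := _root_.abs_lightcone_le hP (hQ i) (elen_sq _).symm hδ hδ' hδR (hR i).2 hδ₁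
      (hz2 i) (hz3 i) (hz4 i)
    have hrad := nsq_radial_le hP (hQ i) (elen_sq _).symm hδ hδ' hδR (hR i).2 hδ₁ hδ₁'
      (hz2 i) (hz3 i) (hz4 i)
    have hd' : nsq ((P.1 - (Q i).1) + (P'.1 - P.1)) = elen (P'.1 - (Q i).1) ^ 2 := by
      rw [elen_sq]; congr 1; abel
    have e : P'.2 - (Q i).2 = (P.2 - (Q i).2) + (P'.2 - P.2) := by ring
    rw [e] at hq'
    refine (abs_tangent_increment_le hP hR0 hδ₁0 (hρ.trans (hR i).1) (elen_sq _).symm hd' hq hq'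
      hrad ha hb).trans ?_
    have h1 : elen (P'.1 - (Q i).1) / elen (P.1 - (Q i).1) ≤ H := by
      rw [div_le_iff₀ hR0]; exact hRR i
    have h2 : √(δ₁ / elen (P.1 - (Q i).1)) ≤ √(δ₁ / ρ) :=
      Real.sqrt_le_sqrt (div_le_div_of_nonneg_left hδ₁0.le hρ0 (hR i).1)
    have h3 : 6 * W / elen (P.1 - (Q i).1) ≤ 6 * ε / ρ :=
      div_le_div₀ (by linarith) (by linarith) hρ0 (hR i).1
    rw [hm]
    gcongr
  have hsep : ∀ i j, i ≠ j → κ ^ 2 ≤ nsq ((z i - P.1) - (z j - P.1)) := by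
    intro i j hij
    rw [sub_sub_sub_cancel_right, nsq_eq_elen]
    refine pow_le_pow_left₀ hκ.le ?_ 2
    have hzc : ∀ i, elen (z i - c i) ≤ κ := fun i => Real.sqrt_le_iff.2 ⟨hκ.le, hz1 i⟩
    have e : c i - c j = (z i - z j) + ((c i - z i) + (z j - c j)) := by abel
    have h1 := elen_add_le (z i - z j) ((c i - z i) + (z j - c j))
    have h2 := elen_add_le (c i - z i) (z j - c j)
    rw [← e] at h1
    rw [elen_sub_comm (c i)] at h2
    linarith [hc i j hij, hzc i, hzc j]
  have hu : ∀ i, |nsq (z i - P.1) - P.2 ^ 2| ≤ δ := fun i => by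
    rw [← rho_eq_nsq]; exact hz2 i
  obtain ⟨h1, h2⟩ := norm_le_of_three_points hP hκ hκ1 hδ.le hδκ hu hsep hinc
  have hm0 : 0 ≤ m := (abs_nonneg _).trans (hinc 0)
  have h1' : ‖P'.1 - P.1‖ ≤ 10000 / κ ^ 3 * m :=
    h1.trans (mul_le_mul_of_nonneg_right (by gcongr; norm_num) hm0)
  have hfin : W ≤ 10000 / κ ^ 3 * m := max_le h1' h2
  have : 10000 / κ ^ 3 * m = 10000 / κ ^ 3 * (50 * δ₁ * (1 + H)) +
      10000 / κ ^ 3 * (120 * √(δ₁ / ρ) + 6 * ε / ρ) * W := by rw [hm]; ring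
  have h5 := mul_le_mul_of_nonneg_right hsmall hW0
  have h6 : 10000 / κ ^ 3 * (50 * δ₁ * (1 + H)) * 2 = 1000000 / κ ^ 3 * (δ₁ * (1 + H)) := by ring
  linarith

/-- Counting configurations of one point related to three others. -/
theorem lintegral_prod_slices_le {X : Type*} [MeasurableSpace X] {μ : Measure X}
    [IsFiniteMeasure μ] {T : Fin 3 → Set (X × X)} (hT : ∀ i, MeasurableSet (T i)) {S D : ℝ≥0∞}
    {U : Set (X × X)} (hU : MeasurableSet U) {i₀ i₁ i₂ : Fin 3}
    (hS : ∀ Q₀ Q₁ Q₂, μ {P | (P, Q₀) ∈ T i₀ ∧ (P, Q₁) ∈ T i₁ ∧ (P, Q₂) ∈ T i₂} ≤ S)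
    (hTU : ∀ P Q₀ Q₂, (P, Q₀) ∈ T i₀ → (P, Q₂) ∈ T i₂ → (Q₀, Q₂) ∈ U)
    (hD : ∀ Q, μ (Prod.mk Q ⁻¹' U) ≤ D) :
    ∫⁻ P, μ (Prod.mk P ⁻¹' T i₀) * (μ (Prod.mk P ⁻¹' T i₁) * μ (Prod.mk P ⁻¹' T i₂)) ∂μ ≤
      S * (μ Set.univ * (μ Set.univ * D)) := by
  set W : Set (X × X × X × X) :=
    {q | (q.1, q.2.1) ∈ T i₀ ∧ (q.1, q.2.2.1) ∈ T i₁ ∧ (q.1, q.2.2.2) ∈ T i₂} with hW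
  have hWm : MeasurableSet W := by
    refine MeasurableSet.inter ?_ (MeasurableSet.inter ?_ ?_)
    · exact (by fun_prop : Measurable fun q : X × X × X × X => (q.1, q.2.1)) (hT i₀)
    · exact (by fun_prop : Measurable fun q : X × X × X × X => (q.1, q.2.2.1)) (hT i₁)
    · exact (by fun_prop : Measurable fun q : X × X × X × X => (q.1, q.2.2.2)) (hT i₂)
  set V : Set (X × X × X) := {q | (q.1, q.2.2) ∈ U} with hV
  have hVm : MeasurableSet V :=
    (by fun_prop : Measurable fun q : X × X × X => (q.1, q.2.2)) hU
  have e1 : ∫⁻ P, μ (Prod.mk P ⁻¹' T i₀) * (μ (Prod.mk P ⁻¹' T i₁) * μ (Prod.mk P ⁻¹' T i₂)) ∂μ =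
      (μ.prod (μ.prod (μ.prod μ))) W := by
    rw [Measure.prod_apply hWm]
    refine lintegral_congr fun P => ?_
    rw [← Measure.prod_prod, ← Measure.prod_prod]
    rfl
  rw [e1, Measure.prod_apply_symm hWm]
  calc ∫⁻ q, μ ((fun P => (P, q)) ⁻¹' W) ∂(μ.prod (μ.prod μ))
      ≤ ∫⁻ q, V.indicator (fun _ => S) q ∂(μ.prod (μ.prod μ)) := by
        refine lintegral_mono fun q => ?_
        by_cases hq : q ∈ V
        · rw [Set.indicator_of_mem hq]
          exact hS q.1 q.2.1 q.2.2
        · rw [Set.indicator_of_notMem hq]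
          have : (fun P => (P, q)) ⁻¹' W = ∅ := by
            ext P
            simp only [Set.mem_preimage, Set.mem_empty_iff_false, iff_false]
            rintro ⟨h0, -, h2⟩
            exact hq (hTU P _ _ h0 h2)
          simp [this]
    _ = S * (μ.prod (μ.prod μ)) V := lintegral_indicator_const hVm S
    _ ≤ S * (μ Set.univ * (μ Set.univ * D)) := by
        gcongr
        rw [Measure.prod_apply hVm]
        calc ∫⁻ Q, (μ.prod μ) (Prod.mk Q ⁻¹' V) ∂μ ≤ ∫⁻ _, μ Set.univ * D ∂μ := by
              refine lintegral_mono fun Q => ?_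
              have : Prod.mk Q ⁻¹' V = Set.univ ×ˢ (Prod.mk Q ⁻¹' U) := by
                ext q; simp [hV]
              rw [this, Measure.prod_prod]
              gcongr
              exact hD Q
          _ = μ Set.univ * (μ Set.univ * D) := by rw [lintegral_const, mul_comm]

theorem volume_closedBall_three (P : (ℝ × ℝ) × ℝ) {r : ℝ} (hr : 0 ≤ r) :
    volume (closedBall P r) = ENNReal.ofReal ((2 * r) ^ 3) := by
  obtain ⟨⟨a, b⟩, c⟩ := P
  rw [← closedBall_prod_same, ← closedBall_prod_same, Measure.volume_eq_prod, Measure.prod_prod,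
    Measure.volume_eq_prod, Measure.prod_prod, Real.volume_closedBall, Real.volume_closedBall,
    Real.volume_closedBall, ← ENNReal.ofReal_mul (by positivity), ← ENNReal.ofReal_mul (by
        positivity)]
  ring_nf

theorem volume_closedBall_two (P : ℝ × ℝ) {r : ℝ} (hr : 0 ≤ r) :
    volume (closedBall P r) = ENNReal.ofReal ((2 * r) ^ 2) := by
  obtain ⟨a, b⟩ := P
  rw [← closedBall_prod_same, Measure.volume_eq_prod, Measure.prod_prod,
    Real.volume_closedBall, Real.volume_closedBall, ← ENNReal.ofReal_mul (by positivity)]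
  ring_nf

/-- Volume of a set whose nearby points are very near. -/
theorem volume_le_of_local_diam {S : Set ((ℝ × ℝ) × ℝ)} (hS : MeasurableSet S)
    {P₀ : (ℝ × ℝ) × ℝ} {L ε e : ℝ} (hL : 0 ≤ L) (hε : 0 < ε) (he : 0 ≤ e)
    (hSL : S ⊆ closedBall P₀ L) (h : ∀ P ∈ S, ∀ P' ∈ S, ‖P' - P‖ ≤ ε → ‖P' - P‖ ≤ e) :
    volume S ≤ ENNReal.ofReal ((2 * (L + ε) / ε) ^ 3 * (2 * e) ^ 3) := by
  set A : Set (((ℝ × ℝ) × ℝ) × ((ℝ × ℝ) × ℝ)) := {q | q.1 ∈ S ∧ ‖q.2 - q.1‖ ≤ ε / 2} with hA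
  have hAm : MeasurableSet A := by
    refine MeasurableSet.inter (measurable_fst hS) ?_
    exact measurableSet_le (f := fun q : ((ℝ × ℝ) × ℝ) × ((ℝ × ℝ) × ℝ) => ‖q.2 - q.1‖)
      (g := fun _ => ε / 2) (by fun_prop) measurable_const
  have e1 : (volume.prod volume) A = volume S * ENNReal.ofReal (ε ^ 3) := by
    rw [Measure.prod_apply hAm]
    have : ∀ P, volume (Prod.mk P ⁻¹' A) = S.indicator (fun _ => ENNReal.ofReal (ε ^ 3)) P := by
      intro P
      by_cases hP : P ∈ S
      · rw [Set.indicator_of_mem hP]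
        have : Prod.mk P ⁻¹' A = closedBall P (ε / 2) := by
          ext c; simp [hA, hP, dist_eq_norm]
        rw [this, volume_closedBall_three _ (by positivity)]
        congr 2; ring
      · rw [Set.indicator_of_notMem hP]
        have : Prod.mk P ⁻¹' A = ∅ := by ext c; simp [hA, hP]
        simp [this]
    rw [lintegral_congr this, lintegral_indicator_const hS, mul_comm]
  have e2 : (volume.prod volume) A ≤
      ENNReal.ofReal ((2 * e) ^ 3) * ENNReal.ofReal ((2 * (L + ε)) ^ 3) := by
    rw [Measure.prod_apply_symm hAm, ← volume_closedBall_three P₀ (by positivity : 0 ≤ L + ε),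
      ← lintegral_indicator_const isClosed_closedBall.measurableSet]
    refine lintegral_mono fun c => ?_
    rcases ((fun P => (P, c)) ⁻¹' A).eq_empty_or_nonempty with hem | ⟨P, hP, hPc⟩
    · rw [hem]; simp
    · have hc : c ∈ closedBall P₀ (L + ε) := by
        have h1 := hSL hP
        have hPc' : ‖c - P‖ ≤ ε / 2 := hPc
        rw [mem_closedBall] at h1 ⊢
        have := dist_triangle c P P₀
        rw [dist_eq_norm c P] at this
        linarith
      rw [Set.indicator_of_mem hc, ← volume_closedBall_three P he]
      refine measure_mono fun P' hP' => ?_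
      obtain ⟨hP', hPc'⟩ := hP'
      rw [mem_closedBall, dist_eq_norm]
      refine h P hP P' hP' ?_
      have e3 : P' - P = (c - P) - (c - P') := by abel
      have hPc1 : ‖c - P‖ ≤ ε / 2 := hPc
      have hPc2 : ‖c - P'‖ ≤ ε / 2 := hPc'
      rw [e3]
      exact (norm_sub_le _ _).trans (by linarith)
  rw [e1, ← ENNReal.ofReal_mul (by positivity)] at e2
  have hε3 : 0 < ε ^ 3 := by positivity
  have e4 : (2 * (L + ε) / ε) ^ 3 * (2 * e) ^ 3 = ((2 * e) ^ 3 * (2 * (L + ε)) ^ 3) / ε ^ 3 := by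
    rw [div_pow]; ring
  rw [e4, ENNReal.ofReal_div_of_pos hε3, ENNReal.le_div_iff_mul_le]
  · exact e2
  · left; simp [hε3]
  · left; simp

/-- The grid cell containing a point. -/
noncomputable def gridCell (κ : ℝ) (z : ℝ × ℝ) : ℤ × ℤ := (⌊z.1 / κ⌋, ⌊z.2 / κ⌋)

/-- The centre of a grid cell. -/
noncomputable def gridCentre (κ : ℝ) (m : ℤ × ℤ) : ℝ × ℝ :=
  (κ * (m.1 + 1 / 2), κ * (m.2 + 1 / 2))

theorem measurable_gridCell (κ : ℝ) : Measurable (gridCell κ) := by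
  unfold gridCell; fun_prop

theorem norm_sub_gridCentre_le {κ : ℝ} (hκ : 0 < κ) (z : ℝ × ℝ) :
    ‖z - gridCentre κ (gridCell κ z)‖ ≤ κ / 2 := by
  have key : ∀ a : ℝ, |a - κ * (⌊a / κ⌋ + 1 / 2)| ≤ κ / 2 := by
    intro a
    have h1 := Int.floor_le (a / κ)
    have h2 := (Int.lt_floor_add_one (a / κ)).le
    rw [le_div_iff₀ hκ] at h1
    rw [div_le_iff₀ hκ] at h2
    rw [abs_le]; constructor <;> linarith
  exact max_le (key z.1) (key z.2)

/-- The grid cells meeting the ball of radius three. -/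
noncomputable def gridIndex (κ : ℝ) : Finset (ℤ × ℤ) :=
  Finset.Icc (-⌈3 / κ⌉) ⌈3 / κ⌉ ×ˢ Finset.Icc (-⌈3 / κ⌉) ⌈3 / κ⌉

theorem gridCell_mem_gridIndex {κ : ℝ} (hκ : 0 < κ) {z : ℝ × ℝ} (hz : ‖z‖ ≤ 3) :
    gridCell κ z ∈ gridIndex κ := by
  have key : ∀ a : ℝ, |a| ≤ 3 → ⌊a / κ⌋ ∈ Finset.Icc (-⌈3 / κ⌉) ⌈3 / κ⌉ := by
    intro a ha
    rw [abs_le] at ha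
    rw [Finset.mem_Icc]
    constructor
    · rw [Int.le_floor]
      push_cast
      have h1 := Int.le_ceil (3 / κ)
      have h2 : -(3 / κ) ≤ a / κ := by rw [← neg_div]; gcongr; exact ha.1
      linarith
    · have h2 : a / κ ≤ 3 / κ := by gcongr; exact ha.2
      exact (Int.floor_le_floor h2).trans (Int.floor_le_ceil _)
  have h1 := (norm_fst_le z).trans hz
  have h2 := (norm_snd_le z).trans hz
  exact Finset.mem_product.2 ⟨key _ h1, key _ h2⟩

theorem card_gridIndex_le {κ : ℝ} (hκ : 0 < κ) (hκ1 : κ ≤ 1) :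
    ((gridIndex κ).card : ℝ) ≤ 81 / κ ^ 2 := by
  have h0 : 0 ≤ ⌈3 / κ⌉ := Int.ceil_nonneg (by positivity)
  have h1 := (Int.ceil_lt_add_one (3 / κ)).le
  have h2 : ((Finset.Icc (-⌈3 / κ⌉) ⌈3 / κ⌉).card : ℝ) ≤ 9 / κ := by
    rw [Int.card_Icc]
    have : (((⌈3 / κ⌉ + 1 - -⌈3 / κ⌉).toNat : ℤ) : ℝ) ≤ 9 / κ := by
      rw [Int.toNat_of_nonneg (by omega)]
      push_cast
      have h3 : 1 ≤ 1 / κ := by rw [le_div_iff₀ hκ]; linarith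
      have e1 : 9 / κ = 2 * (3 / κ) + 3 * (1 / κ) := by ring
      linarith
    exact_mod_cast this
  unfold gridIndex
  rw [Finset.card_product]
  push_cast
  calc _ ≤ 9 / κ * (9 / κ) := by gcongr
    _ = _ := by ring

/-- The parameter set of the thickened circles. -/
def slab : Set ((ℝ × ℝ) × ℝ) := closedBall (0 : ℝ × ℝ) (1 / 8) ×ˢ Set.Icc 1 2

theorem measurableSet_slab : MeasurableSet slab :=
  measurableSet_closedBall.prod measurableSet_Icc

theorem volume_slab_le : volume slab ≤ 1 := by
  rw [slab, Measure.volume_eq_prod, Measure.prod_prod, volume_closedBall_two 0 (by norm_num),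
    Real.volume_Icc, ← ENNReal.ofReal_mul (by norm_num), ENNReal.ofReal_le_one]
  norm_num

theorem measurableSet_thick_gt {φ : ℝ → ℝ} (hφ : IsCutoff φ) (δ l : ℝ) {f : ℝ × ℝ → ℝ}
    (hf : LocData f) : MeasurableSet {P : (ℝ × ℝ) × ℝ | P ∈ slab ∧ l < |thick φ δ f P.1 P.2|} :=
  measurableSet_slab.inter (measurableSet_lt (f := fun _ => l)
    (g := fun P : (ℝ × ℝ) × ℝ => |thick φ δ f P.1 P.2|) measurable_const
    (continuous_thick hφ δ hf).abs.measurable)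

theorem volume_sup_le_volume_slab {φ : ℝ → ℝ} (hφ : IsCutoff φ) {C : ℝ} (hC1 : 1 ≤ C)
    (hC : ∀ v, |deriv φ v| ≤ C) {δ h : ℝ} (hδ : 0 < δ) (hδ' : δ ≤ 1 / 2) (hh : 0 < h)
    (hh1 : h ≤ 1) {f : ℝ × ℝ → ℝ} (hf : LocData f) (hb : ∀ z, |f z| ≤ 1) :
    ENNReal.ofReal (h * δ / (288 * C)) * volume {x | x ∈ closedBall (0 : ℝ × ℝ) (1 / 8) ∧
      ∃ t ∈ Set.Icc (1 : ℝ) 2, h < |thick φ δ f x t|} ≤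
      volume {P | P ∈ slab ∧ h / 2 < |thick φ δ f P.1 P.2|} := by
  set W := {P : (ℝ × ℝ) × ℝ | P ∈ slab ∧ h / 2 < |thick φ δ f P.1 P.2|} with hW
  have hWm : MeasurableSet W := measurableSet_thick_gt hφ δ (h / 2) hf
  set r := h * δ / (288 * C) with hr
  have hr0 : 0 < r := by positivity
  have hr1 : r ≤ 1 / 2 := by
    rw [hr, div_le_iff₀ (by positivity)]
    nlinarith [mul_le_mul hh1 hδ' hδ.le zero_le_one]
  rw [Measure.volume_eq_prod (ℝ × ℝ) ℝ, Measure.prod_apply hWm]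
  refine le_trans (mul_le_mul_right (measure_mono ?_) _)
    (mul_meas_ge_le_lintegral (measurable_measure_prodMk_left hWm) (ENNReal.ofReal r))
  rintro x ⟨hx, t, ht, hlt⟩
  have key : ∀ s ∈ Set.Icc (1 : ℝ) 2, |t - s| ≤ r → (x, s) ∈ W := by
    intro s hs hts
    refine ⟨⟨hx, hs⟩, ?_⟩
    have h1 := abs_thick_sub_le hφ hC hδ hδ' hf hb (x := x) ht hs
    have h2 : 144 * C * 1 / δ * |t - s| ≤ h / 2 := by
      calc 144 * C * 1 / δ * |t - s| ≤ 144 * C * 1 / δ * r := by gcongr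
        _ = h / 2 := by rw [hr]; field_simp; norm_num
    have h3 := abs_sub_abs_le_abs_sub (thick φ δ f x t) (thick φ δ f x s)
    show h / 2 < |thick φ δ f x s|
    linarith
  show ENNReal.ofReal r ≤ volume (Prod.mk x ⁻¹' W)
  rcases le_total t (3 / 2) with h3 | h3
  · have : volume (Set.Icc t (t + r)) = ENNReal.ofReal r := by rw [Real.volume_Icc]; ring_nf
    rw [← this]
    refine measure_mono fun s hs => key s ⟨ht.1.trans hs.1, by linarith [hs.2]⟩ ?_
    rw [abs_le]; constructor <;> linarith [hs.1, hs.2]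
  · have : volume (Set.Icc (t - r) t) = ENNReal.ofReal r := by rw [Real.volume_Icc]; ring_nf
    rw [← this]
    refine measure_mono fun s hs => key s ⟨by linarith [hs.1], hs.2.trans ht.2⟩ ?_
    rw [abs_le]; constructor <;> linarith [hs.1, hs.2]

theorem continuous_thick_left {φ : ℝ → ℝ} (hφ : IsCutoff φ) (δ : ℝ) {f : ℝ × ℝ → ℝ}
    (hf : LocData f) (t : ℝ) : Continuous fun x => thick φ δ f x t := by
  have h := continuous_thick hφ δ hf
  have h2 : Continuous fun x : ℝ × ℝ => (x, t) := by fun_prop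
  have h3 := h.comp h2
  simpa only [Function.comp_def] using h3

theorem exists_thick_slab_weak {η : ℝ → ℝ} (hη : IsCutoff η) {m : ℕ} (hm : 3 ≤ m) :
    ∃ C, 0 < C ∧ ∀ (δ : ℝ) (f : ℝ × ℝ → ℝ) (l : ℝ), 0 < δ → δ ≤ 1 / 2 → LocData f → 0 < l →
      volume {P | P ∈ slab ∧ l < |thick (iteratedDeriv m η) δ f P.1 P.2|} ≤
        ENNReal.ofReal (C * δ / l ^ 2 * ∫ z, f z ^ 2) := by
  obtain ⟨C, hC, h⟩ := exists_thick_sq_fixed hη hm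
  refine ⟨C, hC, fun δ f l hδ hδ' hf hl => ?_⟩
  have hφ := hη.iteratedDeriv m
  set φ := iteratedDeriv m η
  have hI : 0 ≤ ∫ z, f z ^ 2 := integral_nonneg fun z => sq_nonneg _
  have hWm := measurableSet_thick_gt hφ δ l hf
  set W := {P : (ℝ × ℝ) × ℝ | P ∈ slab ∧ l < |thick φ δ f P.1 P.2|} with hW
  rw [Measure.volume_eq_prod (ℝ × ℝ) ℝ, Measure.prod_apply_symm hWm]
  have hslice : ∀ t, volume ((fun x => (x, t)) ⁻¹' W) ≤
      (Set.Icc (1 : ℝ) 2).indicator (fun _ => ENNReal.ofReal (C * δ / l ^ 2 * ∫ z, f z ^ 2)) t := by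
    intro t
    by_cases ht : t ∈ Set.Icc (1 : ℝ) 2
    · rw [Set.indicator_of_mem ht]
      have hc := continuous_thick_left hφ δ hf t
      have hJ : IntegrableOn (fun x => thick φ δ f x t ^ 2) (closedBall (0 : ℝ × ℝ) (1 / 8)) :=
        (hc.pow 2).continuousOn.integrableOn_compact (isCompact_closedBall _ _)
      have hm := mul_meas_ge_le_integral_of_nonneg
        (Eventually.of_forall fun x => sq_nonneg (thick φ δ f x t)) hJ (l ^ 2)
      have hsub : (fun x => (x, t)) ⁻¹' W ⊆
          {x | l ^ 2 ≤ thick φ δ f x t ^ 2} ∩ closedBall 0 (1 / 8) := by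
        rintro x ⟨hx, hlt⟩
        refine ⟨?_, hx.1⟩
        show l ^ 2 ≤ thick φ δ f x t ^ 2
        rw [← sq_abs (thick φ δ f x t)]
        exact pow_le_pow_left₀ hl.le hlt.le 2
      refine (measure_mono hsub).trans ?_
      rw [← Measure.restrict_apply' measurableSet_closedBall]
      have hfin : (volume.restrict (closedBall (0 : ℝ × ℝ) (1 / 8)))
          {x | l ^ 2 ≤ thick φ δ f x t ^ 2} ≠ ⊤ :=
        (lt_of_le_of_lt (measure_mono (Set.subset_univ _)) (by
          rw [Measure.restrict_apply_univ]; exact (isCompact_closedBall _ _).measure_lt_top)).ne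
      refine ENNReal.le_ofReal_iff_toReal_le hfin (by positivity) |>.2 ?_
      rw [div_mul_eq_mul_div, le_div_iff₀ (by positivity), mul_comm]
      exact hm.trans (h δ f t hδ hδ' hf ht)
    · have : (fun x => (x, t)) ⁻¹' W = ∅ := by
        ext x
        simp only [Set.mem_preimage, Set.mem_empty_iff_false, iff_false]
        exact fun hx => ht hx.1.2
      rw [this, measure_empty]; exact zero_le
  refine (lintegral_mono hslice).trans ?_
  rw [lintegral_indicator_const measurableSet_Icc, Real.volume_Icc]
  norm_num

theorem abs_rho_sub_rho_le {P Q : (ℝ × ℝ) × ℝ} (hP : P ∈ slab) (hQ : Q ∈ slab) {z : ℝ × ℝ}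
    (h1 : |z.1 - P.1.1| ≤ 9 / 4) (h2 : |z.2 - P.1.2| ≤ 9 / 4) :
    |rho Q.1 Q.2 z - rho P.1 P.2 z| ≤ 14 * ‖P - Q‖ := by
  have hn1 : |P.1.1 - Q.1.1| ≤ ‖P - Q‖ :=
    (norm_fst_le (P - Q).1).trans (norm_fst_le (P - Q))
  have hn2 : |P.1.2 - Q.1.2| ≤ ‖P - Q‖ :=
    (norm_snd_le (P - Q).1).trans (norm_fst_le (P - Q))
  have hn3 : |P.2 - Q.2| ≤ ‖P - Q‖ := norm_snd_le (P - Q)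
  have p1 : ‖P.1‖ ≤ 1 / 8 := mem_closedBall_zero_iff.1 hP.1
  have q1 : ‖Q.1‖ ≤ 1 / 8 := mem_closedBall_zero_iff.1 hQ.1
  have p11 : |P.1.1| ≤ 1 / 8 := (norm_fst_le P.1).trans p1
  have p12 : |P.1.2| ≤ 1 / 8 := (norm_snd_le P.1).trans p1
  have q11 : |Q.1.1| ≤ 1 / 8 := (norm_fst_le Q.1).trans q1
  have q12 : |Q.1.2| ≤ 1 / 8 := (norm_snd_le Q.1).trans q1
  have p2 := hP.2
  have q2 := hQ.2
  generalize ‖P - Q‖ = r at *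
  have e : rho Q.1 Q.2 z - rho P.1 P.2 z =
      (P.1.1 - Q.1.1) * (2 * (z.1 - P.1.1) + P.1.1 - Q.1.1) +
      (P.1.2 - Q.1.2) * (2 * (z.2 - P.1.2) + P.1.2 - Q.1.2) + (P.2 - Q.2) * (P.2 + Q.2) := by
    unfold rho; ring
  rw [e]
  have b1 : |2 * (z.1 - P.1.1) + P.1.1 - Q.1.1| ≤ 5 := by
    rw [abs_le] at *; constructor <;> linarith
  have b2 : |2 * (z.2 - P.1.2) + P.1.2 - Q.1.2| ≤ 5 := by
    rw [abs_le] at *; constructor <;> linarith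
  have b3 : |P.2 + Q.2| ≤ 4 := by
    rw [abs_le]; constructor <;> linarith [p2.1, p2.2, q2.1, q2.2]
  refine (abs_add_three _ _ _).trans ?_
  rw [abs_mul, abs_mul, abs_mul]
  have r0 : 0 ≤ r := (abs_nonneg _).trans hn1
  have m1 := mul_le_mul hn1 b1 (abs_nonneg _) r0
  have m2 := mul_le_mul hn2 b2 (abs_nonneg _) r0
  have m3 := mul_le_mul hn3 b3 (abs_nonneg _) r0
  linarith

theorem integral_sq_le_of_subset {f : ℝ × ℝ → ℝ} {S : Set (ℝ × ℝ)} {v : ℝ}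
    (hv : 0 ≤ v) (hb : ∀ z, |f z| ≤ 1) (hS : ∀ z, f z ≠ 0 → z ∈ S)
    (hvol : volume S ≤ ENNReal.ofReal v) : ∫ z, f z ^ 2 ≤ v := by
  rw [← setIntegral_eq_integral_of_forall_compl_eq_zero (s := S)]
  · refine (le_abs_self _).trans ?_
    rw [← Real.norm_eq_abs]
    refine (norm_setIntegral_le_of_norm_le_const (C := 1)
      (hvol.trans_lt ENNReal.ofReal_lt_top) ?_).trans ?_
    · intro z _
      rw [Real.norm_eq_abs, abs_pow]
      exact pow_le_one₀ (abs_nonneg _) (hb z)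
    · rw [one_mul]
      exact ENNReal.toReal_le_of_le_ofReal hv hvol
  · intro z hz
    have : f z = 0 := by
      by_contra h
      exact hz (hS z h)
    rw [this]; norm_num

theorem LocData.integral_sq_le {f : ℝ × ℝ → ℝ} (hf : LocData f) (hb : ∀ z, |f z| ≤ 1) :
    ∫ z, f z ^ 2 ≤ 36 := by
  refine integral_sq_le_of_subset (S := closedBall 0 3) (by norm_num) hb ?_ ?_
  · intro z hz
    rw [mem_closedBall_zero_iff]
    by_contra h3
    exact hz (hf.supp z (not_le.1 h3))
  · rw [volume_closedBall_two 0 (by norm_num)]; norm_num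

theorem exists_thick_local_density {η : ℝ → ℝ} (hη : IsCutoff η) {m : ℕ} (hm : 3 ≤ m) :
    ∃ C, 0 < C ∧ ∀ (δ : ℝ) (f : ℝ × ℝ → ℝ) (l r : ℝ) (Q : (ℝ × ℝ) × ℝ), 0 < δ → δ ≤ 1 / 2 →
      LocData f → (∀ z, |f z| ≤ 1) → 0 < l → δ ≤ r → Q ∈ slab →
      volume {P | P ∈ slab ∧ l < |thick (iteratedDeriv m η) δ f P.1 P.2| ∧ ‖P - Q‖ ≤ r} ≤
        ENNReal.ofReal (C * δ * r / l ^ 2) := by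
  obtain ⟨C, hC, h⟩ := exists_thick_slab_weak hη hm
  refine ⟨C * 1080, by positivity, fun δ f l r Q hδ hδ' hf hb hl hr hQ => ?_⟩
  have hφ := hη.iteratedDeriv m
  set φ := iteratedDeriv m η
  set S := {z : ℝ × ℝ | |rho Q.1 Q.2 z| ≤ 15 * r} with hS
  have hSm : MeasurableSet S :=
    measurableSet_le (f := fun z => |rho Q.1 Q.2 z|) (g := fun _ => 15 * r)
      (continuous_rho_right Q.1 Q.2).abs.measurable measurable_const
  have hg : LocData (S.indicator f) := by
    refine hf.of_abs_le (hf.meas.indicator hSm) fun z => ?_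
    by_cases hz : z ∈ S
    · rw [Set.indicator_of_mem hz]
    · rw [Set.indicator_of_notMem hz, abs_zero]; exact abs_nonneg _
  have hgb : ∀ z, |S.indicator f z| ≤ 1 := by
    intro z
    by_cases hz : z ∈ S
    · rw [Set.indicator_of_mem hz]; exact hb z
    · rw [Set.indicator_of_notMem hz, abs_zero]; norm_num
  have hsub : {P : (ℝ × ℝ) × ℝ | P ∈ slab ∧ l < |thick φ δ f P.1 P.2| ∧ ‖P - Q‖ ≤ r} ⊆
      {P | P ∈ slab ∧ l < |thick φ δ (S.indicator f) P.1 P.2|} := by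
    rintro P ⟨hP, hlP, hPQ⟩
    refine ⟨hP, ?_⟩
    have : thick φ δ (S.indicator f) P.1 P.2 = thick φ δ f P.1 P.2 := by
      unfold thick
      congr 1
      refine integral_congr_ae (Eventually.of_forall fun z => ?_)
      show S.indicator f z * _ = f z * _
      by_cases hz : z ∈ S
      · rw [Set.indicator_of_mem hz]
      · rw [Set.indicator_of_notMem hz]
        have : φ (rho P.1 P.2 z / δ) = 0 := by
          refine hφ.zero_of_lt hδ ?_
          by_contra hc
          rw [not_lt] at hc
          obtain ⟨a, b⟩ := mem_ball_of_rho_le hP.2 hδ' hc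
          have h1 := abs_rho_sub_rho_le hP hQ a b
          refine hz ?_
          show |rho Q.1 Q.2 z| ≤ 15 * r
          have h2 := abs_sub_abs_le_abs_sub (rho Q.1 Q.2 z) (rho P.1 P.2 z)
          linarith
        rw [this]; ring
    rw [this]; exact hlP
  refine (measure_mono hsub).trans ((h δ _ l hδ hδ' hg hl).trans (ENNReal.ofReal_le_ofReal ?_))
  have hr0 : 0 < r := hδ.trans_le hr
  have hI : ∫ z, S.indicator f z ^ 2 ≤ 1080 * r := by
    rcases le_or_gt (15 * r) (1 / 2) with h15 | h15
    · refine integral_sq_le_of_subset (S := S) (by positivity) hgb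
        (fun z hz => by_contra fun hn => hz (Set.indicator_of_notMem hn _)) ?_
      refine (volume_annulus_le hQ.2 (by positivity) h15).trans (ENNReal.ofReal_le_ofReal ?_)
      linarith
    · have := hg.integral_sq_le hgb
      linarith
  calc C * δ / l ^ 2 * ∫ z, S.indicator f z ^ 2 ≤ C * δ / l ^ 2 * (1080 * r) := by gcongr
    _ = _ := by ring

theorem LocData.integrable_mul_annulus {f : ℝ × ℝ → ℝ} (hf : LocData f) {φ : ℝ → ℝ}
    (hφ : IsCutoff φ) (δ : ℝ) (x : ℝ × ℝ) (t : ℝ) :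
    Integrable fun z => f z * φ (rho x t z / δ) := by
  obtain ⟨C, _, hC⟩ := hφ.bounded
  exact hf.integrable.mul_bdd (c := C) (measurable_annulus_fun hφ δ x t).aestronglyMeasurable
    (Eventually.of_forall fun z => hC _)

theorem LocData.indicator {f : ℝ × ℝ → ℝ} (hf : LocData f) {S : Set (ℝ × ℝ)}
    (hS : MeasurableSet S) : LocData (S.indicator f) := by
  refine hf.of_abs_le (hf.meas.indicator hS) fun z => ?_
  by_cases hz : z ∈ S
  · rw [Set.indicator_of_mem hz]
  · rw [Set.indicator_of_notMem hz, abs_zero]; exact abs_nonneg _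

theorem abs_indicator_le_one {f : ℝ × ℝ → ℝ} (hb : ∀ z, |f z| ≤ 1) (S : Set (ℝ × ℝ))
    (z : ℝ × ℝ) : |S.indicator f z| ≤ 1 := by
  by_cases hz : z ∈ S
  · rw [Set.indicator_of_mem hz]; exact hb z
  · rw [Set.indicator_of_notMem hz, abs_zero]; norm_num

/-- A thickened circular mean over a small set. -/
theorem abs_thick_le_of_subset {φ : ℝ → ℝ} (hφ : IsCutoff φ) {C : ℝ} (hC : ∀ v, |φ v| ≤ C)
    {δ κ : ℝ} (hδ : 0 < δ) (hδ' : δ ≤ 1 / 2) (hκ : 0 ≤ κ) {f : ℝ × ℝ → ℝ}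
    (hb : ∀ z, |f z| ≤ 1) {a b : ℝ × ℝ}
    (hf : ∀ z, f z ≠ 0 → z ∈ closedBall a κ ∨ z ∈ closedBall b κ) {x : ℝ × ℝ} {t : ℝ}
    (ht : 1 ≤ t) : |thick φ δ f x t| ≤ 32 * C * κ := by
  have hC0 : 0 ≤ C := (abs_nonneg _).trans (hC 0)
  set S := {z : ℝ × ℝ | z ∈ closedBall a κ ∧ |rho x t z| ≤ δ} ∪
    {z : ℝ × ℝ | z ∈ closedBall b κ ∧ |rho x t z| ≤ δ} with hS
  have hvol : volume S ≤ ENNReal.ofReal (32 * δ * κ) := by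
    refine (measure_union_le _ _).trans ((add_le_add (volume_annulus_box_le ht hδ.le hδ' hκ)
      (volume_annulus_box_le ht hδ.le hδ' hκ)).trans ?_)
    rw [← ENNReal.ofReal_add (by positivity) (by positivity)]
    exact ENNReal.ofReal_le_ofReal (by linarith)
  have h1 : |∫ z, f z * φ (rho x t z / δ)| ≤ C * (32 * δ * κ) := by
    rw [← setIntegral_eq_integral_of_forall_compl_eq_zero (s := S)]
    · rw [← Real.norm_eq_abs]
      refine (norm_setIntegral_le_of_norm_le_const (C := C)
        (hvol.trans_lt ENNReal.ofReal_lt_top) ?_).trans ?_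
      · intro z _
        rw [Real.norm_eq_abs, abs_mul]
        calc _ ≤ 1 * C := mul_le_mul (hb z) (hC _) (abs_nonneg _) zero_le_one
          _ = C := one_mul _
      · exact mul_le_mul_of_nonneg_left
          (ENNReal.toReal_le_of_le_ofReal (by positivity) hvol) hC0
    · intro z hz
      by_cases hfz : f z = 0
      · rw [hfz, zero_mul]
      · rw [hφ.zero_of_lt hδ, mul_zero]
        by_contra hr
        rw [not_lt] at hr
        exact hz ((hf z hfz).imp (fun h => ⟨h, hr⟩) fun h => ⟨h, hr⟩)
  unfold thick
  rw [abs_mul, abs_of_pos (inv_pos.2 hδ)]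
  calc _ ≤ δ⁻¹ * (C * (32 * δ * κ)) := by gcongr
    _ = _ := by field_simp

/-- If a thickened mean is large then three pieces of the function in mutually distant grid
cells have large means. -/
theorem exists_three_cells {φ : ℝ → ℝ} (hφ : IsCutoff φ) {C : ℝ} (hC : ∀ v, |φ v| ≤ C)
    {δ κ l : ℝ} (hδ : 0 < δ) (hδ' : δ ≤ 1 / 2) (hκ : 0 < κ) (hκ1 : κ ≤ 1) (hl : 0 ≤ l)
    {f : ℝ × ℝ → ℝ} (hf : LocData f) (hb : ∀ z, |f z| ≤ 1) {x : ℝ × ℝ} {t : ℝ} (ht : 1 ≤ t)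
    (hlt : 81 / κ ^ 2 * l + 128 * C * κ < |thick φ δ f x t|) :
    ∃ c : Fin 3 → ℤ × ℤ, (∀ i, c i ∈ gridIndex κ) ∧
      (∀ i j, i ≠ j → 3 * κ ≤ elen (gridCentre κ (c i) - gridCentre κ (c j))) ∧
      ∀ i, l < |thick φ δ ((gridCell κ ⁻¹' {c i}).indicator f) x t| := by
  by_contra hcon
  push Not at hcon
  set F : ℤ × ℤ → ℝ := fun m => thick φ δ ((gridCell κ ⁻¹' {m}).indicator f) x t with hF
  obtain ⟨a, b, hab⟩ : ∃ a b : ℤ × ℤ, ∀ m ∈ gridIndex κ, l < |F m| →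
      elen (gridCentre κ m - gridCentre κ a) < 3 * κ ∨
        elen (gridCentre κ m - gridCentre κ b) < 3 * κ := by
    by_contra hno
    push Not at hno
    obtain ⟨a, ha, hla, -⟩ := hno 0 0
    obtain ⟨b, hb, hlb, hba, -⟩ := hno a a
    obtain ⟨c, hc, hlc, hca, hcb⟩ := hno a b
    obtain ⟨i, hi⟩ := hcon ![a, b, c] (by
        intro i; fin_cases i
        exacts [ha, hb, hc]) (by
      intro i j hij
      fin_cases i <;> fin_cases j
      · exact absurd rfl hij
      · show _ ≤ elen (gridCentre κ a - gridCentre κ b)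
        rw [elen_sub_comm]; exact hba
      · show _ ≤ elen (gridCentre κ a - gridCentre κ c)
        rw [elen_sub_comm]; exact hca
      · exact hba
      · exact absurd rfl hij
      · show _ ≤ elen (gridCentre κ b - gridCentre κ c)
        rw [elen_sub_comm]; exact hcb
      · exact hca
      · exact hcb
      · exact absurd rfl hij)
    fin_cases i
    · exact absurd hi (not_le.2 hla)
    · exact absurd hi (not_le.2 hlb)
    · exact absurd hi (not_le.2 hlc)
  set near : Set (ℤ × ℤ) := {m | elen (gridCentre κ m - gridCentre κ a) < 3 * κ ∨
        elen (gridCentre κ m - gridCentre κ b) < 3 * κ} with hnear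
  have hnm : MeasurableSet (gridCell κ ⁻¹' near) :=
    measurable_gridCell κ (MeasurableSet.of_discrete)
  have hcm : ∀ m, MeasurableSet (gridCell κ ⁻¹' {m}) := fun m =>
    measurable_gridCell κ (MeasurableSet.of_discrete)
  classical
  set I := (gridIndex κ).filter fun m => m ∉ near with hI
  set g := (gridCell κ ⁻¹' near).indicator f with hg
  have hsum : ∀ z, f z = g z + ∑ m ∈ I, (gridCell κ ⁻¹' {m}).indicator f z := by
    intro z
    by_cases hfz : f z = 0
    · have h0 : ∀ S : Set (ℝ × ℝ), S.indicator f z = 0 := fun S =>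
        Set.indicator_apply_eq_zero.2 fun _ => hfz
      rw [hg, h0, hfz, Finset.sum_eq_zero fun m _ => h0 _, add_zero]
    · have hz3 : ‖z‖ ≤ 3 := by
        by_contra h3
        exact hfz (hf.supp z (not_le.1 h3))
      have hin := gridCell_mem_gridIndex hκ hz3
      by_cases hzn : gridCell κ z ∈ near
      · rw [hg, Set.indicator_of_mem (show z ∈ gridCell κ ⁻¹' near from hzn),
          Finset.sum_eq_zero, add_zero]
        intro m hm
        refine Set.indicator_of_notMem (fun hzm => ?_) _
        have : gridCell κ z = m := hzm
        exact (Finset.mem_filter.1 hm).2 (this ▸ hzn)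
      · rw [hg, Set.indicator_of_notMem (show z ∉ gridCell κ ⁻¹' near from hzn), zero_add,
          Finset.sum_eq_single (gridCell κ z)]
        · exact (Set.indicator_of_mem (show z ∈ gridCell κ ⁻¹' {gridCell κ z} from rfl) f).symm
        · intro m _ hm
          have : z ∉ gridCell κ ⁻¹' {m} := fun hzm => hm (show gridCell κ z = m from hzm).symm
          exact Set.indicator_of_notMem this f
        · intro hn
          exact absurd (Finset.mem_filter.2 ⟨hin, hzn⟩) hn
  have hT : thick φ δ f x t = thick φ δ g x t + ∑ m ∈ I, F m := by
    have e : ∀ z, f z * φ (rho x t z / δ) = g z * φ (rho x t z / δ) +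
        ∑ m ∈ I, (gridCell κ ⁻¹' {m}).indicator f z * φ (rho x t z / δ) := by
      intro z
      rw [← Finset.sum_mul, ← add_mul, ← hsum]
    have i1 := (hf.indicator hnm).integrable_mul_annulus hφ δ x t
    have i2 : ∀ m ∈ I, Integrable fun z =>
        (gridCell κ ⁻¹' {m}).indicator f z * φ (rho x t z / δ) := fun m _ =>
      (hf.indicator (hcm m)).integrable_mul_annulus hφ δ x t
    have e2 : ∫ z, f z * φ (rho x t z / δ) = (∫ z, g z * φ (rho x t z / δ)) +
        ∑ m ∈ I, ∫ z, (gridCell κ ⁻¹' {m}).indicator f z * φ (rho x t z / δ) := by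
      rw [← integral_finsetSum _ i2, ← integral_add i1 (integrable_finsetSum _ i2)]
      exact integral_congr_ae (Eventually.of_forall e)
    show δ⁻¹ * _ = δ⁻¹ * _ + ∑ m ∈ I, δ⁻¹ * _
    rw [e2, mul_add, Finset.mul_sum]
  have h1 : |thick φ δ g x t| ≤ 32 * C * (4 * κ) := by
    refine abs_thick_le_of_subset hφ hC hδ hδ' (by positivity) (abs_indicator_le_one hb _)
      (a := gridCentre κ a) (b := gridCentre κ b) ?_ ht
    intro z hz
    have hzn : gridCell κ z ∈ near := by
      by_contra hn
      exact hz (Set.indicator_of_notMem (show z ∉ gridCell κ ⁻¹' near from hn) f)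
    have hz1 := norm_sub_gridCentre_le hκ z
    have aux : ∀ c, elen (gridCentre κ (gridCell κ z) - gridCentre κ c) < 3 * κ →
        z ∈ closedBall (gridCentre κ c) (4 * κ) := by
      intro c hc
      rw [mem_closedBall, dist_eq_norm]
      have h2 := norm_le_elen (gridCentre κ (gridCell κ z) - gridCentre κ c)
      have h3 := norm_sub_le_norm_sub_add_norm_sub z (gridCentre κ (gridCell κ z))
        (gridCentre κ c)
      linarith
    exact hzn.imp (aux a) (aux b)
  have h2 : |∑ m ∈ I, F m| ≤ 81 / κ ^ 2 * l := by
    refine (Finset.abs_sum_le_sum_abs _ _).trans ?_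
    calc ∑ m ∈ I, |F m| ≤ ∑ m ∈ I, l := by
          refine Finset.sum_le_sum fun m hm => ?_
          obtain ⟨hm1, hm2⟩ := Finset.mem_filter.1 hm
          by_contra hlm
          exact hm2 (hab m hm1 (not_le.1 hlm))
      _ = I.card * l := by rw [Finset.sum_const, nsmul_eq_mul]
      _ ≤ (gridIndex κ).card * l := by
          gcongr
          exact Finset.filter_subset _ _
      _ ≤ _ := by
          gcongr
          exact card_gridIndex_le hκ hκ1
  have h3 := abs_add_le (thick φ δ g x t) (∑ m ∈ I, F m)
  rw [← hT] at h3
  linarith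

/-- Volume of a neighbourhood of a piece of a light cone. -/
theorem volume_lightcone_le (P : (ℝ × ℝ) × ℝ) {r A : ℝ} (hr : 0 ≤ r) (hA : 0 ≤ A) :
    volume {Q : (ℝ × ℝ) × ℝ | elen (P.1 - Q.1) ≤ r ∧ |(elen (P.1 - Q.1) - |P.2 - Q.2|)| ≤ A} ≤
      ENNReal.ofReal (16 * r ^ 2 * A) := by
  have hc : Continuous fun Q : (ℝ × ℝ) × ℝ => elen (P.1 - Q.1) :=
    continuous_elen.comp (by fun_prop)
  set W := {Q : (ℝ × ℝ) × ℝ | elen (P.1 - Q.1) ≤ r ∧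
    |(elen (P.1 - Q.1) - |P.2 - Q.2|)| ≤ A} with hW
  have hWm : MeasurableSet W := by
    refine MeasurableSet.inter (measurableSet_le hc.measurable measurable_const)
      (measurableSet_le (f := fun Q : (ℝ × ℝ) × ℝ => |(elen (P.1 - Q.1) - |P.2 - Q.2|)|)
        (g := fun _ => A) ?_ measurable_const)
    exact (hc.sub (by fun_prop)).abs.measurable
  rw [Measure.volume_eq_prod (ℝ × ℝ) ℝ, Measure.prod_apply hWm]
  have hs : ∀ y, volume (Prod.mk y ⁻¹' W) ≤
      (closedBall P.1 r).indicator (fun _ => ENNReal.ofReal (4 * A)) y := by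
    intro y
    by_cases hy : elen (P.1 - y) ≤ r
    · rw [Set.indicator_of_mem]
      · refine (measure_mono ?_).trans (volume_abs_sub_abs_le (elen (P.1 - y)) P.2 hA)
        exact fun s hs => hs.2
      · rw [mem_closedBall, dist_comm, dist_eq_norm]
        exact (norm_le_elen _).trans hy
    · have : Prod.mk y ⁻¹' W = ∅ := by
        ext s
        simp only [Set.mem_preimage, Set.mem_empty_iff_false, iff_false]
        exact fun h => hy h.1
      rw [this, measure_empty]; exact zero_le
  refine (lintegral_mono hs).trans ?_
  rw [lintegral_indicator_const measurableSet_closedBall, volume_closedBall_two _ hr,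
    ← ENNReal.ofReal_mul (by positivity)]
  exact ENNReal.ofReal_le_ofReal (by linarith [show 4 * A * (2 * r) ^ 2 = 16 * r ^ 2 * A by ring])

/-- Away from tangency the kernel is negligible. -/
theorem exists_kern_tang {η β : ℝ → ℝ} (hη : IsCutoff η) (hβ : IsCutoff β) (m : ℕ) :
    ∃ C, 0 < C ∧ ∀ (δ h : ℝ) (z₀ : ℝ × ℝ) (P Q : (ℝ × ℝ) × ℝ), 0 < δ → δ ≤ 1 / 2 → 0 < h →
      h ≤ 1 / 12 → (1 ≤ Q.2 ∧ Q.2 ≤ 2) → δ / h ^ 12 ≤ elen (P.1 - Q.1) →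
      |(Q.1 - z₀).1| + |(Q.1 - z₀).2| ≤ 8 →
      Tang δ (h ^ 2) (δ / h ^ 2) z₀ P Q ∨
        |kern (iteratedDeriv m η) (wgt β z₀ (h ^ 2)) δ P.1 P.2 Q.1 Q.2| ≤ C * δ * h ^ m := by
  obtain ⟨C, hC, H⟩ := exists_kern_transverse hη hβ m
  refine ⟨C, hC, fun δ h z₀ P Q hδ hδ' hh hh' hQ hR hz₀ => ?_⟩
  by_cases hT : Tang δ (h ^ 2) (δ / h ^ 2) z₀ P Q
  · exact Or.inl hT
  right
  set R := elen (P.1 - Q.1) with hRdef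
  have hR0 : 0 < R := lt_of_lt_of_le (by positivity) hR
  set α := √(δ / h ^ 2 * R) with hα
  have hα0 : 0 < α := Real.sqrt_pos.2 (by positivity)
  have hα2 : α ^ 2 = δ / h ^ 2 * R := Real.sq_sqrt (by positivity)
  set D := α * h / δ with hD
  have hD2 : D ^ 2 = R / δ := by
    rw [hD, div_pow, mul_pow, hα2]; field_simp
  have hD0 : 0 < D := by positivity
  have hDh : 1 ≤ D * h ^ 6 := by
    have : 1 ^ 2 ≤ (D * h ^ 6) ^ 2 := by
      rw [mul_pow, hD2]
      rw [div_le_iff₀ (by positivity)] at hR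
      rw [div_mul_eq_mul_div, le_div_iff₀ hδ]
      calc (1 : ℝ) ^ 2 * δ = δ := by ring
        _ ≤ _ := by rw [← pow_mul]; exact hR
    exact (pow_le_pow_iff_left₀ zero_le_one (by positivity) two_ne_zero).1 this
  have hαD : α * D = R / h := by
    rw [hD, mul_div_assoc', mul_comm α (α * h), mul_right_comm, ← pow_two, hα2]; field_simp
  have hs : δ * D / α = h := by rw [hD]; field_simp
  have h1 : (1 : ℝ) ≤ 1 / h := by rw [le_div_iff₀ hh]; linarith
  have h2 : 144 ≤ D * h ^ 4 := by
    have e : D * h ^ 6 = D * h ^ 4 * h ^ 2 := by ring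
    rw [e] at hDh
    have h3 : h ^ 2 ≤ (1 / 12) ^ 2 := pow_le_pow_left₀ hh.le hh' 2
    have h4 : 0 ≤ D * h ^ 4 := by positivity
    nlinarith only [hDh, h3, h4]
  have key := H δ α (h ^ 2) D z₀ P.1 Q.1 P.2 Q.2 hδ hδ' hα0 (by positivity) ?_ hQ ?_ ?_ ?_
  · rw [hs] at key
    exact key
  · have : h ^ 4 ≤ 1 := pow_le_one₀ hh.le (by linarith)
    nlinarith only [h2, this, hD0]
  · rw [hαD, le_div_iff₀ hh]
    have a := abs_fst_add_abs_snd_sq_le (P.1 - Q.1)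
    rw [nsq_eq_elen, ← hRdef] at a
    have b : |(P.1 - Q.1).1| + |(P.1 - Q.1).2| ≤ 2 * R := by
      refine (pow_le_pow_iff_left₀ (by positivity) (by positivity) two_ne_zero).1 (a.trans ?_)
      nlinarith only [hR0]
    calc _ ≤ 6 * (2 * R) * (1 / 12) := by gcongr
      _ = R := by ring
  · have : (h ^ 2) ^ 2 * D = D * h ^ 4 := by ring
    rw [this]; linarith
  · intro z hz hz1 hz2
    have hzn : nsq (z - z₀) ≤ (h ^ 2) ^ 2 := by
      by_contra hc
      exact hz (wgt_eq_zero hβ (by positivity) (not_le.1 hc))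
    by_contra hc
    refine hT ⟨z, hzn, hz1, hz2, ?_⟩
    rw [← hα2, ← sq_abs (cross _ _)]
    exact pow_le_pow_left₀ (abs_nonneg _) (not_le.1 hc).le 2

/-- Nonvanishing of the kernel forces the radii to be close. -/
theorem norm_sub_le_of_kern_ne_zero {φ : ℝ → ℝ} (hφ : IsCutoff φ) {w : ℝ × ℝ → ℝ} {δ ρ : ℝ}
    (hδ : 0 < δ) (hδ' : δ ≤ 1 / 2) (hδρ : δ ≤ ρ) {P Q : (ℝ × ℝ) × ℝ} (hP : P ∈ slab)
    (hQ : Q ∈ slab) (hR : elen (P.1 - Q.1) ≤ ρ) (hk : kern φ w δ P.1 P.2 Q.1 Q.2 ≠ 0) :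
    ‖Q - P‖ ≤ 6 * ρ := by
  obtain ⟨z, hz1, hz2⟩ : ∃ z, |rho P.1 P.2 z| ≤ δ ∧ |rho Q.1 Q.2 z| ≤ δ := by
    by_contra hno
    push Not at hno
    refine hk ?_
    unfold kern
    rw [← integral_zero (ℝ × ℝ) ℝ]
    refine integral_congr_ae (Eventually.of_forall fun z => ?_)
    show _ * (_ * _) = 0
    rcases le_or_gt |rho P.1 P.2 z| δ with h | h
    · rw [hφ.zero_of_lt hδ (hno z h)]; ring
    · rw [hφ.zero_of_lt hδ h]; ring
  have hn := (norm_le_elen (P.1 - Q.1)).trans hR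
  have hn1 : |P.1.1 - Q.1.1| ≤ ρ := (norm_fst_le (P.1 - Q.1)).trans hn
  have hn2 : |P.1.2 - Q.1.2| ≤ ρ := (norm_snd_le (P.1 - Q.1)).trans hn
  obtain ⟨a1, a2⟩ := mem_ball_of_rho_le hP.2 hδ' hz1
  obtain ⟨b1, b2⟩ := mem_ball_of_rho_le hQ.2 hδ' hz2
  have hρ : 0 ≤ ρ := hδ.le.trans hδρ
  have ht : |P.2 - Q.2| ≤ 6 * ρ := by
    have e : (P.2 - Q.2) * (P.2 + Q.2) = (rho Q.1 Q.2 z - rho P.1 P.2 z) +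
        ((Q.1.1 - P.1.1) * ((z.1 - P.1.1) + (z.1 - Q.1.1)) +
        (Q.1.2 - P.1.2) * ((z.2 - P.1.2) + (z.2 - Q.1.2))) := by
      unfold rho; ring
    have m1 := mul_le_mul hn1 ((abs_add_le _ _).trans (add_le_add a1 b1)) (abs_nonneg _) hρ
    have m2 := mul_le_mul hn2 ((abs_add_le _ _).trans (add_le_add a2 b2)) (abs_nonneg _) hρ
    rw [abs_sub_comm, ← abs_mul] at m1 m2
    have m3 := abs_sub (rho Q.1 Q.2 z) (rho P.1 P.2 z)
    have m4 : |(P.2 - Q.2) * (P.2 + Q.2)| ≤ 12 * ρ := by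
      rw [e]
      refine (abs_add_le _ _).trans ((add_le_add m3 (abs_add_le _ _)).trans ?_)
      linarith
    rw [abs_mul, abs_of_nonneg (by linarith [hP.2.1, hQ.2.1] : 0 ≤ P.2 + Q.2)] at m4
    have := hP.2.1
    have := hQ.2.1
    nlinarith [abs_nonneg (P.2 - Q.2)]
  rw [norm_sub_rev]
  refine max_le ?_ ht
  show ‖P.1 - Q.1‖ ≤ _
  linarith

theorem elen_sub_le_of_slab {P Q : (ℝ × ℝ) × ℝ} (hP : P ∈ slab) (hQ : Q ∈ slab) :
    elen (P.1 - Q.1) ≤ 9 / 25 := by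
  have p1 : ‖P.1‖ ≤ 1 / 8 := mem_closedBall_zero_iff.1 hP.1
  have q1 : ‖Q.1‖ ≤ 1 / 8 := mem_closedBall_zero_iff.1 hQ.1
  have h1 := norm_sub_le P.1 Q.1
  have h2 := nsq_le_norm_sq (P.1 - Q.1)
  rw [nsq_eq_elen] at h2
  have h3 : ‖P.1 - Q.1‖ ^ 2 ≤ (1 / 4) ^ 2 := pow_le_pow_left₀ (norm_nonneg _) (by linarith) 2
  refine (pow_le_pow_iff_left₀ (elen_nonneg _) (by norm_num) two_ne_zero).1 ?_
  linarith

theorem volume_ne_top_of_subset_slab {Ω : Set ((ℝ × ℝ) × ℝ)} (h : Ω ⊆ slab) :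
    volume Ω ≠ ⊤ :=
  ((measure_mono h).trans_lt (volume_slab_le.trans_lt ENNReal.one_lt_top)).ne

/-- Points where the kernel has small total mass are rare in a set of large means. -/
theorem volume_le_of_lintegral_kern_le {φ : ℝ → ℝ} (hφ : IsCutoff φ) {w : ℝ × ℝ → ℝ}
    (hw : Continuous w) (hwi : Integrable w) (hw0 : ∀ z, 0 ≤ w z) {δ : ℝ} (hδ : 0 < δ)
    {f : ℝ × ℝ → ℝ} (hf : LocData f) (hwf : ∀ z, f z ≠ 0 → 1 ≤ w z)
    {Ω B : Set ((ℝ × ℝ) × ℝ)} (hΩs : Ω ⊆ slab) (hB : MeasurableSet B) (hBΩ : B ⊆ Ω) {l e : ℝ}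
    (hl : 0 < l) (he : 0 ≤ e) (hlB : ∀ P ∈ B, l ≤ |thick φ δ f P.1 P.2|)
    (hK : ∀ P ∈ B, ∫⁻ Q in Ω, ENNReal.ofReal |kern φ w δ P.1 P.2 Q.1 Q.2| ≤
      ENNReal.ofReal (e * δ ^ 2)) :
    volume B ≤ ENNReal.ofReal (e * (∫ z, f z ^ 2) / l ^ 2) := by
  have hBfin := volume_ne_top_of_subset_slab (hBΩ.trans hΩs)
  have : IsFiniteMeasure (volume.restrict Ω) :=
    ⟨by rw [Measure.restrict_apply_univ]; exact (volume_ne_top_of_subset_slab hΩs).lt_top⟩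
  obtain ⟨Ca, -, hCa⟩ := hφ.bounded
  obtain ⟨Cf, hCf⟩ := hf.bdd
  have hTm : Measurable fun P : (ℝ × ℝ) × ℝ => thick φ δ f P.1 P.2 :=
    (continuous_thick hφ δ hf).measurable
  have hTi : ∀ P : (ℝ × ℝ) × ℝ, ∫ z, f z * φ (rho P.1 P.2 z / δ) =
      δ * thick φ δ f P.1 P.2 := by
    intro P; unfold thick; field_simp
  set T : (ℝ × ℝ) × ℝ → ℝ := fun P => thick φ δ f P.1 P.2 with hT
  set g : (ℝ × ℝ) × ℝ → ℝ := B.indicator fun P => T P / |T P| with hg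
  have hgm : Measurable g := (hTm.div hTm.abs).indicator hB
  have hg1 : ∀ P, |g P| ≤ 1 := by
    intro P
    by_cases hP : P ∈ B
    · rw [hg, Set.indicator_of_mem hP, abs_div, abs_abs]; exact div_self_le_one _
    · rw [hg, Set.indicator_of_notMem hP, abs_zero]; exact zero_le_one
  have key := sq_integral_le_quadKer (μ := volume.restrict Ω) (ν := (volume : Measure (ℝ × ℝ)))
    (a := fun (P : (ℝ × ℝ) × ℝ) z => φ (rho P.1 P.2 z / δ)) (h := g) (f := f) (w := w)
    (continuous_annulus_fun hφ δ).measurable hgm hf.integrable hf.meas hwi (fun P z => hCa _)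
    hg1 hCf hw0 hwf
  have hKm := measurable_quadKer (volume : Measure (ℝ × ℝ))
    (a := fun (P : (ℝ × ℝ) × ℝ) z => φ (rho P.1 P.2 z / δ))
    (continuous_annulus_fun hφ δ).measurable hw.measurable
  have hK' : ∀ P ∈ B, ∫⁻ Q in Ω, ENNReal.ofReal |quadKer volume
      (fun (P : (ℝ × ℝ) × ℝ) z => φ (rho P.1 P.2 z / δ)) w P Q| ≤ ENNReal.ofReal (e * δ ^ 2) := hK
  set K : (ℝ × ℝ) × ℝ → (ℝ × ℝ) × ℝ → ℝ := quadKer volume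
    (fun (P : (ℝ × ℝ) × ℝ) z => φ (rho P.1 P.2 z / δ)) w with hKd
  have hreal : ∀ c : ℝ, ∫ P in Ω, B.indicator (fun _ => c) P = c * (volume B).toReal := by
    intro c
    rw [integral_indicator_const c hB, measureReal_def, Measure.restrict_apply hB,
      Set.inter_eq_self_of_subset_left hBΩ, smul_eq_mul, mul_comm]
  have hind : ∀ c : ℝ, Integrable (B.indicator fun _ => c) (volume.restrict Ω) :=
    fun c => (integrable_const c).indicator hB
  have hlow : δ * l * (volume B).toReal ≤ ∫ P in Ω, g P * ∫ z, f z * φ (rho P.1 P.2 z / δ) := by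
    rw [← hreal]
    simp_rw [hTi]
    refine integral_mono (hind _) ?_ ?_
    · have hTb : ∀ᵐ P ∂(volume.restrict Ω), |T P| ≤ δ⁻¹ * ((∫ z, |f z|) * Ca) := by
        refine Eventually.of_forall fun P => ?_
        rw [hT]
        unfold thick
        rw [abs_mul, abs_of_pos (inv_pos.2 hδ), ← integral_mul_const]
        gcongr
        rw [← Real.norm_eq_abs]
        refine norm_integral_le_of_norm_le (hf.integrable.abs.mul_const Ca)
          (Eventually.of_forall fun z => ?_)
        rw [Real.norm_eq_abs, abs_mul]
        exact mul_le_mul_of_nonneg_left (hCa _) (abs_nonneg _)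
      refine Integrable.of_bound (C := 1 * (δ * (δ⁻¹ * ((∫ z, |f z|) * Ca))))
        (hgm.mul (hTm.const_mul δ)).aestronglyMeasurable ?_
      filter_upwards [hTb] with P hP
      rw [Real.norm_eq_abs, abs_mul, abs_mul, abs_of_pos hδ]
      exact mul_le_mul (hg1 P) (mul_le_mul_of_nonneg_left hP hδ.le) (by positivity) zero_le_one
    · intro P
      show B.indicator (fun _ => δ * l) P ≤ g P * (δ * T P)
      by_cases hP : P ∈ B
      · have hlP : l ≤ |T P| := hlB P hP
        have hTP : 0 < |T P| := hl.trans_le hlP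
        rw [hg, Set.indicator_of_mem hP, Set.indicator_of_mem hP]
        have : T P / |T P| * (δ * T P) = δ * |T P| := by
          rw [div_mul_eq_mul_div, div_eq_iff hTP.ne', mul_assoc δ, abs_mul_abs_self]; ring
        rw [this]; gcongr
      · rw [hg, Set.indicator_of_notMem hP, Set.indicator_of_notMem hP, zero_mul]
  have hupp : ∫ P in Ω, |g P| * ∫ Q in Ω, |g Q| * |K P Q| ≤ e * δ ^ 2 * (volume B).toReal := by
    rw [← hreal]
    refine integral_mono_of_nonneg (Eventually.of_forall fun P => ?_) (hind _)
      (Eventually.of_forall fun P => ?_)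
    · exact mul_nonneg (abs_nonneg _) (integral_nonneg fun Q => by positivity)
    · show |g P| * _ ≤ B.indicator (fun _ => e * δ ^ 2) P
      by_cases hP : P ∈ B
      · rw [Set.indicator_of_mem hP]
        have hI : ∫ Q in Ω, |g Q| * |K P Q| ≤ e * δ ^ 2 := by
          rw [integral_eq_lintegral_of_nonneg_ae (Eventually.of_forall fun Q => by positivity)]
          · refine ENNReal.toReal_le_of_le_ofReal (by positivity)
              ((lintegral_mono fun Q => ENNReal.ofReal_le_ofReal ?_).trans (hK' P hP))
            exact mul_le_of_le_one_left (abs_nonneg _) (hg1 Q)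
          · exact (hgm.abs.mul (hKm.comp measurable_prodMk_left).abs).aestronglyMeasurable
        calc |g P| * _ ≤ 1 * (e * δ ^ 2) := mul_le_mul (hg1 P) hI
              (integral_nonneg fun Q => by positivity) zero_le_one
          _ = _ := one_mul _
      · rw [Set.indicator_of_notMem hP, hg, Set.indicator_of_notMem hP, abs_zero, zero_mul]
  have hN : 0 ≤ ∫ z, f z ^ 2 := integral_nonneg fun z => sq_nonneg _
  refine (ENNReal.le_ofReal_iff_toReal_le hBfin (by positivity)).2 ?_
  generalize (volume B).toReal = b at *
  rcases le_or_gt b 0 with hb | hb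
  · exact hb.trans (by positivity)
  rw [le_div_iff₀ (by positivity)]
  have h1 := pow_le_pow_left₀ (by positivity) hlow 2
  have h2 := h1.trans (key.trans (mul_le_mul_of_nonneg_left hupp hN))
  have h3 : (δ ^ 2 * b) * (b * l ^ 2) ≤ (δ ^ 2 * b) * (e * ∫ z, f z ^ 2) := by linarith
  exact le_of_mul_le_mul_left h3 (by positivity)

theorem mul_pow_le_pow_of_lt {h c : ℝ} (hh : 0 < h) (hc : 0 ≤ c) (hch : c * h ≤ 1) (hh1 : h ≤ 1)
    {m n : ℕ} (hmn : m < n) : c * h ^ n ≤ h ^ m := by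
  calc c * h ^ n ≤ c * h ^ (m + 1) :=
        mul_le_mul_of_nonneg_left (pow_le_pow_of_le_one hh.le hh1 hmn) hc
    _ = (c * h) * h ^ m := by ring
    _ ≤ _ := mul_le_of_le_one_left (by positivity) hch

theorem measurable_elen_sub (x : ℝ × ℝ) :
    Measurable fun Q : (ℝ × ℝ) × ℝ => elen (x - Q.1) :=
  (continuous_elen.comp (by fun_prop : Continuous fun Q : (ℝ × ℝ) × ℝ => x - Q.1)).measurable

theorem measurableSet_lightcone (P : (ℝ × ℝ) × ℝ) (r A : ℝ) :
    MeasurableSet {Q : (ℝ × ℝ) × ℝ | elen (P.1 - Q.1) ≤ r ∧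
      |(elen (P.1 - Q.1) - |P.2 - Q.2|)| ≤ A} := by
  refine MeasurableSet.inter (measurableSet_le (measurable_elen_sub P.1) measurable_const)
    (measurableSet_le (f := fun Q : (ℝ × ℝ) × ℝ => |(elen (P.1 - Q.1) - |P.2 - Q.2|)|)
      (g := fun _ => A) ?_ measurable_const)
  exact ((measurable_elen_sub P.1).sub (by fun_prop)).abs

theorem lintegral_restrict_indicator_const_le {X : Type*} [MeasurableSpace X] {μ : Measure X}
    {Ω E : Set X} {c v : ℝ} (hc : 0 ≤ c) (hE : μ E ≤ ENNReal.ofReal v) :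
    ∫⁻ Q in Ω, E.indicator (fun _ => ENNReal.ofReal c) Q ∂μ ≤ ENNReal.ofReal (c * v) := by
  refine (lintegral_indicator_const_le _ _).trans ?_
  rw [ENNReal.ofReal_mul hc]
  exact mul_le_mul_right ((Measure.restrict_apply_le _ _).trans hE) _

theorem exists_dyadic_shell {h R : ℝ} {J : ℕ} (h1 : R < 1) (hJ : h ^ (2 * J) ≤ R) :
    ∃ j : Fin J, h ^ (2 * (j : ℕ) + 2) ≤ R ∧ R < h ^ (2 * (j : ℕ)) := by
  by_contra hno
  push Not at hno
  have : ∀ j ≤ J, R < h ^ (2 * j) := by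
    intro j
    induction j with
    | zero => intro _; simpa using h1
    | succ j ih =>
      intro hj
      by_contra hc
      rw [not_lt] at hc
      exact absurd (ih (by omega)) (not_lt.2 (hno ⟨j, by omega⟩ hc))
  exact absurd (this J le_rfl) (not_lt.2 hJ)

/-- A kernel with large mass has a large portion of mass in a tangency shell. -/
theorem exists_tangency_shell {k : (ℝ × ℝ) × ℝ → ℝ} (hk : Measurable k) {A h : ℝ} (hA : 1 ≤ A)
    (hh : 0 < h) (hAh : 10 ^ 9 * A * h ≤ 1) {Ω : Set ((ℝ × ℝ) × ℝ)} (hΩ : MeasurableSet Ω)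
    (hΩs : Ω ⊆ slab) {P : (ℝ × ℝ) × ℝ} (hR : ∀ Q ∈ Ω, elen (P.1 - Q.1) < 1)
    (ha : ∀ Q ∈ Ω, k Q ≤ A * h ^ 1760)
    (hb : ∀ Q ∈ Ω, ∀ n ≤ 450, h ^ (2 * n) ≤ elen (P.1 - Q.1) → k Q ≤ A * h ^ (2640 - n))
    (hc : ∀ Q ∈ Ω, elen (P.1 - Q.1) ≤ h ^ 1748 → k Q ≠ 0 → ‖Q - P‖ ≤ 6 * h ^ 1748)
    (hd : ∀ Q ∈ Ω, h ^ 1748 ≤ elen (P.1 - Q.1) → h ^ 7040 < k Q →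
      |(elen (P.1 - Q.1) - |P.2 - Q.2|)| ≤ 25 * h ^ 1758)
    (hlow : ENNReal.ofReal (h ^ 5313) ≤ ∫⁻ Q in Ω, ENNReal.ofReal (k Q)) :
    ∃ j : Fin 342, ENNReal.ofReal (h ^ (2675 + (j : ℕ))) ≤ volume {Q | Q ∈ Ω ∧ h ^ 7040 < k Q ∧
      h ^ (2 * (j : ℕ) + 2) ≤ elen (P.1 - Q.1) ∧ elen (P.1 - Q.1) < h ^ (2 * (j : ℕ))} := by
  by_contra hno
  push Not at hno
  set T : Fin 342 → Set ((ℝ × ℝ) × ℝ) := fun j => {Q | Q ∈ Ω ∧ h ^ 7040 < k Q ∧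
      h ^ (2 * (j : ℕ) + 2) ≤ elen (P.1 - Q.1) ∧ elen (P.1 - Q.1) < h ^ (2 * (j : ℕ))} with hT
  have hTm : ∀ j, MeasurableSet (T j) := fun j =>
    hΩ.inter ((measurableSet_lt measurable_const hk).inter
      ((measurableSet_le measurable_const (measurable_elen_sub P.1)).inter
        (measurableSet_lt (measurable_elen_sub P.1) measurable_const)))
  set cone : ℝ → Set ((ℝ × ℝ) × ℝ) := fun r => {Q | elen (P.1 - Q.1) ≤ r ∧
    |(elen (P.1 - Q.1) - |P.2 - Q.2|)| ≤ 25 * h ^ 1758} with hcone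
  set E₁ := closedBall P (6 * h ^ 1748) with hE₁
  have hA0 : 0 < A := by linarith
  have hh1 : h ≤ 1 := by nlinarith
  set b : (ℝ × ℝ) × ℝ → ℝ≥0∞ := fun Q => ENNReal.ofReal (h ^ 7040) +
    (E₁.indicator (fun _ => ENNReal.ofReal (A * h ^ 1760)) Q +
    ((cone (h ^ 900)).indicator (fun _ => ENNReal.ofReal (A * h ^ 1760)) Q +
    ((cone (h ^ 684)).indicator (fun _ => ENNReal.ofReal (A * h ^ 2190)) Q +
    ∑ j, (T j).indicator (fun _ => ENNReal.ofReal (A * h ^ (2639 - (j : ℕ)))) Q))) with hbdef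
  have hpt : ∀ Q ∈ Ω, ENNReal.ofReal (k Q) ≤ b Q := by
    intro Q hQ
    rcases le_or_gt (k Q) (h ^ 7040) with h0 | h0
    · exact (ENNReal.ofReal_le_ofReal h0).trans le_self_add
    refine le_trans ?_ le_add_self
    rcases le_or_gt (elen (P.1 - Q.1)) (h ^ 1748) with h1 | h1
    · refine le_trans ?_ le_self_add
      rw [Set.indicator_of_mem]
      · exact ENNReal.ofReal_le_ofReal (ha Q hQ)
      · rw [hE₁, mem_closedBall, dist_eq_norm]
        exact hc Q hQ h1 (lt_of_le_of_lt (by positivity) h0).ne'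
    refine le_trans ?_ le_add_self
    have hcn := hd Q hQ h1.le h0
    rcases le_or_gt (elen (P.1 - Q.1)) (h ^ 900) with h2 | h2
    · refine le_trans ?_ le_self_add
      rw [Set.indicator_of_mem (show Q ∈ cone (h ^ 900) from ⟨h2, hcn⟩)]
      exact ENNReal.ofReal_le_ofReal (ha Q hQ)
    refine le_trans ?_ le_add_self
    rcases le_or_gt (elen (P.1 - Q.1)) (h ^ 684) with h3 | h3
    · refine le_trans ?_ le_self_add
      rw [Set.indicator_of_mem (show Q ∈ cone (h ^ 684) from ⟨h3, hcn⟩)]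
      exact ENNReal.ofReal_le_ofReal (hb Q hQ 450 le_rfl h2.le)
    refine le_trans ?_ le_add_self
    obtain ⟨j, hj1, hj2⟩ := exists_dyadic_shell (J := 342) (hR Q hQ) h3.le
    refine le_trans ?_ (Finset.single_le_sum (fun _ _ => zero_le) (Finset.mem_univ j))
    rw [Set.indicator_of_mem (show Q ∈ T j from ⟨hQ, h0, hj1, hj2⟩)]
    have := hb Q hQ ((j : ℕ) + 1) (by have := j.2; omega) hj1
    rw [show 2640 - ((j : ℕ) + 1) = 2639 - (j : ℕ) by omega] at this
    exact ENNReal.ofReal_le_ofReal this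
  have hIntg : ∫⁻ Q in Ω, b Q ≤ ENNReal.ofReal (h ^ 7040) + (ENNReal.ofReal (1728 * A * h ^ 7004) +
      (ENNReal.ofReal (400 * A * h ^ 5318) + (ENNReal.ofReal (400 * A * h ^ 5316) +
      ENNReal.ofReal (342 * A * h ^ 5314)))) := by
    rw [hbdef, lintegral_add_left (by fun_prop), lintegral_add_left (measurable_const.indicator
      measurableSet_closedBall), lintegral_add_left (measurable_const.indicator
      (measurableSet_lightcone P _ _)), lintegral_add_left (measurable_const.indicator
      (measurableSet_lightcone P _ _)), lintegral_finsetSum _ fun j _ =>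
      measurable_const.indicator (hTm j)]
    gcongr
    · rw [lintegral_const, Measure.restrict_apply_univ]
      exact mul_le_of_le_one_right' ((measure_mono hΩs).trans volume_slab_le)
    · refine (lintegral_restrict_indicator_const_le (by positivity)
        (volume_closedBall_three P (by positivity)).le).trans (ENNReal.ofReal_le_ofReal (le_of_eq
            ?_))
      ring
    · refine (lintegral_restrict_indicator_const_le (by positivity)
        (volume_lightcone_le P (by positivity) (by positivity))).trans
        (ENNReal.ofReal_le_ofReal (le_of_eq ?_))
      ring
    · refine (lintegral_restrict_indicator_const_le (by positivity)
        (volume_lightcone_le P (by positivity) (by positivity))).trans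
        (ENNReal.ofReal_le_ofReal (le_of_eq ?_))
      ring
    · calc _ ≤ ∑ j : Fin 342, ENNReal.ofReal (A * h ^ 5314) := by
            refine Finset.sum_le_sum fun j _ => ?_
            refine (lintegral_restrict_indicator_const_le (by positivity) (hno j).le).trans
              (ENNReal.ofReal_le_ofReal (le_of_eq ?_))
            rw [mul_assoc, ← pow_add]
            congr 2
            have := j.2
            omega
        _ = _ := by
          rw [Finset.sum_const, Finset.card_univ, Fintype.card_fin, nsmul_eq_mul, mul_assoc,
            ENNReal.ofReal_mul (by norm_num : (0 : ℝ) ≤ 342)]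
          norm_num
  have hfin := hlow.trans ((setLIntegral_mono' hΩ hpt).trans hIntg)
  rw [← ENNReal.ofReal_add (by positivity) (by positivity),
    ← ENNReal.ofReal_add (by positivity) (by positivity),
    ← ENNReal.ofReal_add (by positivity) (by positivity),
    ← ENNReal.ofReal_add (by positivity) (by positivity),
    ENNReal.ofReal_le_ofReal_iff (by positivity)] at hfin
  have hp : 0 < h ^ 5313 := by positivity
  have hmono : ∀ n, 5314 ≤ n → h ^ n ≤ h ^ 5314 := fun n hn => pow_le_pow_of_le_one hh.le hh1 hn
  have e1 : h ^ 5314 = h * h ^ 5313 := pow_succ' h 5313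
  have m0 : h ^ 7040 ≤ A * h ^ 5314 :=
    (hmono 7040 (by norm_num)).trans (le_mul_of_one_le_left (by positivity) hA)
  have m1 := mul_le_mul_of_nonneg_left (hmono 7004 (by norm_num)) hA0.le
  have m2 := mul_le_mul_of_nonneg_left (hmono 5318 (by norm_num)) hA0.le
  have m3 := mul_le_mul_of_nonneg_left (hmono 5316 (by norm_num)) hA0.le
  rw [e1] at m0 m1 m2 m3 hfin
  generalize h ^ 5313 = q at *
  generalize h ^ 7040 = q0 at *
  generalize h ^ 7004 = q1 at *
  generalize h ^ 5318 = q2 at *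
  generalize h ^ 5316 = q3 at *
  have h9 : 10 ^ 9 * (A * (h * q)) ≤ q := by
    calc 10 ^ 9 * (A * (h * q)) = (10 ^ 9 * A * h) * q := by ring
      _ ≤ 1 * q := by gcongr
      _ = q := one_mul q
  linarith

theorem Tang.abs_sub_le {δ κ δ₁ : ℝ} {z₀ : ℝ × ℝ} {P Q : (ℝ × ℝ) × ℝ} (h : Tang δ κ δ₁ z₀ P Q)
    (hP : P ∈ slab) (hQ : Q ∈ slab) (hδ : 0 < δ) (hδ' : δ ≤ 1 / 100)
    (hδR : δ ≤ elen (P.1 - Q.1)) (hδ₁ : δ ≤ δ₁) :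
    |(elen (P.1 - Q.1) - |P.2 - Q.2|)| ≤ 25 * δ₁ :=
  abs_sub_le_of_lightcone (hδ.trans_le hδR)
    (h.abs_lightcone_le hP.2 hQ.2 hδ hδ' hδR (elen_sub_le_of_slab hP hQ) hδ₁)

theorem Tang.norm_sub_le {δ κ δ₁ r : ℝ} {z₀ : ℝ × ℝ} {P Q : (ℝ × ℝ) × ℝ} (h : Tang δ κ δ₁ z₀ P Q)
    (hP : P ∈ slab) (hQ : Q ∈ slab) (hδ : 0 < δ) (hδ' : δ ≤ 1 / 100)
    (hδR : δ ≤ elen (P.1 - Q.1)) (hδ₁ : δ ≤ δ₁) (hr : elen (P.1 - Q.1) ≤ r)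
    (hδ₁r : 25 * δ₁ ≤ r) : ‖P - Q‖ ≤ 2 * r := by
  have h1 := h.abs_sub_le hP hQ hδ hδ' hδR hδ₁
  have h2 := (norm_le_elen (P.1 - Q.1)).trans hr
  rw [abs_le] at h1
  have h0 : 0 ≤ r := (elen_nonneg _).trans hr
  refine max_le ?_ ?_
  · show ‖P.1 - Q.1‖ ≤ _
    linarith
  · show |P.2 - Q.2| ≤ _
    linarith [h1.1]

/-- The circles tangent to three given circles at well separated places. -/
theorem volume_three_tang_le {h : ℝ} (hh : 0 < h) (hh9 : 10 ^ 9 * h ≤ 1) {c : Fin 3 → ℝ × ℝ}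
    (hc : ∀ i j, i ≠ j → 3 * h ^ 2 ≤ elen (c i - c j)) {j : Fin 3 → ℕ} (hj : ∀ i, j i < 342)
    {Q : Fin 3 → (ℝ × ℝ) × ℝ} {S : Set ((ℝ × ℝ) × ℝ)} (hSm : MeasurableSet S) (hSs : S ⊆ slab)
    (hQ : ∀ i, Q i ∈ slab)
    (hT : ∀ P ∈ S, ∀ i, Tang (h ^ 1760) (h ^ 2) (h ^ 1758) (c i) P (Q i) ∧
      h ^ (2 * j i + 2) ≤ elen (P.1 - (Q i).1) ∧ elen (P.1 - (Q i).1) < h ^ (2 * j i)) :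
    volume S ≤ ENNReal.ofReal (h ^ 5216) := by
  have hh1 : h ≤ 1 := by linarith
  have hh9' : h ≤ 1 / 10 ^ 9 := by rw [le_div_iff₀ (by norm_num)]; linarith
  have hmono : ∀ {m n : ℕ}, m ≤ n → h ^ n ≤ h ^ m := fun hmn =>
    pow_le_pow_of_le_one hh.le hh1 hmn
  obtain ⟨i₀, hi₀⟩ := Finite.exists_max j
  have hJ := hj i₀
  set J := j i₀ with hJd
  have hδ' : h ^ 1760 ≤ 1 / 100 := (hmono (m := 1) (by norm_num)).trans (by
    rw [pow_one]; linarith)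
  have hδ₁ : h ^ 1760 ≤ h ^ 1758 := hmono (by norm_num)
  have hlocal : ∀ P ∈ S, ∀ P' ∈ S, ‖P' - P‖ ≤ h ^ 10 * h ^ (2 * J) → ‖P' - P‖ ≤ h ^ 1749 := by
    intro P hP P' hP' hε
    have key := norm_sub_le_of_three_tang (P := P) (P' := P') (Q := Q) (c := c) (δ := h ^ 1760)
      (κ := h ^ 2) (δ₁ := h ^ 1758) (ρ := h ^ (2 * J + 2)) (H := 1 / h ^ 2)
      (ε := h ^ 10 * h ^ (2 * J)) (hSs hP).2 (hSs hP').2 (fun i => (hQ i).2) (by positivity)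
      (pow_le_one₀ hh.le hh1) (by positivity) hδ' ?_ hδ₁ (pow_le_one₀ hh.le hh1) ?_ hc ?_ ?_ ?_
      (fun i => (hT P hP i).1) (fun i => (hT P' hP' i).1) hε ?_
    · refine key.trans ?_
      have e : 1000000 / (h ^ 2) ^ 3 * (h ^ 1758 * (1 + 1 / h ^ 2)) =
          1000000 * (h ^ 1752 + h ^ 1750) := by field_simp
      rw [e]
      have h1 : h ^ 1752 ≤ h ^ 1750 := hmono (by norm_num)
      have h2 : 2000000 * h ^ 1750 ≤ h ^ 1749 := mul_pow_le_pow_of_lt hh (by norm_num)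
        (by linarith) hh1 (by norm_num)
      linarith
    · rw [← pow_mul]
      exact mul_pow_le_pow_of_lt hh (by norm_num) (by linarith) hh1 (by norm_num)
    · exact mul_pow_le_pow_of_lt hh (by norm_num) (by linarith) hh1 (by omega)
    · intro i
      exact ⟨(hmono (by have := hi₀ i; omega)).trans (hT P hP i).2.1,
        elen_sub_le_of_slab (hSs hP) (hQ i)⟩
    · intro i
      exact ⟨(hmono (by have := hj i; omega)).trans (hT P' hP' i).2.1,
        elen_sub_le_of_slab (hSs hP') (hQ i)⟩
    · intro i
      refine (hT P' hP' i).2.2.le.trans ?_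
      rw [div_mul_eq_mul_div, one_mul, le_div_iff₀ (by positivity), ← pow_add]
      exact (hT P hP i).2.1
    · have h1 : √(h ^ 1758 / h ^ (2 * J + 2)) ≤ h ^ 8 := by
        refine Real.sqrt_le_iff.2 ⟨by positivity, ?_⟩
        rw [div_le_iff₀ (by positivity), ← pow_mul, ← pow_add]
        exact hmono (by omega)
      have h2 : 6 * (h ^ 10 * h ^ (2 * J)) / h ^ (2 * J + 2) = 6 * h ^ 8 := by
        rw [pow_add h (2 * J) 2]; field_simp
      rw [h2]
      calc 10000 / (h ^ 2) ^ 3 * (120 * √(h ^ 1758 / h ^ (2 * J + 2)) + 6 * h ^ 8)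
          ≤ 10000 / (h ^ 2) ^ 3 * (120 * h ^ 8 + 6 * h ^ 8) := by gcongr
        _ = 1260000 * h ^ 2 := by field_simp; norm_num
        _ ≤ 1260000 * h := by
          have : h ^ 2 ≤ h := by nlinarith
          linarith
        _ ≤ _ := by linarith
  have hsub : S ⊆ closedBall (Q i₀) (2 * h ^ (2 * J)) := by
    intro P hP
    obtain ⟨h1, h2, h3⟩ := hT P hP i₀
    rw [mem_closedBall, dist_eq_norm]
    exact h1.norm_sub_le (hSs hP) (hQ i₀) (by positivity) hδ'
      ((hmono (by omega)).trans h2) hδ₁ h3.le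
      (mul_pow_le_pow_of_lt hh (by norm_num) (by linarith) hh1 (by omega))
  refine (volume_le_of_local_diam hSm (by positivity) (by positivity) (by positivity) hsub
    hlocal).trans (ENNReal.ofReal_le_ofReal ?_)
  have h1 : 2 * (2 * h ^ (2 * J) + h ^ 10 * h ^ (2 * J)) / (h ^ 10 * h ^ (2 * J)) ≤ 6 / h ^ 10 := by
    rw [div_le_div_iff₀ (by positivity) (by positivity)]
    have h2 : h ^ 10 ≤ 1 := pow_le_one₀ hh.le hh1
    have h3 : 0 < h ^ (2 * J) := by positivity
    have h4 : 0 < h ^ 10 := by positivity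
    nlinarith [mul_pos h3 h4, mul_le_mul_of_nonneg_right h2 (mul_pos h3 h4).le]
  calc _ ≤ (6 / h ^ 10) ^ 3 * (2 * h ^ 1749) ^ 3 := by gcongr
    _ = 1728 * h ^ 5217 := by field_simp; norm_num
    _ ≤ h ^ 5216 := mul_pow_le_pow_of_lt hh (by norm_num) (by linarith) hh1 (by norm_num)

/-- Counting points which are tangent to many circles at three separated places. -/
theorem lintegral_three_shells_le {A h : ℝ} (hA : 1 ≤ A) (hh : 0 < h) (hAh : 10 ^ 9 * A * h ≤ 1)
    {c : Fin 3 → ℝ × ℝ} (hc : ∀ i j, i ≠ j → 3 * h ^ 2 ≤ elen (c i - c j)) {j : Fin 3 → ℕ}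
    (hj : ∀ i, j i < 342) {Ω : Set ((ℝ × ℝ) × ℝ)} (hΩs : Ω ⊆ slab)
    (hΩ : MeasurableSet Ω)
    (hD : ∀ Q ∈ Ω, ∀ r, h ^ 1760 ≤ r →
      volume {P | P ∈ Ω ∧ ‖P - Q‖ ≤ r} ≤ ENNReal.ofReal (A * h ^ 1758 * r))
    {T : Fin 3 → Set (((ℝ × ℝ) × ℝ) × ((ℝ × ℝ) × ℝ))} (hTm : ∀ i, MeasurableSet (T i))
    (hT : ∀ i, ∀ q ∈ T i, q.1 ∈ Ω ∧ q.2 ∈ Ω ∧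
      Tang (h ^ 1760) (h ^ 2) (h ^ 1758) (c i) q.1 q.2 ∧
      h ^ (2 * j i + 2) ≤ elen (q.1.1 - q.2.1) ∧ elen (q.1.1 - q.2.1) < h ^ (2 * j i)) :
    ∃ i, ∫⁻ P in Ω, volume (Prod.mk P ⁻¹' T 0) * (volume (Prod.mk P ⁻¹' T 1) *
      volume (Prod.mk P ⁻¹' T 2)) ≤
        ENNReal.ofReal (h ^ 5216) * (volume Ω * (volume Ω * ENNReal.ofReal (h ^ (1757 + 2 * j i))))
        := by
  have hh9 : 10 ^ 9 * h ≤ 1 := by nlinarith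
  have hh1 : h ≤ 1 := by linarith
  have hmono : ∀ {m n : ℕ}, m ≤ n → h ^ n ≤ h ^ m := fun hmn =>
    pow_le_pow_of_le_one hh.le hh1 hmn
  obtain ⟨i₀, hi₀⟩ := Finite.exists_min j
  refine ⟨i₀, ?_⟩
  have : IsFiniteMeasure (volume.restrict Ω) :=
    ⟨by rw [Measure.restrict_apply_univ]; exact (volume_ne_top_of_subset_slab hΩs).lt_top⟩
  have hsl : ∀ i P, volume (Prod.mk P ⁻¹' T i) = volume.restrict Ω (Prod.mk P ⁻¹' T i) :=
    by
      intro i P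
      have hs : Prod.mk P ⁻¹' T i ⊆ Ω := fun Q hQ => (hT i (P, Q) hQ).2.1
      exact (Measure.restrict_eq_self _ hs).symm
  have huniv : volume Ω = volume.restrict Ω Set.univ := by rw [Measure.restrict_apply_univ]
  have hJ := hj i₀
  set J := j i₀ with hJd
  have hδ' : h ^ 1760 ≤ 1 / 100 := (hmono (m := 1) (by norm_num)).trans (by
    rw [pow_one]; linarith)
  have hδ₁ : h ^ 1760 ≤ h ^ 1758 := hmono (by norm_num)
  set U : Set (((ℝ × ℝ) × ℝ) × ((ℝ × ℝ) × ℝ)) :=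
    {q | q.1 ∈ Ω ∧ ‖q.2 - q.1‖ ≤ 4 * h ^ (2 * J)} with hU
  have hUm : MeasurableSet U := by
    have h1 : Measurable fun q : ((ℝ × ℝ) × ℝ) × ((ℝ × ℝ) × ℝ) => ‖q.2 - q.1‖ := by fun_prop
    exact MeasurableSet.inter (measurable_fst hΩ) (measurableSet_le h1 measurable_const)
  have hdist : ∀ i P Q, (P, Q) ∈ T i → ‖P - Q‖ ≤ 2 * h ^ (2 * J) := by
    intro i P Q hPQ
    obtain ⟨a1, a2, a3, a4, a5⟩ := hT i _ hPQ
    have := hj i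
    have := hi₀ i
    exact a3.norm_sub_le (hΩs a1) (hΩs a2) (by positivity) hδ' ((hmono (by omega)).trans a4) hδ₁
      (a5.le.trans (hmono (by omega)))
      (mul_pow_le_pow_of_lt hh (by norm_num) (by linarith) hh1 (by omega))
  simp_rw [hsl]
  rw [huniv]
  refine lintegral_prod_slices_le (U := U) hTm hUm ?_ ?_ ?_
  · intro Q₀ Q₁ Q₂
    set S := {P | (P, Q₀) ∈ T 0 ∧ (P, Q₁) ∈ T 1 ∧ (P, Q₂) ∈ T 2} with hS
    have hSm : MeasurableSet S := by
      refine MeasurableSet.inter ?_ (MeasurableSet.inter ?_ ?_)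
      · exact measurable_prodMk_right (hTm 0)
      · exact measurable_prodMk_right (hTm 1)
      · exact measurable_prodMk_right (hTm 2)
    rcases S.eq_empty_or_nonempty with h0 | ⟨P₀, hP₀⟩
    · rw [h0, measure_empty]; exact zero_le
    refine (Measure.restrict_apply_le _ _).trans ?_
    refine volume_three_tang_le hh hh9 hc hj (Q := ![Q₀, Q₁, Q₂]) hSm
      (fun P hP => hΩs (hT 0 _ hP.1).1) ?_ ?_
    · intro i
      fin_cases i
      · exact hΩs (hT 0 _ hP₀.1).2.1
      · exact hΩs (hT 1 _ hP₀.2.1).2.1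
      · exact hΩs (hT 2 _ hP₀.2.2).2.1
    · intro P hP i
      fin_cases i
      · exact (hT 0 _ hP.1).2.2
      · exact (hT 1 _ hP.2.1).2.2
      · exact (hT 2 _ hP.2.2).2.2
  · intro P Q₀ Q₂ h0 h2
    refine ⟨(hT 0 _ h0).2.1, ?_⟩
    have a := hdist _ _ _ h0
    have b := hdist _ _ _ h2
    show ‖Q₂ - Q₀‖ ≤ _
    have := norm_sub_le_norm_sub_add_norm_sub Q₂ P Q₀
    rw [norm_sub_rev Q₂ P] at this
    linarith
  · intro Q
    rw [Measure.restrict_apply (measurable_prodMk_left hUm)]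
    by_cases hQ : Q ∈ Ω
    · refine (measure_mono (t := {P | P ∈ Ω ∧ ‖P - Q‖ ≤ 4 * h ^ (2 * J)}) ?_).trans
        ((hD Q hQ (4 * h ^ (2 * J)) ?_).trans (ENNReal.ofReal_le_ofReal ?_))
      · exact fun P hP => ⟨hP.2, hP.1.2⟩
      · refine (hmono (m := 2 * J) (by omega)).trans ?_
        have : 0 < h ^ (2 * J) := by positivity
        linarith
      · have e : A * h ^ 1758 * (4 * h ^ (2 * J)) = (4 * A) * h ^ (1758 + 2 * J) := by
          rw [pow_add]; ring
        rw [e]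
        refine mul_pow_le_pow_of_lt hh (by positivity) ?_ hh1 (by omega)
        nlinarith
    · have : Prod.mk Q ⁻¹' U ∩ Ω = ∅ := by
        ext P
        simp only [Set.mem_inter_iff, Set.mem_preimage, Set.mem_empty_iff_false, iff_false]
        exact fun hP => hQ hP.1.1
      rw [this, measure_empty]; exact zero_le

theorem exists_kern_shell {η β : ℝ → ℝ} (hη : IsCutoff η) (hβ : IsCutoff β)
    (hβ01 : ∀ v, 0 ≤ β v ∧ β v ≤ 1) {m : ℕ} (hm : 5281 ≤ m) :
    ∃ A, 1 ≤ A ∧ ∀ (h : ℝ) (z₀ : ℝ × ℝ) (Ω : Set ((ℝ × ℝ) × ℝ)) (P : (ℝ × ℝ) × ℝ), 0 < h →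
      10 ^ 9 * A * h ≤ 1 → MeasurableSet Ω → Ω ⊆ slab → P ∈ slab → ‖z₀‖ ≤ 7 / 2 →
      (∀ Q ∈ Ω, h ^ 1748 ≤ elen (P.1 - Q.1) →
        h ^ 7040 < |kern (iteratedDeriv m η) (wgt β z₀ (h ^ 2)) (h ^ 1760) P.1 P.2 Q.1 Q.2| →
        Tang (h ^ 1760) (h ^ 2) (h ^ 1758) z₀ P Q) ∧
      (ENNReal.ofReal (h ^ 5313) ≤ ∫⁻ Q in Ω, ENNReal.ofReal
        |kern (iteratedDeriv m η) (wgt β z₀ (h ^ 2)) (h ^ 1760) P.1 P.2 Q.1 Q.2| →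
      ∃ j : Fin 342, ENNReal.ofReal (h ^ (2675 + (j : ℕ))) ≤ volume {Q | Q ∈ Ω ∧
        h ^ 7040 < |kern (iteratedDeriv m η) (wgt β z₀ (h ^ 2)) (h ^ 1760) P.1 P.2 Q.1 Q.2| ∧
        h ^ (2 * (j : ℕ) + 2) ≤ elen (P.1 - Q.1) ∧ elen (P.1 - Q.1) < h ^ (2 * (j : ℕ))}) := by
  have hφ := hη.iteratedDeriv m
  obtain ⟨C₀, hC₀, hb₀⟩ := hφ.bounded
  obtain ⟨C₁, hC₁, hK⟩ := exists_kern_tang hη hβ m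
  refine ⟨1 + 96 * C₀ ^ 2 + C₁, by positivity |> fun (_ : (0:ℝ) ≤ 96 * C₀ ^ 2 + C₁) => by linarith,
    ?_⟩
  set A := 1 + 96 * C₀ ^ 2 + C₁ with hAd
  have hA1 : 1 ≤ A := by have : 0 ≤ 96 * C₀ ^ 2 + C₁ := by positivity
                         linarith
  have hAC₀ : 96 * C₀ ^ 2 ≤ A := by linarith
  have hAC₁ : C₁ ≤ A := by have : 0 ≤ C₀ ^ 2 := by positivity
                           linarith
  clear_value A
  intro h z₀ Ω P hh hAh hΩ hΩs hP hz₀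
  have hh9 : 10 ^ 9 * h ≤ 1 := by nlinarith
  have hh1 : h ≤ 1 := by linarith
  have hmono : ∀ {m n : ℕ}, m ≤ n → h ^ n ≤ h ^ m := fun hmn =>
    pow_le_pow_of_le_one hh.le hh1 hmn
  have hδ : 0 < h ^ 1760 := by positivity
  have hδ' : h ^ 1760 ≤ 1 / 100 := (hmono (m := 1) (by norm_num)).trans (by
    rw [pow_one]; linarith)
  have hδ₂ : h ^ 1760 ≤ 1 / 2 := by linarith
  have e12 : h ^ 1760 / h ^ 12 = h ^ 1748 := by
    rw [div_eq_iff (by positivity), ← pow_add]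
  have e2 : h ^ 1760 / h ^ 2 = h ^ 1758 := by
    rw [div_eq_iff (by positivity), ← pow_add]
  have hTang : ∀ Q ∈ Ω, h ^ 1748 ≤ elen (P.1 - Q.1) →
        h ^ 7040 < |kern (iteratedDeriv m η) (wgt β z₀ (h ^ 2)) (h ^ 1760) P.1 P.2 Q.1 Q.2| →
        Tang (h ^ 1760) (h ^ 2) (h ^ 1758) z₀ P Q := by
    intro Q hQ hPQ hk
    have hz1 := (norm_fst_le (Q.1 - z₀)).trans (norm_sub_le Q.1 z₀)
    have hz2 := (norm_snd_le (Q.1 - z₀)).trans (norm_sub_le Q.1 z₀)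
    have hQ1 : ‖Q.1‖ ≤ 1 / 8 := by simpa using (hΩs hQ).1
    rw [Real.norm_eq_abs] at hz1 hz2
    rcases hK (h ^ 1760) h z₀ P Q hδ hδ₂ hh (by linarith) (hΩs hQ).2 (by rwa [e12])
      (by linarith) with h1 | h1
    · rwa [e2] at h1
    · exfalso
      have h2 : C₁ * h ^ 1760 * h ^ m ≤ C₁ * h ^ (1760 + 5281) := by
        rw [mul_assoc, pow_add]
        gcongr ?_ * (?_ * ?_)
        exact hmono hm
      have h3 : C₁ * h ^ (1760 + 5281) ≤ h ^ 7040 := mul_pow_le_pow_of_lt hh hC₁.le (by nlinarith)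
        hh1 (by norm_num)
      linarith
  refine ⟨hTang, fun hlow => ?_⟩
  have hw1 := abs_wgt_le hβ01 z₀ (h ^ 2)
  have hkm : Measurable fun Q : (ℝ × ℝ) × ℝ =>
      |kern (iteratedDeriv m η) (wgt β z₀ (h ^ 2)) (h ^ 1760) P.1 P.2 Q.1 Q.2| :=
    ((measurable_kern hφ (continuous_wgt hβ z₀ (h ^ 2)) (h ^ 1760)).comp measurable_prodMk_left).abs
  refine exists_tangency_shell hkm hA1 hh hAh hΩ hΩs
    (fun Q hQ => (elen_sub_le_of_slab hP (hΩs hQ)).trans_lt (by norm_num)) ?_ ?_ ?_ ?_ hlow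
  · intro Q hQ
    refine (abs_kern_le hφ hb₀ hw1 hδ hδ₂ (hΩs hQ).2).trans ?_
    have : 36 * C₀ ^ 2 ≤ A := by have : 0 ≤ C₀ ^ 2 := by positivity
                                 linarith
    gcongr
  · intro Q hQ n hn hPQ
    have h0 : 0 < h ^ (2 * n) := by positivity
    refine (abs_kern_le_sqrt hφ hb₀ (continuous_wgt hβ z₀ (h ^ 2)) hw1 hδ hδ₂ (hΩs hQ).2 h0
      ?_).trans ?_
    · rw [← elen_sq]; gcongr
    · have h1 : √(h ^ 1760 / h ^ (2 * n)) = h ^ (880 - n) := by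
        rw [Real.sqrt_eq_iff_mul_self_eq (by positivity) (by positivity), div_eq_iff (by
            positivity),
          ← pow_add, ← pow_add]
        congr 1; omega
      have h2 : h ^ (2640 - n) = h ^ 1760 * h ^ (880 - n) := by
        rw [← pow_add]; congr 1; omega
      rw [h1, h2, mul_assoc]
      gcongr
  · intro Q hQ hPQ hk
    exact norm_sub_le_of_kern_ne_zero hφ hδ hδ₂ (hmono (by norm_num)) hP (hΩs hQ) hPQ
      (abs_ne_zero.1 hk)
  · intro Q hQ hPQ hk
    exact (hTang Q hQ hPQ hk).abs_sub_le hP (hΩs hQ) hδ hδ' ((hmono (by norm_num)).trans hPQ)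
      (hmono (by norm_num))

theorem volume_le_of_tangency_shells {A h : ℝ} (hA : 1 ≤ A) (hh : 0 < h) (hAh : 10 ^ 9 * A * h ≤ 1)
    {c : Fin 3 → ℝ × ℝ} (hc : ∀ i j, i ≠ j → 3 * h ^ 2 ≤ elen (c i - c j))
    {Ω : Set ((ℝ × ℝ) × ℝ)} (hΩs : Ω ⊆ slab) (hΩ : MeasurableSet Ω)
    (hΩv : volume Ω ≤ ENNReal.ofReal (h ^ 1757))
    (hD : ∀ Q ∈ Ω, ∀ r, h ^ 1760 ≤ r →
      volume {P | P ∈ Ω ∧ ‖P - Q‖ ≤ r} ≤ ENNReal.ofReal (A * h ^ 1758 * r))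
    {k : Fin 3 → ((ℝ × ℝ) × ℝ) × ((ℝ × ℝ) × ℝ) → ℝ} (hk : ∀ i, Measurable (k i))
    (hT : ∀ i, ∀ P ∈ Ω, ∀ Q ∈ Ω, h ^ 1748 ≤ elen (P.1 - Q.1) → h ^ 7040 < k i (P, Q) →
      Tang (h ^ 1760) (h ^ 2) (h ^ 1758) (c i) P Q)
    {G : Set ((ℝ × ℝ) × ℝ)} (hGΩ : G ⊆ Ω)
    (hG : ∀ P ∈ G, ∀ i, ∃ j : Fin 342, ENNReal.ofReal (h ^ (2675 + (j : ℕ))) ≤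
      volume {Q | Q ∈ Ω ∧ h ^ 7040 < k i (P, Q) ∧
        h ^ (2 * (j : ℕ) + 2) ≤ elen (P.1 - Q.1) ∧ elen (P.1 - Q.1) < h ^ (2 * (j : ℕ))}) :
    volume G ≤ ENNReal.ofReal (h ^ 22) * volume Ω := by
  have hh9 : 10 ^ 9 * h ≤ 1 := by nlinarith
  have hh1 : h ≤ 1 := by linarith
  have hmono : ∀ {m n : ℕ}, m ≤ n → h ^ n ≤ h ^ m := fun hmn =>
    pow_le_pow_of_le_one hh.le hh1 hmn
  set T : (Fin 3 → Fin 342) → Fin 3 → Set (((ℝ × ℝ) × ℝ) × ((ℝ × ℝ) × ℝ)) := fun J i =>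
    {q | q.1 ∈ Ω ∧ q.2 ∈ Ω ∧ h ^ 7040 < k i q ∧ h ^ (2 * (J i : ℕ) + 2) ≤ elen (q.1.1 - q.2.1) ∧
      elen (q.1.1 - q.2.1) < h ^ (2 * (J i : ℕ))} with hTd
  have hel : Measurable fun q : ((ℝ × ℝ) × ℝ) × ((ℝ × ℝ) × ℝ) => elen (q.1.1 - q.2.1) :=
    continuous_elen.measurable.comp (by fun_prop)
  have hTm : ∀ J i, MeasurableSet (T J i) := fun J i =>
    (measurable_fst hΩ).inter ((measurable_snd hΩ).inter
      ((measurableSet_lt measurable_const (hk i)).inter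
        ((measurableSet_le measurable_const hel).inter (measurableSet_lt hel measurable_const))))
  set g : (Fin 3 → Fin 342) → (ℝ × ℝ) × ℝ → ℝ≥0∞ := fun J P =>
    volume (Prod.mk P ⁻¹' T J 0) * (volume (Prod.mk P ⁻¹' T J 1) * volume (Prod.mk P ⁻¹' T J 2))
    with hg
  have hgm : ∀ J, Measurable (g J) := fun J =>
    (measurable_measure_prodMk_left (hTm J 0)).mul
      ((measurable_measure_prodMk_left (hTm J 1)).mul (measurable_measure_prodMk_left (hTm J 2)))
  set E : (Fin 3 → Fin 342) → ℝ≥0∞ := fun J =>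
    ENNReal.ofReal (h ^ (8025 + (J 0 : ℕ) + (J 1 : ℕ) + (J 2 : ℕ))) with hE
  have hcov : G ⊆ ⋃ J, {P | E J ≤ g J P} ∩ Ω := by
    intro P hP
    choose J hJ using hG P hP
    refine Set.mem_iUnion.2 ⟨J, ?_, hGΩ hP⟩
    have hE' : E J = ENNReal.ofReal (h ^ (2675 + (J 0 : ℕ))) *
        (ENNReal.ofReal (h ^ (2675 + (J 1 : ℕ))) * ENNReal.ofReal (h ^ (2675 + (J 2 : ℕ)))) := by
      rw [← ENNReal.ofReal_mul (by positivity), ← ENNReal.ofReal_mul (by positivity), ← pow_add,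
        ← pow_add]
      show ENNReal.ofReal _ = _
      congr 2; omega
    have hsl : ∀ i, ENNReal.ofReal (h ^ (2675 + (J i : ℕ))) ≤ volume (Prod.mk P ⁻¹' T J i) :=
      fun i => (hJ i).trans (measure_mono fun Q hQ => ⟨hGΩ hP, hQ⟩)
    show E J ≤ g J P
    rw [hE']
    exact mul_le_mul' (hsl 0) (mul_le_mul' (hsl 1) (hsl 2))
  have hpiece : ∀ J, volume ({P | E J ≤ g J P} ∩ Ω) ≤ ENNReal.ofReal (h ^ 23) * volume Ω := by
    intro J
    obtain ⟨i, hi⟩ := lintegral_three_shells_le hA hh hAh hc (j := fun i => (J i : ℕ))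
      (fun i => (J i).2) hΩs hΩ hD (hTm J) (by
        intro i q hq
        obtain ⟨a1, a2, a3, a4, a5⟩ := hq
        refine ⟨a1, a2, hT i q.1 a1 q.2 a2 ((hmono ?_).trans a4) a3, a4, a5⟩
        have := (J i).2
        omega)
    have hm := mul_meas_ge_le_lintegral (μ := volume.restrict Ω) (hgm J) (E J)
    rw [Measure.restrict_apply (measurableSet_le measurable_const (hgm J))] at hm
    have hE0 : E J ≠ 0 := by
      simp only [hE, ne_eq, ENNReal.ofReal_eq_zero, not_le]; positivity
    have hEt : E J ≠ ∞ := ENNReal.ofReal_ne_top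
    rw [← ENNReal.mul_le_mul_iff_right hE0 hEt]
    refine hm.trans (hi.trans ?_)
    calc ENNReal.ofReal (h ^ 5216) * (volume Ω *
          (volume Ω * ENNReal.ofReal (h ^ (1757 + 2 * (J i : ℕ)))))
        ≤ ENNReal.ofReal (h ^ 5216) * (volume Ω *
          (ENNReal.ofReal (h ^ 1757) * ENNReal.ofReal (h ^ (1757 + 2 * (J i : ℕ))))) := by
          gcongr
      _ = (ENNReal.ofReal (h ^ 5216) * (ENNReal.ofReal (h ^ 1757) *
          ENNReal.ofReal (h ^ (1757 + 2 * (J i : ℕ))))) * volume Ω := by ring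
      _ = ENNReal.ofReal (h ^ (5216 + (1757 + (1757 + 2 * (J i : ℕ))))) * volume Ω := by
          rw [← ENNReal.ofReal_mul (by positivity), ← ENNReal.ofReal_mul (by positivity),
            ← pow_add, ← pow_add]
      _ ≤ ENNReal.ofReal (h ^ (8025 + (J 0 : ℕ) + (J 1 : ℕ) + (J 2 : ℕ) + 23)) * volume Ω := by
          refine mul_le_mul_left (ENNReal.ofReal_le_ofReal (hmono ?_)) _
          have h0 := (J 0).2
          have h1 := (J 1).2
          have h2 := (J 2).2
          fin_cases i <;> simp <;> omega
      _ = E J * (ENNReal.ofReal (h ^ 23) * volume Ω) := by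
          rw [pow_add _ _ 23, ENNReal.ofReal_mul (by positivity), mul_assoc]
  calc volume G ≤ volume (⋃ J, {P | E J ≤ g J P} ∩ Ω) := measure_mono hcov
    _ ≤ ∑ J, volume ({P | E J ≤ g J P} ∩ Ω) := measure_iUnion_fintype_le _ _
    _ ≤ ∑ _J : Fin 3 → Fin 342, ENNReal.ofReal (h ^ 23) * volume Ω :=
        Finset.sum_le_sum fun J _ => hpiece J
    _ = ENNReal.ofReal (342 ^ 3 * h ^ 23) * volume Ω := by
        rw [Finset.sum_const, Finset.card_univ, Fintype.card_fun, Fintype.card_fin,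
          Fintype.card_fin, nsmul_eq_mul, ENNReal.ofReal_mul (by positivity), mul_assoc]
        congr 1
        norm_num
    _ ≤ _ := by
        refine mul_le_mul_left (ENNReal.ofReal_le_ofReal ?_) _
        exact mul_pow_le_pow_of_lt hh (by norm_num) (by linarith) hh1 (by norm_num)

theorem LocData.integral_sq_mono {f g : ℝ × ℝ → ℝ} (hf : LocData f) (hg : LocData g)
    (h : ∀ z, |g z| ≤ |f z|) : ∫ z, g z ^ 2 ≤ ∫ z, f z ^ 2 :=
  integral_mono hg.sq.integrable hf.sq.integrable fun z => sq_le_sq.2 (h z)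

/-- Three well separated pieces can be simultaneously large only on a small set. -/
theorem exists_thick_three_separated {η : ℝ → ℝ} (hη : IsCutoff η) {m : ℕ} (hm : 5281 ≤ m) :
    ∃ A, 1 ≤ A ∧ ∀ (h : ℝ) (f : ℝ × ℝ → ℝ) (c : Fin 3 → ℝ × ℝ) (g : Fin 3 → ℝ × ℝ → ℝ), 0 < h →
      10 ^ 9 * A * h ≤ 1 → LocData f → (∀ z, |f z| ≤ 1) →
      (∀ i j, i ≠ j → 3 * h ^ 2 ≤ elen (c i - c j)) → (∀ i, ‖c i‖ ≤ 7 / 2) →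
      (∀ i, LocData (g i)) → (∀ i z, |g i z| ≤ |f z|) →
      (∀ i z, g i z ≠ 0 → 2 * nsq (z - c i) ≤ (h ^ 2) ^ 2) →
      volume {P | P ∈ slab ∧ h / 2 < |thick (iteratedDeriv m η) (h ^ 1760) f P.1 P.2| ∧
        ∀ i, h ^ 7 < |thick (iteratedDeriv m η) (h ^ 1760) (g i) P.1 P.2|} ≤
      ENNReal.ofReal (h ^ 1778 * ∫ z, f z ^ 2) := by
  obtain ⟨β, hβ, hβ1, hβ01⟩ := exists_plateau
  have hφ := hη.iteratedDeriv m
  obtain ⟨A₀, hA₀, hshell⟩ := exists_kern_shell hη hβ hβ01 hm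
  obtain ⟨D, hD, hdens⟩ := exists_thick_local_density hη (m := m) (by omega)
  obtain ⟨W, hW, hweak⟩ := exists_thick_slab_weak hη (m := m) (by omega)
  refine ⟨A₀ + 4 * D + 144 * W, by linarith, ?_⟩
  set A := A₀ + 4 * D + 144 * W with hAd
  have hA1 : 1 ≤ A := by linarith
  have hAA₀ : A₀ ≤ A := by linarith
  have hAD : 4 * D ≤ A := by linarith
  have hAW : 144 * W ≤ A := by linarith
  clear_value A
  intro h f c g hh hAh hf hb hc hcn hg hgf hgs
  have hh9 : 10 ^ 9 * h ≤ 1 := by nlinarith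
  have hh1 : h ≤ 1 := by linarith
  have hAh0 : 10 ^ 9 * A₀ * h ≤ 1 := by nlinarith
  have hmono : ∀ {m n : ℕ}, m ≤ n → h ^ n ≤ h ^ m := fun hmn =>
    pow_le_pow_of_le_one hh.le hh1 hmn
  have hδ : 0 < h ^ 1760 := by positivity
  have hδ' : h ^ 1760 ≤ 1 / 2 := (hmono (m := 1) (by norm_num)).trans (by
    rw [pow_one]; linarith)
  set φ := iteratedDeriv m η with hφd
  clear_value φ
  set Ω := {P : (ℝ × ℝ) × ℝ | P ∈ slab ∧ h / 2 < |thick φ (h ^ 1760) f P.1 P.2| ∧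
        ∀ i, h ^ 7 < |thick φ (h ^ 1760) (g i) P.1 P.2|} with hΩd
  have hΩs : Ω ⊆ slab := fun P hP => hP.1
  have hΩm : MeasurableSet Ω := by
    have e : Ω = {P | P ∈ slab ∧ h / 2 < |thick φ (h ^ 1760) f P.1 P.2|} ∩
        ⋂ i, {P | P ∈ slab ∧ h ^ 7 < |thick φ (h ^ 1760) (g i) P.1 P.2|} := by
      ext P
      simp only [hΩd, Set.mem_ofPred_eq, Set.mem_inter_iff, Set.mem_iInter]
      constructor
      · rintro ⟨a, b, d⟩; exact ⟨⟨a, b⟩, fun i => ⟨a, d i⟩⟩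
      · rintro ⟨⟨a, b⟩, d⟩; exact ⟨a, b, fun i => (d i).2⟩
    rw [e]
    exact (measurableSet_thick_gt hφ _ _ hf).inter
      (MeasurableSet.iInter fun i => measurableSet_thick_gt hφ _ _ (hg i))
  set N := ∫ z, f z ^ 2 with hN
  have hN0 : 0 ≤ N := integral_nonneg fun z => sq_nonneg _
  have hN36 : N ≤ 36 := hf.integral_sq_le hb
  by_contra hlt
  rw [not_le] at hlt
  have hfin := volume_ne_top_of_subset_slab hΩs
  have hpos : volume Ω ≠ 0 := (zero_le.trans_lt hlt).ne'
  have hΩv : volume Ω ≤ ENNReal.ofReal (h ^ 1757) := by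
    refine (measure_mono fun P hP => (⟨hP.1, hP.2.1⟩ :
      P ∈ slab ∧ h / 2 < |thick φ (h ^ 1760) f P.1 P.2|)).trans
      ((hweak (h ^ 1760) f (h / 2) hδ hδ' hf (by positivity)).trans (ENNReal.ofReal_le_ofReal ?_))
    have e : W * h ^ 1760 / (h / 2) ^ 2 = 4 * W * h ^ 1758 := by
      field_simp; ring
    rw [e]
    calc 4 * W * h ^ 1758 * N ≤ 4 * W * h ^ 1758 * 36 := by gcongr
      _ = 144 * W * h ^ 1758 := by ring
      _ ≤ h ^ 1757 := mul_pow_le_pow_of_lt hh (by positivity) (by nlinarith) hh1 (by norm_num)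
  have hDΩ : ∀ Q ∈ Ω, ∀ r, h ^ 1760 ≤ r →
      volume {P | P ∈ Ω ∧ ‖P - Q‖ ≤ r} ≤ ENNReal.ofReal (A * h ^ 1758 * r) := by
    intro Q hQ r hr
    refine (measure_mono fun P hP => (⟨hP.1.1, hP.1.2.1, hP.2⟩ :
      P ∈ slab ∧ h / 2 < |thick φ (h ^ 1760) f P.1 P.2| ∧ ‖P - Q‖ ≤ r)).trans
      ((hdens (h ^ 1760) f (h / 2) r Q hδ hδ' hf hb (by positivity) hr hQ.1).trans
      (ENNReal.ofReal_le_ofReal ?_))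
    have e : D * h ^ 1760 * r / (h / 2) ^ 2 = 4 * D * h ^ 1758 * r := by
      field_simp; ring
    have hr0 := hδ.le.trans hr
    rw [e]
    gcongr
  set k : Fin 3 → ((ℝ × ℝ) × ℝ) × ((ℝ × ℝ) × ℝ) → ℝ := fun i q =>
    |kern φ (wgt β (c i) (h ^ 2)) (h ^ 1760) q.1.1 q.1.2 q.2.1 q.2.2| with hk
  have hkm : ∀ i, Measurable (k i) := fun i =>
    (measurable_kern hφ (continuous_wgt hβ (c i) (h ^ 2)) (h ^ 1760)).abs
  set I : Fin 3 → (ℝ × ℝ) × ℝ → ℝ≥0∞ := fun i P =>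
    ∫⁻ Q in Ω, ENNReal.ofReal (k i (P, Q)) with hI
  have hIm : ∀ i, Measurable (I i) := fun i =>
    Measurable.lintegral_prod_right' (f := fun q => ENNReal.ofReal (k i q)) (hkm i).ennreal_ofReal
  set B : Fin 3 → Set ((ℝ × ℝ) × ℝ) := fun i => Ω ∩ {P | I i P < ENNReal.ofReal (h ^ 5313)} with hB
  have hBm : ∀ i, MeasurableSet (B i) := fun i =>
    hΩm.inter (measurableSet_lt (hIm i) measurable_const)
  have hBv : ∀ i, volume (B i) ≤ ENNReal.ofReal h * volume Ω := by
    intro i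
    have h1 := volume_le_of_lintegral_kern_le hφ (continuous_wgt hβ (c i) (h ^ 2))
      (integrable_wgt hβ (c i) (by positivity)) (fun z => (hβ01 _).1) hδ (hg i)
      (fun z hz => (wgt_eq_one hβ1 (by positivity) (hgs i z hz)).ge) hΩs (hBm i)
      Set.inter_subset_left (l := h ^ 7) (e := h ^ 1793) (by positivity) (by positivity)
      (fun P hP => (hP.1.2.2 i).le) (fun P hP => by
        have e : h ^ 1793 * (h ^ 1760) ^ 2 = h ^ 5313 := by
          rw [← pow_mul, ← pow_add]
        rw [e]
        exact (show I i P < ENNReal.ofReal (h ^ 5313) from hP.2).le)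
    refine h1.trans ?_
    have h2 : h ^ 1793 * (∫ z, g i z ^ 2) / (h ^ 7) ^ 2 ≤ h * (h ^ 1778 * N) := by
      have h3 : ∫ z, g i z ^ 2 ≤ N := hf.integral_sq_mono (hg i) (hgf i)
      rw [div_le_iff₀ (by positivity)]
      calc h ^ 1793 * (∫ z, g i z ^ 2) ≤ h ^ 1793 * N := by gcongr
        _ = h * (h ^ 1778 * N) * (h ^ 7) ^ 2 := by ring
    refine (ENNReal.ofReal_le_ofReal h2).trans ?_
    rw [ENNReal.ofReal_mul hh.le]
    exact mul_le_mul_right hlt.le _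
  set G := Ω \ ⋃ i, B i with hG
  have hGv : volume G ≤ ENNReal.ofReal (h ^ 22) * volume Ω := by
    refine volume_le_of_tangency_shells hA1 hh hAh hc hΩs hΩm hΩv hDΩ hkm ?_ Set.sdiff_subset ?_
    · intro i P hP Q hQ
      exact (hshell h (c i) Ω P hh hAh0 hΩm hΩs (hΩs hP) (hcn i)).1 Q hQ
    · intro P hP i
      refine (hshell h (c i) Ω P hh hAh0 hΩm hΩs (hΩs hP.1) (hcn i)).2 ?_
      by_contra hcon
      exact hP.2 (Set.mem_iUnion.2 ⟨i, hP.1, not_le.1 hcon⟩)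
  have hcover : Ω ⊆ G ∪ ⋃ i, B i := fun P hP => by
    by_cases h1 : P ∈ ⋃ i, B i
    · exact Or.inr h1
    · exact Or.inl ⟨hP, h1⟩
  have htot : volume Ω ≤ ENNReal.ofReal (4 * h) * volume Ω := by
    calc volume Ω ≤ volume G + volume (⋃ i, B i) :=
          (measure_mono hcover).trans (measure_union_le _ _)
      _ ≤ ENNReal.ofReal (h ^ 22) * volume Ω + ∑ _i : Fin 3, ENNReal.ofReal h * volume Ω :=
          add_le_add hGv ((measure_iUnion_fintype_le _ _).trans
            (Finset.sum_le_sum fun i _ => hBv i))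
      _ ≤ ENNReal.ofReal h * volume Ω + ∑ _i : Fin 3, ENNReal.ofReal h * volume Ω := by
          have := hmono (m := 1) (n := 22) (by norm_num)
          rw [pow_one] at this
          gcongr
      _ = ENNReal.ofReal (4 * h) * volume Ω := by
          rw [Finset.sum_const, Finset.card_univ, Fintype.card_fin, nsmul_eq_mul,
            ENNReal.ofReal_mul (by norm_num)]
          norm_num
          ring
  have hlt1 : ENNReal.ofReal (4 * h) * volume Ω < 1 * volume Ω := by
    refine (ENNReal.mul_lt_mul_iff_left hpos hfin).2 ?_
    rw [← ENNReal.ofReal_one]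
    exact (ENNReal.ofReal_lt_ofReal_iff (by norm_num)).2 (by linarith)
  rw [one_mul] at hlt1
  exact absurd htot (not_le.2 hlt1)

theorem norm_gridCentre_le {κ : ℝ} (hκ : 0 < κ) (hκ1 : κ ≤ 1 / 3) {m : ℤ × ℤ}
    (hm : m ∈ gridIndex κ) : ‖gridCentre κ m‖ ≤ 7 / 2 := by
  have key : ∀ a : ℤ, a ∈ Finset.Icc (-⌈3 / κ⌉) ⌈3 / κ⌉ → |κ * ((a : ℝ) + 1 / 2)| ≤ 7 / 2 := by
    intro a ha
    obtain ⟨h1, h2⟩ := Finset.mem_Icc.1 ha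
    have h3 : (⌈3 / κ⌉ : ℝ) < 3 / κ + 1 := Int.ceil_lt_add_one _
    have h4 : (a : ℝ) ≤ (⌈3 / κ⌉ : ℝ) := by exact_mod_cast h2
    have h5 : -(⌈3 / κ⌉ : ℝ) ≤ (a : ℝ) := by exact_mod_cast h1
    have h6 : κ * (3 / κ) = 3 := by field_simp
    rw [abs_le]
    constructor <;> nlinarith
  obtain ⟨h1, h2⟩ := Finset.mem_product.1 hm
  exact max_le (key _ h1) (key _ h2)

/-- For functions bounded by one, the maximal function is small outside a very small set. -/
theorem exists_thick_sup_small {η : ℝ → ℝ} (hη : IsCutoff η) {m : ℕ} (hm : 5281 ≤ m) :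
    ∃ A, 1 ≤ A ∧ ∀ (h : ℝ) (f : ℝ × ℝ → ℝ), 0 < h → 10 ^ 9 * A * h ≤ 1 → LocData f →
      (∀ z, |f z| ≤ 1) →
      volume {x | x ∈ closedBall (0 : ℝ × ℝ) (1 / 8) ∧ ∃ t ∈ Set.Icc (1 : ℝ) 2,
        h < |thick (iteratedDeriv m η) (h ^ 1760) f x t|} ≤ ENNReal.ofReal (h * ∫ z, f z ^ 2) := by
  have hφ := hη.iteratedDeriv m
  obtain ⟨A₀, hA₀, hthree⟩ := exists_thick_three_separated hη hm
  obtain ⟨C₀, hC₀, hb₀⟩ := hφ.bounded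
  obtain ⟨C₁, hC₁, hb₁⟩ := hφ.deriv.bounded
  refine ⟨A₀ + C₀ + C₁ + 1, by linarith, ?_⟩
  set A := A₀ + C₀ + C₁ + 1 with hAd
  have hAA₀ : A₀ ≤ A := by linarith
  have hA1 : 1 ≤ A := by linarith
  have hAC₀ : C₀ ≤ A := by linarith
  have hAC₁ : C₁ + 1 ≤ A := by linarith
  clear_value A
  set φ := iteratedDeriv m η with hφd
  clear_value φ
  intro h f hh hAh hf hb
  have hh9 : 10 ^ 9 * h ≤ 1 := by nlinarith
  have hh1 : h ≤ 1 := by linarith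
  have hAh0 : 10 ^ 9 * A₀ * h ≤ 1 := by nlinarith
  have hmono : ∀ {m n : ℕ}, m ≤ n → h ^ n ≤ h ^ m := fun hmn =>
    pow_le_pow_of_le_one hh.le hh1 hmn
  have hδ : 0 < h ^ 1760 := by positivity
  have hδ' : h ^ 1760 ≤ 1 / 2 := (hmono (m := 1) (by norm_num)).trans (by
    rw [pow_one]; linarith)
  have hκ : 0 < h ^ 2 := by positivity
  have hκ1 : h ^ 2 ≤ 1 / 3 := (hmono (m := 1) (by norm_num)).trans (by rw [pow_one]; linarith)
  set N := ∫ z, f z ^ 2 with hN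
  have hN0 : 0 ≤ N := integral_nonneg fun z => sq_nonneg _
  set Ω : (Fin 3 → ℤ × ℤ) → Set ((ℝ × ℝ) × ℝ) := fun c => {P | P ∈ slab ∧
    h / 2 < |thick φ (h ^ 1760) f P.1 P.2| ∧
    ∀ i, h ^ 7 < |thick φ (h ^ 1760) ((gridCell (h ^ 2) ⁻¹' {c i}).indicator f) P.1 P.2|} with hΩ
  set I := (Fintype.piFinset fun _ : Fin 3 => gridIndex (h ^ 2)).filter fun c =>
    ∀ i j, i ≠ j → 3 * h ^ 2 ≤ elen (gridCentre (h ^ 2) (c i) - gridCentre (h ^ 2) (c j)) with hI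
  have hcov : {P | P ∈ slab ∧ h / 2 < |thick φ (h ^ 1760) f P.1 P.2|} ⊆ ⋃ c ∈ I, Ω c := by
    intro P hP
    obtain ⟨c, c1, c2, c3⟩ := exists_three_cells hφ hb₀ hδ hδ' hκ (by linarith)
      (l := h ^ 7) (by positivity) hf hb hP.1.2.1 (x := P.1) (t := P.2) (by
        refine lt_of_le_of_lt ?_ hP.2
        have e : 81 / (h ^ 2) ^ 2 * h ^ 7 = 81 * h ^ 3 := by field_simp
        rw [e]
        have h3 : h ^ 3 ≤ h * h := by have := hmono (m := 2) (n := 3) (by norm_num); nlinarith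
        have h2 : h ^ 2 = h * h := sq h
        have h4 : C₀ * h ≤ 1 / 10 ^ 9 := by rw [le_div_iff₀ (by norm_num)]; nlinarith
        rw [h2]
        nlinarith)
    refine Set.mem_iUnion₂.2 ⟨c, Finset.mem_filter.2 ⟨Fintype.mem_piFinset.2 c1, c2⟩, ?_⟩
    exact ⟨hP.1, hP.2, c3⟩
  have hpiece : ∀ c ∈ I, volume (Ω c) ≤ ENNReal.ofReal (h ^ 1778 * N) := by
    intro c hc
    obtain ⟨c1, c2⟩ := Finset.mem_filter.1 hc
    have c1' := Fintype.mem_piFinset.1 c1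
    refine hthree h f (fun i => gridCentre (h ^ 2) (c i))
      (fun i => (gridCell (h ^ 2) ⁻¹' {c i}).indicator f) hh hAh0 hf hb c2
      (fun i => norm_gridCentre_le hκ hκ1 (c1' i))
      (fun i => hf.indicator (measurable_gridCell _ (measurableSet_singleton _))) ?_ ?_
    · intro i z
      by_cases hz : z ∈ gridCell (h ^ 2) ⁻¹' {c i}
      · rw [Set.indicator_of_mem hz]
      · rw [Set.indicator_of_notMem hz, abs_zero]; exact abs_nonneg _
    · intro i z hz
      have hz' := Set.mem_of_indicator_ne_zero hz
      have h1 := norm_sub_gridCentre_le hκ z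
      rw [show gridCell (h ^ 2) z = c i from hz'] at h1
      have h2 := nsq_le_norm_sq (z - gridCentre (h ^ 2) (c i))
      have h3 : ‖z - gridCentre (h ^ 2) (c i)‖ ^ 2 ≤ (h ^ 2 / 2) ^ 2 := by gcongr
      linarith
  have hcard : (I.card : ℝ) ≤ (81 / (h ^ 2) ^ 2) ^ 3 := by
    have h1 : I.card ≤ (gridIndex (h ^ 2)).card ^ 3 := by
      refine (Finset.card_filter_le _ _).trans ?_
      rw [Fintype.card_piFinset]
      simp
    calc (I.card : ℝ) ≤ ((gridIndex (h ^ 2)).card : ℝ) ^ 3 := by exact_mod_cast h1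
      _ ≤ _ := by gcongr; exact card_gridIndex_le hκ (by linarith)
  have hslab : volume {P | P ∈ slab ∧ h / 2 < |thick φ (h ^ 1760) f P.1 P.2|} ≤
      ENNReal.ofReal (531441 * h ^ 1766 * N) := by
    calc _ ≤ ∑ c ∈ I, volume (Ω c) := (measure_mono hcov).trans (measure_biUnion_finset_le _ _)
      _ ≤ ∑ _c ∈ I, ENNReal.ofReal (h ^ 1778 * N) := Finset.sum_le_sum hpiece
      _ = ENNReal.ofReal (I.card * (h ^ 1778 * N)) := by
          rw [Finset.sum_const, nsmul_eq_mul, ENNReal.ofReal_mul (Nat.cast_nonneg _),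
            ENNReal.ofReal_natCast]
      _ ≤ _ := by
          refine ENNReal.ofReal_le_ofReal ?_
          have e1 : (81 / (h ^ 2) ^ 2) ^ 3 * h ^ 12 = 531441 := by field_simp; norm_num
          have e2 : h ^ 1778 = h ^ 12 * h ^ 1766 := by rw [← pow_add]
          have e3 : 0 ≤ h ^ 1778 * N := mul_nonneg (pow_nonneg hh.le _) hN0
          refine (mul_le_mul_of_nonneg_right hcard e3).trans_eq ?_
          rw [e2, ← e1]
          generalize h ^ 1766 = y
          ring
  have hsup := volume_sup_le_volume_slab hφ (C := C₁ + 1) (by linarith)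
    (fun v => (hb₁ v).trans (by linarith)) hδ hδ' hh hh1 hf hb
  have hc0 : ENNReal.ofReal (h * h ^ 1760 / (288 * (C₁ + 1))) ≠ 0 := by
    simp only [ne_eq, ENNReal.ofReal_eq_zero, not_le]; positivity
  rw [← ENNReal.mul_le_mul_iff_right hc0 ENNReal.ofReal_ne_top]
  refine (hsup.trans hslab).trans ?_
  rw [← ENNReal.ofReal_mul (by positivity)]
  refine ENNReal.ofReal_le_ofReal ?_
  have h1 : 531441 * (288 * (C₁ + 1)) * h ^ 1766 ≤ h ^ 1762 :=
    mul_pow_le_pow_of_lt hh (by positivity) (by nlinarith) hh1 (by norm_num)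
  have h2 : h * h ^ 1760 / (288 * (C₁ + 1)) * (h * N) = h ^ 1762 * N / (288 * (C₁ + 1)) := by
    rw [show h ^ 1762 = h * h ^ 1760 * h by ring]; ring
  rw [h2, le_div_iff₀ (by positivity)]
  calc 531441 * h ^ 1766 * N * (288 * (C₁ + 1))
      = 531441 * (288 * (C₁ + 1)) * h ^ 1766 * N := by ring
    _ ≤ _ := by gcongr

theorem lintegral_weighted_tail {f : ℝ × ℝ → ℝ} (hf : Measurable f) {p c : ℝ} (hp : 2 < p)
    (hc : 0 < c) :
    ∫⁻ t in Set.Ioi (0 : ℝ), volume.withDensity (fun z => ENNReal.ofReal (f z ^ 2))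
        {z | t < |f z| / c} * ENNReal.ofReal (t ^ (p - 2 - 1)) =
      ENNReal.ofReal (c ^ (2 - p) / (p - 2)) * ∫⁻ z, ENNReal.ofReal (|f z| ^ p) := by
  have hp2 : 0 < p - 2 := by linarith
  have hm : Measurable fun z => |f z| / c := hf.abs.div_const c
  have h1 := lintegral_rpow_eq_lintegral_meas_lt_mul
    (volume.withDensity fun z => ENNReal.ofReal (f z ^ 2)) (f := fun z => |f z| / c)
    (Eventually.of_forall fun z => by positivity) hm.aemeasurable hp2
  have h2 : ∫⁻ z, ENNReal.ofReal ((|f z| / c) ^ (p - 2))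
      ∂(volume.withDensity fun z => ENNReal.ofReal (f z ^ 2)) =
      ENNReal.ofReal (c ^ (2 - p)) * ∫⁻ z, ENNReal.ofReal (|f z| ^ p) := by
    rw [lintegral_withDensity_eq_lintegral_mul _ (hf.pow_const 2).ennreal_ofReal
      (hm.pow_const _).ennreal_ofReal, ← lintegral_const_mul _ (hf.abs.pow_const p).ennreal_ofReal]
    refine lintegral_congr fun z => ?_
    simp only [Pi.mul_apply]
    rw [← ENNReal.ofReal_mul (by positivity), ← ENNReal.ofReal_mul (by positivity)]
    congr 1
    rw [Real.div_rpow (abs_nonneg _) hc.le, show 2 - p = -(p - 2) by ring, Real.rpow_neg hc.le,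
      ← sq_abs, ← Real.rpow_natCast, div_eq_mul_inv, ← mul_assoc,
      ← Real.rpow_add_of_nonneg (abs_nonneg _) (by norm_num) hp2.le]
    rw [mul_comm]; congr 2; push_cast; ring
  rw [h2] at h1
  have h0 : ENNReal.ofReal (p - 2) ≠ 0 := by simpa using hp
  rw [← ENNReal.mul_right_inj h0 ENNReal.ofReal_ne_top, ← h1, ← mul_assoc,
    ← ENNReal.ofReal_mul hp2.le]
  congr 2
  field_simp

/-- A Marcinkiewicz type interpolation lemma. -/
theorem lintegral_rpow_le_of_weak {μ : Measure (ℝ × ℝ)} {G f : ℝ × ℝ → ℝ} (hG : Measurable G)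
    (hG0 : ∀ x, 0 ≤ G x) (hf : Measurable f) {p a b c L : ℝ} (hp : 2 < p) (ha : 0 ≤ a) (hb : 0 ≤ b)
    (hc : 0 < c) (hL : 0 < L)
    (h : ∀ l, 0 < l → μ {x | l < G x} ≤ ENNReal.ofReal (l ^ (-2 : ℝ)) *
      (ENNReal.ofReal a * volume.withDensity (fun z => ENNReal.ofReal (f z ^ 2)) {z | l < |f z| /
          c} +
      ENNReal.ofReal b *
        volume.withDensity (fun z => ENNReal.ofReal (f z ^ 2)) {z | l < |f z| / L})) :
    ∫⁻ x, ENNReal.ofReal (G x ^ p) ∂μ ≤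
      ENNReal.ofReal (p / (p - 2) * (a * c ^ (2 - p) + b * L ^ (2 - p))) *
        ∫⁻ z, ENNReal.ofReal (|f z| ^ p) := by
  have hp2 : 0 < p - 2 := by linarith
  set ν := volume.withDensity (fun z => ENNReal.ofReal (f z ^ 2)) with hν
  have hmeas : ∀ c : ℝ, Measurable fun t : ℝ => ν {z | t < |f z| / c} := fun c =>
    Antitone.measurable fun s t hst => measure_mono fun z hz => lt_of_le_of_lt hst hz
  rw [lintegral_rpow_eq_lintegral_meas_lt_mul μ (Eventually.of_forall hG0) hG.aemeasurable
    (by linarith)]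
  have hpow : Measurable fun t : ℝ => ENNReal.ofReal (t ^ (p - 2 - 1)) :=
    (measurable_id.pow_const _).ennreal_ofReal
  have hprod : ∀ c : ℝ, Measurable fun t : ℝ =>
      ν {z | t < |f z| / c} * ENNReal.ofReal (t ^ (p - 2 - 1)) := fun c => (hmeas c).mul hpow
  calc ENNReal.ofReal p * ∫⁻ t in Set.Ioi (0 : ℝ), μ {x | t < G x} * ENNReal.ofReal (t ^ (p - 1))
      ≤ ENNReal.ofReal p * ∫⁻ t in Set.Ioi (0 : ℝ),
        (ENNReal.ofReal a * (ν {z | t < |f z| / c} * ENNReal.ofReal (t ^ (p - 2 - 1))) +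
          ENNReal.ofReal b * (ν {z | t < |f z| / L} * ENNReal.ofReal (t ^ (p - 2 - 1)))) := by
        refine mul_le_mul_right (setLIntegral_mono' measurableSet_Ioi fun t ht => ?_) _
        have ht0 : (0 : ℝ) < t := ht
        have e : ENNReal.ofReal (t ^ (-2 : ℝ)) * ENNReal.ofReal (t ^ (p - 1)) =
            ENNReal.ofReal (t ^ (p - 2 - 1)) := by
          rw [← ENNReal.ofReal_mul (by positivity), ← Real.rpow_add ht0]
          congr 2; ring
        refine (mul_le_mul_left (h t ht0) _).trans_eq ?_
        rw [← e]; ring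
    _ = ENNReal.ofReal p * (ENNReal.ofReal a * (ENNReal.ofReal (c ^ (2 - p) / (p - 2)) *
          ∫⁻ z, ENNReal.ofReal (|f z| ^ p)) + ENNReal.ofReal b *
          (ENNReal.ofReal (L ^ (2 - p) / (p - 2)) * ∫⁻ z, ENNReal.ofReal (|f z| ^ p))) := by
        rw [lintegral_add_left ((hprod c).const_mul _),
          lintegral_const_mul _ (hprod c), lintegral_const_mul _ (hprod L),
          hν, lintegral_weighted_tail hf hp hc, lintegral_weighted_tail hf hp hL]
    _ = _ := by
        rw [← mul_assoc (ENNReal.ofReal a), ← mul_assoc (ENNReal.ofReal b), ← add_mul, ← mul_assoc,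
          ← ENNReal.ofReal_mul ha, ← ENNReal.ofReal_mul hb,
          ← ENNReal.ofReal_add (by positivity) (by positivity), ← ENNReal.ofReal_mul (by linarith)]
        congr 2
        field_simp

theorem rpow_lintegral_le {X : Type*} [MeasurableSpace X] {μ : Measure X} {g : X → ℝ≥0∞}
    (hg : AEMeasurable g μ) {p : ℝ} (hp : 1 < p) :
    (∫⁻ x, g x ∂μ) ^ p ≤ μ Set.univ ^ (p - 1) * ∫⁻ x, g x ^ p ∂μ := by
  have hpq := Real.HolderConjugate.conjExponent hp
  have h1 := ENNReal.lintegral_mul_le_Lp_mul_Lq μ hpq hg (g := fun _ => 1) aemeasurable_const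
  simp only [Pi.mul_def, mul_one, ENNReal.one_rpow, lintegral_one] at h1
  have hp0 : 0 < p := by linarith
  have hq : 1 / Real.conjExponent p * p = p - 1 := by
    unfold Real.conjExponent
    have : p - 1 ≠ 0 := by linarith
    field_simp
  calc (∫⁻ x, g x ∂μ) ^ p
      ≤ ((∫⁻ x, g x ^ p ∂μ) ^ (1 / p) * μ Set.univ ^ (1 / Real.conjExponent p)) ^ p := by gcongr
    _ = _ := by
      rw [ENNReal.mul_rpow_of_nonneg _ _ hp0.le, ← ENNReal.rpow_mul, ← ENNReal.rpow_mul, hq,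
        one_div_mul_cancel hp0.ne', ENNReal.rpow_one, mul_comm]

theorem rpow_tsum_le {a : ℕ → ℝ≥0∞} {q : ℝ≥0∞} (hq0 : q ≠ 0) (hq1 : q < 1) {p : ℝ} (hp : 0 < p) :
    (∑' k, a k) ^ p ≤ ((1 - q)⁻¹) ^ p * ∑' k, (a k / q ^ k) ^ p := by
  have hqt : q ≠ ∞ := (hq1.trans ENNReal.one_lt_top).ne
  set T := ∑' k, (a k / q ^ k) ^ p with hT
  have hk : ∀ k, a k ≤ q ^ k * T ^ (1 / p) := by
    intro k
    have h1 : a k / q ^ k ≤ T ^ (1 / p) := by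
      have h2 := ENNReal.rpow_le_rpow (ENNReal.le_tsum (f := fun k => (a k / q ^ k) ^ p) k)
        (one_div_pos.2 hp).le
      rwa [← ENNReal.rpow_mul, mul_one_div_cancel hp.ne', ENNReal.rpow_one] at h2
    rw [ENNReal.div_le_iff (pow_ne_zero _ hq0) (ENNReal.pow_ne_top hqt)] at h1
    rwa [mul_comm]
  calc (∑' k, a k) ^ p ≤ (∑' k, q ^ k * T ^ (1 / p)) ^ p := by
        gcongr with k; exact hk k
    _ = _ := by
        rw [ENNReal.tsum_mul_right, ENNReal.tsum_geometric, ENNReal.mul_rpow_of_nonneg _ _ hp.le,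
          ← ENNReal.rpow_mul, one_div_mul_cancel hp.ne', ENNReal.rpow_one]

/-- The supremum of `|F x t|` over `t ∈ [1, 2]`. -/
noncomputable def supMean (F : ℝ × ℝ → ℝ → ℝ) (x : ℝ × ℝ) : ℝ≥0∞ :=
  ⨆ t ∈ Set.Icc (1 : ℝ) 2, ENNReal.ofReal |F x t|

theorem lt_supMean {F : ℝ × ℝ → ℝ → ℝ} {x : ℝ × ℝ} {l : ℝ} (hl : 0 ≤ l) :
    ENNReal.ofReal l < supMean F x ↔ ∃ t ∈ Set.Icc (1 : ℝ) 2, l < |F x t| := by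
  simp only [supMean, lt_iSup_iff, exists_prop, ENNReal.ofReal_lt_ofReal_iff_of_nonneg hl]

theorem supMean_le {F : ℝ × ℝ → ℝ → ℝ} {x : ℝ × ℝ} {a : ℝ≥0∞}
    (h : ∀ t ∈ Set.Icc (1 : ℝ) 2, ENNReal.ofReal |F x t| ≤ a) : supMean F x ≤ a :=
  iSup₂_le h

theorem le_supMean {F : ℝ × ℝ → ℝ → ℝ} {x : ℝ × ℝ} {t : ℝ} (ht : t ∈ Set.Icc (1 : ℝ) 2) :
    ENNReal.ofReal |F x t| ≤ supMean F x :=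
  le_iSup₂ (f := fun (t : ℝ) (_ : t ∈ Set.Icc (1 : ℝ) 2) => ENNReal.ofReal |F x t|) t ht

theorem measurable_supMean {F : ℝ × ℝ → ℝ → ℝ} (hF : ∀ t, Continuous fun x => F x t) :
    Measurable (supMean F) := by
  refine LowerSemicontinuous.measurable (lowerSemicontinuous_biSup fun t _ => ?_)
  exact (ENNReal.continuous_ofReal.comp (hF t).abs).lowerSemicontinuous

theorem LocData.const_mul {f : ℝ × ℝ → ℝ} (hf : LocData f) (c : ℝ) :
    LocData fun z => c * f z := by
  obtain ⟨C, hC⟩ := hf.bdd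
  refine ⟨hf.meas.const_mul c, ⟨|c| * C, fun z => ?_⟩, fun z hz => ?_⟩
  · rw [abs_mul]; exact mul_le_mul_of_nonneg_left (hC z) (abs_nonneg c)
  · rw [hf.supp z hz, mul_zero]

theorem thick_add {φ : ℝ → ℝ} (hφ : IsCutoff φ) (δ : ℝ) {f g : ℝ × ℝ → ℝ} (hf : LocData f)
    (hg : LocData g) (x : ℝ × ℝ) (t : ℝ) :
    thick φ δ (fun z => f z + g z) x t = thick φ δ f x t + thick φ δ g x t := by
  unfold thick
  rw [← mul_add, ← integral_add (hf.integrable_mul_annulus hφ δ x t)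
    (hg.integrable_mul_annulus hφ δ x t)]
  simp only [add_mul]

theorem thick_const_mul (φ : ℝ → ℝ) (δ c : ℝ) (f : ℝ × ℝ → ℝ) (x : ℝ × ℝ) (t : ℝ) :
    thick φ δ (fun z => c * f z) x t = c * thick φ δ f x t := by
  unfold thick
  simp only [mul_assoc]
  rw [integral_const_mul]
  ring

theorem LocData.ofReal_integral_indicator_sq {f : ℝ × ℝ → ℝ} (hf : LocData f) {S : Set (ℝ × ℝ)}
    (hS : MeasurableSet S) : ENNReal.ofReal (∫ z, S.indicator f z ^ 2) =
      volume.withDensity (fun z => ENNReal.ofReal (f z ^ 2)) S := by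
  rw [withDensity_apply _ hS, ← lintegral_indicator hS, ofReal_integral_eq_lintegral_ofReal
    (hf.indicator hS).sq.integrable (Eventually.of_forall fun z => sq_nonneg _)]
  refine lintegral_congr fun z => ?_
  by_cases hz : z ∈ S
  · rw [Set.indicator_of_mem hz, Set.indicator_of_mem hz]
  · rw [Set.indicator_of_notMem hz, Set.indicator_of_notMem hz]; simp

theorem supMean_thick_ne_top {φ : ℝ → ℝ} (hφ : IsCutoff φ) {δ : ℝ} (hδ : 0 < δ) (hδ' : δ ≤ 1 / 2)
    {f : ℝ × ℝ → ℝ} (hf : LocData f) (x : ℝ × ℝ) : supMean (thick φ δ f) x ≠ ∞ := by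
  obtain ⟨C, _, hC⟩ := hφ.bounded
  obtain ⟨b, hb⟩ := hf.bdd
  exact ((supMean_le fun t ht => ENNReal.ofReal_le_ofReal
    (abs_thick_le hφ hC hδ hδ' hb ht)).trans_lt ENNReal.ofReal_lt_top).ne

/-- Splitting a function according to its size. -/
theorem volume_sup_thick_le_of_split {φ : ℝ → ℝ} (hφ : IsCutoff φ) {C₀ : ℝ} (hC₀ : 0 < C₀)
    (hb₀ : ∀ v, |φ v| ≤ C₀) {δ h W : ℝ} (hδ : 0 < δ) (hδ' : δ ≤ 1 / 2) (hh : 0 < h)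
    (hL : 1 / (108 * C₀) ≤ 1 / (3 * h)) (hW : 0 < W)
    (hsmall : ∀ f : ℝ × ℝ → ℝ, LocData f → (∀ z, |f z| ≤ 1) →
      volume {x | x ∈ closedBall (0 : ℝ × ℝ) (1 / 8) ∧ ∃ t ∈ Set.Icc (1 : ℝ) 2,
        h < |thick φ δ f x t|} ≤ ENNReal.ofReal (h * ∫ z, f z ^ 2))
    (hweak : ∀ (f : ℝ × ℝ → ℝ) (l : ℝ), LocData f → 0 < l →
      volume {x | x ∈ closedBall (0 : ℝ × ℝ) (1 / 8) ∧ ∃ t ∈ Set.Icc (1 : ℝ) 2,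
        l < |thick φ δ f x t|} ≤ ENNReal.ofReal (W / l ^ 2 * ∫ z, f z ^ 2))
    {f : ℝ × ℝ → ℝ} (hf : LocData f) {l : ℝ} (hl : 0 < l) :
    volume {x | x ∈ closedBall (0 : ℝ × ℝ) (1 / 8) ∧ ∃ t ∈ Set.Icc (1 : ℝ) 2,
        l < |thick φ δ f x t|} ≤ ENNReal.ofReal (l ^ (-2 : ℝ)) *
      (ENNReal.ofReal (9 * h ^ 3) * volume.withDensity (fun z => ENNReal.ofReal (f z ^ 2))
        {z | l < |f z| / (1 / (108 * C₀))} +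
      ENNReal.ofReal (9 * W) * volume.withDensity (fun z => ENNReal.ofReal (f z ^ 2))
        {z | l < |f z| / (1 / (3 * h))}) := by
  set c := 1 / (108 * C₀) with hcd
  set L := 1 / (3 * h) with hLd
  have hc : 0 < c := by positivity
  have hL0 : 0 < L := by positivity
  set S := {z | l < |f z| / c} with hS
  set V := {z | l < |f z| / L} with hV
  have hSm : MeasurableSet S := measurableSet_lt measurable_const (hf.meas.abs.div_const c)
  have hVm : MeasurableSet V := measurableSet_lt measurable_const (hf.meas.abs.div_const L)
  set f₀ := Sᶜ.indicator f with hf₀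
  set f₁ := (S \ V).indicator f with hf₁
  set f₂ := V.indicator f with hf₂
  have hVS : V ⊆ S := by
    intro z hz
    have hz' : l < |f z| / L := hz
    rw [lt_div_iff₀ hL0] at hz'
    show l < |f z| / c
    rw [lt_div_iff₀ hc]
    nlinarith
  have hl0 := hf.indicator hSm.compl
  have hl1 := hf.indicator (hSm.diff hVm)
  have hl2 := hf.indicator hVm
  have hsplit : f = fun z => (f₀ z + f₁ z) + f₂ z := by
    funext z
    by_cases h1 : z ∈ V
    · have h2 := hVS h1
      rw [hf₀, hf₁, hf₂, Set.indicator_of_notMem (show z ∉ Sᶜ from fun h => h h2) f,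
        Set.indicator_of_notMem (show z ∉ S \ V from fun h => h.2 h1) f, Set.indicator_of_mem h1]
      ring
    · by_cases h2 : z ∈ S
      · rw [hf₀, hf₁, hf₂, Set.indicator_of_notMem (show z ∉ Sᶜ from fun h => h h2) f,
          Set.indicator_of_mem (show z ∈ S \ V from ⟨h2, h1⟩) f, Set.indicator_of_notMem h1]
        ring
      · rw [hf₀, hf₁, hf₂, Set.indicator_of_mem (show z ∈ Sᶜ from h2) f,
          Set.indicator_of_notMem (show z ∉ S \ V from fun h => h2 h.1) f,
          Set.indicator_of_notMem h1]
        ring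
  have hl01 : LocData fun z => f₀ z + f₁ z := by
    refine hf.of_abs_le (hl0.meas.add hl1.meas) fun z => ?_
    by_cases h1 : z ∈ V
    · rw [hf₀, hf₁, Set.indicator_of_notMem (show z ∉ Sᶜ from fun h => h (hVS h1)) f,
        Set.indicator_of_notMem (show z ∉ S \ V from fun h => h.2 h1) f]
      simp
    · have h2 := congrFun hsplit z
      rw [hf₂, Set.indicator_of_notMem h1, add_zero] at h2
      rw [← h2]
  set g := fun z => (L * l)⁻¹ * f₁ z with hg
  have hLl : 0 < L * l := by positivity
  have hg1 : ∀ z, |g z| ≤ 1 := by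
    intro z
    rw [hg]
    by_cases h1 : z ∈ S \ V
    · have h2 : ¬ l < |f z| / L := h1.2
      rw [not_lt, div_le_iff₀ hL0] at h2
      simp only [hf₁, Set.indicator_of_mem h1, abs_mul, abs_inv, abs_of_pos hLl]
      rw [inv_mul_le_iff₀ hLl]; linarith
    · simp only [hf₁, Set.indicator_of_notMem h1, mul_zero, abs_zero]; norm_num
  have hsub : {x | x ∈ closedBall (0 : ℝ × ℝ) (1 / 8) ∧ ∃ t ∈ Set.Icc (1 : ℝ) 2,
        l < |thick φ δ f x t|} ⊆
      {x | x ∈ closedBall (0 : ℝ × ℝ) (1 / 8) ∧ ∃ t ∈ Set.Icc (1 : ℝ) 2, h < |thick φ δ g x t|} ∪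
      {x | x ∈ closedBall (0 : ℝ × ℝ) (1 / 8) ∧ ∃ t ∈ Set.Icc (1 : ℝ) 2,
        l / 3 < |thick φ δ f₂ x t|} := by
    rintro x ⟨hx, t, ht, hlt⟩
    by_contra hno
    rw [Set.mem_union, not_or] at hno
    have h1 : |thick φ δ g x t| ≤ h := not_lt.1 fun hh => hno.1 ⟨hx, t, ht, hh⟩
    have h2 : |thick φ δ f₂ x t| ≤ l / 3 := not_lt.1 fun hh => hno.2 ⟨hx, t, ht, hh⟩
    have h0 : |thick φ δ f₀ x t| ≤ l / 3 := by
      have := abs_thick_le hφ hb₀ hδ hδ' (f := f₀) (b := c * l) (x := x) (t := t) (by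
        intro z
        by_cases hz : z ∈ S
        · rw [hf₀, Set.indicator_of_notMem (show z ∉ Sᶜ from fun h => h hz) f, abs_zero]
          positivity
        · rw [hf₀, Set.indicator_of_mem (show z ∈ Sᶜ from hz) f]
          have h3 : ¬ l < |f z| / c := hz
          rw [not_lt, div_le_iff₀ hc] at h3
          linarith) ht
      refine this.trans_eq ?_
      rw [hcd]; field_simp; ring
    have hfg : thick φ δ f₁ x t = L * l * thick φ δ g x t := by
      rw [hg, thick_const_mul, ← mul_assoc, mul_inv_cancel₀ hLl.ne', one_mul]
    rw [hsplit, thick_add hφ δ hl01 hl2, thick_add hφ δ hl0 hl1, hfg] at hlt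
    have h3 := abs_add_le (thick φ δ f₀ x t + L * l * thick φ δ g x t) (thick φ δ f₂ x t)
    have h4 := abs_add_le (thick φ δ f₀ x t) (L * l * thick φ δ g x t)
    rw [abs_mul, abs_of_pos hLl] at h4
    have h5 : L * l * |thick φ δ g x t| ≤ L * l * h := by gcongr
    have h6 : L * l * h = l / 3 := by rw [hLd]; field_simp
    linarith
  have hlm2 : l ^ (-2 : ℝ) = 1 / l ^ 2 := by
    rw [Real.rpow_neg hl.le, one_div]
    norm_num
  refine (measure_mono hsub).trans ((measure_union_le _ _).trans ?_)
  rw [mul_add]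
  refine add_le_add ?_ ?_
  · refine (hsmall g (hl1.const_mul _) hg1).trans ?_
    rw [← hf.ofReal_integral_indicator_sq hSm, ← ENNReal.ofReal_mul (by positivity),
      ← ENNReal.ofReal_mul (by positivity)]
    refine ENNReal.ofReal_le_ofReal ?_
    have e : ∫ z, g z ^ 2 = (L * l)⁻¹ ^ 2 * ∫ z, f₁ z ^ 2 := by
      rw [← integral_const_mul]; simp only [hg, mul_pow]
    have h1 : ∫ z, f₁ z ^ 2 ≤ ∫ z, S.indicator f z ^ 2 := by
      refine (hf.indicator hSm).integral_sq_mono hl1 fun z => ?_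
      by_cases h1 : z ∈ S \ V
      · rw [hf₁, Set.indicator_of_mem h1, Set.indicator_of_mem h1.1]
      · rw [hf₁, Set.indicator_of_notMem h1, abs_zero]; exact abs_nonneg _
    rw [e, hlm2]
    calc h * ((L * l)⁻¹ ^ 2 * ∫ z, f₁ z ^ 2) ≤ h * ((L * l)⁻¹ ^ 2 * ∫ z, S.indicator f z ^ 2) := by
          gcongr
      _ = _ := by rw [hLd]; field_simp; ring
  · refine (hweak f₂ (l / 3) hl2 (by positivity)).trans ?_
    rw [← hf.ofReal_integral_indicator_sq hVm, ← ENNReal.ofReal_mul (by positivity),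
      ← ENNReal.ofReal_mul (by positivity), hlm2]
    refine ENNReal.ofReal_le_ofReal (le_of_eq ?_)
    rw [hf₂]; field_simp; ring

theorem exists_lintegral_supMean_thick_le {η : ℝ → ℝ} (hη : IsCutoff η) {m : ℕ} (hm : 5281 ≤ m)
    {p : ℝ} (hp : 2 < p) :
    ∃ A K, 1 ≤ A ∧ 0 < K ∧ ∀ (h : ℝ) (f : ℝ × ℝ → ℝ), 0 < h → 10 ^ 9 * A * h ≤ 1 → LocData f →
      ∫⁻ x in closedBall (0 : ℝ × ℝ) (1 / 8),
        supMean (thick (iteratedDeriv m η) (h ^ 1760) f) x ^ p ≤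
      ENNReal.ofReal (K * (h + h ^ (p - 2))) * ∫⁻ z, ENNReal.ofReal (|f z| ^ p) := by
  have hφ := hη.iteratedDeriv m
  obtain ⟨A, hA, hsmall⟩ := exists_thick_sup_small hη hm
  obtain ⟨W, hW, hweak⟩ := exists_thick_weak_two hη (m := m) (by omega)
  obtain ⟨C₀, hC₀, hb₀⟩ := hφ.bounded
  have hp2 : 0 < p - 2 := by linarith
  refine ⟨A, p / (p - 2) * (9 * (1 / (108 * C₀ + 1)) ^ (2 - p) + 9 * W * 3 ^ (p - 2)), hA,
    by positivity, ?_⟩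
  set φ := iteratedDeriv m η with hφd
  clear_value φ
  intro h f hh hAh hf
  have hh9 : 10 ^ 9 * h ≤ 1 := by nlinarith
  have hh1 : h ≤ 1 := by linarith
  have hδ : 0 < h ^ 1760 := by positivity
  have hδ' : h ^ 1760 ≤ 1 / 2 := (pow_le_pow_of_le_one hh.le hh1 (m := 1) (by norm_num)).trans (by
    rw [pow_one]; linarith)
  set C₁ := C₀ + 1 / 108 with hC₁
  have hC₁0 : 0 < C₁ := by positivity
  have e108 : 108 * C₁ = 108 * C₀ + 1 := by rw [hC₁]; ring
  set δ := h ^ 1760 with hδd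
  have hne := supMean_thick_ne_top hφ hδ hδ' hf
  have hSm : Measurable (supMean (thick φ δ f)) :=
    measurable_supMean (continuous_thick_left hφ δ hf)
  have key := lintegral_rpow_le_of_weak (μ := volume.restrict (closedBall (0 : ℝ × ℝ) (1 / 8)))
    (G := fun x => (supMean (thick φ δ f) x).toReal) (f := f) (p := p) (a := 9 * h ^ 3)
    (b := 9 * W) (c := 1 / (108 * C₁)) (L := 1 / (3 * h)) hSm.ennreal_toReal
    (fun x => ENNReal.toReal_nonneg) hf.meas hp (by positivity) (by positivity) (by positivity)
    (by positivity) (by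
      intro l hl
      rw [Measure.restrict_apply (measurableSet_lt measurable_const hSm.ennreal_toReal)]
      refine (measure_mono fun x hx => ?_).trans (volume_sup_thick_le_of_split hφ hC₁0
        (fun v => (hb₀ v).trans (by linarith)) hδ hδ' hh (by
          rw [e108]
          exact one_div_le_one_div_of_le (by positivity) (by linarith)) hW
        (fun f hf hb => hsmall h f hh hAh hf hb) (fun f l hf hl => hweak δ f l hδ hδ' hf hl) hf hl)
      refine ⟨hx.2, (lt_supMean hl.le).1 ?_⟩
      have h1 : l < (supMean (thick φ δ f) x).toReal := hx.1
      rwa [← ENNReal.ofReal_lt_iff_lt_toReal hl.le (hne x)] at h1)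
  have e1 : ∀ x, ENNReal.ofReal ((supMean (thick φ δ f) x).toReal ^ p) =
      supMean (thick φ δ f) x ^ p := fun x => by
    rw [← ENNReal.ofReal_rpow_of_nonneg ENNReal.toReal_nonneg (by linarith),
      ENNReal.ofReal_toReal (hne x)]
  simp only [e1] at key
  refine key.trans (mul_le_mul_left (ENNReal.ofReal_le_ofReal ?_) _)
  have h3 : (1 / (3 * h)) ^ (2 - p) = 3 ^ (p - 2) * h ^ (p - 2) := by
    rw [one_div, Real.inv_rpow (by positivity), ← Real.rpow_neg (by positivity), neg_sub,
      Real.mul_rpow (by norm_num) hh.le]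
  rw [h3, e108, mul_assoc (p / (p - 2))]
  have h4 : h ^ 3 ≤ h := by
    have := pow_le_pow_of_le_one hh.le hh1 (show 1 ≤ 3 by norm_num)
    rwa [pow_one] at this
  have h5 : (0 : ℝ) ≤ (1 / (108 * C₀ + 1)) ^ (2 - p) := by positivity
  have h6 : (0 : ℝ) ≤ 3 ^ (p - 2) := by positivity
  have h7 : (0 : ℝ) ≤ h ^ (p - 2) := by positivity
  gcongr
  generalize (1 / (108 * C₀ + 1)) ^ (2 - p) = X at *
  generalize (3 : ℝ) ^ (p - 2) = Y at *
  generalize h ^ (p - 2) = Z at *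
  have h8 : 0 ≤ X * Z := mul_nonneg h5 h7
  have h9 : 0 ≤ W * Y * h := by positivity
  have h10 : h ^ 3 * X ≤ h * X := by gcongr
  nlinarith

/-- The unnormalized circular mean of `f` around `x` at radius `t`. -/
noncomputable def circMean (f : ℝ × ℝ → ℝ) (x : ℝ × ℝ) (t : ℝ) : ℝ :=
  ∫ θ in (-Real.pi)..Real.pi, f (x.1 + t * Real.cos θ, x.2 + t * Real.sin θ)

theorem continuous_circMean {f : ℝ × ℝ → ℝ} (hf : Continuous f) :
    Continuous fun P : (ℝ × ℝ) × ℝ => circMean f P.1 P.2 := by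
  refine intervalIntegral.continuous_parametric_intervalIntegral_of_continuous' ?_ _ _
  exact hf.comp (by fun_prop)

theorem IsCutoff.support_subset_Ioc {φ : ℝ → ℝ} (hφ : IsCutoff φ) {a b : ℝ} (ha : a ≤ -1)
    (hb : 1 ≤ b) : Function.support φ ⊆ Set.Ioc a b := by
  intro u hu
  have h1 : |u| ≤ 1 := by
    by_contra h
    exact hu (hφ.2 u (not_le.1 h))
  rw [abs_le] at h1
  refine ⟨lt_of_le_of_ne (ha.trans h1.1) ?_, h1.2.trans hb⟩
  rintro rfl
  have : a = -1 := le_antisymm ha h1.1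
  exact hu (this ▸ hφ.zero_at_one.2)

theorem integral_polar {F : ℝ × ℝ → ℝ} (hF : Continuous F) {R : ℝ} (hR : 0 ≤ R)
    (h0 : ∀ z : ℝ × ℝ, R ^ 2 < z.1 ^ 2 + z.2 ^ 2 → F z = 0) :
    ∫ z, F z = ∫ r in (0 : ℝ)..R, r * ∫ θ in (-Real.pi)..Real.pi,
      F (r * Real.cos θ, r * Real.sin θ) := by
  have hpi := Real.pi_pos
  rw [← integral_comp_polarCoord_symm F, polarCoord_target]
  have hc : Continuous fun q : ℝ × ℝ => q.1 • F (polarCoord.symm q) := by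
    simp only [polarCoord_symm_apply]
    exact continuous_fst.smul (hF.comp (by fun_prop))
  rw [setIntegral_eq_of_subset_of_forall_sdiff_eq_zero (s := Set.Ioc 0 R ×ˢ Set.Ioo (-Real.pi)
      Real.pi)
    (measurableSet_Ioi.prod measurableSet_Ioo)
    (Set.prod_mono (fun r hr => hr.1) le_rfl)]
  · rw [Measure.volume_eq_prod, setIntegral_prod, intervalIntegral.integral_of_le hR]
    · refine setIntegral_congr_fun measurableSet_Ioc fun r _ => ?_
      simp only [polarCoord_symm_apply, smul_eq_mul]
      rw [integral_const_mul, intervalIntegral.integral_of_le (by linarith),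
        integral_Ioc_eq_integral_Ioo]
    · rw [← Measure.volume_eq_prod]
      refine (hc.continuousOn.integrableOn_compact
        (isCompact_Icc.prod isCompact_Icc : IsCompact
          (Set.Icc 0 R ×ˢ Set.Icc (-Real.pi) Real.pi))).mono_set ?_
      exact Set.prod_mono Set.Ioc_subset_Icc_self Set.Ioo_subset_Icc_self
  · rintro ⟨r, θ⟩ ⟨⟨hr, hθ⟩, h2⟩
    have hrR : R < r := by
      by_contra h
      exact h2 ⟨⟨hr, not_lt.1 h⟩, hθ⟩
    rw [polarCoord_symm_apply, h0, smul_zero]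
    have : (r * Real.cos θ) ^ 2 + (r * Real.sin θ) ^ 2 = r ^ 2 := by
      rw [mul_pow, mul_pow, ← mul_add, Real.cos_sq_add_sin_sq, mul_one]
    simp only [this]
    exact pow_lt_pow_left₀ hrR hR (by norm_num)

theorem thick_eq_integral_circMean {φ : ℝ → ℝ} (hφ : IsCutoff φ) {f : ℝ × ℝ → ℝ} (hf : Continuous f)
    {δ t : ℝ} (hδ : 0 < δ) (hδ' : δ ≤ 1 / 2) (ht : t ∈ Set.Icc (1 : ℝ) 2) (x : ℝ × ℝ) :
    thick φ δ f x t = 1 / 2 * ∫ u in (-1 : ℝ)..1, φ u * circMean f x √(t ^ 2 + δ * u) := by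
  obtain ⟨ht1, ht2⟩ := ht
  have hcf : Continuous fun r => circMean f x r :=
    (continuous_circMean hf).comp (by fun_prop : Continuous fun r : ℝ => (x, r))
  have hφc := hφ.1.continuous
  have e1 : ∫ z, f z * φ (rho x t z / δ)
      = ∫ z : ℝ × ℝ, f (x + z) * φ ((z.1 ^ 2 + z.2 ^ 2 - t ^ 2) / δ) := by
    rw [← integral_add_left_eq_self (fun z => f z * φ (rho x t z / δ)) x]
    simp only [rho, Prod.fst_add, Prod.snd_add, add_sub_cancel_left]
  have e2 := integral_polar (F := fun z : ℝ × ℝ => f (x + z) * φ ((z.1 ^ 2 + z.2 ^ 2 - t ^ 2) / δ))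
    ((hf.comp (by fun_prop)).mul (hφc.comp (by fun_prop))) (R := 3) (by norm_num) (by
      intro z hz
      rw [hφ.zero_of_lt hδ, mul_zero]
      refine lt_of_lt_of_le ?_ (le_abs_self _)
      nlinarith)
  have e3 : ∀ r : ℝ, (r * ∫ θ in (-Real.pi)..Real.pi,
      f (x + (r * Real.cos θ, r * Real.sin θ)) *
        φ (((r * Real.cos θ) ^ 2 + (r * Real.sin θ) ^ 2 - t ^ 2) / δ))
      = r * (circMean f x r * φ ((r ^ 2 - t ^ 2) / δ)) := by
    intro r
    rw [circMean, ← intervalIntegral.integral_mul_const]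
    congr 2
    ext θ
    congr 3
    rw [mul_pow, mul_pow, ← mul_add, Real.cos_sq_add_sin_sq, mul_one]
  have e4 : ∫ r in (0 : ℝ)..3, ((fun u => φ u * circMean f x √(t ^ 2 + δ * u)) ∘
      (fun r => (r ^ 2 - t ^ 2) / δ)) r * (2 * r / δ)
      = ∫ u in ((0 ^ 2 - t ^ 2) / δ)..((3 ^ 2 - t ^ 2) / δ), φ u * circMean f x √(t ^ 2 + δ * u)
          := by
    refine intervalIntegral.integral_comp_mul_deriv (fun r _ => ?_) ?_ ?_
    · have := ((hasDerivAt_pow 2 r).sub_const (t ^ 2)).div_const δ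
      simpa using this
    · fun_prop
    · exact hφc.mul (hcf.comp (by fun_prop))
  have hsupp : ∀ a b : ℝ, a ≤ -1 → 1 ≤ b → ∫ u in a..b, φ u * circMean f x √(t ^ 2 + δ * u)
      = ∫ u, φ u * circMean f x √(t ^ 2 + δ * u) := by
    intro a b ha hb
    refine intervalIntegral.integral_eq_integral_of_support_subset ?_
    exact (Function.support_mul_subset_left _ _).trans (hφ.support_subset_Ioc ha hb)
  rw [thick, e1, e2, hsupp _ _ le_rfl le_rfl, ← hsupp ((0 ^ 2 - t ^ 2) / δ) ((3 ^ 2 - t ^ 2) / δ),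
    ← e4, ← intervalIntegral.integral_const_mul, ← intervalIntegral.integral_const_mul]
  · refine intervalIntegral.integral_congr fun r hr => ?_
    rw [Set.uIcc_of_le (by norm_num)] at hr
    have hs : t ^ 2 + δ * ((r ^ 2 - t ^ 2) / δ) = r ^ 2 := by field_simp; ring
    simp only [Function.comp, e3, hs, Real.sqrt_sq hr.1]
    ring
  · rw [div_le_iff₀ hδ]; nlinarith
  · rw [le_div_iff₀ hδ]; nlinarith

theorem tendsto_thick {φ : ℝ → ℝ} (hφ : IsCutoff φ) (h1 : ∫ w, φ w = 1) {f : ℝ × ℝ → ℝ}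
    (hf : Continuous f) {t : ℝ} (ht : t ∈ Set.Icc (1 : ℝ) 2) (x : ℝ × ℝ) :
    Tendsto (fun δ => thick φ δ f x t) (𝓝[>] 0) (𝓝 (1 / 2 * circMean f x t)) := by
  have hcf : Continuous fun r => circMean f x r :=
    (continuous_circMean hf).comp (by fun_prop : Continuous fun r : ℝ => (x, r))
  have hc : Continuous fun δ : ℝ => 1 / 2 * ∫ u in (-1 : ℝ)..1, φ u * circMean f x √(t ^ 2 + δ *
      u) := by
    refine continuous_const.mul ?_
    refine intervalIntegral.continuous_parametric_intervalIntegral_of_continuous' ?_ _ _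
    exact (hφ.1.continuous.comp continuous_snd).mul (hcf.comp (by fun_prop))
  have h0 : (1 / 2 * ∫ u in (-1 : ℝ)..1, φ u * circMean f x √(t ^ 2 + 0 * u)) = 1 / 2 * circMean f
      x t := by
    simp only [zero_mul, add_zero, Real.sqrt_sq (zero_le_one.trans ht.1)]
    rw [intervalIntegral.integral_mul_const, intervalIntegral.integral_eq_integral_of_support_subset
      (hφ.support_subset_Ioc le_rfl le_rfl), h1, one_mul]
  rw [← h0]
  refine Tendsto.congr' ?_ (hc.continuousAt.tendsto.mono_left nhdsWithin_le_nhds)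
  filter_upwards [Ioc_mem_nhdsGT (show (0 : ℝ) < 1 / 2 by norm_num)] with δ hδ
  exact (thick_eq_integral_circMean hφ hf hδ.1 hδ.2 ht x).symm

theorem lintegral_rpow_tsum_le {X : Type*} [MeasurableSpace X] {μ : Measure X}
    {a : ℕ → X → ℝ≥0∞} (ha : ∀ k, Measurable (a k)) {R : ℝ≥0∞} (hR0 : R ≠ 0) (hR1 : R < 1)
    {p : ℝ} (hp : 0 < p) {M : ℝ≥0∞} (h : ∀ k, ∫⁻ x, a k x ^ p ∂μ ≤ (R ^ 2) ^ k * M) :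
    ∫⁻ x, (∑' k, a k x) ^ p ∂μ ≤ ((1 - R ^ (1 / p))⁻¹) ^ p * ((1 - R)⁻¹ * M) := by
  have hRt : R ≠ ∞ := (hR1.trans ENNReal.one_lt_top).ne
  have hp' : 0 < 1 / p := by positivity
  have hq0 : R ^ (1 / p) ≠ 0 := (ENNReal.rpow_pos (pos_iff_ne_zero.2 hR0) hRt).ne'
  have hq1 : R ^ (1 / p) < 1 := ENNReal.rpow_lt_one hR1 hp'
  have hqp : ∀ k : ℕ, ((R ^ (1 / p)) ^ k) ^ p = R ^ k := by
    intro k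
    rw [← ENNReal.rpow_natCast, ← ENNReal.rpow_mul, ← ENNReal.rpow_mul, mul_left_comm,
      one_div_mul_cancel hp.ne', mul_one, ENNReal.rpow_natCast]
  have hterm : ∀ (k : ℕ) x, (a k x / (R ^ (1 / p)) ^ k) ^ p = (R ^ k)⁻¹ * a k x ^ p := by
    intro k x
    rw [ENNReal.div_rpow_of_nonneg _ _ hp.le, hqp, ENNReal.div_eq_inv_mul]
  have hm : ∀ k, Measurable fun x => a k x ^ p := fun k => (ha k).pow_const p
  calc ∫⁻ x, (∑' k, a k x) ^ p ∂μ
      ≤ ∫⁻ x, ((1 - R ^ (1 / p))⁻¹) ^ p * ∑' k, (R ^ k)⁻¹ * a k x ^ p ∂μ := by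
        refine lintegral_mono fun x => (rpow_tsum_le hq0 hq1 hp).trans (le_of_eq ?_)
        simp only [hterm]
    _ = ((1 - R ^ (1 / p))⁻¹) ^ p * ∑' k, (R ^ k)⁻¹ * ∫⁻ x, a k x ^ p ∂μ := by
        rw [lintegral_const_mul _ (Measurable.tsum fun k => (hm k).const_mul _),
          lintegral_tsum fun k => ((hm k).const_mul _).aemeasurable]
        simp only [lintegral_const_mul _ (hm _)]
    _ ≤ ((1 - R ^ (1 / p))⁻¹) ^ p * ∑' k, R ^ k * M := by
        refine mul_le_mul_right (ENNReal.tsum_le_tsum fun k => ?_) _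
        refine (mul_le_mul_right (h k) _).trans (le_of_eq ?_)
        rw [← mul_assoc, ← pow_mul, mul_comm 2 k, pow_mul, sq, ← mul_assoc,
          ENNReal.inv_mul_cancel (pow_ne_zero _ hR0) (ENNReal.pow_ne_top hRt), one_mul]
    _ = _ := by rw [ENNReal.tsum_mul_right, ENNReal.tsum_geometric]

theorem locData_indicator_closedBall {f : ℝ × ℝ → ℝ} (hf : Continuous f) :
    LocData ((closedBall 0 3).indicator f) := by
  obtain ⟨C, hC⟩ := (isCompact_closedBall (0 : ℝ × ℝ) 3).exists_bound_of_continuousOn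
    hf.continuousOn
  refine ⟨hf.measurable.indicator measurableSet_closedBall, ⟨|C|, fun z => ?_⟩, fun z hz => ?_⟩
  · by_cases hz : z ∈ closedBall (0 : ℝ × ℝ) 3
    · rw [Set.indicator_of_mem hz]; exact (hC z hz).trans (le_abs_self C)
    · rw [Set.indicator_of_notMem hz, abs_zero]; exact abs_nonneg _
  · refine Set.indicator_of_notMem (fun h => ?_) _
    rw [mem_closedBall_zero_iff] at h
    linarith

theorem thick_indicator_closedBall {φ : ℝ → ℝ} (hφ : IsCutoff φ) {δ t : ℝ} (hδ : 0 < δ)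
    (hδ' : δ ≤ 1 / 2) (ht : t ∈ Set.Icc (1 : ℝ) 2) (f : ℝ × ℝ → ℝ) {x : ℝ × ℝ}
    (hx : x ∈ closedBall (0 : ℝ × ℝ) (1 / 8)) :
    thick φ δ ((closedBall 0 3).indicator f) x t = thick φ δ f x t := by
  unfold thick
  congr 2
  ext z
  by_cases hz : z ∈ closedBall (0 : ℝ × ℝ) 3
  · rw [Set.indicator_of_mem hz]
  · rw [Set.indicator_of_notMem hz, hφ.zero_of_lt hδ, zero_mul, mul_zero]
    by_contra h
    have h1 := mem_ball_of_rho_le ⟨ht.1, ht.2⟩ hδ' (not_lt.1 h)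
    apply hz
    rw [mem_closedBall_zero_iff, Prod.norm_def, max_le_iff, Real.norm_eq_abs, Real.norm_eq_abs]
      at hx ⊢
    simp only [abs_le] at *
    constructor <;> constructor <;> linarith [hx.1.1, hx.1.2, hx.2.1, hx.2.2, h1.1.1, h1.1.2,
        h1.2.1, h1.2.2]

theorem thick_telescope {Θ φ : ℝ → ℝ} (hΘ : IsCutoff Θ) {a : ℝ}
    (h : ∀ w, a * Θ (a * w) - Θ w = φ w) {f : ℝ × ℝ → ℝ} (hf : LocData f) (δ : ℝ)
    (x : ℝ × ℝ) (t : ℝ) :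
    thick Θ (δ / a) f x t = thick Θ δ f x t + thick φ δ f x t := by
  have i1 := (hf.integrable_mul_annulus hΘ (δ / a) x t).const_mul a
  have i2 := hf.integrable_mul_annulus hΘ δ x t
  have e : ∫ z, f z * φ (rho x t z / δ) = a * (∫ z, f z * Θ (rho x t z / (δ / a)))
      - ∫ z, f z * Θ (rho x t z / δ) := by
    rw [← integral_const_mul, ← integral_sub i1 i2]
    refine integral_congr_ae (Eventually.of_forall fun z => ?_)
    simp only [← h]
    rw [show rho x t z / (δ / a) = a * (rho x t z / δ) by rw [div_div_eq_mul_div]; ring]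
    ring
  unfold thick
  rw [e, inv_div]
  ring

theorem supMean_circMean_le {Θ φ : ℝ → ℝ} (hΘ : IsCutoff Θ) (h1 : ∫ w, Θ w = 1) {a : ℝ}
    (ha : 1 < a) (h : ∀ w, a * Θ (a * w) - Θ w = φ w) {f : ℝ × ℝ → ℝ} (hf : Continuous f) {δ : ℝ}
    (hδ : 0 < δ) (hδ' : δ ≤ 1 / 2) {x : ℝ × ℝ} (hx : x ∈ closedBall (0 : ℝ × ℝ) (1 / 8)) :
    supMean (fun x t => 1 / 2 * circMean f x t) x ≤
      supMean (thick Θ δ ((closedBall 0 3).indicator f)) x +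
        ∑' k : ℕ, supMean (thick φ (δ / a ^ k) ((closedBall 0 3).indicator f)) x := by
  have ha0 : 0 < a := by linarith
  set g := (closedBall (0 : ℝ × ℝ) 3).indicator f with hg
  have hgl : LocData g := locData_indicator_closedBall hf
  refine supMean_le fun t ht => ?_
  have hsum : ∀ N : ℕ, thick Θ (δ / a ^ N) g x t
      = thick Θ δ g x t + ∑ k ∈ Finset.range N, thick φ (δ / a ^ k) g x t := by
    intro N
    induction N with
    | zero => simp
    | succ N ih =>
      rw [Finset.sum_range_succ, ← add_assoc, ← ih, pow_succ, ← div_div]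
      exact thick_telescope hΘ h hgl _ x t
  have hb : ∀ N : ℕ, ENNReal.ofReal |thick Θ (δ / a ^ N) g x t| ≤
      supMean (thick Θ δ g) x + ∑' k : ℕ, supMean (thick φ (δ / a ^ k) g) x := by
    intro N
    rw [hsum]
    refine (ENNReal.ofReal_le_ofReal (abs_add_le _ _)).trans ?_
    rw [ENNReal.ofReal_add (abs_nonneg _) (abs_nonneg _)]
    refine add_le_add (le_supMean ht) ?_
    refine (ENNReal.ofReal_le_ofReal (Finset.abs_sum_le_sum_abs _ _)).trans ?_
    rw [ENNReal.ofReal_sum_of_nonneg fun _ _ => abs_nonneg _]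
    refine (Finset.sum_le_sum fun k _ => le_supMean ht).trans ?_
    exact ENNReal.sum_le_tsum _
  have hlim : Tendsto (fun N : ℕ => δ / a ^ N) atTop (𝓝[>] 0) := by
    refine tendsto_nhdsWithin_iff.2 ⟨?_, Eventually.of_forall fun N => ?_⟩
    · exact tendsto_const_nhds.div_atTop (tendsto_pow_atTop_atTop_of_one_lt ha)
    · exact div_pos hδ (pow_pos ha0 N)
  have ht' := (tendsto_thick hΘ h1 hf ht x).comp hlim
  have h2 := (ENNReal.continuous_ofReal.tendsto _).comp ht'.abs
  refine le_of_tendsto h2 (Eventually.of_forall fun N => ?_)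
  refine le_of_eq_of_le ?_ (hb N)
  simp only [Function.comp]
  rw [hg, thick_indicator_closedBall hΘ (div_pos hδ (pow_pos ha0 N)) _ ht f hx]
  exact (div_le_self hδ.le (one_le_pow₀ ha.le)).trans hδ'

theorem lintegral_supMean_thick_low_le {Θ : ℝ → ℝ} (hΘ : IsCutoff Θ) {δ : ℝ} (hδ : 0 < δ) {p : ℝ}
    (hp : 1 < p) : ∃ K : ℝ≥0∞, K ≠ ∞ ∧ ∀ f : ℝ × ℝ → ℝ, Continuous f →
      ∫⁻ x in closedBall (0 : ℝ × ℝ) (1 / 8),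
        supMean (thick Θ δ ((closedBall 0 3).indicator f)) x ^ p ≤
      K * ∫⁻ z in closedBall (0 : ℝ × ℝ) 3, ENNReal.ofReal (|f z| ^ p) := by
  obtain ⟨C, hC0, hC⟩ := hΘ.bounded
  have hp0 : 0 ≤ p := by linarith
  have hfin : ∀ r : ℝ, volume (closedBall (0 : ℝ × ℝ) r) ≠ ∞ := fun r =>
    (isCompact_closedBall _ _).measure_lt_top.ne
  refine ⟨ENNReal.ofReal (δ⁻¹ * C) ^ p * volume (closedBall (0 : ℝ × ℝ) 3) ^ (p - 1) *
    volume (closedBall (0 : ℝ × ℝ) (1 / 8)), ?_, fun f hf => ?_⟩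
  · refine ENNReal.mul_ne_top (ENNReal.mul_ne_top ?_ ?_) (hfin _)
    · exact ENNReal.rpow_ne_top_of_nonneg hp0 ENNReal.ofReal_ne_top
    · exact ENNReal.rpow_ne_top_of_nonneg (by linarith) (hfin _)
  have hgl := locData_indicator_closedBall hf
  have hpt : ∀ x, supMean (thick Θ δ ((closedBall 0 3).indicator f)) x ≤
      ENNReal.ofReal (δ⁻¹ * C) * ∫⁻ z in closedBall (0 : ℝ × ℝ) 3, ENNReal.ofReal |f z| := by
    intro x
    refine supMean_le fun t _ => ?_
    have e1 : |thick Θ δ ((closedBall 0 3).indicator f) x t| ≤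
        δ⁻¹ * C * ∫ z in closedBall (0 : ℝ × ℝ) 3, |f z| := by
      rw [thick, abs_mul, abs_of_pos (inv_pos.2 hδ), mul_assoc]
      refine mul_le_mul_of_nonneg_left ?_ (inv_pos.2 hδ).le
      rw [← Real.norm_eq_abs, ← integral_const_mul, ← integral_indicator measurableSet_closedBall]
      refine norm_integral_le_of_norm_le ?_ (Eventually.of_forall fun z => ?_)
      · refine (integrable_indicator_iff measurableSet_closedBall).2 ?_
        exact (hf.abs.const_mul C).continuousOn.integrableOn_compact (isCompact_closedBall _ _)
      · by_cases hz : z ∈ closedBall (0 : ℝ × ℝ) 3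
        · rw [Set.indicator_of_mem hz, Set.indicator_of_mem hz, norm_mul, mul_comm]
          exact mul_le_mul_of_nonneg_right (hC _) (abs_nonneg _)
        · rw [Set.indicator_of_notMem hz, Set.indicator_of_notMem hz, zero_mul, norm_zero]
    refine (ENNReal.ofReal_le_ofReal e1).trans (le_of_eq ?_)
    rw [ENNReal.ofReal_mul (by positivity), ofReal_integral_eq_lintegral_ofReal]
    · exact hf.abs.continuousOn.integrableOn_compact (isCompact_closedBall _ _)
    · exact Eventually.of_forall fun z => abs_nonneg _
  have hJ := rpow_lintegral_le (μ := volume.restrict (closedBall (0 : ℝ × ℝ) 3))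
    (g := fun z => ENNReal.ofReal |f z|) (hf.abs.measurable.ennreal_ofReal.aemeasurable) hp
  rw [Measure.restrict_apply_univ] at hJ
  simp only [ENNReal.ofReal_rpow_of_nonneg (abs_nonneg _) hp0] at hJ
  calc ∫⁻ x in closedBall (0 : ℝ × ℝ) (1 / 8),
        supMean (thick Θ δ ((closedBall 0 3).indicator f)) x ^ p
      ≤ ∫⁻ _ in closedBall (0 : ℝ × ℝ) (1 / 8), ENNReal.ofReal (δ⁻¹ * C) ^ p *
        (volume (closedBall (0 : ℝ × ℝ) 3) ^ (p - 1) *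
          ∫⁻ z in closedBall (0 : ℝ × ℝ) 3, ENNReal.ofReal (|f z| ^ p)) := by
        refine lintegral_mono fun x => (ENNReal.rpow_le_rpow (hpt x) hp0).trans ?_
        rw [ENNReal.mul_rpow_of_nonneg _ _ hp0]
        exact mul_le_mul_right hJ _
    _ = _ := by
        rw [setLIntegral_const]
        ring

theorem add_rpow_le_dyadic {p : ℝ} (hp : 2 < p) {h₀ : ℝ} (h0 : 0 < h₀) (h1 : h₀ ≤ 1) (k : ℕ) :
    h₀ / 2 ^ k + (h₀ / 2 ^ k) ^ (p - 2) ≤ 2 * (((2 : ℝ) ^ (-(min 1 (p - 2) / 2))) ^ 2) ^ k := by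
  set e := min 1 (p - 2) with he
  have he0 : 0 < e := lt_min one_pos (by linarith)
  have h2k : (0 : ℝ) < 2 ^ k := by positivity
  have hk0 : 0 < h₀ / 2 ^ k := by positivity
  have hk1 : h₀ / 2 ^ k ≤ 1 := (div_le_self h0.le (one_le_pow₀ one_le_two)).trans h1
  have e1 : h₀ / 2 ^ k ≤ (h₀ / 2 ^ k) ^ e := by
    conv_lhs => rw [← Real.rpow_one (h₀ / 2 ^ k)]
    exact Real.rpow_le_rpow_of_exponent_ge hk0 hk1 (min_le_left _ _)
  have e2 : (h₀ / 2 ^ k) ^ (p - 2) ≤ (h₀ / 2 ^ k) ^ e :=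
    Real.rpow_le_rpow_of_exponent_ge hk0 hk1 (min_le_right _ _)
  have e3 : (h₀ / 2 ^ k) ^ e ≤ (1 / 2 ^ k) ^ e :=
    Real.rpow_le_rpow hk0.le (by gcongr) he0.le
  have e4 : ((1 : ℝ) / 2 ^ k) ^ e = (((2 : ℝ) ^ (-(e / 2))) ^ 2) ^ k := by
    rw [one_div, ← Real.rpow_natCast 2 k, ← Real.rpow_neg two_pos.le, ← Real.rpow_mul two_pos.le,
      ← pow_mul, ← Real.rpow_natCast (_ ^ _), ← Real.rpow_mul two_pos.le]
    congr 1
    push_cast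
    ring
  linarith

/-- The local circular maximal inequality in the plane. -/
theorem exists_lintegral_supMean_circMean_le {p : ℝ} (hp : 2 < p) :
    ∃ K : ℝ≥0∞, K ≠ ∞ ∧ ∀ f : ℝ × ℝ → ℝ, Continuous f →
      ∫⁻ x in closedBall (0 : ℝ × ℝ) (1 / 8), supMean (circMean f) x ^ p ≤
      K * ∫⁻ z in closedBall (0 : ℝ × ℝ) 3, ENNReal.ofReal (|f z| ^ p) := by
  obtain ⟨N, hN⟩ : ∃ N : ℕ, N = 1760 := ⟨_, rfl⟩
  obtain ⟨Θ, η, hΘ, hη, h1, htel⟩ := exists_cutoff_telescope 5281 (2 ^ N)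
    (one_le_pow₀ one_le_two)
  obtain ⟨A, K₁, hA, hK₁, hhigh⟩ := exists_lintegral_supMean_thick_le hη (m := 5281) le_rfl hp
  rw [← hN] at hhigh
  have ha : (1 : ℝ) < 2 ^ N := one_lt_pow₀ one_lt_two (by omega)
  have hφ := hη.iteratedDeriv 5281
  set φ := iteratedDeriv 5281 η with hφd
  clear_value φ
  have hAp : 0 < A := by linarith
  obtain ⟨h₀, hh₀⟩ : ∃ h₀ : ℝ, h₀ = 1 / (10 ^ 9 * A) := ⟨_, rfl⟩
  have h00 : 0 < h₀ := by rw [hh₀]; positivity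
  have h0A : 10 ^ 9 * A * h₀ = 1 := by rw [hh₀]; field_simp
  have h0half : h₀ ≤ 1 / 2 := by nlinarith
  have hδ0 : 0 < h₀ ^ N := pow_pos h00 N
  have hδ1 : h₀ ^ N ≤ 1 / 2 :=
    (pow_le_of_le_one h00.le (by linarith) (by omega)).trans h0half
  obtain ⟨K₀, hK₀, hlow⟩ := lintegral_supMean_thick_low_le hΘ hδ0 (p := p) (by linarith)
  have hp0 : 0 < p := by linarith
  have hr0 : (0 : ℝ) < 2 ^ (-(min 1 (p - 2) / 2)) := Real.rpow_pos_of_pos two_pos _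
  have hr1 : (2 : ℝ) ^ (-(min 1 (p - 2) / 2)) < 1 := by
    refine Real.rpow_lt_one_of_one_lt_of_neg one_lt_two ?_
    have : 0 < min 1 (p - 2) := lt_min one_pos (by linarith)
    linarith
  have hgeo := fun k => add_rpow_le_dyadic hp h00 (by linarith) k
  set r : ℝ := 2 ^ (-(min 1 (p - 2) / 2)) with hr
  clear_value r
  set R := ENNReal.ofReal r with hR
  have hR0 : R ≠ 0 := (ENNReal.ofReal_pos.2 hr0).ne'
  have hR1 : R < 1 := ENNReal.ofReal_lt_one.2 hr1
  set G := ((1 - R ^ (1 / p))⁻¹) ^ p * ((1 - R)⁻¹ * ENNReal.ofReal (2 * K₁)) with hG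
  have hGt : G ≠ ∞ := by
    have hR2 : R ^ (1 / p) < 1 := ENNReal.rpow_lt_one hR1 (by positivity)
    refine ENNReal.mul_ne_top (ENNReal.rpow_ne_top_of_nonneg hp0.le ?_)
      (ENNReal.mul_ne_top ?_ ENNReal.ofReal_ne_top)
    · exact ENNReal.inv_ne_top.2 (tsub_pos_of_lt hR2).ne'
    · exact ENNReal.inv_ne_top.2 (tsub_pos_of_lt hR1).ne'
  refine ⟨2 ^ p * (2 ^ (p - 1) * (K₀ + G)), ?_, fun f hf => ?_⟩
  · refine ENNReal.mul_ne_top ?_ (ENNReal.mul_ne_top ?_ (ENNReal.add_ne_top.2 ⟨hK₀, hGt⟩))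
    · exact ENNReal.rpow_ne_top_of_nonneg hp0.le (by norm_num)
    · exact ENNReal.rpow_ne_top_of_nonneg (by linarith) (by norm_num)
  set I := ∫⁻ z in closedBall (0 : ℝ × ℝ) 3, ENNReal.ofReal (|f z| ^ p) with hI
  set g := (closedBall (0 : ℝ × ℝ) 3).indicator f with hg
  have hgl : LocData g := locData_indicator_closedBall hf
  have hIg : ∫⁻ z, ENNReal.ofReal (|g z| ^ p) = I := by
    rw [hI, ← lintegral_indicator measurableSet_closedBall]
    refine lintegral_congr fun z => ?_
    by_cases hz : z ∈ closedBall (0 : ℝ × ℝ) 3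
    · rw [hg, Set.indicator_of_mem hz, Set.indicator_of_mem hz]
    · rw [hg, Set.indicator_of_notMem hz, Set.indicator_of_notMem hz, abs_zero,
        Real.zero_rpow hp0.ne', ENNReal.ofReal_zero]
  have hδk : ∀ k : ℕ, h₀ ^ N / (2 ^ N) ^ k = (h₀ / 2 ^ k) ^ N := by
    intro k
    rw [div_pow, ← pow_mul, ← pow_mul, mul_comm N k]
  have hhk : ∀ k : ℕ, ∫⁻ x in closedBall (0 : ℝ × ℝ) (1 / 8),
      supMean (thick φ (h₀ ^ N / (2 ^ N) ^ k) g) x ^ p ≤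
      (R ^ 2) ^ k * (ENNReal.ofReal (2 * K₁) * I) := by
    intro k
    have hk0 : 0 < h₀ / 2 ^ k := by positivity
    rw [hδk]
    refine (hhigh _ g hk0 ?_ hgl).trans ?_
    · rw [← h0A]
      exact mul_le_mul_of_nonneg_left (div_le_self h00.le (one_le_pow₀ one_le_two)) (by positivity)
    · rw [hIg, ← mul_assoc]
      refine mul_le_mul_left ?_ _
      rw [hR, ← ENNReal.ofReal_pow hr0.le, ← ENNReal.ofReal_pow (by positivity),
        ← ENNReal.ofReal_mul (by positivity)]
      refine ENNReal.ofReal_le_ofReal ?_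
      have := mul_le_mul_of_nonneg_left (hgeo k) hK₁.le
      linarith
  have hmeas : ∀ (ψ : ℝ → ℝ) (δ : ℝ), IsCutoff ψ → Measurable (supMean (thick ψ δ g)) :=
    fun ψ δ hψ => measurable_supMean fun t => continuous_thick_left hψ δ hgl t
  have hsum := lintegral_rpow_tsum_le (μ := volume.restrict (closedBall (0 : ℝ × ℝ) (1 / 8)))
    (fun k : ℕ => hmeas φ (h₀ ^ N / (2 ^ N) ^ k) hφ) hR0 hR1 hp0 hhk
  have hdouble : ∀ x, supMean (circMean f) x ≤ 2 * supMean (fun x t => 1 / 2 * circMean f x t) x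
      := by
    intro x
    refine supMean_le fun t ht => ?_
    refine le_trans (le_of_eq ?_) (mul_le_mul_right
      (le_supMean (F := fun x t => 1 / 2 * circMean f x t) (x := x) ht) 2)
    rw [abs_mul, ← ENNReal.ofReal_ofNat 2, ← ENNReal.ofReal_mul (by norm_num)]
    congr 1
    rw [abs_of_pos (by norm_num : (0 : ℝ) < 1 / 2)]
    ring
  have hpt : ∀ x ∈ closedBall (0 : ℝ × ℝ) (1 / 8), supMean (circMean f) x ^ p ≤
      2 ^ p * (2 ^ (p - 1) * (supMean (thick Θ (h₀ ^ N) g) x ^ p +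
        (∑' k : ℕ, supMean (thick φ (h₀ ^ N / (2 ^ N) ^ k) g) x) ^ p)) := by
    intro x hx
    refine (ENNReal.rpow_le_rpow (hdouble x) hp0.le).trans ?_
    rw [ENNReal.mul_rpow_of_nonneg _ _ hp0.le]
    refine mul_le_mul_right ?_ _
    refine (ENNReal.rpow_le_rpow (supMean_circMean_le hΘ h1 ha htel hf hδ0 hδ1 hx) hp0.le).trans ?_
    exact ENNReal.rpow_add_le_mul_rpow_add_rpow _ _ (by linarith)
  have m1 : Measurable fun x => supMean (thick Θ (h₀ ^ N) g) x ^ p := (hmeas _ _ hΘ).pow_const p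
  have m2 : Measurable fun x =>
      (∑' k : ℕ, supMean (thick φ (h₀ ^ N / (2 ^ N) ^ k) g) x) ^ p :=
    (Measurable.tsum fun k => hmeas _ _ hφ).pow_const p
  have m3 : Measurable fun x => supMean (thick Θ (h₀ ^ N) g) x ^ p +
      (∑' k : ℕ, supMean (thick φ (h₀ ^ N / (2 ^ N) ^ k) g) x) ^ p := m1.add m2
  refine (setLIntegral_mono' measurableSet_closedBall hpt).trans ?_
  rw [lintegral_const_mul _ (m3.const_mul _), lintegral_const_mul _ m3,
    lintegral_add_left m1, mul_assoc, mul_assoc, add_mul]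
  refine mul_le_mul_right (mul_le_mul_right (add_le_add (hlow f hf) (hsum.trans (le_of_eq ?_))) _) _
  rw [hG]
  ring

/-- The orthogonal group of `E`. -/
noncomputable abbrev OrthGroup (E : Type*) [NormedAddCommGroup E] [InnerProductSpace ℝ E]
    [CompleteSpace E] :=
  unitary (E →L[ℝ] E)

section
variable {E : Type*} [NormedAddCommGroup E] [InnerProductSpace ℝ E] [FiniteDimensional ℝ E]

theorem compactSpace_orthGroup : CompactSpace (OrthGroup E) := by
  have : ProperSpace (E →L[ℝ] E) := FiniteDimensional.proper ℝ _
  refine isCompact_iff_compactSpace.1 (Metric.isCompact_of_isClosed_isBounded ?_ ?_)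
  · have : ((unitary (E →L[ℝ] E) : Submonoid (E →L[ℝ] E)) : Set (E →L[ℝ] E)) =
        {u | star u * u = 1} ∩ {u | u * star u = 1} := by
      ext u; exact Unitary.mem_iff
    rw [this]
    exact (isClosed_eq (by fun_prop) continuous_const).inter
      (isClosed_eq (by fun_prop) continuous_const)
  · refine (isBounded_closedBall (x := (0 : E →L[ℝ] E)) (r := 1)).subset fun u hu => ?_
    rw [mem_closedBall_zero_iff]
    refine ContinuousLinearMap.opNorm_le_bound _ zero_le_one fun x => ?_
    rw [one_mul, ContinuousLinearMap.norm_map_of_mem_unitary hu]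

theorem exists_orthGroup_map_eq {v w : E} (h : ‖v‖ = ‖w‖) :
    ∃ L : OrthGroup E, (L : E →L[ℝ] E) v = w :=
  ⟨Unitary.linearIsometryEquiv.symm (Submodule.reflection (ℝ ∙ (v - w))ᗮ),
    Submodule.reflection_sub h⟩

/-- The action of an isometry on the unit sphere. -/
def sphereMap (L : E ≃ₗᵢ[ℝ] E) (ω : sphere (0 : E) 1) : sphere (0 : E) 1 :=
  ⟨L ω, by rw [mem_sphere_zero_iff_norm, L.norm_map]; exact norm_eq_of_mem_sphere ω⟩

open scoped Pointwise in
theorem measurePreserving_sphereMap [MeasurableSpace E] [BorelSpace E] (L : E ≃ₗᵢ[ℝ] E) :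
    MeasurePreserving (sphereMap L) (volume : Measure E).toSphere (volume : Measure E).toSphere :=
        by
  have hm : Measurable (sphereMap L) :=
    ((L.continuous.comp continuous_subtype_val).subtype_mk _).measurable
  refine ⟨hm, Measure.ext fun s hs => ?_⟩
  rw [Measure.map_apply hm hs, Measure.toSphere_apply' _ (hm hs), Measure.toSphere_apply' _ hs]
  congr 1
  have : Set.Ioo (0 : ℝ) 1 • (Subtype.val '' (sphereMap L ⁻¹' s) : Set E) =
      L ⁻¹' (Set.Ioo (0 : ℝ) 1 • (Subtype.val '' s : Set E)) := by
    ext x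
    simp only [Set.mem_smul, Set.mem_preimage, Set.mem_image]
    constructor
    · rintro ⟨r, hr, _, ⟨ω, hω, rfl⟩, rfl⟩
      exact ⟨r, hr, _, ⟨_, hω, rfl⟩, (L.map_smul r _).symm⟩
    · rintro ⟨r, hr, _, ⟨ω, hω, rfl⟩, hx⟩
      refine ⟨r, hr, _, ⟨sphereMap L.symm ω, ?_, rfl⟩, ?_⟩
      · have : sphereMap L (sphereMap L.symm ω) = ω := Subtype.ext (L.apply_symm_apply _)
        rwa [this]
      · change r • L.symm ω = x
        rw [← L.symm.map_smul, hx, L.symm_apply_apply]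
  rw [this]
  exact L.measurePreserving.measure_preimage_emb L.toHomeomorph.measurableEmbedding _

theorem exists_haar_average [MeasurableSpace E] [BorelSpace E]
    (σ : Measure (sphere (0 : E) 1)) [IsProbabilityMeasure σ]
    (hσ : ∀ (L : E ≃ₗᵢ[ℝ] E) (F : E → ℝ), Continuous F →
      ∫ ω : sphere (0 : E) 1, F (L ω) ∂σ = ∫ ω : sphere (0 : E) 1, F ω ∂σ) :
    ∃ ν : Measure (OrthGroup E), IsProbabilityMeasure ν ∧
      ∀ F : E → ℝ, Continuous F → ∀ v : E, ‖v‖ = 1 → ∫ ω : sphere (0 : E) 1, F ω ∂σ =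
          ∫ g, F (((g⁻¹ : OrthGroup E) : E →L[ℝ] E) v) ∂ν := by
  have : CompactSpace (OrthGroup E) := compactSpace_orthGroup
  let ν : Measure (OrthGroup E) := Measure.haarMeasure ⊤
  have hν : IsProbabilityMeasure ν := ⟨Measure.haarMeasure_self⟩
  refine ⟨ν, hν, fun F hF v hv => ?_⟩
  have hcont : Continuous fun q : OrthGroup E × E => F (((q.1⁻¹ : OrthGroup E) : E →L[ℝ] E) q.2)
      := by
    refine hF.comp ?_
    exact (continuous_subtype_val.comp continuous_fst.inv).clm_apply continuous_snd
  have hconst : ∀ w : E, ‖w‖ = 1 → ∫ g, F (((g⁻¹ : OrthGroup E) : E →L[ℝ] E) w) ∂ν =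
      ∫ g, F (((g⁻¹ : OrthGroup E) : E →L[ℝ] E) v) ∂ν := by
    intro w hw
    obtain ⟨L, hL⟩ := exists_orthGroup_map_eq (v := v) (w := w) (hv.trans hw.symm)
    rw [← integral_mul_left_eq_self (fun g => F (((g⁻¹ : OrthGroup E) : E →L[ℝ] E) w)) L]
    refine integral_congr_ae (Eventually.of_forall fun g => ?_)
    have : (((L * g)⁻¹ : OrthGroup E) : E →L[ℝ] E) w = ((g⁻¹ : OrthGroup E) : E →L[ℝ] E) v := by
      rw [mul_inv_rev, ← hL]
      change ((g⁻¹ : OrthGroup E) : E →L[ℝ] E) (((L⁻¹ * L : OrthGroup E) : E →L[ℝ] E) v) = _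
      rw [inv_mul_cancel]
      rfl
    simp only [this]
  have hswap : ∀ act : OrthGroup E → E → ℝ, Continuous (fun q : OrthGroup E × E => act q.1 q.2) →
      ∫ ω : sphere (0 : E) 1, (∫ g, act g ω ∂ν) ∂σ = ∫ g, (∫ ω : sphere (0 : E) 1, act g ω ∂σ) ∂ν
          := by
    intro act hact
    refine integral_integral_swap_of_hasCompactSupport ?_ (HasCompactSupport.of_compactSpace _)
    exact hact.comp (continuous_snd.prodMk (continuous_subtype_val.comp continuous_fst))
  have hsw := hswap (fun g w => F (((g⁻¹ : OrthGroup E) : E →L[ℝ] E) w)) hcont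
  have e1 : ∫ ω : sphere (0 : E) 1, (∫ g, F (((g⁻¹ : OrthGroup E) : E →L[ℝ] E) ω) ∂ν)
      ∂σ = ∫ g, F (((g⁻¹ : OrthGroup E) : E →L[ℝ] E) v) ∂ν := by
    rw [integral_congr_ae (Eventually.of_forall fun ω : sphere (0 : E) 1 => hconst ω
        (norm_eq_of_mem_sphere ω)),
      integral_const, probReal_univ, one_smul]
  have e2 : ∫ g, (∫ ω : sphere (0 : E) 1, F (((g⁻¹ : OrthGroup E) : E →L[ℝ] E) ω)
      ∂σ) ∂ν = ∫ ω : sphere (0 : E) 1, F ω ∂σ := by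
    have : ∀ g : OrthGroup E, ∫ ω : sphere (0 : E) 1, F (((g⁻¹ : OrthGroup E) : E →L[ℝ] E) ω) ∂σ =
        ∫ ω : sphere (0 : E) 1, F ω ∂σ := fun g => hσ (Unitary.linearIsometryEquiv g⁻¹) F hF
    simp only [this]
    rw [integral_const, probReal_univ, one_smul]
  rw [← e2, ← hsw, e1]

end

theorem surfMeasureNorm_univ {n : ℕ} (hn : 2 ≤ n) : surfMeasureNorm n Set.univ = 1 := by
  have : Nonempty (Fin n) := ⟨⟨0, by omega⟩⟩
  rw [surfMeasureNorm, Measure.smul_apply, smul_eq_mul, ENNReal.inv_mul_cancel]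
  · exact fun h => Measure.toSphere_ne_zero _ (Measure.measure_univ_eq_zero.1 h)
  · exact measure_ne_top (volume : Measure (EuclideanSpace ℝ (Fin n))).toSphere _

theorem integral_sphereMap {n : ℕ} (L : EuclideanSpace ℝ (Fin n) ≃ₗᵢ[ℝ] EuclideanSpace ℝ (Fin n))
    {F : EuclideanSpace ℝ (Fin n) → ℝ} (hF : Continuous F) :
    ∫ ω, F (L (ω : EuclideanSpace ℝ (Fin n))) ∂surfMeasureNorm n =
      ∫ ω, F (ω : EuclideanSpace ℝ (Fin n)) ∂surfMeasureNorm n := by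
  have h := measurePreserving_sphereMap L
  rw [surfMeasureNorm, integral_smul_measure, integral_smul_measure]
  congr 1
  have e := integral_map (μ := surfMeasure n) h.measurable.aemeasurable
    (f := fun ω : sphere (0 : EuclideanSpace ℝ (Fin n)) 1 => F ω)
    (hF.comp continuous_subtype_val).aestronglyMeasurable
  have h2 : Measure.map (sphereMap L) (surfMeasure n) = surfMeasure n := h.map_eq
  rw [h2] at e
  exact e.symm

theorem lintegral_supMean_slice_le {E : Type*} [NormedAddCommGroup E] [InnerProductSpace ℝ E]
    [FiniteDimensional ℝ E] [MeasurableSpace E] [BorelSpace E] {p : ℝ} {K : ℝ≥0∞}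
    (hK : ∀ f : ℝ × ℝ → ℝ, Continuous f →
      ∫⁻ x in closedBall (0 : ℝ × ℝ) (1 / 8), supMean (circMean f) x ^ p ≤
      K * ∫⁻ z in closedBall (0 : ℝ × ℝ) 3, ENNReal.ofReal (|f z| ^ p))
    {f : E → ℝ} (hf : Continuous f) (u v : E) :
    volume (closedBall (0 : ℝ × ℝ) (1 / 8)) *
      ∫⁻ x, supMean (circMean fun a => f (x + a.1 • u + a.2 • v)) 0 ^ p ≤
      K * volume (closedBall (0 : ℝ × ℝ) 3) * ∫⁻ x, ENNReal.ofReal (|f x| ^ p) := by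
  have hcirc : Continuous fun P : (E × (ℝ × ℝ)) × ℝ =>
      circMean (fun a => f (P.1.1 + a.1 • u + a.2 • v)) P.1.2 P.2 := by
    refine intervalIntegral.continuous_parametric_intervalIntegral_of_continuous' ?_ _ _
    exact hf.comp (by fun_prop)
  have hmeas : Measurable fun q : E × (ℝ × ℝ) =>
      supMean (circMean fun a => f (q.1 + a.1 • u + a.2 • v)) q.2 ^ p := by
    refine Measurable.pow_const (LowerSemicontinuous.measurable
      (lowerSemicontinuous_biSup fun t _ => ?_)) p
    exact (ENNReal.continuous_ofReal.comp (hcirc.comp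
      (Continuous.prodMk_left t)).abs).lowerSemicontinuous
  have hshift : ∀ (x : E) (y : ℝ × ℝ),
      supMean (circMean fun a => f (x + a.1 • u + a.2 • v)) y =
      supMean (circMean fun a => f ((x + (y.1 • u + y.2 • v)) + a.1 • u + a.2 • v)) 0 := by
    intro x y
    have : ∀ t, circMean (fun a => f (x + a.1 • u + a.2 • v)) y t =
        circMean (fun a => f ((x + (y.1 • u + y.2 • v)) + a.1 • u + a.2 • v)) 0 t := by
      intro t
      simp only [circMean, Prod.fst_zero, Prod.snd_zero, zero_add, add_smul]
      refine intervalIntegral.integral_congr fun θ _ => ?_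
      congr 1
      abel
    simp only [supMean, this]
  have hfm : Measurable fun q : E × (ℝ × ℝ) =>
      ENNReal.ofReal (|f (q.1 + q.2.1 • u + q.2.2 • v)| ^ p) := by
    refine Measurable.ennreal_ofReal (Measurable.pow_const ?_ p)
    exact (hf.comp (by fun_prop : Continuous fun q : E × (ℝ × ℝ) =>
      q.1 + q.2.1 • u + q.2.2 • v)).abs.measurable
  calc volume (closedBall (0 : ℝ × ℝ) (1 / 8)) *
      ∫⁻ x, supMean (circMean fun a => f (x + a.1 • u + a.2 • v)) 0 ^ p
      = ∫⁻ y in closedBall (0 : ℝ × ℝ) (1 / 8), ∫⁻ x,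
          supMean (circMean fun a => f (x + a.1 • u + a.2 • v)) y ^ p := by
        rw [mul_comm, ← setLIntegral_const]
        refine lintegral_congr fun y => ?_
        have e : ∀ x, supMean (circMean fun a => f (x + a.1 • u + a.2 • v)) y ^ p =
            (fun x => supMean (circMean fun a => f (x + a.1 • u + a.2 • v)) 0 ^ p)
              (x + (y.1 • u + y.2 • v)) := fun x => by rw [hshift x y]
        exact ((lintegral_congr e).trans (lintegral_add_right_eq_self
          (fun x => supMean (circMean fun a => f (x + a.1 • u + a.2 • v)) 0 ^ p) _)).symm
    _ = ∫⁻ x, ∫⁻ y in closedBall (0 : ℝ × ℝ) (1 / 8),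
          supMean (circMean fun a => f (x + a.1 • u + a.2 • v)) y ^ p :=
        (lintegral_lintegral_swap hmeas.aemeasurable).symm
    _ ≤ ∫⁻ x, K * ∫⁻ z in closedBall (0 : ℝ × ℝ) 3,
          ENNReal.ofReal (|f (x + z.1 • u + z.2 • v)| ^ p) :=
        lintegral_mono fun x => hK _ (hf.comp (by fun_prop))
    _ = K * ∫⁻ z in closedBall (0 : ℝ × ℝ) 3, ∫⁻ x,
          ENNReal.ofReal (|f (x + z.1 • u + z.2 • v)| ^ p) := by
        rw [lintegral_const_mul _ hfm.lintegral_prod_right',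
          lintegral_lintegral_swap hfm.aemeasurable]
    _ = _ := by
        have : ∀ z : ℝ × ℝ, ∫⁻ x, ENNReal.ofReal (|f (x + z.1 • u + z.2 • v)| ^ p) =
            ∫⁻ x, ENNReal.ofReal (|f x| ^ p) := by
          intro z
          simp only [add_assoc]
          exact lintegral_add_right_eq_self (fun x => ENNReal.ofReal (|f x| ^ p)) _
        simp only [this]
        rw [setLIntegral_const]
        ring

/-- The maximal function of the spherical means with respect to a measure on the unit sphere. -/
noncomputable def sphereSup {E : Type*} [NormedAddCommGroup E] [NormedSpace ℝ E]
    [MeasurableSpace E] (σ : Measure (sphere (0 : E) 1)) (f : E → ℝ) (x : E) : ℝ≥0∞ :=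
  ⨆ t ∈ Set.Icc (1 : ℝ) 2, ENNReal.ofReal |∫ ω : sphere (0 : E) 1, f (x + t • (ω : E)) ∂σ|

theorem mul_lintegral_rpow_le_of_average {E G : Type*} [MeasurableSpace E] [MeasurableSpace G]
    {μ : Measure E} [SFinite μ] {ν : Measure G} [IsProbabilityMeasure ν] {p : ℝ} (hp : 1 < p)
    {H : E × G → ℝ≥0∞} (hH : Measurable H) {S : E → ℝ≥0∞} (hS : ∀ x, S x ≤ ∫⁻ g, H (x, g) ∂ν)
    {c M : ℝ≥0∞} (hM : ∀ g, c * ∫⁻ x, H (x, g) ^ p ∂μ ≤ M) : c * ∫⁻ x, S x ^ p ∂μ ≤ M := by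
  have hHp : Measurable fun q => H q ^ p := hH.pow_const p
  have hmg : Measurable fun g => ∫⁻ x, H (x, g) ^ p ∂μ := hHp.lintegral_prod_left'
  have hJ : ∀ x, S x ^ p ≤ ∫⁻ g, H (x, g) ^ p ∂ν := by
    intro x
    refine (ENNReal.rpow_le_rpow (hS x) (by linarith)).trans ?_
    have hm : Measurable fun g => H (x, g) := hH.comp measurable_prodMk_left
    refine (rpow_lintegral_le hm.aemeasurable hp).trans ?_
    rw [measure_univ, ENNReal.one_rpow, one_mul]
  calc c * ∫⁻ x, S x ^ p ∂μ ≤ c * ∫⁻ x, ∫⁻ g, H (x, g) ^ p ∂ν ∂μ :=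
        mul_le_mul_right (lintegral_mono hJ) _
    _ = ∫⁻ g, c * ∫⁻ x, H (x, g) ^ p ∂μ ∂ν := by
        rw [lintegral_lintegral_swap hHp.aemeasurable, lintegral_const_mul _ hmg]
    _ ≤ ∫⁻ _, M ∂ν := lintegral_mono hM
    _ = M := by rw [lintegral_const, measure_univ, mul_one]

theorem lintegral_sphereSup_le_of_average {E : Type*} [NormedAddCommGroup E] [InnerProductSpace ℝ E]
    [FiniteDimensional ℝ E] [MeasurableSpace E] [BorelSpace E]
    {G : Type*} [TopologicalSpace G] [CompactSpace G] [FirstCountableTopology G]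
    [MeasurableSpace G] [BorelSpace G] {ν : Measure G} [IsProbabilityMeasure ν]
    {rot : G → E → E} (hrc : ∀ w, Continuous fun g => rot g w)
    (hadd : ∀ g v w, rot g (v + w) = rot g v + rot g w)
    (hsmul : ∀ g (a : ℝ) w, rot g (a • w) = a • rot g w)
    {σ : Measure (sphere (0 : E) 1)}
    (hav : ∀ F : E → ℝ, Continuous F → ∀ v : E, ‖v‖ = 1 →
      ∫ ω : sphere (0 : E) 1, F ω ∂σ = ∫ g, F (rot g v) ∂ν)
    {e₁ e₂ : E} (he : ∀ θ : ℝ, ‖Real.cos θ • e₁ + Real.sin θ • e₂‖ = 1) {p : ℝ} (hp : 1 < p)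
    {K : ℝ≥0∞} (hK : ∀ f : ℝ × ℝ → ℝ, Continuous f →
      ∫⁻ x in closedBall (0 : ℝ × ℝ) (1 / 8), supMean (circMean f) x ^ p ≤
      K * ∫⁻ z in closedBall (0 : ℝ × ℝ) 3, ENNReal.ofReal (|f z| ^ p))
    {f : E → ℝ} (hf : Continuous f) (hfc : HasCompactSupport f) :
    volume (closedBall (0 : ℝ × ℝ) (1 / 8)) * ∫⁻ x, sphereSup σ f x ^ p ≤
      K * volume (closedBall (0 : ℝ × ℝ) 3) * ∫⁻ x, ENNReal.ofReal (|f x| ^ p) := by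
  obtain ⟨C, hC⟩ := hfc.exists_bound_of_continuous hf
  have hr1 := hrc e₁
  have hr2 := hrc e₂
  have hcirc : Continuous fun P : (E × G) × ℝ =>
      circMean (fun a => f (P.1.1 + a.1 • rot P.1.2 e₁ + a.2 • rot P.1.2 e₂)) 0 P.2 := by
    refine intervalIntegral.continuous_parametric_intervalIntegral_of_continuous' ?_ _ _
    exact hf.comp (by fun_prop)
  have hmeas : Measurable fun q : E × G =>
      supMean (circMean fun a => f (q.1 + a.1 • rot q.2 e₁ + a.2 • rot q.2 e₂)) 0 := by
    refine LowerSemicontinuous.measurable (lowerSemicontinuous_biSup fun t _ => ?_)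
    exact (ENNReal.continuous_ofReal.comp (hcirc.comp
      (Continuous.prodMk_left t)).abs).lowerSemicontinuous
  have hrep : ∀ (x : E) (t : ℝ), (2 * Real.pi) * ∫ ω : sphere (0 : E) 1, f (x + t • (ω : E)) ∂σ =
      ∫ g, circMean (fun a => f (x + a.1 • rot g e₁ + a.2 • rot g e₂)) 0 t ∂ν := by
    intro x t
    have hle : -Real.pi ≤ Real.pi := by linarith [Real.pi_pos]
    have hc : Continuous fun q : ℝ × G =>
        f (x + (t * Real.cos q.1) • rot q.2 e₁ + (t * Real.sin q.1) • rot q.2 e₂) :=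
      hf.comp (by fun_prop)
    have h1 : ∀ θ : ℝ, ∫ g, f (x + (t * Real.cos θ) • rot g e₁ + (t * Real.sin θ) • rot g e₂) ∂ν =
        ∫ ω : sphere (0 : E) 1, f (x + t • (ω : E)) ∂σ := by
      intro θ
      rw [hav (fun w => f (x + t • w)) (hf.comp (by fun_prop)) _ (he θ)]
      simp only [hadd, hsmul, smul_add, smul_smul, add_assoc]
    have h2 : ∫ θ in Set.Ioc (-Real.pi) Real.pi, (∫ g, f (x + (t * Real.cos θ) • rot g e₁ +
        (t * Real.sin θ) • rot g e₂) ∂ν) = ∫ g, (∫ θ in Set.Ioc (-Real.pi) Real.pi,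
        f (x + (t * Real.cos θ) • rot g e₁ + (t * Real.sin θ) • rot g e₂)) ∂ν := by
      refine integral_integral_swap ?_
      exact Integrable.of_bound hc.aestronglyMeasurable C (Eventually.of_forall fun q => hC _)
    simp only [circMean, Prod.fst_zero, Prod.snd_zero, zero_add]
    simp only [intervalIntegral.integral_of_le hle]
    rw [← h2]
    simp only [h1]
    rw [setIntegral_const, Real.volume_real_Ioc_of_le hle, smul_eq_mul]
    ring
  have hpt : ∀ x, sphereSup σ f x ≤
      ∫⁻ g, supMean (circMean fun a => f (x + a.1 • rot g e₁ + a.2 • rot g e₂)) 0 ∂ν := by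
    intro x
    refine iSup₂_le fun t ht => ?_
    calc ENNReal.ofReal |∫ ω : sphere (0 : E) 1, f (x + t • (ω : E)) ∂σ|
        ≤ ENNReal.ofReal |(2 * Real.pi) * ∫ ω : sphere (0 : E) 1, f (x + t • (ω : E)) ∂σ| := by
          refine ENNReal.ofReal_le_ofReal ?_
          rw [abs_mul, abs_of_pos Real.two_pi_pos]
          exact le_mul_of_one_le_left (abs_nonneg _) (by linarith [Real.pi_gt_three])
      _ ≤ ∫⁻ g, ENNReal.ofReal
            |circMean (fun a => f (x + a.1 • rot g e₁ + a.2 • rot g e₂)) 0 t| ∂ν := by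
          rw [hrep, ← Real.norm_eq_abs]
          refine (ENNReal.ofReal_le_ofReal (norm_integral_le_integral_norm _)).trans ?_
          refine (ofReal_integral_eq_lintegral_ofReal ?_ ?_).le
          · have hc : Continuous fun g =>
                circMean (fun a => f (x + a.1 • rot g e₁ + a.2 • rot g e₂)) 0 t :=
              hcirc.comp (by fun_prop : Continuous fun g : G => ((x, g), t))
            exact hc.norm.integrable_of_hasCompactSupport (HasCompactSupport.of_compactSpace _)
          · exact Eventually.of_forall fun g => norm_nonneg _
      _ ≤ _ := lintegral_mono fun g => le_supMean ht
  have hM : ∀ g : G, volume (closedBall (0 : ℝ × ℝ) (1 / 8)) *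
      ∫⁻ x, supMean (circMean fun a => f (x + a.1 • rot g e₁ + a.2 • rot g e₂)) 0 ^ p ≤
      K * volume (closedBall (0 : ℝ × ℝ) 3) * ∫⁻ x, ENNReal.ofReal (|f x| ^ p) :=
    fun g => lintegral_supMean_slice_le hK hf (rot g e₁) (rot g e₂)
  obtain ⟨H, hH⟩ : ∃ H : E × G → ℝ≥0∞, ∀ x g, H (x, g) =
      supMean (circMean fun a => f (x + a.1 • rot g e₁ + a.2 • rot g e₂)) 0 :=
    ⟨fun q => supMean (circMean fun a => f (q.1 + a.1 • rot q.2 e₁ + a.2 • rot q.2 e₂)) 0,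
      fun _ _ => rfl⟩
  have hHm : Measurable H := by
    have e : H = fun q : E × G =>
        supMean (circMean fun a => f (q.1 + a.1 • rot q.2 e₁ + a.2 • rot q.2 e₂)) 0 :=
      funext fun q => hH q.1 q.2
    rw [e]
    exact hmeas
  simp only [← hH] at hpt hM
  exact mul_lintegral_rpow_le_of_average hp hHm hpt hM

theorem lintegral_sphereSup_le {E : Type*} [NormedAddCommGroup E] [InnerProductSpace ℝ E]
    [FiniteDimensional ℝ E] [MeasurableSpace E] [BorelSpace E]
    (σ : Measure (sphere (0 : E) 1)) [IsProbabilityMeasure σ]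
    (hσ : ∀ (L : E ≃ₗᵢ[ℝ] E) (F : E → ℝ), Continuous F →
      ∫ ω : sphere (0 : E) 1, F (L ω) ∂σ = ∫ ω : sphere (0 : E) 1, F ω ∂σ)
    {e₁ e₂ : E} (he : ∀ θ : ℝ, ‖Real.cos θ • e₁ + Real.sin θ • e₂‖ = 1) {p : ℝ} (hp : 1 < p)
    {K : ℝ≥0∞} (hK : ∀ f : ℝ × ℝ → ℝ, Continuous f →
      ∫⁻ x in closedBall (0 : ℝ × ℝ) (1 / 8), supMean (circMean f) x ^ p ≤
      K * ∫⁻ z in closedBall (0 : ℝ × ℝ) 3, ENNReal.ofReal (|f z| ^ p))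
    {f : E → ℝ} (hf : Continuous f) (hfc : HasCompactSupport f) :
    volume (closedBall (0 : ℝ × ℝ) (1 / 8)) * ∫⁻ x, sphereSup σ f x ^ p ≤
      K * volume (closedBall (0 : ℝ × ℝ) 3) * ∫⁻ x, ENNReal.ofReal (|f x| ^ p) := by
  obtain ⟨ν, hν, hav⟩ := exists_haar_average σ hσ
  have : CompactSpace (OrthGroup E) := compactSpace_orthGroup
  exact lintegral_sphereSup_le_of_average
    (rot := fun g w => ((g⁻¹ : OrthGroup E) : E →L[ℝ] E) w)
    (fun w => (continuous_subtype_val.comp continuous_inv).clm_apply continuous_const)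
    (fun g v w => map_add _ v w) (fun g a w => map_smul _ a w) hav he hp hK hf hfc

theorem measurable_sphereSup {E : Type*} [NormedAddCommGroup E] [NormedSpace ℝ E]
    [FiniteDimensional ℝ E] [MeasurableSpace E] [BorelSpace E] {σ : Measure (sphere (0 : E) 1)}
    [IsFiniteMeasure σ] {f : E → ℝ} (hf : Continuous f) : Measurable (sphereSup σ f) := by
  have : ProperSpace E := FiniteDimensional.proper ℝ E
  refine LowerSemicontinuous.measurable (lowerSemicontinuous_biSup fun t _ => ?_)
  have hc : Continuous fun x => ∫ ω : sphere (0 : E) 1, f (x + t • (ω : E)) ∂σ := by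
    have := continuous_parametric_integral_of_continuous (μ := σ) (s := Set.univ)
      (f := fun x (ω : sphere (0 : E) 1) => f (x + t • (ω : E)))
      (hf.comp (by fun_prop)) isCompact_univ
    simpa only [Measure.restrict_univ] using this
  exact (ENNReal.continuous_ofReal.comp hc.abs).lowerSemicontinuous

theorem nnnorm_sphAvg_le {n : ℕ} (hn : 2 ≤ n) {f : EuclideanSpace ℝ (Fin n) → ℂ}
    (hf : Continuous f) (x : EuclideanSpace ℝ (Fin n)) {t : ℝ} (ht : t ∈ Set.Icc (1 : ℝ) 2) :
    (‖sphAvg n t f x‖₊ : ℝ≥0∞) ≤ sphereSup (surfMeasureNorm n) (fun y => (f y).re) x +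
      sphereSup (surfMeasureNorm n) (fun y => (f y).im) x := by
  have : IsProbabilityMeasure (surfMeasureNorm n) := ⟨surfMeasureNorm_univ hn⟩
  have hi : Integrable (fun ω : sphere (0 : EuclideanSpace ℝ (Fin n)) 1 =>
      f (x + t • (ω : EuclideanSpace ℝ (Fin n)))) (surfMeasureNorm n) := by
    refine Continuous.integrable_of_hasCompactSupport (hf.comp (by fun_prop))
      (HasCompactSupport.of_compactSpace _)
  have hre : (sphAvg n t f x).re = ∫ ω : sphere (0 : EuclideanSpace ℝ (Fin n)) 1,
      (f (x + t • (ω : EuclideanSpace ℝ (Fin n)))).re ∂surfMeasureNorm n :=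
    (integral_re hi).symm
  have him : (sphAvg n t f x).im = ∫ ω : sphere (0 : EuclideanSpace ℝ (Fin n)) 1,
      (f (x + t • (ω : EuclideanSpace ℝ (Fin n)))).im ∂surfMeasureNorm n :=
    (integral_im hi).symm
  rw [← enorm_eq_nnnorm, ← ofReal_norm]
  refine (ENNReal.ofReal_le_ofReal (Complex.norm_le_abs_re_add_abs_im _)).trans ?_
  rw [ENNReal.ofReal_add (abs_nonneg _) (abs_nonneg _), hre, him]
  exact add_le_add
    (le_iSup₂ (f := fun (t : ℝ) (_ : t ∈ Set.Icc (1 : ℝ) 2) => ENNReal.ofReal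
      |∫ ω : sphere (0 : EuclideanSpace ℝ (Fin n)) 1,
        (f (x + t • (ω : EuclideanSpace ℝ (Fin n)))).re ∂surfMeasureNorm n|) t ht)
    (le_iSup₂ (f := fun (t : ℝ) (_ : t ∈ Set.Icc (1 : ℝ) 2) => ENNReal.ofReal
      |∫ ω : sphere (0 : EuclideanSpace ℝ (Fin n)) 1,
        (f (x + t • (ω : EuclideanSpace ℝ (Fin n)))).im ∂surfMeasureNorm n|) t ht)

theorem norm_cos_smul_add_sin_smul {E : Type*} [NormedAddCommGroup E] [InnerProductSpace ℝ E]
    {u v : E} (hu : ‖u‖ = 1) (hv : ‖v‖ = 1) (huv : inner ℝ u v = 0) (θ : ℝ) :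
    ‖Real.cos θ • u + Real.sin θ • v‖ = 1 := by
  have h := norm_add_sq_real (Real.cos θ • u) (Real.sin θ • v)
  rw [inner_smul_left, inner_smul_right, huv, norm_smul, norm_smul, hu, hv, mul_one, mul_one,
    Real.norm_eq_abs, Real.norm_eq_abs, sq_abs, sq_abs, mul_zero, mul_zero, mul_zero, add_zero,
    Real.cos_sq_add_sin_sq] at h
  exact (pow_eq_one_iff_of_nonneg (norm_nonneg _) two_ne_zero).1 h

theorem exists_lintegral_sphereSup_le {n : ℕ} (hn : 2 ≤ n) {p : ℝ} (hp : 2 < p) :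
    ∃ K : ℝ≥0∞, K ≠ ∞ ∧ ∀ f : EuclideanSpace ℝ (Fin n) → ℝ, Continuous f → HasCompactSupport f →
      ∫⁻ x, sphereSup (surfMeasureNorm n) f x ^ p ≤ K * ∫⁻ x, ENNReal.ofReal (|f x| ^ p) := by
  obtain ⟨K, hK, hKf⟩ := exists_lintegral_supMean_circMean_le hp
  have : IsProbabilityMeasure (surfMeasureNorm n) := ⟨surfMeasureNorm_univ hn⟩
  have he := norm_cos_smul_add_sin_smul
    (u := (EuclideanSpace.single ⟨0, by omega⟩ 1 : EuclideanSpace ℝ (Fin n)))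
    (v := (EuclideanSpace.single ⟨1, by omega⟩ 1 : EuclideanSpace ℝ (Fin n)))
    (by simp) (by simp) (by simp [EuclideanSpace.inner_single_left])
  have h0 : volume (closedBall (0 : ℝ × ℝ) (1 / 8)) ≠ 0 :=
    (measure_closedBall_pos volume _ (by norm_num)).ne'
  have h1 : volume (closedBall (0 : ℝ × ℝ) (1 / 8)) ≠ ∞ := measure_closedBall_lt_top.ne
  refine ⟨(volume (closedBall (0 : ℝ × ℝ) (1 / 8)))⁻¹ * (K * volume (closedBall (0 : ℝ × ℝ) 3)),
    ENNReal.mul_ne_top (ENNReal.inv_ne_top.2 h0)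
      (ENNReal.mul_ne_top hK measure_closedBall_lt_top.ne), fun f hf hfc => ?_⟩
  have h := lintegral_sphereSup_le (surfMeasureNorm n) (fun L F hF => integral_sphereMap L hF)
    he (by linarith : 1 < p) hKf hf hfc
  rw [mul_assoc]
  calc ∫⁻ x, sphereSup (surfMeasureNorm n) f x ^ p
      = (volume (closedBall (0 : ℝ × ℝ) (1 / 8)))⁻¹ * (volume (closedBall (0 : ℝ × ℝ) (1 / 8)) *
        ∫⁻ x, sphereSup (surfMeasureNorm n) f x ^ p) := by
        rw [← mul_assoc, ENNReal.inv_mul_cancel h0 h1, one_mul]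
    _ ≤ _ := mul_le_mul_right h _

/-- The truncated spherical maximal inequality: the maximal operator over `t ∈ [1,2]` of the
spherical means is bounded on `L^p(ℝⁿ)` for `2 < p < ∞`, `n ≥ 2`. -/
theorem truncated_spherical_maximal_theorem (n : ℕ) (hn : 2 ≤ n) (p : ℝ) (hp : 2 < p) :
    ∃ C : ℝ, 0 < C ∧ ∀ f : EuclideanSpace ℝ (Fin n) → ℂ,
      Continuous f → HasCompactSupport f →
      (∫⁻ x, (⨆ (t : ℝ) (_ : t ∈ Set.Icc (1 : ℝ) 2), (‖sphAvg n t f x‖₊ : ℝ≥0∞)) ^ p) ^ (1 / p) ≤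
        ENNReal.ofReal C * eLpNorm f (ENNReal.ofReal p) volume := by
  obtain ⟨K, hK, hKf⟩ := exists_lintegral_sphereSup_le hn hp
  have : IsProbabilityMeasure (surfMeasureNorm n) := ⟨surfMeasureNorm_univ hn⟩
  have hp0 : 0 < p := by linarith
  have hB : 2 ^ (p - 1) * (K + K) ≠ ∞ :=
    ENNReal.mul_ne_top (ENNReal.rpow_ne_top_of_nonneg (by linarith) ENNReal.ofNat_ne_top)
      (ENNReal.add_ne_top.2 ⟨hK, hK⟩)
  have hB' : (2 ^ (p - 1) * (K + K)) ^ (1 / p) ≠ ∞ :=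
    ENNReal.rpow_ne_top_of_nonneg (by positivity) hB
  refine ⟨((2 ^ (p - 1) * (K + K)) ^ (1 / p)).toReal + 1, by positivity, fun f hf hfc => ?_⟩
  have hre := hKf (fun y => (f y).re) (Complex.continuous_re.comp hf)
    (hfc.comp_left (g := Complex.re) Complex.zero_re)
  have him := hKf (fun y => (f y).im) (Complex.continuous_im.comp hf)
    (hfc.comp_left (g := Complex.im) Complex.zero_im)
  have hle : ∀ g : EuclideanSpace ℝ (Fin n) → ℝ, (∀ x, |g x| ≤ ‖f x‖) →
      ∫⁻ x, ENNReal.ofReal (|g x| ^ p) ≤ ∫⁻ x, ‖f x‖ₑ ^ p := by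
    intro g hg
    refine lintegral_mono fun x => ?_
    rw [← ofReal_norm, ENNReal.ofReal_rpow_of_nonneg (norm_nonneg _) hp0.le]
    exact ENNReal.ofReal_le_ofReal (Real.rpow_le_rpow (abs_nonneg _) (hg x) hp0.le)
  have hm : Measurable fun x => sphereSup (surfMeasureNorm n) (fun y => (f y).re) x ^ p :=
    (measurable_sphereSup (Complex.continuous_re.comp hf)).pow_const p
  have hm' : Measurable fun x => sphereSup (surfMeasureNorm n) (fun y => (f y).im) x ^ p :=
    (measurable_sphereSup (Complex.continuous_im.comp hf)).pow_const p
  have hs : Measurable fun x => sphereSup (surfMeasureNorm n) (fun y => (f y).re) x ^ p +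
      sphereSup (surfMeasureNorm n) (fun y => (f y).im) x ^ p := hm.add hm'
  have hmain : ∫⁻ x, (⨆ (t : ℝ) (_ : t ∈ Set.Icc (1 : ℝ) 2), (‖sphAvg n t f x‖₊ : ℝ≥0∞)) ^ p ≤
      2 ^ (p - 1) * (K + K) * ∫⁻ x, ‖f x‖ₑ ^ p := by
    calc ∫⁻ x, (⨆ (t : ℝ) (_ : t ∈ Set.Icc (1 : ℝ) 2), (‖sphAvg n t f x‖₊ : ℝ≥0∞)) ^ p
        ≤ ∫⁻ x, 2 ^ (p - 1) * (sphereSup (surfMeasureNorm n) (fun y => (f y).re) x ^ p +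
            sphereSup (surfMeasureNorm n) (fun y => (f y).im) x ^ p) := by
          refine lintegral_mono fun x => le_trans (ENNReal.rpow_le_rpow
            (iSup₂_le fun t ht => nnnorm_sphAvg_le hn hf x ht) hp0.le) ?_
          exact ENNReal.rpow_add_le_mul_rpow_add_rpow _ _ (by linarith)
      _ = 2 ^ (p - 1) * ((∫⁻ x, sphereSup (surfMeasureNorm n) (fun y => (f y).re) x ^ p) +
            ∫⁻ x, sphereSup (surfMeasureNorm n) (fun y => (f y).im) x ^ p) := by
          rw [lintegral_const_mul _ hs, lintegral_add_left hm]
      _ ≤ 2 ^ (p - 1) * (K * (∫⁻ x, ‖f x‖ₑ ^ p) + K * ∫⁻ x, ‖f x‖ₑ ^ p) := by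
          refine mul_le_mul_right (add_le_add ?_ ?_) _
          · exact hre.trans (mul_le_mul_right (hle _ fun x => Complex.abs_re_le_norm _) _)
          · exact him.trans (mul_le_mul_right (hle _ fun x => Complex.abs_im_le_norm _) _)
      _ = _ := by rw [← add_mul, mul_assoc]
  rw [eLpNorm_eq_lintegral_rpow_enorm_toReal (by simpa using hp0) ENNReal.ofReal_ne_top,
    ENNReal.toReal_ofReal hp0.le]
  refine (ENNReal.rpow_le_rpow hmain (by positivity)).trans ?_
  rw [ENNReal.mul_rpow_of_nonneg _ _ (by positivity)]
  refine mul_le_mul_left ?_ _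
  rw [← ENNReal.ofReal_toReal hB']
  refine ENNReal.ofReal_le_ofReal ?_
  rw [ENNReal.ofReal_toReal hB']
  linarith
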